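/- For every natural number K ≥ 1 there are infinitely many natural numbers n such that τ(p_n − 1) > τ(p_{n+1} − 1) > ⋯ > τ(p_{n+K−1} − 1), i.e., the number of divisors of the shifted primes p − 1 is strictly decreasing along some run of K consecutive primes, for infinitely many starting indices n. -/

import Mathlib

open Nat (mem_divisorsAntidiagonal totient_pos le_ceil floor_le prime_dvd_prime_iff_eq prime_two totient_le infinite_setOf_prime)
open Complex (norm_real ofReal_re ofReal_im hasSum_re hasSum_taylorSeries_neg_log)
open Function (update)
open Fintype (sum_option prod_eq_mul_prod_subtype_ne piFinset_univ)
open DirichletCharacter (changeLevel)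
open Real (pi exp sqrt exp_pos exp_add norm_of_nonneg exp_le_exp log_nonneg log_natCast_nonneg one_le_exp sqrt_pos sq_sqrt log_le_log log_le_iff_le_exp le_log_iff_exp_le rpow_def_of_pos exp_nat_mul add_one_le_exp sqrt_le_sqrt sqrt_nonneg log log_div log_le_sub_one_of_pos pow_div_factorial_le_exp exp_log log_pow log_exp norm_eq_abs summable_nat_rpow tendsto_exp_atTop sqrt_div_self')

namespace TDR

noncomputable section
open Finset ComplexConjugate

/-! ### Character sums, Abel summation, abstract large sieve -/

lemma sum_range_char (q : ℕ) [NeZero q] (χ : DirichletCharacter ℂ q) :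
    ∑ n ∈ range q, χ (n : ZMod q) = ∑ a : ZMod q, χ a := by
  obtain ⟨m, rfl⟩ := Nat.exists_eq_succ_of_ne_zero (NeZero.ne q)
  rw [← Fin.sum_univ_eq_sum_range (fun n => χ (n : ZMod (m+1)))]
  change _ = ∑ a : Fin (m+1), χ (a : ZMod (m+1))
  refine sum_congr rfl fun a _ => ?_
  congr 1
  exact Fin.cast_val_eq_self a

lemma char_sum_bound (q : ℕ) [NeZero q] (χ : DirichletCharacter ℂ q) (hχ : χ ≠ 1) (N : ℕ) :
    ‖∑ n ∈ range N, χ (n : ZMod q)‖ ≤ q := by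
  have h0 : ∑ n ∈ range q, χ (n : ZMod q) = 0 := by
    rw [sum_range_char, MulChar.sum_eq_zero_of_ne_one hχ]
  have hper : Function.Periodic (fun N : ℕ => ∑ n ∈ range N, χ (n : ZMod q)) q := by
    intro N
    induction N with
    | zero => simpa using h0
    | succ k ih =>
      simp only at ih ⊢
      rw [show k + 1 + q = (k + q) + 1 by ring, sum_range_succ, sum_range_succ, ih]
      simp
  have := hper.map_mod_nat N
  rw [← this]
  calc ‖∑ n ∈ range (N % q), χ (n : ZMod q)‖ ≤ ∑ n ∈ range (N % q), ‖χ (n : ZMod q)‖ := norm_sum_le _ _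
    _ ≤ ∑ n ∈ range (N % q), (1 : ℝ) := sum_le_sum fun i _ => χ.norm_le_one _
    _ = ((N % q : ℕ) : ℝ) := by simp
    _ ≤ q := by exact_mod_cast (Nat.mod_lt _ (Nat.pos_of_ne_zero (NeZero.ne q))).le

lemma abel_bound (a Φ : ℕ → ℂ) (V : ℕ → ℝ) (B : ℝ) (N0 M : ℕ) (hM : N0 ≤ M)
    (ha : ∀ N, ‖∑ n ∈ range N, a n‖ ≤ B)
    (hV : ∀ n, N0 ≤ n → ‖Φ n - Φ (n+1)‖ ≤ V n - V (n+1))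
    (hΦ : ∀ n, N0 ≤ n → ‖Φ n‖ ≤ V n) :
    ‖∑ n ∈ Ico N0 M, a n * Φ n‖ ≤ 2 * B * V N0 := by
  have hA : ∀ m, N0 ≤ m → ‖∑ n ∈ Ico N0 m, a n‖ ≤ 2 * B := by
    intro m hm
    rw [sum_Ico_eq_sub _ hm]
    calc _ ≤ ‖∑ n ∈ range m, a n‖ + ‖∑ n ∈ range N0, a n‖ := norm_sub_le _ _
      _ ≤ 2 * B := by linarith [ha m, ha N0]
  have hB : 0 ≤ 2 * B := (norm_nonneg _).trans (hA N0 le_rfl)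
  have key : ∀ m, N0 ≤ m → ‖∑ n ∈ Ico N0 m, a n * Φ n - (∑ n ∈ Ico N0 m, a n) * Φ m‖
      ≤ 2 * B * (V N0 - V m) := by
    intro m hm
    induction m, hm using Nat.le_induction with
    | base => simp
    | succ m hm ih =>
      rw [sum_Ico_succ_top hm, sum_Ico_succ_top hm]
      have h1 := hA (m+1) (by omega)
      rw [sum_Ico_succ_top hm] at h1
      have : (∑ n ∈ Ico N0 m, a n * Φ n) + a m * Φ m - ((∑ n ∈ Ico N0 m, a n) + a m) * Φ (m+1)
        = (∑ n ∈ Ico N0 m, a n * Φ n - (∑ n ∈ Ico N0 m, a n) * Φ m)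
          + ((∑ n ∈ Ico N0 m, a n) + a m) * (Φ m - Φ (m+1)) := by ring
      rw [this]
      refine (norm_add_le _ _).trans ?_
      rw [norm_mul]
      have h2 := mul_le_mul h1 (hV m hm) (norm_nonneg _) hB
      linarith
  have h1 := key M hM
  have h2 : ‖(∑ n ∈ Ico N0 M, a n) * Φ M‖ ≤ 2 * B * V M := by
    rw [norm_mul]
    exact mul_le_mul (hA M hM) (hΦ M hM) (norm_nonneg _) hB
  have h3 : ∑ n ∈ Ico N0 M, a n * Φ n = (∑ n ∈ Ico N0 M, a n * Φ n - (∑ n ∈ Ico N0 M, a n) * Φ M)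
    + (∑ n ∈ Ico N0 M, a n) * Φ M := by ring
  rw [h3]
  refine (norm_add_le _ _).trans ?_
  linarith

section LS
variable {ι : Type*} [Fintype ι]

lemma large_sieve_dual (S : Finset ℕ) (w : ℕ → ℝ) (f : ι → ℕ → ℂ) (E : ℝ)
    (hw : ∀ n, 0 ≤ w n) (hE : 0 ≤ E) (hf : ∀ i n, ‖f i n‖ ≤ 1)
    (hoff : ∀ i j, i ≠ j → ‖∑ n ∈ S, (w n : ℂ) * (f i n * conj (f j n))‖ ≤ E) (c : ι → ℂ) :
    ∑ n ∈ S, w n * ‖∑ i, c i * f i n‖ ^ 2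
      ≤ (∑ n ∈ S, w n + Fintype.card ι * E) * ∑ i, ‖c i‖ ^ 2 := by
  classical
  have h1 : ((∑ n ∈ S, w n * ‖∑ i, c i * f i n‖ ^ 2 : ℝ) : ℂ)
      = ∑ i, ∑ j, c i * conj (c j) * ∑ n ∈ S, (w n : ℂ) * (f i n * conj (f j n)) := by
    push_cast
    simp_rw [← Complex.mul_conj', map_sum, map_mul, sum_mul_sum, mul_sum]
    rw [sum_comm]
    refine sum_congr rfl fun i _ => ?_
    rw [sum_comm]
    refine sum_congr rfl fun j _ => sum_congr rfl fun n _ => by ring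
  have hnn : 0 ≤ ∑ n ∈ S, w n * ‖∑ i, c i * f i n‖ ^ 2 :=
    sum_nonneg fun n _ => mul_nonneg (hw n) (by positivity)
  have hW : 0 ≤ ∑ n ∈ S, w n := sum_nonneg fun n _ => hw n
  have hterm : ∀ i j, ‖∑ n ∈ S, (w n : ℂ) * (f i n * conj (f j n))‖
      ≤ (if i = j then ∑ n ∈ S, w n else 0) + E := by
    intro i j
    by_cases hij : i = j
    · simp only [hij, if_true]
      have : ‖∑ n ∈ S, (w n : ℂ) * (f j n * conj (f j n))‖ ≤ ∑ n ∈ S, w n := by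
        refine (norm_sum_le _ _).trans (sum_le_sum fun n _ => ?_)
        rw [norm_mul, norm_mul, RCLike.norm_conj, norm_real, norm_of_nonneg (hw n)]
        have := hf j n
        have h3 : ‖f j n‖ * ‖f j n‖ ≤ 1 := mul_le_one₀ this (norm_nonneg _) this
        exact mul_le_of_le_one_right (hw n) h3
      linarith
    · simp only [hij, if_false]
      linarith [hoff i j hij]
  have h2 : ∑ n ∈ S, w n * ‖∑ i, c i * f i n‖ ^ 2
      ≤ ∑ i, ∑ j, ‖c i‖ * ‖c j‖ * ((if i = j then ∑ n ∈ S, w n else 0) + E) := by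
    have : ∑ n ∈ S, w n * ‖∑ i, c i * f i n‖ ^ 2
      = ‖((∑ n ∈ S, w n * ‖∑ i, c i * f i n‖ ^ 2 : ℝ) : ℂ)‖ := by
      rw [norm_real, norm_of_nonneg hnn]
    rw [this, h1]
    refine (norm_sum_le _ _).trans (sum_le_sum fun i _ => ?_)
    refine (norm_sum_le _ _).trans (sum_le_sum fun j _ => ?_)
    rw [norm_mul, norm_mul, RCLike.norm_conj]
    exact mul_le_mul_of_nonneg_left (hterm i j) (by positivity)
  refine h2.trans ?_
  simp_rw [mul_add, sum_add_distrib]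
  have h3 : ∑ i, ∑ j, ‖c i‖ * ‖c j‖ * (if i = j then ∑ n ∈ S, w n else 0)
      = (∑ n ∈ S, w n) * ∑ i, ‖c i‖ ^ 2 := by
    simp only [mul_ite, mul_zero, sum_ite_eq, mem_univ, if_true]
    rw [mul_sum]
    refine sum_congr rfl fun i _ => by ring
  have h4 : ∑ i, ∑ j, ‖c i‖ * ‖c j‖ * E = E * (∑ i, ‖c i‖) ^ 2 := by
    rw [sq, sum_mul_sum, mul_sum]
    refine sum_congr rfl fun i _ => ?_
    rw [mul_sum]
    refine sum_congr rfl fun j _ => by ring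
  have h5 : (∑ i, ‖c i‖) ^ 2 ≤ Fintype.card ι * ∑ i, ‖c i‖ ^ 2 := by
    have := sq_sum_le_card_mul_sum_sq (s := (univ : Finset ι)) (f := fun i => ‖c i‖)
    simpa using this
  rw [h3, h4]
  nlinarith [mul_le_mul_of_nonneg_left h5 hE]

lemma large_sieve (S : Finset ℕ) (w : ℕ → ℝ) (f : ι → ℕ → ℂ) (E : ℝ)
    (hw : ∀ n, 0 ≤ w n) (hE : 0 ≤ E) (hf : ∀ i n, ‖f i n‖ ≤ 1)
    (hoff : ∀ i j, i ≠ j → ‖∑ n ∈ S, (w n : ℂ) * (f i n * conj (f j n))‖ ≤ E) (b : ℕ → ℂ) :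
    ∑ i, ‖∑ n ∈ S, (w n : ℂ) * (b n * f i n)‖ ^ 2
      ≤ (∑ n ∈ S, w n + Fintype.card ι * E) * ∑ n ∈ S, w n * ‖b n‖ ^ 2 := by
  set T : ι → ℂ := fun i => ∑ n ∈ S, (w n : ℂ) * (b n * f i n) with hT
  set D := (∑ n ∈ S, w n + Fintype.card ι * E) with hD
  have hD0 : 0 ≤ D := add_nonneg (sum_nonneg fun n _ => hw n) (by positivity)
  set X := ∑ i, ‖T i‖ ^ 2 with hX
  have hX0 : 0 ≤ X := sum_nonneg fun i _ => by positivity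
  have hY0 : 0 ≤ ∑ n ∈ S, w n * ‖b n‖ ^ 2 :=
    sum_nonneg fun n _ => mul_nonneg (hw n) (by positivity)
  have hdual := large_sieve_dual S w f E hw hE hf hoff (fun i => conj (T i))
  simp only [RCLike.norm_conj] at hdual
  have h1 : (X : ℂ) = ∑ n ∈ S, (w n : ℂ) * (b n * ∑ i, conj (T i) * f i n) := by
    rw [hX]; push_cast
    simp_rw [← Complex.conj_mul']
    simp_rw [mul_sum]
    rw [sum_comm]
    refine sum_congr rfl fun i _ => ?_
    conv_lhs => rw [show T i = ∑ n ∈ S, (w n : ℂ) * (b n * f i n) from rfl]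
    rw [mul_sum]
    refine sum_congr rfl fun n _ => by ring
  have h2 : X ≤ ∑ n ∈ S, (sqrt (w n) * ‖b n‖) * (sqrt (w n) * ‖∑ i, conj (T i) * f i n‖) := by
    have : X = ‖(X : ℂ)‖ := by rw [norm_real, norm_of_nonneg hX0]
    rw [this, h1]
    refine (norm_sum_le _ _).trans (sum_le_sum fun n _ => ?_)
    rw [norm_mul, norm_mul, norm_real, norm_of_nonneg (hw n)]
    have := Real.mul_self_sqrt (hw n)
    apply le_of_eq
    calc w n * (‖b n‖ * ‖∑ i, conj (T i) * f i n‖)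
        = (sqrt (w n) * sqrt (w n)) * (‖b n‖ * ‖∑ i, conj (T i) * f i n‖) := by rw [this]
      _ = _ := by ring
  have h3 := sum_mul_sq_le_sq_mul_sq S (fun n => sqrt (w n) * ‖b n‖)
    (fun n => sqrt (w n) * ‖∑ i, conj (T i) * f i n‖)
  simp only [mul_pow, sq_sqrt (hw _)] at h3
  have h4 : X ^ 2 ≤ (∑ n ∈ S, w n * ‖b n‖ ^ 2) * (D * X) := by
    refine (pow_le_pow_left₀ hX0 h2 2).trans (h3.trans ?_)
    exact mul_le_mul_of_nonneg_left hdual hY0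
  rcases hX0.eq_or_lt with h0 | h0
  · rw [← h0]; positivity
  · have : X * X ≤ (D * ∑ n ∈ S, w n * ‖b n‖ ^ 2) * X := by nlinarith
    exact le_of_mul_le_mul_right this h0

end LS

open MeasureTheory
open scoped FourierTransform ContDiff

/-! ### Smooth cutoff and Fourier representation -/

lemma fourier_rep (Ψ : ℝ → ℂ) (h1 : HasCompactSupport Ψ) (h2 : ContDiff ℝ ∞ Ψ) :
    ∃ φ : ℝ → ℂ, Continuous φ ∧ Integrable φ ∧ (∀ k : ℕ, Integrable (fun ξ => |ξ| ^ k * ‖φ ξ‖)) ∧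
      ∀ u : ℝ, Ψ u = ∫ ξ : ℝ, φ ξ * Complex.exp ((2 * pi * (ξ * u) : ℝ) * Complex.I) := by
  set f : SchwartzMap ℝ ℂ := h1.toSchwartzMap h2 with hf
  set g : SchwartzMap ℝ ℂ := 𝓕 f with hg
  refine ⟨⇑g, g.continuous, g.integrable, fun k => ?_, fun u => ?_⟩
  · simpa using g.integrable_pow_mul volume k
  · have h3 : 𝓕⁻ (⇑g) u = Ψ u := by
      rw [hg, SchwartzMap.fourier_coe]
      have h4 : Integrable (𝓕 (f : ℝ → ℂ)) := by
        rw [← SchwartzMap.fourier_coe]; exact g.integrable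
      have := f.continuous.fourierInv_fourier_eq f.integrable h4
      rw [this]
      rfl
    rw [← h3, Real.fourierInv_eq']
    refine integral_congr_ae (Filter.Eventually.of_forall fun ξ => ?_)
    simp only [smul_eq_mul]
    rw [mul_comm]
    congr 2
    push_cast
    simp [mul_comm]

/-- The bump. -/
def bumpF : ContDiffBump (3/2 : ℝ) := ⟨1/4, 1/2, by norm_num, by norm_num⟩

/-- The cutoff function. -/
def F (u : ℝ) : ℝ := bumpF u

lemma F_nonneg (u : ℝ) : 0 ≤ F u := bumpF.nonneg
lemma F_le_one (u : ℝ) : F u ≤ 1 := bumpF.le_one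
lemma F_contDiff : ContDiff ℝ ∞ F := bumpF.contDiff
lemma F_hcs : HasCompactSupport F := bumpF.hasCompactSupport
lemma F_zero_left {u : ℝ} (h : u ≤ 1) : F u = 0 := by
  apply bumpF.zero_of_le_dist
  rw [Real.dist_eq, abs_of_nonpos (by linarith)]
  show (1/2 : ℝ) ≤ _
  linarith
lemma F_zero_right {u : ℝ} (h : 2 ≤ u) : F u = 0 := by
  apply bumpF.zero_of_le_dist
  rw [Real.dist_eq, abs_of_nonneg (by linarith)]
  show (1/2 : ℝ) ≤ _
  linarith
lemma F_one {u : ℝ} (h1 : 5/4 ≤ u) (h2 : u ≤ 7/4) : F u = 1 := by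
  apply bumpF.one_of_mem_closedBall
  rw [Metric.mem_closedBall, Real.dist_eq, abs_le]
  show -(1/4 : ℝ) ≤ _ ∧ _ ≤ (1/4 : ℝ)
  constructor <;> linarith
lemma F_lip : ∃ C : ℝ, 1 ≤ C ∧ ∀ u v, |F u - F v| ≤ C * |u - v| := by
  obtain ⟨C, hC⟩ := (F_contDiff.of_le (by norm_cast)).lipschitzWith_of_hasCompactSupport
    F_hcs (n := 1) (by norm_num)
  refine ⟨max C 1, le_max_right _ _, fun u v => ?_⟩
  have := hC.dist_le_mul u v
  rw [Real.dist_eq, Real.dist_eq] at this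
  exact this.trans (mul_le_mul_of_nonneg_right (le_max_left _ _) (abs_nonneg _))

/-- Lipschitz constant of the cutoff. -/
def CF : ℝ := F_lip.choose
lemma one_le_CF : 1 ≤ CF := F_lip.choose_spec.1
lemma F_lip' (u v : ℝ) : |F u - F v| ≤ CF * |u - v| := F_lip.choose_spec.2 u v

/-- The weight. -/
def hw (L t : ℝ) : ℝ := F (log t / L) / t

lemma hw_nonneg {L t : ℝ} (ht : 0 ≤ t) : 0 ≤ hw L t := div_nonneg (F_nonneg _) ht
lemma hw_le {L t : ℝ} (ht : 0 ≤ t) : hw L t ≤ 1 / t :=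
  div_le_div_of_nonneg_right (F_le_one _) ht
lemma hw_zero_left {L t : ℝ} (hL : 0 < L) (ht0 : 0 ≤ t) (ht : t ≤ exp L) : hw L t = 0 := by
  rcases ht0.eq_or_lt with h | h
  · simp [hw, ← h]
  · rw [hw, F_zero_left, zero_div]
    rw [div_le_one hL]
    exact (log_le_iff_le_exp h).2 ht
lemma hw_zero_right {L t : ℝ} (hL : 0 < L) (ht : exp (2 * L) ≤ t) : hw L t = 0 := by
  rw [hw, F_zero_right, zero_div]
  rw [le_div_iff₀ hL]
  exact (le_log_iff_exp_le (lt_of_lt_of_le (exp_pos _) ht)).2 ht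

lemma log_sub_log_le {t t' : ℝ} (ht : 0 < t) (h : t ≤ t') :
    log t' - log t ≤ (t' - t) / t := by
  rw [← log_div (by linarith) ht.ne']
  have := log_le_sub_one_of_pos (show 0 < t' / t from div_pos (by linarith) ht)
  refine this.trans (le_of_eq ?_)
  field_simp

lemma hw_diff {L t t' : ℝ} (hL : 1 ≤ L) (ht : 0 < t) (h : t ≤ t') :
    |hw L t - hw L t'| ≤ (1 + CF) * ((t' - t) / (t * t')) := by
  have ht' : 0 < t' := by linarith
  have hlog : log t ≤ log t' := log_le_log ht h
  have e : hw L t - hw L t' = F (log t / L) * ((t' - t) / (t * t'))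
      + (F (log t / L) - F (log t' / L)) / t' := by
    unfold hw; field_simp; ring
  have h1 : |F (log t / L) - F (log t' / L)| ≤ CF * ((t' - t) / t) := by
    refine (F_lip' _ _).trans (mul_le_mul_of_nonneg_left ?_ (by linarith [one_le_CF]))
    rw [← sub_div, abs_div, abs_of_nonpos (by linarith), abs_of_pos (by linarith)]
    refine (div_le_self (by linarith) hL).trans ?_
    linarith [log_sub_log_le ht h]
  have hd : 0 ≤ (t' - t) / (t * t') := div_nonneg (by linarith) (by positivity)
  rw [e]
  refine (abs_add_le _ _).trans ?_
  rw [abs_mul, abs_of_nonneg hd, abs_of_nonneg (F_nonneg _), abs_div, abs_of_pos ht', add_mul]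
  refine add_le_add (mul_le_mul_of_nonneg_right (F_le_one _) hd) ?_
  calc _ ≤ CF * ((t' - t) / t) / t' := div_le_div_of_nonneg_right h1 ht'.le
    _ = _ := by field_simp

/-- Type I bound. -/
lemma typeI_bound (L : ℝ) (hL : 1 ≤ L) (a : ℕ → ℂ) (B : ℝ) (ha : ∀ N, ‖∑ n ∈ range N, a n‖ ≤ B)
    (m : ℕ) (hm : 1 ≤ m) (N : ℕ) :
    ‖∑ n ∈ range N, a n * (hw L (m * n) : ℂ)‖ ≤ 2 * B * ((1 + CF) / exp L) ∧
    ‖∑ n ∈ range N, a n * ((log n * hw L (m * n) : ℝ) : ℂ)‖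
      ≤ 2 * B * ((2 * L * (1 + CF) + 1) / exp L) := by
  have hB : 0 ≤ B := (norm_nonneg _).trans (ha 0)
  have hC := one_le_CF
  have hm0 : (0:ℝ) < m := by exact_mod_cast hm
  set N0 := ⌈exp L / m⌉₊ with hN0
  have hN0pos : 1 ≤ N0 := Nat.one_le_iff_ne_zero.2 (Nat.ceil_pos.2 (by positivity)).ne'
  have hN0' : exp L / m ≤ N0 := le_ceil _
  have hlow : ∀ n, n < N0 → hw L (m * n) = 0 := by
    intro n hn
    apply hw_zero_left (by linarith) (by positivity)
    have := (Nat.lt_ceil.1 hn).le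
    rw [le_div_iff₀ hm0] at this
    linarith
  have hsplit : ∀ Φ : ℕ → ℂ, (∀ n, n < N0 → Φ n = 0) →
      ∑ n ∈ range N, a n * Φ n = ∑ n ∈ Ico N0 (max N N0), a n * Φ n := by
    intro Φ hΦ
    have hz : ∑ n ∈ range N0, a n * Φ n = 0 :=
      sum_eq_zero fun n hn => by rw [hΦ n (mem_range.1 hn), mul_zero]
    rcases le_total N N0 with h | h
    · rw [max_eq_right h]
      simp only [Ico_self, sum_empty]
      refine sum_eq_zero fun n hn => ?_
      rw [hΦ n (lt_of_lt_of_le (mem_range.1 hn) h), mul_zero]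
    · rw [max_eq_left h, sum_Ico_eq_sub _ h, hz, sub_zero]
  have hbound : ∀ (Φ : ℕ → ℂ) (D : ℝ), 0 ≤ D → (∀ n, n < N0 → Φ n = 0) →
      (∀ n, 1 ≤ n → ‖Φ n - Φ (n+1)‖ ≤ D / (m * (n * (n + 1)))) →
      (∀ n, 1 ≤ n → ‖Φ n‖ ≤ D / (m * n)) →
      ‖∑ n ∈ range N, a n * Φ n‖ ≤ 2 * B * (D / exp L) := by
    intro Φ D hD hΦ0 hΦ1 hΦ2
    rw [hsplit Φ hΦ0]
    refine (abel_bound a Φ (fun n => D / (m * n)) B N0 _ (le_max_right _ _) ha ?_ ?_).trans ?_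
    · intro n hn
      have hn0 : (0:ℝ) < n := by exact_mod_cast (by omega : 0 < n)
      refine (hΦ1 n (by omega)).trans (le_of_eq ?_)
      push_cast
      field_simp
      ring
    · intro n hn
      exact hΦ2 n (by omega)
    · apply mul_le_mul_of_nonneg_left _ (by positivity)
      apply div_le_div_of_nonneg_left hD (exp_pos _)
      rw [div_le_iff₀ hm0] at hN0'
      linarith
  have hd : ∀ n : ℕ, 1 ≤ n → |hw L (m * n) - hw L (m * (n + 1 : ℕ))| ≤ (1 + CF) / (m * (n * (n + 1))) := by
    intro n hn
    have hn0 : (0:ℝ) < n := by exact_mod_cast hn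
    refine (hw_diff hL (by positivity) (by push_cast; nlinarith)).trans (le_of_eq ?_)
    push_cast
    field_simp
    ring
  constructor
  · apply hbound _ _ (by linarith)
    · intro n hn; rw [hlow n hn]; simp
    · intro n hn
      rw [← Complex.ofReal_sub, norm_real]
      exact hd n hn
    · intro n hn
      have hn0 : (0:ℝ) < n := by exact_mod_cast hn
      rw [norm_real, norm_of_nonneg (hw_nonneg (by positivity))]
      refine (hw_le (by positivity)).trans ?_
      gcongr; linarith
  · have hlogn : ∀ n : ℕ, (n : ℝ) < exp (2 * L) → log n ≤ 2 * L := by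
      intro n hn
      rcases n.eq_zero_or_pos with h | h
      · subst h; simp; linarith
      · exact ((Real.log_lt_iff_lt_exp (by exact_mod_cast h)).2 hn).le
    apply hbound _ _ (by nlinarith)
    · intro n hn; rw [hlow n hn]; simp
    · intro n hn
      have hn0 : (0:ℝ) < n := by exact_mod_cast hn
      have hm1 : (1:ℝ) ≤ m := by exact_mod_cast hm
      rw [← Complex.ofReal_sub, norm_real, norm_eq_abs]
      by_cases hbig : exp (2 * L) ≤ n
      · rw [hw_zero_right (by linarith) (show exp (2*L) ≤ m * n by nlinarith),
          hw_zero_right (by linarith) (show exp (2*L) ≤ m * ((n+1 : ℕ) : ℝ) by push_cast; nlinarith)]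
        simp only [mul_zero, sub_zero, abs_zero]
        positivity
      · push Not at hbig
        have hl0 : 0 ≤ log n := log_natCast_nonneg n
        have hl := hlogn n hbig
        have e : log n * hw L (m * n) - log ((n+1 : ℕ)) * hw L (m * (n+1 : ℕ))
          = log n * (hw L (m * n) - hw L (m * (n+1:ℕ)))
            - (log ((n + 1 : ℕ)) - log n) * hw L (m * (n+1:ℕ)) := by ring
        have h1 := hd n hn
        have h2 : log ((n+1 : ℕ)) - log n ≤ 1 / n := by
          refine (log_sub_log_le hn0 (by push_cast; linarith)).trans (le_of_eq ?_)
          push_cast; ring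
        have h2' : 0 ≤ log ((n+1 : ℕ)) - log n :=
          sub_nonneg.2 (log_le_log hn0 (by push_cast; linarith))
        have h3 : hw L (m * (n+1:ℕ)) ≤ 1 / (m * (n+1)) := by
          refine (hw_le (by positivity)).trans (le_of_eq ?_); push_cast; rfl
        have h3' : 0 ≤ hw L (m * (n+1:ℕ)) := hw_nonneg (by positivity)
        rw [e]
        refine (abs_sub _ _).trans ?_
        rw [abs_mul, abs_mul, abs_of_nonneg hl0, abs_of_nonneg h2', abs_of_nonneg h3', add_div]
        refine add_le_add ?_ ?_
        · calc log n * |hw L (m * n) - hw L (m * (n+1:ℕ))|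
              ≤ (2 * L) * ((1 + CF) / (m * (n * (n + 1)))) :=
                mul_le_mul hl h1 (abs_nonneg _) (by linarith)
            _ = _ := by ring
        · calc _ ≤ (1 / (n:ℝ)) * (1 / (m * (n+1))) := mul_le_mul h2 h3 h3' (by positivity)
            _ = _ := by field_simp
    · intro n hn
      have hn0 : (0:ℝ) < n := by exact_mod_cast hn
      have hm1 : (1:ℝ) ≤ m := by exact_mod_cast hm
      rw [norm_real, norm_mul, norm_of_nonneg (log_natCast_nonneg n),
        norm_of_nonneg (hw_nonneg (by positivity))]
      by_cases hbig : exp (2 * L) ≤ n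
      · rw [hw_zero_right (by linarith) (show exp (2*L) ≤ m * n by nlinarith), mul_zero]
        positivity
      · push Not at hbig
        calc _ ≤ (2 * L) * (1 / (m * n)) :=
              mul_le_mul (hlogn n hbig) (hw_le (by positivity)) (hw_nonneg (by positivity)) (by linarith)
          _ = 2 * L / (m * n) := by ring
          _ ≤ _ := by gcongr; nlinarith

open scoped ArithmeticFunction
open ArithmeticFunction hiding log

/-! ### Vaughan identity and the mean value bound -/

lemma conv_sum (f g : ArithmeticFunction ℝ) (H : ℕ → ℂ) (N : ℕ) (hH : ∀ k, N ≤ k → H k = 0) :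
    ∑ n ∈ range N, (((f * g) n : ℝ) : ℂ) * H n
      = ∑ m ∈ range N, ∑ n ∈ range N, (f m : ℂ) * (g n : ℂ) * H (m * n) := by
  simp_rw [ArithmeticFunction.mul_apply, Complex.ofReal_sum, sum_mul]
  rw [sum_sigma', ← sum_product']
  refine sum_of_injOn (fun x => x.2) ?_ ?_ ?_ ?_
  · rintro ⟨n, a, b⟩ h1 ⟨n', a', b'⟩ h2 h
    simp only [coe_sigma, Set.mem_sigma_iff, mem_coe, mem_divisorsAntidiagonal] at h1 h2 h
    obtain ⟨_, h1, _⟩ := h1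
    obtain ⟨_, h2, _⟩ := h2
    simp only [Prod.mk.injEq] at h
    obtain ⟨rfl, rfl⟩ := h
    subst h1; subst h2; rfl
  · rintro ⟨n, a, b⟩ h1
    simp only [coe_sigma, Set.mem_sigma_iff, mem_coe, mem_divisorsAntidiagonal,
      mem_range] at h1
    obtain ⟨h0, h1, h3⟩ := h1
    simp only [coe_product, coe_range, Set.mem_prod, Set.mem_Iio]
    subst h1
    have ha : a ≠ 0 := left_ne_zero_of_mul h3
    have hb : b ≠ 0 := right_ne_zero_of_mul h3
    exact ⟨lt_of_le_of_lt (Nat.le_mul_of_pos_right _ (Nat.pos_of_ne_zero hb)) h0,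
      lt_of_le_of_lt (Nat.le_mul_of_pos_left _ (Nat.pos_of_ne_zero ha)) h0⟩
  · rintro ⟨a, b⟩ _ h
    simp only
    by_cases ha : a = 0
    · simp [ha]
    by_cases hb : b = 0
    · simp [hb]
    by_cases hab : N ≤ a * b
    · rw [hH _ hab, mul_zero]
    · exfalso
      apply h
      refine ⟨⟨a * b, a, b⟩, ?_, rfl⟩
      simp only [coe_sigma, Set.mem_sigma_iff, mem_coe, mem_divisorsAntidiagonal,
        mem_range]
      exact ⟨by omega, trivial, mul_ne_zero ha hb⟩
  · rintro ⟨n, a, b⟩ h1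
    simp only [mem_sigma, mem_divisorsAntidiagonal] at h1
    rw [h1.2.1]
    push_cast; ring

/-- Fourier transform of the cutoff (complexified). -/
lemma F_rep : ∃ φ : ℝ → ℂ, Continuous φ ∧ Integrable φ ∧
    ∀ u : ℝ, (F u : ℂ) = ∫ ξ : ℝ, φ ξ * Complex.exp ((2 * pi * (ξ * u) : ℝ) * Complex.I) := by
  obtain ⟨φ, h1, h2, _, h3⟩ := fourier_rep (fun u => (F u : ℂ))
    (F_hcs.comp_left (g := Complex.ofReal) (by simp))
    (Complex.ofRealCLM.contDiff.comp F_contDiff)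
  exact ⟨φ, h1, h2, h3⟩

section bil
variable {ι : Type*} [Fintype ι]

lemma bilinear_bound : ∃ I : ℝ, 0 ≤ I ∧ ∀ {ι : Type} [Fintype ι] (L : ℝ) (_ : 1 ≤ L) (S : Finset ℕ)
    (_ : ∀ n ∈ S, 1 ≤ n)
    (f : ι → ℕ → ℂ) (E : ℝ) (_ : 0 ≤ E) (_ : ∀ i n, ‖f i n‖ ≤ 1)
    (_ : ∀ i m n, f i (m * n) = f i m * f i n)
    (_ : ∀ i j, i ≠ j → ‖∑ n ∈ S, ((1 / (n:ℝ) : ℝ) : ℂ) * (f i n * conj (f j n))‖ ≤ E)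
    (a b : ℕ → ℝ),
    ∑ i, ‖∑ m ∈ S, ∑ n ∈ S, (a m : ℂ) * (b n : ℂ) * (f i (m * n) * (hw L ((m * n : ℕ) : ℝ) : ℂ))‖
      ≤ I * ((∑ n ∈ S, 1 / (n:ℝ) + Fintype.card ι * E) *
        (∑ n ∈ S, 1 / (n:ℝ) * (a n) ^ 2 + ∑ n ∈ S, 1 / (n:ℝ) * (b n) ^ 2)) := by
  obtain ⟨φ, hφc, hφi, hφ⟩ := F_rep
  refine ⟨∫ ξ, ‖φ ξ‖, integral_nonneg fun _ => norm_nonneg _, ?_⟩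
  intro ι _ L hL S hS f E hE hf hmul hoff a b
  set D := (∑ n ∈ S, 1 / (n:ℝ) + Fintype.card ι * E) with hD
  have hD0 : 0 ≤ D := add_nonneg (sum_nonneg fun n _ => by positivity) (by positivity)
  set ex : ℝ → ℕ → ℂ := fun ξ n => Complex.exp ((2 * pi * (ξ * (log n / L)) : ℝ) * Complex.I) with hex
  have hexn : ∀ ξ n, ‖ex ξ n‖ = 1 := fun ξ n => Complex.norm_exp_ofReal_mul_I _
  set A : ι → ℝ → ℂ := fun i ξ => ∑ n ∈ S, ((1 / (n:ℝ) : ℝ) : ℂ) * (((a n : ℂ) * ex ξ n) * f i n) with hA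
  set B : ι → ℝ → ℂ := fun i ξ => ∑ n ∈ S, ((1 / (n:ℝ) : ℝ) : ℂ) * (((b n : ℂ) * ex ξ n) * f i n) with hB
  have hcont : ∀ n, Continuous fun ξ => ex ξ n := by
    intro n; simp only [hex]; fun_prop
  have hAc : ∀ i, Continuous (A i) := by
    intro i; simp only [hA]
    refine continuous_finsetSum _ fun n _ => ?_
    exact continuous_const.mul ((continuous_const.mul (hcont n)).mul continuous_const)
  have hBc : ∀ i, Continuous (B i) := by
    intro i; simp only [hB]
    refine continuous_finsetSum _ fun n _ => ?_
    exact continuous_const.mul ((continuous_const.mul (hcont n)).mul continuous_const)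
  have hterm : ∀ (c : ℂ) (m n : ℕ), Integrable fun ξ => c * (φ ξ * (ex ξ m * ex ξ n)) := by
    intro c m n
    refine Integrable.const_mul ?_ _
    refine hφi.mono (by exact (hφc.mul ((hcont m).mul (hcont n))).aestronglyMeasurable) ?_
    refine Filter.Eventually.of_forall fun ξ => ?_
    simp [hexn]
  have hprod : ∀ i ξ, φ ξ * (A i ξ * B i ξ) = ∑ m ∈ S, ∑ n ∈ S,
      (((1 / (m:ℝ) : ℝ) : ℂ) * ((1 / (n:ℝ) : ℝ) : ℂ) * (a m) * (b n) * f i m * f i n)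
        * (φ ξ * (ex ξ m * ex ξ n)) := by
    intro i ξ
    simp only [hA, hB]
    rw [sum_mul_sum, mul_sum]
    simp only [mul_sum]
    refine sum_congr rfl fun m _ => sum_congr rfl fun n _ => by ring
  have hInt : ∀ i, Integrable fun ξ => φ ξ * (A i ξ * B i ξ) := by
    intro i
    simp_rw [hprod]
    exact integrable_finsetSum _ fun m _ => integrable_finsetSum _ fun n _ => hterm _ m n
  have hrep : ∀ i, ∑ m ∈ S, ∑ n ∈ S, (a m : ℂ) * (b n : ℂ) * (f i (m * n) * (hw L ((m * n : ℕ) : ℝ) : ℂ))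
      = ∫ ξ, φ ξ * (A i ξ * B i ξ) := by
    intro i
    simp_rw [hprod]
    rw [integral_finsetSum _ fun m _ => integrable_finsetSum _ fun n _ => hterm _ m n]
    refine sum_congr rfl fun m hm => ?_
    rw [integral_finsetSum _ fun n _ => hterm _ m n]
    refine sum_congr rfl fun n hn => ?_
    rw [integral_const_mul]
    have hm0 : (m : ℝ) ≠ 0 := by exact_mod_cast (by have := hS m hm; omega : m ≠ 0)
    have hn0 : (n : ℝ) ≠ 0 := by exact_mod_cast (by have := hS n hn; omega : n ≠ 0)
    have : ∫ ξ, φ ξ * (ex ξ m * ex ξ n) = (F (log ((m * n : ℕ) : ℝ) / L) : ℂ) := by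
      rw [hφ]
      refine integral_congr_ae (Filter.Eventually.of_forall fun ξ => ?_)
      simp only [hex]
      rw [← Complex.exp_add]
      congr 2
      have hl : log ((m * n : ℕ) : ℝ) = log m + log n := by
        push_cast; exact Real.log_mul hm0 hn0
      rw [hl, ← add_mul, ← Complex.ofReal_add]
      congr 2
      ring
    rw [this, hw, hmul]
    push_cast
    field_simp
  have hls : ∀ ξ, ∑ i, ‖A i ξ‖ * ‖B i ξ‖ ≤ D * (∑ n ∈ S, 1 / (n:ℝ) * (a n) ^ 2 + ∑ n ∈ S, 1 / (n:ℝ) * (b n) ^ 2) := by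
    intro ξ
    have h1 := large_sieve S (fun n => 1 / (n:ℝ)) f E (fun n => by positivity) hE hf hoff
      (fun n => (a n : ℂ) * ex ξ n)
    have h2 := large_sieve S (fun n => 1 / (n:ℝ)) f E (fun n => by positivity) hE hf hoff
      (fun n => (b n : ℂ) * ex ξ n)
    simp only [norm_mul, hexn, mul_one, norm_real, norm_eq_abs, sq_abs] at h1 h2
    rw [mul_add]
    have h3 : ∑ i, ‖A i ξ‖ * ‖B i ξ‖ ≤ ∑ i, (‖A i ξ‖ ^ 2 + ‖B i ξ‖ ^ 2) := by
      refine sum_le_sum fun i _ => ?_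
      nlinarith [sq_nonneg (‖A i ξ‖ - ‖B i ξ‖), norm_nonneg (A i ξ), norm_nonneg (B i ξ), sq_nonneg (‖A i ξ‖), sq_nonneg (‖B i ξ‖)]
    rw [sum_add_distrib] at h3
    exact h3.trans (add_le_add h1 h2)
  calc _ = ∑ i, ‖∫ ξ, φ ξ * (A i ξ * B i ξ)‖ := sum_congr rfl fun i _ => by rw [hrep]
    _ ≤ ∑ i, ∫ ξ, ‖φ ξ * (A i ξ * B i ξ)‖ := sum_le_sum fun i _ => norm_integral_le_integral_norm _
    _ = ∫ ξ, ∑ i, ‖φ ξ * (A i ξ * B i ξ)‖ := (integral_finsetSum _ fun i _ => (hInt i).norm).symm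
    _ ≤ ∫ ξ, ‖φ ξ‖ * (D * (∑ n ∈ S, 1 / (n:ℝ) * (a n) ^ 2 + ∑ n ∈ S, 1 / (n:ℝ) * (b n) ^ 2)) := by
      refine integral_mono (integrable_finsetSum _ fun i _ => (hInt i).norm) (hφi.norm.mul_const _) ?_
      intro ξ
      simp only [norm_mul, ← mul_sum]
      exact mul_le_mul_of_nonneg_left (hls ξ) (norm_nonneg _)
    _ = _ := by rw [integral_mul_const]

end bil

lemma af_sub_apply (f g : ArithmeticFunction ℝ) (n : ℕ) : (f - g) n = f n - g n := by
  have : ((f - g) + g) n = f n := by rw [sub_add_cancel]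
  rw [ArithmeticFunction.add_apply] at this
  linarith

/-- Truncation of arithmetic functions. -/
def trunc (U : ℕ) (f : ArithmeticFunction ℝ) : ArithmeticFunction ℝ :=
  ⟨fun n => if n ≤ U then f n else 0, by simp⟩

lemma trunc_apply (U : ℕ) (f : ArithmeticFunction ℝ) (n : ℕ) :
    trunc U f n = if n ≤ U then f n else 0 := rfl

/-- Real Moebius function. -/
def muR : ArithmeticFunction ℝ := ((moebius : ArithmeticFunction ℤ) : ArithmeticFunction ℝ)
/-- Real zeta function. -/
def zetaR : ArithmeticFunction ℝ := ((ArithmeticFunction.zeta : ArithmeticFunction ℕ) : ArithmeticFunction ℝ)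

lemma abs_muR (n : ℕ) : |muR n| ≤ 1 := by
  unfold muR
  rw [ArithmeticFunction.intCoe_apply]
  exact_mod_cast ArithmeticFunction.abs_moebius_le_one

lemma zetaR_apply (n : ℕ) (hn : n ≠ 0) : zetaR n = 1 := by
  unfold zetaR
  rw [ArithmeticFunction.natCoe_apply, ArithmeticFunction.zeta_apply, if_neg hn]; simp

lemma vaughan (U : ℕ) : vonMangoldt = trunc U vonMangoldt
    + (vonMangoldt - trunc U vonMangoldt) * (1 - zetaR * trunc U muR)
    + (trunc U muR * ArithmeticFunction.log - (trunc U vonMangoldt * trunc U muR) * zetaR) := by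
  have h : vonMangoldt * zetaR = ArithmeticFunction.log := ArithmeticFunction.vonMangoldt_mul_zeta
  rw [← h]; ring

lemma zetaM_zero (U n : ℕ) (hn : n ≤ U) : (1 - zetaR * trunc U muR) n = 0 := by
  rcases n.eq_zero_or_pos with h0 | h0
  · subst h0; simp
  have h : muR * zetaR = 1 := ArithmeticFunction.coe_moebius_mul_coe_zeta
  rw [← h, mul_comm zetaR]
  rw [af_sub_apply, ArithmeticFunction.mul_apply, ArithmeticFunction.mul_apply, ← sum_sub_distrib]
  refine sum_eq_zero fun x hx => ?_
  have := Nat.divisor_le (Nat.fst_mem_divisors_of_mem_antidiagonal hx)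
  rw [trunc_apply, if_pos (this.trans hn), sub_self]

lemma zetaM_bound (U n : ℕ) (hn : 2 ≤ n) : |(1 - zetaR * trunc U muR) n| ≤ n.divisors.card := by
  rw [af_sub_apply, ArithmeticFunction.one_apply_ne (by omega), zero_sub, abs_neg,
    ArithmeticFunction.mul_apply]
  refine (abs_sum_le_sum_abs _ _).trans ?_
  calc _ ≤ ∑ x ∈ n.divisorsAntidiagonal, (1:ℝ) := by
        refine sum_le_sum fun x hx => ?_
        rw [abs_mul, trunc_apply]
        have hx1 : x.1 ≠ 0 := by
          have := (mem_divisorsAntidiagonal.1 hx)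
          rintro h; rw [h] at this; simp at this; omega
        rw [zetaR_apply _ hx1]
        split_ifs
        · simpa using abs_muR _
        · simp
    _ = _ := by
      rw [sum_const, nsmul_eq_mul, mul_one, ← Nat.map_div_right_divisors, card_map]

lemma LM_bound (U n : ℕ) : |(trunc U vonMangoldt * trunc U muR) n| ≤ log n := by
  rw [ArithmeticFunction.mul_apply]
  refine (abs_sum_le_sum_abs _ _).trans ?_
  calc _ ≤ ∑ x ∈ n.divisorsAntidiagonal, vonMangoldt x.1 := by
        refine sum_le_sum fun x hx => ?_
        rw [abs_mul, trunc_apply, trunc_apply]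
        have h0 : 0 ≤ vonMangoldt x.1 := ArithmeticFunction.vonMangoldt_nonneg
        have h1 : |if x.1 ≤ U then vonMangoldt x.1 else 0| ≤ vonMangoldt x.1 := by
          split_ifs
          · rw [abs_of_nonneg h0]
          · simpa using h0
        have h2 : |if x.2 ≤ U then muR x.2 else 0| ≤ 1 := by
          split_ifs
          · exact abs_muR _
          · simp
        calc _ ≤ vonMangoldt x.1 * 1 := mul_le_mul h1 h2 (abs_nonneg _) h0
          _ = _ := mul_one _
    _ = ∑ i ∈ n.divisors, vonMangoldt i := by
      rw [Nat.sum_divisorsAntidiagonal (fun a _ => vonMangoldt a)]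
    _ = _ := ArithmeticFunction.vonMangoldt_sum

lemma LM_zero (U n : ℕ) (hn : U * U < n) : (trunc U vonMangoldt * trunc U muR) n = 0 := by
  rw [ArithmeticFunction.mul_apply]
  refine sum_eq_zero fun x hx => ?_
  rw [trunc_apply, trunc_apply]
  have := (mem_divisorsAntidiagonal.1 hx).1
  split_ifs with h1 h2
  · have := Nat.mul_le_mul h1 h2; omega
  · simp
  · simp
  · simp

lemma inv_sum_le (N : ℕ) (hN : 1 ≤ N) : ∑ n ∈ range (N+1), 1 / (n:ℝ) ≤ 1 + log N := by
  have h := harmonic_le_one_add_log N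
  refine le_trans (le_of_eq ?_) h
  rw [harmonic_eq_sum_Icc]
  push_cast
  rw [range_eq_Ico, sum_eq_sum_Ico_succ_bot (by omega)]
  simp only [Nat.cast_zero, div_zero, zero_add]
  refine sum_congr ?_ fun x _ => by simp
  first | rfl | (ext x; simp)

lemma card_divisors_mul_le (a b : ℕ) : (a * b).divisors.card ≤ a.divisors.card * b.divisors.card := by
  rw [Nat.divisors_mul]
  exact card_mul_le

lemma divisor_sum_conv (N : ℕ) (f g : ℕ → ℝ) (hf : ∀ n, 0 ≤ f n) (hg : ∀ n, 0 ≤ g n) :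
    ∑ n ∈ range N, (∑ x ∈ n.divisorsAntidiagonal, f x.1 * g x.2)
      ≤ (∑ n ∈ range N, f n) * (∑ n ∈ range N, g n) := by
  rw [sum_sigma', sum_mul_sum, ← sum_product']
  refine (sum_image (f := fun x : ℕ × ℕ => f x.1 * g x.2)
    (g := fun y : (_ : ℕ) × (ℕ × ℕ) => y.2) ?_).symm.le.trans ?_
  · rintro ⟨n, a, b⟩ h1 ⟨n', a', b'⟩ h2 h
    simp only [coe_sigma, Set.mem_sigma_iff, mem_coe, mem_divisorsAntidiagonal] at h1 h2 h
    obtain ⟨_, h1, _⟩ := h1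
    obtain ⟨_, h2, _⟩ := h2
    simp only [Prod.mk.injEq] at h
    obtain ⟨rfl, rfl⟩ := h
    subst h1; subst h2; rfl
  · refine sum_le_sum_of_subset_of_nonneg ?_ fun x _ _ => mul_nonneg (hf _) (hg _)
    intro x hx
    simp only [mem_image, mem_sigma, mem_range, mem_divisorsAntidiagonal] at hx
    obtain ⟨⟨n, a, b⟩, ⟨h0, h1, h3⟩, rfl⟩ := hx
    simp only at h0 h1 h3 ⊢
    subst h1
    have ha : a ≠ 0 := left_ne_zero_of_mul h3
    have hb : b ≠ 0 := right_ne_zero_of_mul h3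
    simp only [mem_product, mem_range]
    exact ⟨lt_of_le_of_lt (Nat.le_mul_of_pos_right _ (Nat.pos_of_ne_zero hb)) h0,
      lt_of_le_of_lt (Nat.le_mul_of_pos_left _ (Nat.pos_of_ne_zero ha)) h0⟩

lemma card_antidiag (n : ℕ) : n.divisorsAntidiagonal.card = n.divisors.card := by
  rw [← Nat.map_div_right_divisors, card_map]

lemma divisor_sum_le (N : ℕ) :
    ∑ n ∈ range N, 1 / (n:ℝ) * (n.divisors.card : ℝ) ≤ (∑ n ∈ range N, 1 / (n:ℝ)) ^ 2 := by
  rw [sq]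
  refine le_trans (sum_le_sum fun n _ => ?_)
    (divisor_sum_conv N (fun n => 1 / (n:ℝ)) (fun n => 1 / (n:ℝ)) (fun n => by positivity) fun n => by positivity)
  rw [← card_antidiag, mul_comm, ← nsmul_eq_mul, ← sum_const]
  refine sum_le_sum fun x hx => ?_
  rw [← (mem_divisorsAntidiagonal.1 hx).1]
  push_cast
  rw [one_div_mul_one_div]

lemma divisor_sq_sum_le (N : ℕ) :
    ∑ n ∈ range N, 1 / (n:ℝ) * (n.divisors.card : ℝ) ^ 2 ≤ (∑ n ∈ range N, 1 / (n:ℝ)) ^ 4 := by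
  have h : ∑ n ∈ range N, 1 / (n:ℝ) * (n.divisors.card : ℝ) ^ 2 ≤
      (∑ n ∈ range N, 1 / (n:ℝ) * (n.divisors.card : ℝ)) * (∑ n ∈ range N, 1 / (n:ℝ) * (n.divisors.card : ℝ)) := by
    refine le_trans (sum_le_sum fun n _ => ?_)
      (divisor_sum_conv N _ _ (fun n => by positivity) fun n => by positivity)
    have : 1 / (n:ℝ) * (n.divisors.card : ℝ) ^ 2 = ∑ x ∈ n.divisorsAntidiagonal, 1 / (n:ℝ) * (n.divisors.card : ℝ) := by
      rw [sum_const, card_antidiag, nsmul_eq_mul]; ring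
    rw [this]
    refine sum_le_sum fun x hx => ?_
    have hx1 := (mem_divisorsAntidiagonal.1 hx).1
    rw [← hx1]
    have h3 : ((x.1 * x.2).divisors.card : ℝ) ≤ x.1.divisors.card * x.2.divisors.card := by
      exact_mod_cast card_divisors_mul_le _ _
    calc _ ≤ 1 / ((x.1 * x.2 : ℕ) : ℝ) * (x.1.divisors.card * x.2.divisors.card) :=
          mul_le_mul_of_nonneg_left h3 (by positivity)
      _ = _ := by push_cast; rw [← one_div_mul_one_div]; ring
  have h2 := divisor_sum_le N
  have h0 : 0 ≤ ∑ n ∈ range N, 1 / (n:ℝ) * (n.divisors.card : ℝ) := sum_nonneg fun n _ => by positivity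
  calc _ ≤ _ := h
    _ ≤ (∑ n ∈ range N, 1 / (n:ℝ)) ^ 2 * (∑ n ∈ range N, 1 / (n:ℝ)) ^ 2 :=
        mul_le_mul h2 h2 h0 (by positivity)
    _ = _ := by ring

/-- Range of summation. -/
def NN (L : ℝ) : ℕ := ⌈exp (2 * L)⌉₊ + 1

lemma exp_le_NN (L : ℝ) : exp (2 * L) ≤ NN L := by
  unfold NN; push_cast; linarith [le_ceil (exp (2 * L))]

lemma NN_pred_log (L : ℝ) (hL : 1 ≤ L) : log ⌈exp (2 * L)⌉₊ ≤ 2 * L + 1 := by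
  have h1 : (⌈exp (2 * L)⌉₊ : ℝ) ≤ 2 * exp (2 * L) := by
    have := (Nat.ceil_lt_add_one (exp_pos (2 * L)).le).le
    have h2 : 1 ≤ exp (2 * L) := one_le_exp (by linarith)
    linarith
  have h0 : (0:ℝ) < ⌈exp (2 * L)⌉₊ := by
    exact_mod_cast Nat.ceil_pos.2 (exp_pos _)
  rw [log_le_iff_le_exp h0]
  refine h1.trans ?_
  rw [exp_add]
  have := Real.exp_one_gt_d9
  nlinarith [exp_pos (2 * L)]

lemma NN_inv_sum (L : ℝ) (hL : 1 ≤ L) : ∑ n ∈ range (NN L), 1 / (n:ℝ) ≤ 4 * L := by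
  have h0 : 1 ≤ ⌈exp (2 * L)⌉₊ := Nat.ceil_pos.2 (exp_pos _)
  have := inv_sum_le _ h0
  have h2 := NN_pred_log L hL
  unfold NN
  linarith

lemma log_lt_NN (L : ℝ) (hL : 1 ≤ L) (n : ℕ) (hn : n < NN L) : log n ≤ 3 * L := by
  rcases n.eq_zero_or_pos with h | h
  · subst h; simp; linarith
  have h2 := NN_pred_log L hL
  have : n ≤ ⌈exp (2 * L)⌉₊ := by unfold NN at hn; omega
  have h3 : log n ≤ log ⌈exp (2 * L)⌉₊ :=
    log_le_log (by exact_mod_cast h) (by exact_mod_cast this)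
  linarith

lemma hw_NN_zero (L : ℝ) (hL : 1 ≤ L) (n : ℕ) (hn : NN L ≤ n) : hw L n = 0 :=
  hw_zero_right (by linarith) ((exp_le_NN L).trans (by exact_mod_cast hn))

/-- The mean value theorem for a family of multiplicative functions. -/
lemma mean_value : ∃ C : ℝ, 0 ≤ C ∧ ∀ {ι : Type} [Fintype ι] (L : ℝ) (_ : 8 ≤ L) (Q : ℝ) (_ : 1 ≤ Q)
    (_ : Q ^ 4 ≤ exp (L / 8))
    (f : ι → ℕ → ℂ) (_ : (Fintype.card ι : ℝ) ≤ Q ^ 2) (_ : ∀ i n, ‖f i n‖ ≤ 1)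
    (_ : ∀ i m n, f i (m * n) = f i m * f i n)
    (_ : ∀ i N, ‖∑ n ∈ range N, f i n‖ ≤ Q)
    (_ : ∀ i j, i ≠ j → ∀ N, ‖∑ n ∈ range N, f i n * conj (f j n)‖ ≤ Q ^ 2),
    ∑ i, ‖∑ n ∈ range (NN L), ((vonMangoldt n : ℝ) : ℂ) * (f i n * (hw L n : ℂ))‖ ≤ C * L ^ 5 := by
  obtain ⟨I, hI, hbil⟩ := bilinear_bound
  refine ⟨I * (6 * 328) + 16 * (1 + CF), by have := one_le_CF; positivity, ?_⟩
  intro ι _ L hL Q hQ hQU f hcard hf hmul hsum hoff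
  have hC := one_le_CF
  have hL1 : 1 ≤ L := by linarith
  set N := NN L with hN
  set U := ⌊exp (L / 8)⌋₊ with hU
  have hUle : (U : ℝ) ≤ exp (L / 8) := floor_le (exp_pos _).le
  have hUlt : exp (L / 8) < U + 1 := Nat.lt_floor_add_one _
  have hU1 : 1 ≤ U := Nat.le_floor (by push_cast; exact one_le_exp (by positivity))
  set a : ArithmeticFunction ℝ := vonMangoldt - trunc U vonMangoldt with ha
  set b : ArithmeticFunction ℝ := 1 - zetaR * trunc U muR with hb
  set LM : ArithmeticFunction ℝ := trunc U vonMangoldt * trunc U muR with hLM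
  set H : ι → ℕ → ℂ := fun i n => f i n * (hw L n : ℂ) with hH
  have hH0 : ∀ i k, N ≤ k → H i k = 0 := by
    intro i k hk; simp only [hH]; rw [hw_NN_zero L hL1 k hk]; simp
  have hsplit : ∀ i, ∑ n ∈ range N, ((vonMangoldt n : ℝ) : ℂ) * H i n
      = ∑ n ∈ range N, (((a * b) n : ℝ) : ℂ) * H i n
        + (∑ n ∈ range N, (((trunc U muR * ArithmeticFunction.log) n : ℝ) : ℂ) * H i n
        - ∑ n ∈ range N, (((LM * zetaR) n : ℝ) : ℂ) * H i n) := by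
    intro i
    rw [← sum_sub_distrib, ← sum_add_distrib]
    refine sum_congr rfl fun n _ => ?_
    have hv : vonMangoldt n = trunc U vonMangoldt n + (a * b) n
        + ((trunc U muR * ArithmeticFunction.log) n - (LM * zetaR) n) := by
      conv_lhs => rw [vaughan U]
      rw [ArithmeticFunction.add_apply, ArithmeticFunction.add_apply, af_sub_apply]
    by_cases hn : n ≤ U
    · have : H i n = 0 := by
        simp only [hH]
        rw [hw_zero_left (by linarith) (by positivity)]
        · simp
        · have h1 : (n:ℝ) ≤ U := by exact_mod_cast hn
          exact h1.trans (hUle.trans (exp_le_exp.2 (by linarith)))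
      rw [this]; simp
    · rw [hv, trunc_apply, if_neg hn]; push_cast; ring
  -- bilinear part
  set S := Ico (U+1) N with hS
  have hSsub : S ⊆ range N := by intro x hx; simp [hS] at hx ⊢; omega
  have hbilpart : ∀ i, ∑ n ∈ range N, (((a * b) n : ℝ) : ℂ) * H i n
      = ∑ m ∈ S, ∑ n ∈ S, (a m : ℂ) * (b n : ℂ) * (f i (m * n) * (hw L ((m * n : ℕ) : ℝ) : ℂ)) := by
    intro i
    rw [conv_sum a b (H i) N (hH0 i)]
    rw [← sum_subset hSsub]
    · refine sum_congr rfl fun m _ => ?_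
      rw [← sum_subset hSsub]
      intro n hn hn'
      have : n ≤ U := by simp [hS] at hn hn'; by_contra h; omega
      rw [zetaM_zero U n this]; simp
    · intro m hm hm'
      have : m ≤ U := by simp [hS] at hm hm'; by_contra h; omega
      have h0 : a m = 0 := by rw [ha, af_sub_apply, trunc_apply, if_pos this, sub_self]
      simp [h0]
  have hinv : ∑ n ∈ S, 1 / (n:ℝ) ≤ 4 * L :=
    (sum_le_sum_of_subset_of_nonneg hSsub fun n _ _ => by positivity).trans (NN_inv_sum L hL1)
  have hoff' : ∀ i j, i ≠ j → ‖∑ n ∈ S, ((1 / (n:ℝ) : ℝ) : ℂ) * (f i n * conj (f j n))‖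
      ≤ 2 * Q ^ 2 / (U + 1) := by
    intro i j hij
    by_cases hUN : U + 1 ≤ N
    · have := abel_bound (fun n => f i n * conj (f j n)) (fun n => ((1 / (n:ℝ) : ℝ) : ℂ))
        (fun n => 1 / (n:ℝ)) (Q^2) (U+1) N hUN (hoff i j hij) ?_ ?_
      · simp_rw [mul_comm (((1 / _ : ℝ) : ℂ))]
        refine this.trans (le_of_eq ?_)
        push_cast; ring
      · intro n hn
        have hn0 : (0:ℝ) < n := by exact_mod_cast (by omega : 0 < n)
        rw [← Complex.ofReal_sub, norm_real, norm_of_nonneg]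
        rw [sub_nonneg]
        apply one_div_le_one_div_of_le hn0; push_cast; linarith
      · intro n hn
        rw [norm_real, norm_of_nonneg (by positivity)]
    · have : S = ∅ := by rw [hS]; exact Ico_eq_empty (by omega)
      rw [this]; simp; positivity
  have hE1 : Fintype.card ι * (2 * Q ^ 2 / (U + 1)) ≤ 2 := by
    rw [mul_div_assoc', div_le_iff₀ (by positivity)]
    nlinarith [sq_nonneg Q]
  have hB := hbil L hL1 S (fun n hn => by simp [hS] at hn; omega) f (2 * Q ^ 2 / (U + 1))
    (by positivity) hf hmul hoff' a b
  have hXa : ∑ n ∈ S, 1 / (n:ℝ) * (a n) ^ 2 ≤ 72 * L ^ 4 := by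
    calc _ ≤ ∑ n ∈ S, 1 / (n:ℝ) * (9 * L ^ 2) := by
          refine sum_le_sum fun n hn => mul_le_mul_of_nonneg_left ?_ (by positivity)
          have hnN : n < N := mem_range.1 (hSsub hn)
          have hnU : ¬ n ≤ U := by simp [hS] at hn; omega
          have e : a n = vonMangoldt n := by rw [ha, af_sub_apply, trunc_apply, if_neg hnU, sub_zero]
          rw [e]
          have h0 : 0 ≤ vonMangoldt n := vonMangoldt_nonneg
          have h1 : vonMangoldt n ≤ 3 * L := vonMangoldt_le_log.trans (log_lt_NN L hL1 n hnN)
          nlinarith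
      _ = (∑ n ∈ S, 1 / (n:ℝ)) * (9 * L ^ 2) := by rw [sum_mul]
      _ ≤ (4 * L) * (9 * L ^ 2) := mul_le_mul_of_nonneg_right hinv (by positivity)
      _ ≤ 72 * L ^ 4 := by
        have : L ^ 3 ≤ L ^ 4 := pow_le_pow_right₀ hL1 (by norm_num)
        nlinarith [pow_pos (by linarith : 0 < L) 3]
  have hXb : ∑ n ∈ S, 1 / (n:ℝ) * (b n) ^ 2 ≤ 256 * L ^ 4 := by
    calc _ ≤ ∑ n ∈ S, 1 / (n:ℝ) * (n.divisors.card : ℝ) ^ 2 := by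
          refine sum_le_sum fun n hn => mul_le_mul_of_nonneg_left ?_ (by positivity)
          have hn2 : 2 ≤ n := by simp [hS] at hn; omega
          rw [← sq_abs (b n)]
          exact pow_le_pow_left₀ (abs_nonneg _) (zetaM_bound U n hn2) 2
      _ ≤ ∑ n ∈ range N, 1 / (n:ℝ) * (n.divisors.card : ℝ) ^ 2 :=
          sum_le_sum_of_subset_of_nonneg hSsub fun n _ _ => by positivity
      _ ≤ (∑ n ∈ range N, 1 / (n:ℝ)) ^ 4 := divisor_sq_sum_le N
      _ ≤ (4 * L) ^ 4 := pow_le_pow_left₀ (sum_nonneg fun n _ => by positivity) (NN_inv_sum L hL1) 4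
      _ = _ := by ring
  have hpart1 : ∑ i, ‖∑ n ∈ range N, (((a * b) n : ℝ) : ℂ) * H i n‖ ≤ I * (6 * 328) * L ^ 5 := by
    simp_rw [hbilpart]
    refine hB.trans ?_
    rw [mul_assoc]
    refine mul_le_mul_of_nonneg_left ?_ hI
    calc _ ≤ (6 * L) * (328 * L ^ 4) := by
          apply mul_le_mul
          · linarith
          · linarith
          · exact add_nonneg (sum_nonneg fun n _ => by positivity) (sum_nonneg fun n _ => by positivity)
          · positivity
      _ = _ := by ring
  -- type I parts
  have htI : ∀ (i : ι) (m : ℕ), 1 ≤ m → ‖∑ n ∈ range N, f i n * (hw L (m * n) : ℂ)‖ ≤ 2 * Q * ((1 + CF) / exp L) ∧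
    ‖∑ n ∈ range N, f i n * ((log n * hw L (m * n) : ℝ) : ℂ)‖
      ≤ 2 * Q * ((2 * L * (1 + CF) + 1) / exp L) :=
    fun i m hm => typeI_bound L hL1 (f i) Q (hsum i) m hm N
  have hQ4 : Q ≤ Q ^ 4 := le_self_pow₀ hQ (by norm_num)
  have hQ24 : Q ^ 2 ≤ Q ^ 4 := pow_le_pow_right₀ hQ (by norm_num)
  have hmain : ∀ (g z : ArithmeticFunction ℝ) (G T : ℝ), 0 ≤ G → 0 ≤ T →
      (∀ m, U * U < m → g m = 0) → (∀ m, m < N → |g m| ≤ G) →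
      (∀ (i : ι) (m : ℕ), 1 ≤ m → ‖∑ n ∈ range N, f i n * ((z n * hw L (m * n) : ℝ) : ℂ)‖ ≤ T) →
      ∀ i, ‖∑ n ∈ range N, (((g * z) n : ℝ) : ℂ) * H i n‖ ≤ (U * U : ℝ) * (G * T) := by
    intro g z G T hG hT hg0 hgG hz i
    rw [conv_sum g z (H i) N (hH0 i)]
    have : ∀ m ∈ range N, ‖∑ n ∈ range N, (g m : ℂ) * (z n : ℂ) * H i (m * n)‖
        ≤ if m ∈ Icc 1 (U * U) then G * T else 0 := by
      intro m hm
      split_ifs with h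
      · have e : ∑ n ∈ range N, (g m : ℂ) * (z n : ℂ) * H i (m * n)
          = (g m : ℂ) * f i m * ∑ n ∈ range N, f i n * ((z n * hw L (m * n) : ℝ) : ℂ) := by
          rw [mul_sum]
          refine sum_congr rfl fun n _ => ?_
          simp only [hH]
          rw [hmul]; push_cast; ring
        rw [e, norm_mul, norm_mul, norm_real]
        refine mul_le_mul ?_ (hz i m (mem_Icc.1 h).1) (norm_nonneg _) hG
        calc _ ≤ G * 1 := mul_le_mul (hgG m (mem_range.1 hm)) (hf i m) (norm_nonneg _) hG
          _ = G := mul_one _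
      · have : g m = 0 := by
          rcases m.eq_zero_or_pos with h0 | h0
          · subst h0; simp
          · apply hg0; by_contra h1; exact h (mem_Icc.2 ⟨h0, by omega⟩)
        simp [this]
    refine (norm_sum_le _ _).trans ((sum_le_sum this).trans ?_)
    rw [← sum_filter, sum_const, nsmul_eq_mul]
    refine mul_le_mul_of_nonneg_right ?_ (by positivity)
    have h1 : (filter (fun m => m ∈ Icc 1 (U*U)) (range N)).card ≤ U * U := by
      refine (card_le_card (t := Icc 1 (U*U)) fun x hx => (mem_filter.1 hx).2).trans ?_
      simp
    exact_mod_cast h1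
  have hUU : (U * U : ℝ) ≤ exp (L / 4) := by
    calc (U * U : ℝ) ≤ exp (L/8) * exp (L/8) := by gcongr
      _ = _ := by rw [← exp_add]; ring_nf
  have hpA : ∀ i, ‖∑ n ∈ range N, (((trunc U muR * ArithmeticFunction.log) n : ℝ) : ℂ) * H i n‖
      ≤ (U * U : ℝ) * (1 * (2 * Q * ((2 * L * (1 + CF) + 1) / exp L))) := by
    apply hmain _ _ _ _ (by norm_num) (by positivity)
    · intro m hm
      rw [trunc_apply, if_neg]
      have : U ≤ U * U := Nat.le_mul_of_pos_left _ (by omega)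
      omega
    · intro m _
      rw [trunc_apply]; split_ifs
      · exact abs_muR m
      · simp
    · intro i m hm
      exact (htI i m hm).2
  have hpB : ∀ i, ‖∑ n ∈ range N, (((LM * zetaR) n : ℝ) : ℂ) * H i n‖
      ≤ (U * U : ℝ) * (3 * L * (2 * Q * ((1 + CF) / exp L))) := by
    apply hmain _ _ _ _ (by positivity) (by positivity)
    · intro m hm; exact LM_zero U m hm
    · intro m hm; exact (LM_bound U m).trans (log_lt_NN L hL1 m hm)
    · intro i m hm
      refine le_trans (le_of_eq ?_) (htI i m hm).1
      congr 1
      refine sum_congr rfl fun n _ => ?_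
      rcases n.eq_zero_or_pos with h0 | h0
      · subst h0; simp [hw]
      · rw [zetaR_apply n (by omega), one_mul]
  have hfin : ∀ i, ‖∑ n ∈ range N, ((vonMangoldt n : ℝ) : ℂ) * H i n‖ ≤
      ‖∑ n ∈ range N, (((a * b) n : ℝ) : ℂ) * H i n‖ + exp (L/4) * (16 * L * (1 + CF) * Q / exp L) := by
    intro i
    rw [hsplit i]
    refine (norm_add_le _ _).trans (add_le_add le_rfl ?_)
    refine (norm_sub_le _ _).trans ((add_le_add (hpA i) (hpB i)).trans ?_)
    rw [← mul_add]
    refine mul_le_mul hUU ?_ (by positivity) (by positivity)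
    rw [mul_div_assoc', mul_div_assoc', mul_div_assoc', mul_div_assoc', ← add_div]
    gcongr
    nlinarith [mul_nonneg (by linarith : 0 ≤ Q) (by linarith : 0 ≤ L), mul_nonneg (mul_nonneg (by linarith : 0 ≤ Q) (by linarith : 0 ≤ L)) (by linarith : 0 ≤ CF)]
  have hlast : (Fintype.card ι : ℝ) * (exp (L/4) * (16 * L * (1 + CF) * Q / exp L)) ≤ 16 * (1 + CF) * L ^ 5 := by
    have h1 : (Fintype.card ι : ℝ) * Q * exp (L/4) ≤ exp L := by
      calc _ ≤ Q ^ 4 * Q ^ 4 * exp (L/4) := by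
            gcongr
            exact hcard.trans hQ24
        _ ≤ exp (L/8) * exp (L/8) * exp (L/4) := by gcongr
        _ = exp (L/2) := by rw [← exp_add, ← exp_add]; ring_nf
        _ ≤ _ := exp_le_exp.2 (by linarith)
    have h2 : L ≤ L ^ 5 := le_self_pow₀ hL1 (by norm_num)
    calc _ = ((Fintype.card ι : ℝ) * Q * exp (L/4)) / exp L * (16 * (1 + CF) * L) := by ring
      _ ≤ 1 * (16 * (1 + CF) * L) := by
          gcongr
          exact (div_le_one (exp_pos _)).2 h1
      _ ≤ _ := by rw [one_mul]; gcongr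
  calc _ ≤ ∑ i, (‖∑ n ∈ range N, (((a * b) n : ℝ) : ℂ) * H i n‖ + exp (L/4) * (16 * L * (1 + CF) * Q / exp L)) :=
        sum_le_sum fun i _ => hfin i
    _ = ∑ i, ‖∑ n ∈ range N, (((a * b) n : ℝ) : ℂ) * H i n‖ + (Fintype.card ι : ℝ) * (exp (L/4) * (16 * L * (1 + CF) * Q / exp L)) := by
        rw [sum_add_distrib, sum_const, nsmul_eq_mul, card_univ]
    _ ≤ I * (6 * 328) * L ^ 5 + 16 * (1 + CF) * L ^ 5 := add_le_add hpart1 hlast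
    _ = _ := by ring

/-- `log^j t * t^{-s}` -/
def Phi (j : ℕ) (s : ℂ) (t : ℝ) : ℂ := ((log t ^ j : ℝ) : ℂ) * Complex.exp (-s * (log t : ℝ))

lemma Phi_norm (j : ℕ) (s : ℂ) (t : ℝ) (ht : 0 < t) :
    ‖Phi j s t‖ = |log t| ^ j * t ^ (-s.re) := by
  unfold Phi
  rw [norm_mul, norm_real, Complex.norm_exp, norm_eq_abs, abs_pow]
  congr 1
  rw [rpow_def_of_pos ht]
  simp
  ring

lemma log_pow_le (j : ℕ) (t : ℝ) (ht : 1 ≤ t) :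
    (1 + log t) ^ j ≤ (2 ^ j * j.factorial * 2) * sqrt t := by
  have h0 : 0 ≤ log t := log_nonneg ht
  have h := pow_div_factorial_le_exp ((1 + log t) / 2) (by positivity) j
  have hf : (0:ℝ) < j.factorial := by positivity
  rw [div_le_iff₀ hf, div_pow, div_le_iff₀ (by positivity)] at h
  refine h.trans ?_
  have he : exp ((1 + log t) / 2) ≤ 2 * sqrt t := by
    rw [add_div, exp_add]
    have h1 : exp (log t / 2) = sqrt t := by
      rw [Real.exp_half, exp_log (by linarith)]
    rw [h1]
    have h2 : exp (1/2) ≤ 2 := by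
      rw [Real.exp_half]
      refine Real.sqrt_le_iff.mpr ⟨by norm_num, ?_⟩
      have := Real.exp_one_lt_d9; linarith
    gcongr
  calc _ ≤ (2 * sqrt t) * j.factorial * 2 ^ j := by gcongr
    _ = _ := by ring

lemma Phi_hasDeriv (j : ℕ) (s : ℂ) (t : ℝ) (ht : 0 < t) :
    HasDerivAt (Phi j s) (((j * log t ^ (j-1) * t⁻¹ : ℝ) : ℂ) * Complex.exp (-s * (log t : ℝ))
      + ((log t ^ j : ℝ) : ℂ) * (Complex.exp (-s * (log t : ℝ)) * (-s * ((t⁻¹:ℝ):ℂ)))) t := by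
  unfold Phi
  have h1 : HasDerivAt (fun t => ((log t ^ j : ℝ) : ℂ)) ((j * log t ^ (j-1) * t⁻¹ : ℝ) : ℂ) t :=
    ((Real.hasDerivAt_log ht.ne').pow j).ofReal_comp
  have h2 : HasDerivAt (fun t => Complex.exp (-s * (log t : ℝ))) _ t :=
    ((Real.hasDerivAt_log ht.ne').ofReal_comp.const_mul (-s)).cexp
  exact h1.mul h2

lemma Phi_deriv_bound (j : ℕ) (s : ℂ) (hs : 1 < s.re) (hs2 : ‖s‖ ≤ 3) (t : ℝ) (ht : 1 ≤ t) :
    ‖((j * log t ^ (j-1) * t⁻¹ : ℝ) : ℂ) * Complex.exp (-s * (log t : ℝ))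
      + ((log t ^ j : ℝ) : ℂ) * (Complex.exp (-s * (log t : ℝ)) * (-s * ((t⁻¹:ℝ):ℂ)))‖
     ≤ (j+3) * (2 ^ j * j.factorial * 2) * (sqrt t / t^2) := by
  have h0 : 0 ≤ log t := log_nonneg ht
  have ht0 : 0 < t := by linarith
  have he : ‖Complex.exp (-s * (log t : ℝ))‖ ≤ t⁻¹ := by
    rw [Complex.norm_exp]
    have : (-s * (log t : ℝ)).re = -(s.re * log t) := by simp
    rw [this, ← exp_log (inv_pos.mpr ht0), Real.log_inv]
    apply exp_le_exp.mpr
    nlinarith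
  have hA : log t ^ (j-1) ≤ (1 + log t) ^ j :=
    (pow_le_pow_left₀ h0 (by linarith) _).trans (pow_le_pow_right₀ (by linarith) (by omega))
  have hB : log t ^ j ≤ (1 + log t) ^ j := pow_le_pow_left₀ h0 (by linarith) _
  have hC := log_pow_le j t ht
  refine (norm_add_le _ _).trans ?_
  rw [norm_mul, norm_mul, norm_mul, norm_mul, norm_neg, norm_real, norm_real, norm_real,
    norm_of_nonneg (by positivity), norm_of_nonneg (by positivity), norm_of_nonneg (by positivity)]
  calc _ ≤ j * (1 + log t) ^ j * t⁻¹ * t⁻¹ + (1 + log t) ^ j * (t⁻¹ * (3 * t⁻¹)) := by gcongr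
    _ = (j+3) * (1 + log t) ^ j * (t⁻¹)^2 := by ring
    _ ≤ (j+3) * ((2 ^ j * j.factorial * 2) * sqrt t) * (t⁻¹)^2 := by gcongr
    _ = _ := by field_simp

lemma sqrt_diff (n : ℝ) (hn : 1 ≤ n) : sqrt n / n^2 ≤ 5 * (1 / sqrt n - 1 / sqrt (n+1)) := by
  have hn0 : 0 < n := by linarith
  set a := sqrt n with ha
  set b := sqrt (n+1) with hb
  have ha0 : 0 < a := sqrt_pos.mpr hn0
  have hb0 : 0 < b := sqrt_pos.mpr (by linarith)
  have ha2 : a^2 = n := sq_sqrt hn0.le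
  have hb2 : b^2 = n+1 := sq_sqrt (by linarith)
  have hba : b ≤ 3/2 * a := by
    rw [← abs_of_pos hb0, ← abs_of_pos (show 0 < 3/2*a by positivity)]
    apply sq_le_sq.mp; nlinarith
  have h1 : 1/a - 1/b = 1/(a*b*(a+b)) := by
    field_simp
    nlinarith
  rw [h1, ← ha2]
  have h2 : a*b*(a+b) ≤ 5 * a^3 := by
    calc a*b*(a+b) ≤ a*(3/2*a)*(a+3/2*a) := by gcongr
      _ = 15/4*a^3 := by ring
      _ ≤ _ := by nlinarith [pow_pos ha0 3]
  rw [div_le_iff₀ (by positivity), mul_one_div, div_mul_eq_mul_div, le_div_iff₀ (by positivity)]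
  nlinarith [mul_le_mul_of_nonneg_left h2 ha0.le]

lemma Phi_diff (j : ℕ) (s : ℂ) (hs : 1 < s.re) (hs2 : ‖s‖ ≤ 3) (n : ℕ) (hn : 1 ≤ n) :
    ‖Phi j s n - Phi j s ((n+1 : ℕ):ℝ)‖ ≤ 5 * ((j+3) * (2 ^ j * j.factorial * 2)) / sqrt n
       - 5 * ((j+3) * (2 ^ j * j.factorial * 2)) / sqrt ((n+1:ℕ):ℝ) := by
  have hn1 : (1:ℝ) ≤ n := by exact_mod_cast hn
  have h := (convex_Icc (n:ℝ) (n+1)).norm_image_sub_le_of_norm_hasDerivWithin_le (f := Phi j s)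
    (C := (j+3) * (2 ^ j * j.factorial * 2) * (sqrt n / n^2)) (x := (n:ℝ)+1) (y := n)
    (fun x hx => (Phi_hasDeriv j s x (by linarith [hx.1])).hasDerivWithinAt)
    (fun x hx => (Phi_deriv_bound j s hs hs2 x (by linarith [hx.1])).trans ?_) (by simp) (by simp)
  · push_cast
    refine h.trans ?_
    have e1 : ‖(n:ℝ) - (n+1)‖ = 1 := by simp
    rw [e1, mul_one]
    refine (mul_le_mul_of_nonneg_left (sqrt_diff n hn1) (by positivity)).trans (le_of_eq ?_)
    ring
  · have hx0 : 0 < x := by linarith [hx.1]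
    have key : ∀ y : ℝ, 0 < y → sqrt y / y^2 = 1 / (y * sqrt y) := by
      intro y hy
      have := sq_sqrt hy.le
      have h0 := sqrt_pos.mpr hy
      rw [div_eq_div_iff (by positivity) (by positivity)]
      nlinarith
    rw [key x hx0, key n (by linarith)]
    have := sqrt_le_sqrt hx.1
    have h3 : 0 < sqrt n := sqrt_pos.mpr (by linarith)
    have := hx.1
    gcongr

/-- coefficients of `L_j` -/
def cL {r : ℕ} (χ : DirichletCharacter ℂ r) (j : ℕ) (n : ℕ) : ℂ :=
  χ (n : ZMod r) * ((log n ^ j : ℝ) : ℂ)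

def cG {r : ℕ} (χ : DirichletCharacter ℂ r) (j : ℕ) (n : ℕ) : ℂ :=
  χ (n : ZMod r) * ((vonMangoldt n * log n ^ j : ℝ) : ℂ)

lemma term_cL {r : ℕ} (χ : DirichletCharacter ℂ r) (j : ℕ) (s : ℂ) (n : ℕ) (hn : n ≠ 0) :
    LSeries.term (cL χ j) s n = χ (n : ZMod r) * Phi j s n := by
  rw [LSeries.term_of_ne_zero hn, cL, Phi, div_eq_mul_inv, ← Complex.cpow_neg,
    Complex.cpow_def_of_ne_zero (by exact_mod_cast hn), ← Complex.natCast_log, mul_assoc]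
  congr 3
  ring

lemma summable_log_pow (j : ℕ) (σ : ℝ) (hσ : 1 < σ) :
    Summable fun n : ℕ => log n ^ j * (n:ℝ) ^ (-σ) := by
  have h1 : Summable fun n : ℕ => (n:ℝ) ^ (-((1+σ)/2)) := by
    rw [summable_nat_rpow]; linarith
  set c : ℝ := (2/(σ-1))^j * j.factorial
  refine Summable.of_nonneg_of_le (fun n => by have := log_natCast_nonneg n; positivity) (fun n => ?_) (h1.mul_left c)
  rcases n.eq_zero_or_pos with rfl | hn
  · simp only [Nat.cast_zero]
    rw [Real.zero_rpow (by linarith), Real.zero_rpow (by linarith)]; simp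
  have hn0 : (0:ℝ) < n := by exact_mod_cast hn
  have h := pow_div_factorial_le_exp ((σ-1)/2 * log n) (mul_nonneg (by linarith) (log_natCast_nonneg n)) j
  have hd : 0 < σ - 1 := by linarith
  have hf : (0:ℝ) < j.factorial := by positivity
  rw [div_le_iff₀ hf, mul_pow] at h
  have h2 : log n ^ j ≤ c * exp ((σ-1)/2 * log n) := by
    have := mul_le_mul_of_nonneg_left h (show 0 ≤ (2/(σ-1))^j by positivity)
    rw [← mul_assoc, ← mul_pow] at this
    have e : 2/(σ-1) * ((σ-1)/2) = 1 := by field_simp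
    rw [e, one_pow, one_mul] at this
    refine this.trans (le_of_eq ?_); ring
  calc _ ≤ c * exp ((σ-1)/2 * log n) * (n:ℝ) ^ (-σ) := by gcongr
    _ = _ := by
      rw [rpow_def_of_pos hn0, rpow_def_of_pos hn0, mul_assoc, ← exp_add]
      congr 2; ring

lemma cL_summable {r : ℕ} (χ : DirichletCharacter ℂ r) (j : ℕ) (s : ℂ) (hs : 1 < s.re) :
    LSeriesSummable (cL χ j) s := by
  refine Summable.of_norm_bounded (summable_log_pow j s.re hs) fun n => ?_
  rcases n.eq_zero_or_pos with rfl | hn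
  · simp only [LSeries.term_zero, norm_zero]
    positivity
  rw [term_cL _ _ _ _ hn.ne', norm_mul, Phi_norm _ _ _ (by exact_mod_cast hn), abs_of_nonneg (log_natCast_nonneg n)]
  refine mul_le_of_le_one_left ?_ (χ.norm_le_one _)
  have := log_natCast_nonneg n
  positivity

lemma L_bound (j : ℕ) : ∃ C : ℝ, 1 ≤ C ∧ ∀ (r : ℕ) [NeZero r] (χ : DirichletCharacter ℂ r), χ ≠ 1 →
    ∀ s : ℂ, 1 < s.re → s.re ≤ 2 → |s.im| ≤ 1 → ‖LSeries (cL χ j) s‖ ≤ C * (1 + log r) ^ (j+1) := by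
  set V0 : ℝ := 5 * ((j+3) * (2 ^ j * j.factorial * 2)) with hV0
  refine ⟨2 * V0 + 2^(j+1), ?_, fun r _ χ hχ s hs hs2 him => ?_⟩
  · have : (1:ℝ) ≤ 2^(j+1) := one_le_pow₀ (by norm_num)
    have : 0 ≤ V0 := by positivity
    linarith
  have hr : 1 ≤ r := Nat.one_le_iff_ne_zero.mpr (NeZero.ne r)
  have hr1 : (1:ℝ) ≤ r := by exact_mod_cast hr
  have hlr : 0 ≤ log r := log_natCast_nonneg r
  have hs3 : ‖s‖ ≤ 3 := by
    refine (Complex.norm_le_abs_re_add_abs_im s).trans ?_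
    rw [abs_of_pos (by linarith)]; linarith
  have hnn : ‖∑' n, LSeries.term (cL χ j) s n‖ ≤ _ := 
    le_of_tendsto ((cL_summable χ j s hs).hasSum.tendsto_sum_nat.norm) (b := (2 * V0 + 2^(j+1)) * (1 + log r) ^ (j+1)) ?_
  · exact hnn
  filter_upwards [Filter.eventually_ge_atTop (r^2)] with M hM
  rw [← sum_range_add_sum_Ico _ hM, add_comm]
  have hone : 1 ≤ (1 + log r) ^ (j+1) := one_le_pow₀ (by linarith)
  have hr2 : 1 ≤ r^2 := Nat.one_le_pow _ _ hr
  refine (norm_add_le _ _).trans ?_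
  rw [add_mul]
  refine add_le_add ?_ ?_
  · refine le_trans ?_ (le_mul_of_one_le_right (by positivity) hone)
    have := abel_bound (fun n => χ (n : ZMod r)) (fun n => Phi j s n) (fun n => V0 / sqrt n) r (r^2) M hM
      (fun N => char_sum_bound r χ hχ N) (fun n hn => ?_) (fun n hn => ?_)
    · refine le_trans (le_of_eq ?_) (this.trans (le_of_eq ?_))
      · congr 1
        refine sum_congr rfl fun n hn => term_cL _ _ _ _ ?_
        have := (mem_Ico.mp hn).1; omega
      · push_cast
        rw [Real.sqrt_sq (by positivity)]; field_simp
    · exact Phi_diff j s hs hs3 n (hr2.trans hn)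
    · have hn1 : (1:ℝ) ≤ n := by exact_mod_cast hr2.trans hn
      have hl : 0 ≤ log n := log_nonneg hn1
      rw [Phi_norm j s n (by linarith), abs_of_nonneg hl]
      have h1 : (n:ℝ) ^ (-s.re) ≤ (n:ℝ)⁻¹ := by
        rw [← Real.rpow_neg_one]; exact Real.rpow_le_rpow_of_exponent_le hn1 (by linarith)
      have h2 : log n ^ j ≤ (2 ^ j * j.factorial * 2) * sqrt n :=
        (pow_le_pow_left₀ hl (by linarith) _).trans (log_pow_le j n hn1)
      have hsn : 0 < sqrt n := sqrt_pos.mpr (by linarith)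
      calc _ ≤ ((2 ^ j * j.factorial * 2) * sqrt n) * (n:ℝ)⁻¹ := by gcongr
        _ = (2 ^ j * j.factorial * 2) / sqrt n := by
          have := sq_sqrt (show (0:ℝ) ≤ n by linarith)
          field_simp
          linarith
        _ ≤ _ := by
          gcongr
          rw [hV0]
          have : (0:ℝ) ≤ 2 ^ j * j.factorial * 2 := by positivity
          have hj : (0:ℝ) ≤ j := by positivity
          nlinarith [mul_nonneg hj this]
  · calc ‖∑ n ∈ range (r^2), LSeries.term (cL χ j) s n‖ ≤ ∑ n ∈ range (r^2), (2 * log r)^j * (1 / (n:ℝ)) := by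
          refine norm_sum_le_of_le _ fun n hn => ?_
          rcases n.eq_zero_or_pos with rfl | hn0
          · simp
          have hn1 : (1:ℝ) ≤ n := by exact_mod_cast hn0
          have hl : 0 ≤ log n := log_nonneg hn1
          rw [term_cL _ _ _ _ hn0.ne', norm_mul, Phi_norm j s n (by linarith), abs_of_nonneg hl]
          refine (mul_le_of_le_one_left (by positivity) (χ.norm_le_one _)).trans ?_
          have h1 : (n:ℝ) ^ (-s.re) ≤ 1/(n:ℝ) := by
            rw [one_div, ← Real.rpow_neg_one]; exact Real.rpow_le_rpow_of_exponent_le hn1 (by linarith)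
          have h2 : log n ≤ 2 * log r := by
            have := log_le_log (by linarith) (show (n:ℝ) ≤ (r:ℝ)^2 by exact_mod_cast (mem_range.mp hn).le)
            rwa [log_pow] at this
          gcongr
      _ ≤ (2 * log r)^j * (1 + log ((r^2:ℕ):ℝ)) := by
          rw [← mul_sum]
          gcongr
          refine le_trans (sum_le_sum_of_subset_of_nonneg (range_mono (Nat.le_succ _)) fun i _ _ => by positivity) (inv_sum_le (r^2) hr2)
      _ ≤ (2 * (1 + log r))^j * (2 * (1 + log r)) := by
          push_cast
          rw [log_pow]
          gcongr <;> push_cast <;> linarith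
      _ = _ := by rw [← mul_pow, ← pow_succ]

lemma term_cG {r : ℕ} (χ : DirichletCharacter ℂ r) (j : ℕ) (s : ℂ) (n : ℕ) (hn : n ≠ 0) :
    LSeries.term (cG χ j) s n = χ (n : ZMod r) * ((vonMangoldt n : ℝ) : ℂ) * Phi j s n := by
  rw [LSeries.term_of_ne_zero hn, cG, Phi, div_eq_mul_inv, ← Complex.cpow_neg,
    Complex.cpow_def_of_ne_zero (by exact_mod_cast hn), ← Complex.natCast_log]
  push_cast
  rw [mul_comm (-s)]
  ring

lemma term_cG_norm {r : ℕ} (χ : DirichletCharacter ℂ r) (j : ℕ) (s : ℂ) (n : ℕ) (hs : 1 < s.re) :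
    ‖LSeries.term (cG χ j) s n‖ ≤ log n ^ (j+1) * (n:ℝ) ^ (-s.re) := by
  rcases n.eq_zero_or_pos with rfl | hn
  · simp only [LSeries.term_zero, norm_zero]
    simp
  have hl := log_natCast_nonneg n
  rw [term_cG _ _ _ _ hn.ne', norm_mul, norm_mul, Phi_norm _ _ _ (by exact_mod_cast hn), abs_of_nonneg hl,
    norm_real, norm_of_nonneg vonMangoldt_nonneg]
  have h1 := χ.norm_le_one (n : ZMod r)
  have h2 : vonMangoldt n ≤ log n := vonMangoldt_le_log
  calc _ ≤ 1 * log n * (log n ^ j * (n:ℝ) ^ (-s.re)) := by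
        gcongr
    _ = _ := by ring

lemma cG_summable {r : ℕ} (χ : DirichletCharacter ℂ r) (j : ℕ) (s : ℂ) (hs : 1 < s.re) :
    LSeriesSummable (cG χ j) s :=
  Summable.of_norm_bounded (summable_log_pow (j+1) s.re hs) fun n => term_cG_norm χ j s n hs

lemma L_rec {r : ℕ} (χ : DirichletCharacter ℂ r) (j : ℕ) (s : ℂ) (hs : 1 < s.re) :
    LSeries (cL χ (j+1)) s = ∑ i ∈ range (j+1), (j.choose i : ℂ) * (LSeries (cG χ i) s * LSeries (cL χ (j-i)) s) := by
  have h1 : ∀ i, HasSum (fun n => LSeries.term (LSeries.convolution (cG χ i) (cL χ (j-i))) s n)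
      (LSeries (cG χ i) s * LSeries (cL χ (j-i)) s) := fun i =>
    LSeriesHasSum.convolution (cG_summable χ i s hs).LSeriesHasSum (cL_summable χ (j-i) s hs).LSeriesHasSum
  have h2 := hasSum_sum (s := range (j+1)) fun i _ => (h1 i).mul_left (j.choose i : ℂ)
  refine HasSum.unique ((cL_summable χ (j+1) s hs).hasSum) ?_
  suffices hf : LSeries.term (cL χ (j+1)) s = fun n => ∑ i ∈ range (j+1), (j.choose i : ℂ) *
      LSeries.term (LSeries.convolution (cG χ i) (cL χ (j-i))) s n by rw [hf]; exact h2
  funext n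
  rcases n.eq_zero_or_pos with rfl | hn
  · simp
  rw [LSeries.term_of_ne_zero hn.ne']
  simp only [LSeries.term_of_ne_zero hn.ne', ← mul_div_assoc, ← sum_div]
  congr 1
  simp only [LSeries.convolution_def, mul_sum]
  rw [sum_comm]
  have : ∀ p ∈ n.divisorsAntidiagonal, ∑ i ∈ range (j+1), (j.choose i : ℂ) * (cG χ i p.1 * cL χ (j-i) p.2)
      = χ (n : ZMod r) * ((vonMangoldt p.1 * log n ^ j : ℝ) : ℂ) := by
    intro p hp
    obtain ⟨hp1, hp2⟩ := mem_divisorsAntidiagonal.mp hp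
    have ha : p.1 ≠ 0 := fun h => by simp [h] at hp1; omega
    have hb : p.2 ≠ 0 := fun h => by simp [h] at hp1; omega
    have hlog : log n = log p.1 + log p.2 := by
      rw [← hp1, Nat.cast_mul, Real.log_mul (by exact_mod_cast ha) (by exact_mod_cast hb)]
    have hchi : χ (n : ZMod r) = χ (p.1 : ZMod r) * χ (p.2 : ZMod r) := by
      rw [← hp1, Nat.cast_mul, map_mul]
    rw [hlog, hchi, add_pow]
    push_cast
    rw [mul_sum, mul_sum]
    refine sum_congr rfl fun i _ => ?_
    rw [cG, cL]
    push_cast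
    ring
  rw [sum_congr rfl this, ← mul_sum, cL]
  congr 1
  rw [← Complex.ofReal_sum, ← sum_mul]
  congr 1
  have h3 := congrFun (congrArg DFunLike.coe vonMangoldt_mul_zeta) n
  rw [ArithmeticFunction.mul_apply, ArithmeticFunction.log_apply] at h3
  rw [pow_succ, mul_comm, ← h3]
  congr 1
  refine sum_congr rfl fun p hp => ?_
  obtain ⟨hp1, hp2⟩ := mem_divisorsAntidiagonal.mp hp
  have hb : p.2 ≠ 0 := fun h => by simp [h] at hp1; omega
  rw [ArithmeticFunction.natCoe_apply, ArithmeticFunction.zeta_apply_ne hb]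
  simp

lemma G_bound (j : ℕ) : ∃ c : ℝ, 0 ≤ c ∧ ∀ (r : ℕ) (χ : DirichletCharacter ℂ r) (s : ℂ) (H T : ℝ), 1 < s.re →
    0 < T → T ≤ H → 1 ≤ H → (∀ i ≤ j+1, ‖LSeries (cL χ i) s‖ ≤ H) → T ≤ ‖LSeries (cL χ 0) s‖ →
    ‖LSeries (cG χ j) s‖ ≤ c * (H / T) ^ (j+1) := by
  induction j using Nat.strong_induction_on with
  | _ j ih =>
  choose! c hc0 hc using ih
  refine ⟨1 + ∑ i ∈ range j, (j.choose i : ℝ) * c i, ?_, ?_⟩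
  · have : 0 ≤ ∑ i ∈ range j, (j.choose i : ℝ) * c i :=
      sum_nonneg fun i hi => mul_nonneg (by positivity) (hc0 i (mem_range.mp hi))
    linarith
  intro r χ s H T hs hT hTH hH hL hL0
  have hrec := L_rec χ j s hs
  rw [sum_range_succ, Nat.sub_self, Nat.choose_self, Nat.cast_one, one_mul] at hrec
  have hHT : 1 ≤ H / T := by rw [le_div_iff₀ hT]; linarith
  have h1 : ‖LSeries (cG χ j) s‖ * ‖LSeries (cL χ 0) s‖ ≤ H + ∑ i ∈ range j, (j.choose i : ℝ) * (c i * (H/T)^j * H) := by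
    rw [← norm_mul, ← sub_eq_iff_eq_add'.mpr hrec]
    refine (norm_sub_le _ _).trans (add_le_add (hL _ le_rfl) ?_)
    refine norm_sum_le_of_le _ fun i hi => ?_
    have hi' := mem_range.mp hi
    rw [norm_mul, norm_mul, Complex.norm_natCast]
    have h3 := hc i hi' r χ s H T hs hT hTH hH (fun i' hi2 => hL i' (by omega)) hL0
    have h4 : (H/T)^(i+1) ≤ (H/T)^j := pow_le_pow_right₀ hHT (by omega)
    have h5 := hc0 i hi'
    have h6 := hL (j-i) (by omega)
    gcongr
    exact h3.trans (by gcongr)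
  have h2 : ‖LSeries (cG χ j) s‖ * T ≤ (1 + ∑ i ∈ range j, (j.choose i : ℝ) * c i) * (H/T)^j * H := by
    refine (mul_le_mul_of_nonneg_left hL0 (norm_nonneg _)).trans (h1.trans ?_)
    rw [add_mul, add_mul, one_mul, sum_mul, sum_mul]
    refine add_le_add ?_ (le_of_eq (sum_congr rfl fun i _ => by ring))
    exact le_mul_of_one_le_left (by linarith) (one_le_pow₀ hHT)
  rw [← le_div_iff₀ hT] at h2
  refine h2.trans (le_of_eq ?_)
  rw [pow_succ]; ring

lemma zeta_sum_bound : ∃ δ0 : ℝ, 0 < δ0 ∧ ∀ δ, 0 < δ → δ < δ0 → ∑' n : ℕ, (n:ℝ) ^ (-(1+δ)) ≤ 2 / δ := by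
  have h := tendsto_sub_mul_tsum_nat_rpow.eventually (Iio_mem_nhds (show (1:ℝ) < 2 by norm_num))
  rw [eventually_nhdsWithin_iff, Metric.eventually_nhds_iff] at h
  obtain ⟨ε, hε, h⟩ := h
  refine ⟨ε, hε, fun δ hδ hδ2 => ?_⟩
  have h1 := @h (1+δ) (by rw [Real.dist_eq, add_sub_cancel_left, abs_of_pos hδ]; exact hδ2) (by simp [hδ])
  rw [le_div_iff₀ hδ, mul_comm]
  simp only [Set.mem_Iio, add_sub_cancel_left, one_div] at h1
  refine le_trans (le_of_eq ?_) h1.le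
  congr 2; ext n
  rw [Real.rpow_neg (by positivity)]

lemma G_triv (j : ℕ) : ∃ C Y0 : ℝ, 0 ≤ C ∧ 1 ≤ Y0 ∧ ∀ Y, Y0 ≤ Y → ∀ (r : ℕ) (χ : DirichletCharacter ℂ r) (s : ℂ),
    s.re = 1 + 1/Y → ‖LSeries (cG χ j) s‖ ≤ C * Y^(j+2) := by
  obtain ⟨δ0, hδ0, hz⟩ := zeta_sum_bound
  refine ⟨2^(j+1) * (j+1).factorial * 4, max 1 (1/δ0), by positivity, le_max_left _ _, fun Y hY r χ s hs => ?_⟩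
  have hY1 : 1 ≤ Y := (le_max_left _ _).trans hY
  have hY0 : 0 < Y := by linarith
  have hY2 : 1/δ0 ≤ Y := (le_max_right _ _).trans hY
  have hd : 1/(2*Y) < δ0 := by
    rw [div_le_iff₀ hδ0] at hY2
    rw [div_lt_iff₀ (by positivity)]; nlinarith
  have hs1 : 1 < s.re := by rw [hs]; have : 0 < 1/Y := by positivity
                            linarith
  have hb : ∀ n : ℕ, ‖LSeries.term (cG χ j) s n‖ ≤ (2*Y)^(j+1) * (j+1).factorial * (n:ℝ) ^ (-(1+1/(2*Y))) := by
    intro n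
    refine (term_cG_norm χ j s n hs1).trans ?_
    rcases n.eq_zero_or_pos with rfl | hn
    · simp; positivity
    have hn0 : (0:ℝ) < n := by exact_mod_cast hn
    have h := pow_div_factorial_le_exp (1/(2*Y) * log n) (by have := log_natCast_nonneg n; positivity) (j+1)
    rw [div_le_iff₀ (by positivity), mul_pow] at h
    have h2 := mul_le_mul_of_nonneg_left h (show 0 ≤ (2*Y)^(j+1) by positivity)
    rw [← mul_assoc, ← mul_pow] at h2
    have e : 2*Y * (1/(2*Y)) = 1 := by field_simp
    rw [e, one_pow, one_mul] at h2
    calc _ ≤ ((2*Y)^(j+1) * (exp (1/(2*Y) * log n) * (j+1).factorial)) * (n:ℝ) ^ (-s.re) := by gcongr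
      _ = (2*Y)^(j+1) * (j+1).factorial * (exp (1/(2*Y) * log n) * (n:ℝ) ^ (-s.re)) := by ring
      _ = _ := by
        rw [rpow_def_of_pos hn0, rpow_def_of_pos hn0, ← exp_add, hs]
        congr 2; field_simp; ring
  have hsum : Summable fun n : ℕ => (n:ℝ) ^ (-(1+1/(2*Y))) := by
    rw [summable_nat_rpow]
    have : 0 < 1/(2*Y) := by positivity
    linarith
  refine (tsum_of_norm_bounded ((hsum.hasSum).mul_left _) hb).trans ?_
  refine (mul_le_mul_of_nonneg_left (hz _ (by positivity) hd) (by positivity)).trans (le_of_eq ?_)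
  rw [mul_pow, pow_succ Y (j+1)]
  field_simp
  ring

def psiA (A : ℕ) (u : ℝ) : ℝ := F u * exp u * (u⁻¹)^A

lemma psiA_contDiff (A : ℕ) : ContDiff ℝ ∞ (psiA A) := by
  rw [contDiff_iff_contDiffAt]
  intro u
  rcases lt_or_ge u 1 with h | h
  · have : psiA A =ᶠ[nhds u] fun _ => 0 := by
      filter_upwards [Iio_mem_nhds h] with v hv
      simp [psiA, F_zero_left (le_of_lt hv)]
    exact contDiffAt_const.congr_of_eventuallyEq this
  · unfold psiA
    exact (F_contDiff.contDiffAt.mul Real.contDiff_exp.contDiffAt).mul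
      ((contDiffAt_id.inv (by simp; linarith)).pow A)

lemma psiA_hcs (A : ℕ) : HasCompactSupport (psiA A) := by
  unfold psiA
  exact (F_hcs.mul_right).mul_right

/-- The twisted prime sum -/
def psiX (L : ℝ) {r : ℕ} (χ : DirichletCharacter ℂ r) : ℂ :=
  ∑ n ∈ range (NN L), ((vonMangoldt n : ℝ) : ℂ) * (χ (n : ZMod r) * (hw L n : ℂ))

lemma Phi_split (A : ℕ) (L ξ t : ℝ) (hL : 0 < L) :
    Phi A (((1 + 1/L : ℝ) : ℂ) - ((2 * pi * ξ / L : ℝ) : ℂ) * Complex.I) t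
     = Phi A ((1 + 1/L : ℝ) : ℂ) t * Complex.exp ((2 * pi * (ξ * (log t / L)) : ℝ) * Complex.I) := by
  unfold Phi
  rw [mul_assoc (Complex.ofReal (log t ^ A)), ← Complex.exp_add]
  congr 2
  push_cast
  have : (L:ℂ) ≠ 0 := by exact_mod_cast hL.ne'
  field_simp
  ring

lemma psi_bound (A : ℕ) : ∃ C L0 : ℝ, 0 ≤ C ∧ 1 ≤ L0 ∧ ∀ L, L0 ≤ L → ∀ (r : ℕ) (χ : DirichletCharacter ℂ r) (K : ℝ), 0 ≤ K →
    (∀ t : ℝ, |t| ≤ 1 / sqrt L → ‖LSeries (cG χ A) (((1 + 1/L : ℝ) : ℂ) + (t : ℂ) * Complex.I)‖ ≤ K) →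
    ‖psiX L χ‖ ≤ C * (K + 1) / L^A := by
  obtain ⟨φ, hφc, hφi, hφk, hφ⟩ := fourier_rep (fun u => (psiA A u : ℂ))
    ((psiA_hcs A).comp_left (g := Complex.ofReal) (by simp))
    (Complex.ofRealCLM.contDiff.comp (psiA_contDiff A))
  obtain ⟨C1, L1, hC1, hL1, hG⟩ := G_triv A
  set k := 2*(A+2) with hk
  set I0 := ∫ ξ, ‖φ ξ‖ with hI0
  set Ik := ∫ ξ, |ξ|^k * ‖φ ξ‖ with hIk
  have hI0n : 0 ≤ I0 := integral_nonneg fun _ => norm_nonneg _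
  have hIkn : 0 ≤ Ik := integral_nonneg fun _ => by positivity
  refine ⟨I0 + C1 * (2*pi)^k * Ik, L1, by positivity, hL1, fun L hL r χ K hK hKb => ?_⟩
  have hLone : 1 ≤ L := hL1.trans hL
  have hL0 : 0 < L := by linarith
  have hσ : 1 < 1 + 1/L := by have : 0 < 1/L := by positivity
                              linarith
  set S : ℝ → ℂ := fun ξ => ((1 + 1/L : ℝ) : ℂ) - ((2 * pi * ξ / L : ℝ) : ℂ) * Complex.I with hS
  have hSre : ∀ ξ, (S ξ).re = 1 + 1/L := by intro ξ; simp [hS]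
  set a : ℕ → ℂ := fun n => LSeries.term (cG χ A) ((1 + 1/L : ℝ) : ℂ) n with ha
  set ex : ℝ → ℕ → ℂ := fun ξ n => Complex.exp ((2 * pi * (ξ * (log n / L)) : ℝ) * Complex.I) with hex
  have hexn : ∀ ξ n, ‖ex ξ n‖ = 1 := fun ξ n => Complex.norm_exp_ofReal_mul_I _
  have hexc : ∀ n, Continuous fun ξ => ex ξ n := by intro n; simp only [hex]; fun_prop
  have hterm : ∀ ξ n, LSeries.term (cG χ A) (S ξ) n = a n * ex ξ n := by
    intro ξ n
    rcases n.eq_zero_or_pos with rfl | hn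
    · simp [ha]
    simp only [ha, hex, hS]
    rw [term_cG _ _ _ _ hn.ne', term_cG _ _ _ _ hn.ne', Phi_split A L ξ n hL0]
    ring
  have hasum : Summable fun n => ‖a n‖ := 
    (cG_summable χ A ((1 + 1/L : ℝ) : ℂ) (by simpa using hL0)).norm
  -- the integral identity
  have hInt : ∀ n, Integrable fun ξ => φ ξ * (a n * ex ξ n) := by
    intro n
    refine (hφi.mul_const ‖a n‖).mono ((hφc.mul (continuous_const.mul (hexc n))).aestronglyMeasurable) ?_
    refine Filter.Eventually.of_forall fun ξ => ?_
    simp [hexn]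
  have hI := hasSum_integral_of_summable_integral_norm hInt (by
    have : ∀ n, ∫ ξ, ‖φ ξ * (a n * ex ξ n)‖ = I0 * ‖a n‖ := by
      intro n
      simp only [norm_mul, hexn, mul_one]
      rw [integral_mul_const]
    simp only [this]
    exact hasum.mul_left _)
  have hI2 : ∀ n, ∫ ξ, φ ξ * (a n * ex ξ n) = a n * (psiA A (log n / L) : ℂ) := by
    intro n
    rw [hφ, ← integral_const_mul]
    refine integral_congr_ae (Filter.Eventually.of_forall fun ξ => ?_)
    simp only [hex]; ring
  have hterm2 : ∀ n, a n * (psiA A (log n / L) : ℂ) = (L:ℂ)^A * (((vonMangoldt n : ℝ) : ℂ) * (χ (n : ZMod r) * (hw L n : ℂ))) := by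
    intro n
    rcases n.eq_zero_or_pos with rfl | hn
    · simp [ha]
    have hn0 : (0:ℝ) < n := by exact_mod_cast hn
    simp only [ha]
    rw [term_cG _ _ _ _ hn.ne']
    have key : Phi A ((1 + 1/L : ℝ) : ℂ) n * (psiA A (log n / L) : ℂ) = (L:ℂ)^A * (hw L n : ℂ) := by
      unfold Phi
      have : Complex.exp (-((1 + 1/L : ℝ) : ℂ) * (log n : ℝ)) = ((exp (-(1+1/L) * log n) : ℝ) : ℂ) := by
        push_cast; rfl
      rw [this]
      have : log n ^ A * exp (-(1+1/L) * log n) * psiA A (log n / L) = L^A * hw L n := by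
        unfold psiA hw
        by_cases h1 : log n / L ≤ 1
        · rw [F_zero_left h1]; simp
        push Not at h1
        have hlog : 0 < log n := by
          rw [lt_div_iff₀ hL0] at h1; linarith
        have h2 : exp (-(1+1/L) * log n) * exp (log n / L) = (n:ℝ)⁻¹ := by
          rw [← exp_add, ← exp_log (inv_pos.mpr hn0), Real.log_inv]
          congr 1; field_simp; ring
        calc _ = log n ^ A * ((log n / L)⁻¹)^A * F (log n / L) * (exp (-(1+1/L) * log n) * exp (log n / L)) := by ring
          _ = _ := by
            rw [h2, ← mul_pow, inv_div]
            have : log n * (L / log n) = L := by field_simp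
            rw [this]; ring
      exact_mod_cast this
    rw [mul_assoc, key]; ring
  simp only [hI2, hterm2] at hI
  have hfin : HasSum (fun n => (L:ℂ)^A * (((vonMangoldt n : ℝ) : ℂ) * (χ (n : ZMod r) * (hw L n : ℂ)))) ((L:ℂ)^A * psiX L χ) := by
    unfold psiX
    rw [mul_sum]
    refine hasSum_sum_of_ne_finset_zero fun n hn => ?_
    rw [hw_NN_zero L hLone n (by simpa using hn)]; simp
  have heq := hI.unique hfin
  -- bound
  have hsq : 0 < sqrt L := sqrt_pos.mpr hL0
  have hbound : ‖∫ ξ, ∑' n, φ ξ * (a n * ex ξ n)‖ ≤ ∫ ξ, (K * ‖φ ξ‖ + C1 * (2*pi)^k * (|ξ|^k * ‖φ ξ‖)) := by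
    refine norm_integral_le_of_norm_le ((hφi.norm.const_mul K).add ((hφk k).const_mul _)) (Filter.Eventually.of_forall fun ξ => ?_)
    rw [tsum_mul_left]
    have e : ∑' n, a n * ex ξ n = LSeries (cG χ A) (S ξ) := by
      unfold LSeries; exact tsum_congr fun n => (hterm ξ n).symm
    rw [e, norm_mul]
    by_cases h : |-(2 * pi * ξ / L)| ≤ 1 / sqrt L
    · have := hKb _ h
      have e2 : (((1 + 1/L : ℝ) : ℂ) + ((-(2 * pi * ξ / L) : ℝ) : ℂ) * Complex.I) = S ξ := by
        simp only [hS]; push_cast; ring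
      rw [e2] at this
      have h2 : 0 ≤ C1 * (2*pi)^k * (|ξ|^k * ‖φ ξ‖) := by positivity
      nlinarith [norm_nonneg (φ ξ), mul_le_mul_of_nonneg_left this (norm_nonneg (φ ξ))]
    · push Not at h
      have h1 := hG L hL r χ (S ξ) (hSre ξ)
      have h2 : L^(A+2) ≤ (2*pi)^k * |ξ|^k := by
        rw [abs_neg, abs_div, abs_of_pos hL0, abs_mul, abs_of_pos Real.two_pi_pos, div_lt_div_iff₀ hsq hL0, one_mul] at h
        have h3 : sqrt L ≤ 2 * pi * |ξ| := by
          have := sq_sqrt hL0.le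
          by_contra hh
          push Not at hh
          nlinarith [mul_lt_mul_of_pos_right hh hsq]
        have h4 := pow_le_pow_left₀ hsq.le h3 k
        rw [hk, pow_mul, sq_sqrt hL0.le] at h4
        rw [hk, ← mul_pow]; exact h4
      have h3 : C1 * L^(A+2) ≤ C1 * ((2*pi)^k * |ξ|^k) := mul_le_mul_of_nonneg_left h2 hC1
      have h4 := mul_le_mul_of_nonneg_left (h1.trans h3) (norm_nonneg (φ ξ))
      have h5 : 0 ≤ K * ‖φ ξ‖ := by positivity
      linarith
  rw [heq, integral_add (hφi.norm.const_mul K) ((hφk k).const_mul _), integral_const_mul, integral_const_mul, norm_mul, norm_pow,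
    norm_real, norm_of_nonneg hL0.le] at hbound
  rw [le_div_iff₀ (by positivity), mul_comm]
  refine hbound.trans ?_
  have h9 : 0 ≤ C1 * (2 * pi) ^ k * Ik := by positivity
  rw [← hI0, ← hIk]
  nlinarith [mul_nonneg hK h9]

open Filter

/-- `χ` is bad at scale `u`, where `ℓ = u^100`. -/
def Bad (u : ℝ) {r : ℕ} (χ : DirichletCharacter ℂ r) : Prop :=
  ‖LSeries (cL χ 0) ((1 + (u^10)⁻¹ : ℝ) : ℂ)‖ ≤ (u^6)⁻¹

lemma log_pow_eventually (C : ℝ) (B j : ℕ) : ∀ᶠ u : ℝ in atTop, C * (1 + B * log u) ^ j ≤ u := by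
  have h := (Real.isLittleO_pow_log_id_atTop (n := j)).bound (c := 1 / (|C| * (B+1)^j + 1)) (by positivity)
  filter_upwards [h, eventually_ge_atTop (exp 1)] with u h1 h2
  have hu0 : 0 < u := (exp_pos 1).trans_le h2
  have hlog : 1 ≤ log u := by rw [le_log_iff_exp_le hu0]; exact h2
  rw [norm_of_nonneg (by positivity), id, norm_of_nonneg hu0.le, one_div, inv_mul_eq_div, le_div_iff₀ (by positivity)] at h1
  have h3 : (1 + B * log u) ^ j ≤ ((B+1) * log u)^j := by
    gcongr; nlinarith
  calc _ ≤ |C| * (1 + B * log u) ^ j := by gcongr; exact le_abs_self C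
    _ ≤ |C| * ((B+1) * log u)^j := by gcongr
    _ = log u ^ j * (|C| * (B+1)^j) := by rw [mul_pow]; ring
    _ ≤ log u ^ j * (|C| * (B+1)^j + 1) := by gcongr; linarith
    _ ≤ u := h1

lemma L_bound_unif (A B : ℕ) : ∀ᶠ u : ℝ in atTop, ∀ (r : ℕ) [NeZero r] (χ : DirichletCharacter ℂ r), χ ≠ 1 →
    (r:ℝ) ≤ u^B → ∀ j ≤ A, ∀ s : ℂ, 1 < s.re → s.re ≤ 2 → |s.im| ≤ 1 → ‖LSeries (cL χ j) s‖ ≤ u := by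
  choose C hC hL using L_bound
  have h : ∀ j ∈ range (A+1), ∀ᶠ u : ℝ in atTop, C j * (1 + B * log u) ^ (j+1) ≤ u :=
    fun j _ => log_pow_eventually (C j) B (j+1)
  filter_upwards [(Filter.eventually_all_finset _).mpr h, eventually_ge_atTop 1] with u hu hu1 r _ χ hχ hr j hj s h1 h2 h3
  refine (hL j r χ hχ s h1 h2 h3).trans (le_trans ?_ (hu j (by simp; omega)))
  have hr1 : (1:ℝ) ≤ r := by exact_mod_cast Nat.one_le_iff_ne_zero.mpr (NeZero.ne r)
  have := log_nonneg hr1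
  have hC0 := hC j
  have h4 : log r ≤ B * log u := by
    rw [← log_pow]; exact log_le_log (by linarith) hr
  gcongr

lemma cL_abscissa {r : ℕ} (χ : DirichletCharacter ℂ r) (j : ℕ) (s : ℂ) (hs : 1 < s.re) :
    LSeries.abscissaOfAbsConv (cL χ j) < s.re := by
  have h := (cL_summable χ j (((1 + s.re)/2 : ℝ) : ℂ) (by rw [ofReal_re]; linarith)).abscissaOfAbsConv_le
  refine h.trans_lt ?_
  rw [ofReal_re]
  exact_mod_cast (show (1 + s.re)/2 < s.re by linarith)

lemma cL_hasDeriv {r : ℕ} (χ : DirichletCharacter ℂ r) (j : ℕ) (s : ℂ) (hs : 1 < s.re) :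
    HasDerivAt (LSeries (cL χ j)) (-LSeries (cL χ (j+1)) s) s := by
  have h := LSeries_hasDerivAt (cL_abscissa χ j s hs)
  have e : LSeries.logMul (cL χ j) = cL χ (j+1) := by
    funext n
    simp only [LSeries.logMul, cL]
    rw [← Complex.natCast_log, pow_succ]
    push_cast; ring
  rwa [e] at h

/-- non-bad characters have small prime sums -/
lemma nonbad_small (A B : ℕ) : ∀ᶠ u : ℝ in atTop, ∀ (r : ℕ) [NeZero r] (χ : DirichletCharacter ℂ r), χ ≠ 1 →
    (r:ℝ) ≤ u^B → ¬ Bad u χ → ‖psiX (u^100) χ‖ ≤ 1 / (u^100)^A := by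
  set A' := 2*A+1 with hA'
  obtain ⟨C, ℓ0, hC, hℓ0, hpsi⟩ := psi_bound A'
  obtain ⟨c, hc, hG⟩ := G_bound A'
  have hlarge : ∀ᶠ u : ℝ in atTop, C * (c + 1) ≤ u := eventually_ge_atTop _
  filter_upwards [L_bound_unif (A'+1) B, eventually_ge_atTop 6, eventually_ge_atTop ℓ0, hlarge] with u hL hu hu0 hCc r _ χ hχ hr hbad
  have hu1 : 1 ≤ u := by linarith
  have hup : 0 < u := by linarith
  unfold Bad at hbad
  push Not at hbad
  have hell : ℓ0 ≤ u^100 := hu0.trans (le_self_pow₀ hu1 (by norm_num))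
  have hsq : sqrt (u^100) = u^50 := by
    rw [show u^100 = (u^50)^2 by ring, Real.sqrt_sq (by positivity)]
  have hi10 : (u^10)⁻¹ ≤ 1/2 := by
    rw [inv_le_comm₀ (by positivity) (by norm_num)]
    have := le_self_pow₀ hu1 (show 10 ≠ 0 by norm_num)
    norm_num; linarith
  have hi50 : (u^50)⁻¹ ≤ (u^10)⁻¹ := by
    gcongr 1; exact pow_le_pow_right₀ hu1 (by norm_num)
  have hi100 : (u^100)⁻¹ ≤ (u^10)⁻¹ := by
    gcongr 1; exact pow_le_pow_right₀ hu1 (by norm_num)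
  have hpos : 0 < (u^10)⁻¹ := by positivity
  have hpos100 : 0 < (u^100)⁻¹ := by positivity
  have hK := hpsi (u^100) hell r χ (c * (u^8)^(A'+1)) (by positivity) (fun t ht => ?_)
  · refine hK.trans ?_
    rw [div_le_div_iff₀ (by positivity) (by positivity), one_mul]
    have h1 : c * (u^8)^(A'+1) + 1 ≤ (c+1) * (u^8)^(A'+1) := by
      have : 1 ≤ (u^8)^(A'+1) := one_le_pow₀ (one_le_pow₀ hu1)
      linarith
    calc _ ≤ C * ((c+1) * (u^8)^(A'+1)) * (u^100)^A := by gcongr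
      _ = (C * (c+1)) * ((u^8)^(A'+1) * (u^100)^A) := by ring
      _ ≤ u * ((u^8)^(A'+1) * (u^100)^A) := by gcongr
      _ = u^(1 + 8*(A'+1) + 100*A) := by ring
      _ ≤ u^(100*A') := pow_le_pow_right₀ hu1 (by omega)
      _ = _ := by ring
  · rw [hsq, one_div] at ht
    set s : ℂ := (((1 + 1/(u^100) : ℝ) : ℂ) + (t : ℂ) * Complex.I) with hs
    have hre : s.re = 1 + (u^100)⁻¹ := by
      rw [hs, Complex.add_re, ofReal_re, Complex.re_ofReal_mul, Complex.I_re]; simp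
    have him : s.im = t := by
      rw [hs, Complex.add_im, ofReal_im, Complex.im_ofReal_mul, Complex.I_im]; simp
    have hs1 : 1 < s.re := by rw [hre]; linarith
    have hs2 : s.re ≤ 2 := by rw [hre]; linarith
    have hs3 : |s.im| ≤ 1 := by rw [him]; linarith
    set w : ℂ := ((1 + (u^10)⁻¹ : ℝ) : ℂ) with hw
    have hwre : w.re = 1 + (u^10)⁻¹ := by rw [hw, ofReal_re]
    have hwim : w.im = 0 := by rw [hw, ofReal_im]
    set D : Set ℂ := {z | 1 < z.re ∧ z.re ≤ 2} ∩ {z | -1 ≤ z.im ∧ z.im ≤ 1} with hD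
    have hconv : Convex ℝ D := by
      refine Convex.inter (Convex.inter ?_ ?_) (Convex.inter ?_ ?_)
      · exact convex_halfSpace_re_gt 1
      · exact convex_halfSpace_re_le 2
      · exact convex_halfSpace_im_ge (-1)
      · exact convex_halfSpace_im_le 1
    have hsD : s ∈ D := ⟨⟨hs1, hs2⟩, abs_le.mp hs3⟩
    have hwD : w ∈ D := ⟨⟨by rw [hwre]; linarith, by rw [hwre]; linarith⟩, by show -1 ≤ w.im ∧ w.im ≤ 1; rw [hwim]; norm_num⟩
    have hdiff := hconv.norm_image_sub_le_of_norm_hasDerivWithin_le (f := LSeries (cL χ 0)) (C := u)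
      (fun z hz => (cL_hasDeriv χ 0 z hz.1.1).hasDerivWithinAt)
      (fun z hz => by
        rw [norm_neg]; exact hL r χ hχ hr 1 (by omega) z hz.1.1 hz.1.2 (abs_le.mpr hz.2)) hsD hwD
    have hws : ‖w - s‖ ≤ 3 * (u^10)⁻¹ := by
      refine (Complex.norm_le_abs_re_add_abs_im _).trans ?_
      rw [Complex.sub_re, Complex.sub_im, hwre, hwim, hre, him, zero_sub, abs_neg]
      have : |1 + (u ^ 10)⁻¹ - (1 + (u ^ 100)⁻¹)| ≤ (u^10)⁻¹ := by
        rw [abs_le]; constructor <;> linarith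
      linarith
    have hL0 : (u^6)⁻¹ / 2 ≤ ‖LSeries (cL χ 0) s‖ := by
      have h1 := norm_sub_norm_le (LSeries (cL χ 0) w) (LSeries (cL χ 0) s)
      have h2 : u * (3 * (u^10)⁻¹) ≤ (u^6)⁻¹ / 2 := by
        rw [show u * (3 * (u^10)⁻¹) = 3 * (u^9)⁻¹ by field_simp, show (u^6)⁻¹/2 = (u^3/2) * (u^9)⁻¹ by field_simp]
        gcongr
        nlinarith [sq_nonneg u, mul_pos hup hup]
      have h3 := mul_le_mul_of_nonneg_left hws hup.le
      linarith
    have h6 : (u^6)⁻¹ ≤ 1 := inv_le_one_of_one_le₀ (one_le_pow₀ hu1)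
    have hg := hG r χ s u ((u^6)⁻¹ / 2) hs1 (by positivity) (by linarith) hu1
      (fun i hi => hL r χ hχ hr i hi s hs1 hs2 hs3) hL0
    refine hg.trans ?_
    gcongr
    rw [div_le_iff₀ (by positivity), show u^8 * ((u^6)⁻¹/2) = u^2/2 by field_simp]
    nlinarith

lemma log_comb_nonneg {a : ℝ} (ha₀ : 0 ≤ a) (ha₁ : a < 1) {z w : ℂ} (hz : ‖z‖ ≤ 1) (hw : ‖w‖ ≤ 1) :
    0 ≤ 2 * (-Complex.log (1 - a)).re + 2 * (-Complex.log (1 - a * z)).re + 2 * (-Complex.log (1 - a * w)).re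
       + (-Complex.log (1 - a * (z * w))).re + (-Complex.log (1 - a * (z * conj w))).re := by
  have key : ∀ v : ℂ, ‖v‖ ≤ 1 → ‖(a:ℂ) * v‖ < 1 := by
    intro v hv
    rw [norm_mul, Complex.norm_of_nonneg ha₀]
    nlinarith [norm_nonneg v]
  have h0 : ‖(a:ℂ)‖ < 1 := by rw [Complex.norm_of_nonneg ha₀]; exact ha₁
  have hzw : ‖z * w‖ ≤ 1 := by rw [norm_mul]; exact mul_le_one₀ hz (norm_nonneg _) hw
  have hzw' : ‖z * conj w‖ ≤ 1 := by rw [norm_mul, Complex.norm_conj]; exact mul_le_one₀ hz (norm_nonneg _) hw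
  rw [← (((((hasSum_re <| hasSum_taylorSeries_neg_log h0).mul_left 2).add
    ((hasSum_re <| hasSum_taylorSeries_neg_log (key z hz)).mul_left 2)).add
    ((hasSum_re <| hasSum_taylorSeries_neg_log (key w hw)).mul_left 2)).add
    (hasSum_re <| hasSum_taylorSeries_neg_log (key _ hzw))).add
    (hasSum_re <| hasSum_taylorSeries_neg_log (key _ hzw')) |>.tsum_eq]
  refine tsum_nonneg fun n ↦ ?_
  simp only [← Complex.ofReal_pow, Complex.div_natCast_re, ofReal_re, mul_pow, Complex.mul_re, ofReal_im, zero_mul,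
    sub_zero, ← map_pow, Complex.conj_re, Complex.conj_im]
  simp only [← mul_div_assoc, ← add_div]
  refine div_nonneg ?_ n.cast_nonneg
  have h1 : -1 ≤ (z^n).re := by
    have := Complex.abs_re_le_norm (z^n)
    rw [norm_pow] at this
    exact (abs_le.mp (this.trans (pow_le_one₀ (norm_nonneg _) hz))).1
  have h2 : -1 ≤ (w^n).re := by
    have := Complex.abs_re_le_norm (w^n)
    rw [norm_pow] at this
    exact (abs_le.mp (this.trans (pow_le_one₀ (norm_nonneg _) hw))).1
  have h3 : 0 ≤ a^n * ((1 + (z^n).re) * (1 + (w^n).re)) := mul_nonneg (pow_nonneg ha₀ n) (mul_nonneg (by linarith) (by linarith))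
  nlinarith

lemma cl_apply {n m : ℕ} (h : n ∣ m) (χ : DirichletCharacter ℂ n) (k : ℕ) (hk : k.Coprime m) :
    changeLevel h χ (k : ZMod m) = χ (k : ZMod n) := by
  have := DirichletCharacter.changeLevel_eq_cast_of_dvd χ h (ZMod.unitOfCoprime k hk)
  rw [ZMod.coe_unitOfCoprime, ZMod.cast_natCast h] at this
  exact this

lemma chi_zero {n : ℕ} (χ : DirichletCharacter ℂ n) (k : ℕ) (hk : ¬ k.Coprime n) : χ (k : ZMod n) = 0 :=
  χ.map_nonunit (by rwa [ZMod.isUnit_iff_coprime])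

lemma prod_apply {r1 r2 : ℕ} (χ1 : DirichletCharacter ℂ r1) (χ2 : DirichletCharacter ℂ r2) (k : ℕ) :
    (changeLevel (Nat.dvd_mul_right r1 r2) χ1 *
      changeLevel (Nat.dvd_mul_left r2 r1) χ2) (k : ZMod (r1 * r2)) =
      χ1 (k : ZMod r1) * χ2 (k : ZMod r2) := by
  by_cases hk : k.Coprime (r1 * r2)
  · rw [MulChar.mul_apply, cl_apply _ _ _ hk, cl_apply _ _ _ hk]
  · rw [chi_zero _ _ hk]
    rw [Nat.coprime_mul_iff_right, not_and_or] at hk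
    rcases hk with hk | hk
    · rw [chi_zero _ _ hk, zero_mul]
    · rw [chi_zero _ _ hk, mul_zero]

lemma cL_zero {r : ℕ} (χ : DirichletCharacter ℂ r) : cL χ 0 = fun n : ℕ => χ (n : ZMod r) := by
  funext n; simp [cL]

lemma L_prod_ge_one {r1 r2 : ℕ} (χ1 : DirichletCharacter ℂ r1) (χ2 : DirichletCharacter ℂ r2) (σ : ℝ) (hσ : 1 < σ) :
    1 ≤ ‖LSeries (cL (1 : DirichletCharacter ℂ 1) 0) σ‖^2 * ‖LSeries (cL χ1 0) σ‖^2 * ‖LSeries (cL χ2 0) σ‖^2 *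
      ‖LSeries (cL (changeLevel (Nat.dvd_mul_right r1 r2) χ1 *
      changeLevel (Nat.dvd_mul_left r2 r1) χ2) 0) σ‖ *
      ‖LSeries (cL (changeLevel (Nat.dvd_mul_right r1 r2) χ1 *
      changeLevel (Nat.dvd_mul_left r2 r1) χ2⁻¹) 0) σ‖ := by
  have hs : 1 < (σ:ℂ).re := by simpa using hσ
  have key : ∀ {r : ℕ} (χ : DirichletCharacter ℂ r), ‖LSeries (cL χ 0) σ‖ =
      exp (∑' p : Nat.Primes, (-Complex.log (1 - χ (p:ℕ) * ((p:ℕ):ℂ) ^ (-(σ:ℂ)))).re) := by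
    intro r χ
    rw [cL_zero, ← DirichletCharacter.LSeries_eulerProduct_exp_log χ hs, Complex.norm_exp,
      Complex.re_tsum (DirichletCharacter.summable_neg_log_one_sub_mul_prime_cpow χ hs)]
  have hsum : ∀ {r : ℕ} (χ : DirichletCharacter ℂ r), Summable fun p : Nat.Primes =>
      (-Complex.log (1 - χ (p:ℕ) * ((p:ℕ):ℂ) ^ (-(σ:ℂ)))).re := fun χ =>
    (hasSum_re (DirichletCharacter.summable_neg_log_one_sub_mul_prime_cpow χ hs).hasSum).summable
  simp only [key, ← exp_nat_mul, ← exp_add]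
  rw [Real.one_le_exp_iff, ← tsum_mul_left, ← tsum_mul_left, ← tsum_mul_left,
    ← ((hsum _).mul_left _).tsum_add ((hsum _).mul_left _),
    ← (((hsum _).mul_left _).add ((hsum _).mul_left _)).tsum_add ((hsum _).mul_left _),
    ← ((((hsum _).mul_left _).add ((hsum _).mul_left _)).add ((hsum _).mul_left _)).tsum_add (hsum _),
    ← (((((hsum _).mul_left _).add ((hsum _).mul_left _)).add ((hsum _).mul_left _)).add (hsum _)).tsum_add (hsum _)]
  refine tsum_nonneg fun p => ?_
  rw [prod_apply, prod_apply, ← MulChar.star_apply']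
  have hp : (0:ℝ) < ((p:ℕ):ℝ) := by exact_mod_cast p.prop.pos
  have e : ((p:ℕ):ℂ) ^ (-(σ:ℂ)) = ((((p:ℕ):ℝ) ^ (-σ) : ℝ) : ℂ) := by
    rw [Complex.ofReal_cpow hp.le]; simp
  have hlt : (((p:ℕ):ℝ) ^ (-σ) : ℝ) < 1 :=
    Real.rpow_lt_one_of_one_lt_of_neg (by exact_mod_cast p.prop.one_lt) (by linarith)
  have := log_comb_nonneg (a := ((p:ℕ):ℝ) ^ (-σ)) (by positivity) hlt (χ1.norm_le_one (p:ℕ)) (χ2.norm_le_one (p:ℕ))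
  rw [e]
  have h1 : (1 : DirichletCharacter ℂ 1) ((p:ℕ) : ZMod 1) = 1 := by
    rw [MulChar.one_apply]; exact isUnit_of_subsingleton _
  rw [h1, one_mul]
  simp only [mul_comm _ (((((p:ℕ):ℝ) ^ (-σ) : ℝ)) : ℂ)]
  exact_mod_cast this

lemma zeta_L_bound : ∀ᶠ u : ℝ in atTop, ‖LSeries (cL (1 : DirichletCharacter ℂ 1) 0) ((1 + (u^10)⁻¹ : ℝ) : ℂ)‖ ≤ 2 * u^10 := by
  obtain ⟨δ0, hδ0, hz⟩ := zeta_sum_bound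
  filter_upwards [eventually_gt_atTop (1/δ0), eventually_ge_atTop 1] with u h1 h2
  have hu : 0 < u := by linarith
  have h3 : (u^10)⁻¹ < δ0 := by
    rw [inv_lt_comm₀ (by positivity) hδ0, ← one_div]
    exact h1.trans_le (le_self_pow₀ h2 (by norm_num))
  have hp : 0 < (u^10)⁻¹ := by positivity
  have hb := hz _ hp h3
  have hsum : Summable fun n : ℕ => (n:ℝ) ^ (-(1+(u^10)⁻¹)) := by
    rw [summable_nat_rpow]; linarith
  refine (tsum_of_norm_bounded hsum.hasSum fun n => ?_).trans (hb.trans (le_of_eq ?_))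
  · rcases n.eq_zero_or_pos with rfl | hn
    · simp only [LSeries.term_zero, norm_zero]; positivity
    rw [term_cL _ _ _ _ hn.ne', norm_mul, Phi_norm _ _ _ (by exact_mod_cast hn), pow_zero, one_mul, ofReal_re]
    exact mul_le_of_le_one_left (by positivity) (DirichletCharacter.norm_le_one _ _)
  · field_simp

lemma two_bad (B : ℕ) : ∀ᶠ u : ℝ in atTop, ∀ (r1 r2 : ℕ) [NeZero r1] [NeZero r2] (χ1 : DirichletCharacter ℂ r1)
    (χ2 : DirichletCharacter ℂ r2), χ1.IsPrimitive → χ2.IsPrimitive → r1 ≠ r2 → (r1:ℝ) ≤ u^B → (r2:ℝ) ≤ u^B →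
    Bad u χ1 → Bad u χ2 → False := by
  filter_upwards [L_bound_unif 0 (2*B), zeta_L_bound, eventually_ge_atTop 3] with u hL hz hu r1 r2 _ _ χ1 χ2 hp1 hp2 hne hr1 hr2 hb1 hb2
  have hu0 : 0 < u := by linarith
  have hu1 : 1 ≤ u := by linarith
  have hσ : 1 < 1 + (u^10)⁻¹ := by have : 0 < (u^10)⁻¹ := by positivity
                                   linarith
  have hσ2 : 1 + (u^10)⁻¹ ≤ 2 := by
    have : (u^10)⁻¹ ≤ 1 := inv_le_one_of_one_le₀ (one_le_pow₀ hu1)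
    linarith
  have h := L_prod_ge_one χ1 χ2 (1 + (u^10)⁻¹) hσ
  have hne1 : ∀ χ : DirichletCharacter ℂ r2, χ.conductor = r2 → changeLevel (Nat.dvd_mul_right r1 r2) χ1 *
      changeLevel (Nat.dvd_mul_left r2 r1) χ ≠ 1 := by
    intro χ hχ hh
    have h1 := eq_inv_of_mul_eq_one_left hh
    have h2 := congrArg DirichletCharacter.conductor h1
    rw [DirichletCharacter.conductor_inv, DirichletCharacter.conductor_changeLevel,
      DirichletCharacter.conductor_changeLevel, hχ, (DirichletCharacter.isPrimitive_def _).mp hp1] at h2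
    exact hne h2
  have hr : ((r1 * r2 : ℕ) : ℝ) ≤ u^(2*B) := by
    push_cast
    calc (r1:ℝ) * r2 ≤ u^B * u^B := by gcongr
      _ = _ := by ring
  have h12 := hL (r1 * r2) _ (hne1 χ2 hp2) hr 0 le_rfl ((1 + (u^10)⁻¹ : ℝ) : ℂ) (by rw [ofReal_re]; exact hσ)
    (by rw [ofReal_re]; exact hσ2) (by rw [ofReal_im]; simp)
  have h12' := hL (r1 * r2) _ (hne1 χ2⁻¹ (by rw [DirichletCharacter.conductor_inv]; exact hp2)) hr 0 le_rfl
    ((1 + (u^10)⁻¹ : ℝ) : ℂ) (by rw [ofReal_re]; exact hσ)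
    (by rw [ofReal_re]; exact hσ2) (by rw [ofReal_im]; simp)
  unfold Bad at hb1 hb2
  have : (1:ℝ) ≤ (2 * u^10)^2 * ((u^6)⁻¹)^2 * ((u^6)⁻¹)^2 * u * u := by
    refine h.trans ?_
    gcongr
  have e : (2 * u^10)^2 * ((u^6)⁻¹)^2 * ((u^6)⁻¹)^2 * u * u = 4 / u^2 := by field_simp; norm_num
  rw [e, le_div_iff₀ (by positivity)] at this
  nlinarith

lemma fixed_nonbad (r : ℕ) [NeZero r] (χ : DirichletCharacter ℂ r) (hχ : χ ≠ 1) : ∀ᶠ u : ℝ in atTop, ¬ Bad u χ := by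
  have h1 : Tendsto (fun u : ℝ => (u^10)⁻¹) atTop (nhds 0) := tendsto_inv_atTop_zero.comp (tendsto_pow_atTop (by norm_num))
  have h2 : Tendsto (fun u : ℝ => (u^6)⁻¹) atTop (nhds 0) := tendsto_inv_atTop_zero.comp (tendsto_pow_atTop (by norm_num))
  have h3 : Tendsto (fun u : ℝ => ((1 + (u^10)⁻¹ : ℝ) : ℂ)) atTop (nhds 1) := by
    have h5 : Tendsto (fun u : ℝ => 1 + (u^10)⁻¹) atTop (nhds 1) := by simpa using h1.const_add 1
    have := (Complex.continuous_ofReal.tendsto (1:ℝ)).comp h5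
    simpa [Function.comp_def] using this
  have h4 : Tendsto (fun u : ℝ => ‖DirichletCharacter.LFunction χ ((1 + (u^10)⁻¹ : ℝ) : ℂ)‖) atTop (nhds ‖DirichletCharacter.LFunction χ 1‖) :=
    (((DirichletCharacter.differentiable_LFunction hχ).continuous.tendsto 1).comp h3).norm
  have h6 : 0 < ‖DirichletCharacter.LFunction χ 1‖ := norm_pos_iff.mpr (DirichletCharacter.LFunction_apply_one_ne_zero hχ)
  filter_upwards [h2.eventually_lt h4 h6, eventually_gt_atTop 0] with u hu hu0
  unfold Bad
  push Not
  rw [cL_zero, ← DirichletCharacter.LFunction_eq_LSeries]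
  · exact hu
  · rw [ofReal_re]
    have : 0 < (u^10)⁻¹ := by positivity
    linarith

lemma tau_pow_sum (k N : ℕ) : ∑ n ∈ range N, (n.divisors.card : ℝ)^k / n ≤ (∑ n ∈ range N, 1 / (n:ℝ))^(2^k) := by
  induction k with
  | zero => simp
  | succ k ih =>
    have h0 : 0 ≤ ∑ n ∈ range N, (n.divisors.card : ℝ)^k / n := sum_nonneg fun _ _ => by positivity
    calc _ ≤ ∑ n ∈ range N, ∑ x ∈ n.divisorsAntidiagonal,
          ((x.1.divisors.card : ℝ)^k / x.1) * ((x.2.divisors.card : ℝ)^k / x.2) := by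
          refine sum_le_sum fun n _ => ?_
          calc _ = ∑ x ∈ n.divisorsAntidiagonal, (n.divisors.card : ℝ)^k / n := by
                rw [sum_const, card_antidiag, nsmul_eq_mul]; ring
            _ ≤ _ := by
                refine sum_le_sum fun x hx => ?_
                obtain ⟨h, _⟩ := mem_divisorsAntidiagonal.1 hx
                rw [div_mul_div_comm, ← mul_pow, ← h]
                push_cast
                gcongr
                exact_mod_cast card_divisors_mul_le _ _
      _ ≤ (∑ n ∈ range N, (n.divisors.card : ℝ)^k / n) * (∑ n ∈ range N, (n.divisors.card : ℝ)^k / n) :=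
          divisor_sum_conv N (fun n => (n.divisors.card : ℝ)^k / n) (fun n => (n.divisors.card : ℝ)^k / n)
            (fun _ => by positivity) (fun _ => by positivity)
      _ ≤ _ := by rw [pow_succ 2 k, pow_mul, pow_two]; gcongr

lemma tau_bound (k : ℕ) : ∃ C : ℝ, 1 ≤ C ∧ ∀ n : ℕ, n ≠ 0 → (n.divisors.card : ℝ)^k ≤ C * sqrt n := by
  have h1 : ∃ K : ℝ, 1 ≤ K ∧ ∀ a : ℕ, ((a:ℝ)+1)^(2*k) ≤ K * 2^a := by
    have : Tendsto (fun a : ℕ => (a:ℝ)^(2*k) / 2^a) atTop (nhds 0) :=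
      tendsto_pow_const_div_const_pow_of_one_lt (2*k) (by norm_num)
    have h2 := (tendsto_add_atTop_iff_nat 1).2 this
    obtain ⟨K, hK⟩ := h2.bddAbove_range
    refine ⟨2 * max K 1, by linarith [le_max_right K 1], fun a => ?_⟩
    have := hK ⟨a, rfl⟩
    simp only [Nat.cast_add, Nat.cast_one] at this
    rw [div_le_iff₀ (by positivity)] at this
    refine this.trans ?_
    rw [pow_succ]
    have := le_max_left K 1
    have h3 : (0:ℝ) < 2^a := by positivity
    nlinarith
  obtain ⟨K, hK1, hK⟩ := h1
  refine ⟨K^(2^(2*k)), one_le_pow₀ hK1, fun n hn => ?_⟩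
  have key : (n.divisors.card : ℝ)^(2*k) ≤ K^(2^(2*k)) * n := by
    have e1 : (n.divisors.card : ℝ)^(2*k) = ∏ p ∈ n.primeFactors, ((n.factorization p : ℝ)+1)^(2*k) := by
      rw [Nat.card_divisors hn]; push_cast; rw [prod_pow]
    have e2 : (n:ℝ) = ∏ p ∈ n.primeFactors, (p:ℝ)^(n.factorization p) := by
      conv_lhs => rw [← Nat.prod_factorization_pow_eq_self hn]
      rw [Finsupp.prod]; push_cast; rfl
    have e3 : ∏ p ∈ n.primeFactors, (if p < 2^(2*k) then K else 1) ≤ K^(2^(2*k)) := by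
      rw [prod_ite]
      simp only [prod_const, one_pow, mul_one]
      refine pow_le_pow_right₀ hK1 ?_
      calc _ ≤ (range (2^(2*k))).card := card_le_card fun p hp => by
              simp only [mem_filter] at hp; exact mem_range.2 hp.2
        _ = _ := by simp
    rw [e1]
    calc _ ≤ ∏ p ∈ n.primeFactors, ((if p < 2^(2*k) then K else 1) * (p:ℝ)^(n.factorization p)) := by
          refine Finset.prod_le_prod (fun _ _ => by positivity) fun p hp => ?_
          have hp2 : 2 ≤ p := (Nat.prime_of_mem_primeFactors hp).two_le
          split_ifs with h
          · refine (hK _).trans ?_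
            gcongr; exact_mod_cast hp2
          · push Not at h
            rw [one_mul]
            calc ((n.factorization p : ℝ)+1)^(2*k) ≤ ((2:ℝ)^(n.factorization p))^(2*k) := by
                  gcongr
                  have := Nat.lt_two_pow_self (n := n.factorization p)
                  exact_mod_cast this
              _ = ((2:ℝ)^(2*k))^(n.factorization p) := by rw [← pow_mul, ← pow_mul, mul_comm]
              _ ≤ _ := by gcongr; exact_mod_cast h
      _ ≤ _ := by
          rw [prod_mul_distrib, ← e2]; gcongr
  have h5 : 0 ≤ K^(2^(2*k)) := by positivity
  have h6 : 1 ≤ K^(2^(2*k)) := one_le_pow₀ hK1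
  refine abs_le_of_sq_le_sq' ?_ (by positivity) |>.2
  rw [mul_pow, sq_sqrt (by positivity), ← pow_mul, mul_comm k 2]
  refine key.trans ?_
  gcongr
  nlinarith

lemma le_totient_mul_tau (n : ℕ) : n ≤ n.totient * n.divisors.card := by
  conv_lhs => rw [← Nat.sum_totient n]
  rw [mul_comm, ← smul_eq_mul]
  refine sum_le_card_nsmul _ _ _ fun d hd => ?_
  obtain ⟨h1, h2⟩ := Nat.mem_divisors.1 hd
  exact Nat.le_of_dvd (totient_pos.2 (Nat.pos_of_ne_zero h2)) (Nat.totient_dvd_of_dvd h1)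

lemma by_parts (G v : ℕ → ℝ) (N : ℕ) : ∑ n ∈ range N, (G (n+1) - G n) * v n =
    G N * v N - G 0 * v 0 + ∑ n ∈ range N, G (n+1) * (v n - v (n+1)) := by
  induction N with
  | zero => simp
  | succ N ih => rw [sum_range_succ, sum_range_succ, ih]; ring

lemma range_succ_Ioc (f : ℕ → ℝ) (h: f 0 = 0) (n : ℕ) : ∑ i ∈ range (n+1), f i = ∑ i ∈ Ioc 0 n, f i := by
  symm
  apply sum_subset
  · intro x hx
    simp at hx ⊢; omega
  · intro x hx hx'
    simp at hx hx'
    have : x = 0 := by omega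
    simpa [this] using h

/-- non-prime prime powers are negligible -/
lemma PP_bound : ∃ C : ℝ, 0 ≤ C ∧ ∀ L : ℝ, 1 ≤ L →
    ∑ n ∈ (range (NN L)).filter (fun n => ¬ n.Prime), vonMangoldt n * hw L n ≤ C * L * exp (-(L/2)) := by
  obtain ⟨C, hC⟩ := Chebyshev.psi_sub_theta_le_mul_sqrt
  have hC0 : 0 ≤ C := by
    have := hC 1
    simpa using this
  refine ⟨C * 5, by positivity, fun L hL => ?_⟩
  set M : ℕ := ⌈exp L⌉₊ with hM
  have hM1 : exp L ≤ M := le_ceil _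
  have hM0 : (0:ℝ) < M := lt_of_lt_of_le (exp_pos _) hM1
  set g : ℕ → ℝ := fun n => if n.Prime then 0 else vonMangoldt n with hg
  have hg0 : ∀ n, 0 ≤ g n := fun n => by
    simp only [hg]; split_ifs
    · exact le_rfl
    · exact vonMangoldt_nonneg
  set G : ℕ → ℝ := fun N => ∑ n ∈ range N, g n with hG
  set v : ℕ → ℝ := fun n => 1 / (max n M : ℕ) with hv
  have hmaxpos : ∀ n, (0:ℝ) < (max n M : ℕ) := fun n => by
    have : (M:ℝ) ≤ (max n M : ℕ) := by exact_mod_cast le_max_right _ _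
    linarith
  have hGle : ∀ n, G (n+1) ≤ C * sqrt n := fun n => by
    refine le_trans (le_of_eq ?_) (hC n)
    rw [Chebyshev.psi_sub_theta_eq_sum_not_prime, Nat.floor_natCast, hG]
    simp only
    rw [range_succ_Ioc g (by simp [hg]), sum_filter]
    refine sum_congr rfl fun n _ => ?_
    simp only [hg]
    by_cases h : n.Prime <;> simp [h]
  have hsq : exp (-(L/2)) = 1 / sqrt (exp L) := by
    rw [Real.exp_neg, ← Real.exp_half, one_div]
  have hsq' : ∀ n : ℕ, exp L ≤ n → 1 / sqrt n ≤ exp (-(L/2)) := fun n hn => by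
    rw [hsq]
    exact one_div_le_one_div_of_le (sqrt_pos.2 (exp_pos _)) (sqrt_le_sqrt hn)
  have h1 : ∑ n ∈ (range (NN L)).filter (fun n => ¬ n.Prime), vonMangoldt n * hw L n ≤
      ∑ n ∈ range (NN L), (G (n+1) - G n) * v n := by
    rw [sum_filter]
    refine sum_le_sum fun n _ => ?_
    have e : G (n+1) - G n = g n := by simp only [hG, sum_range_succ]; ring
    rw [e]
    have hvn : 0 ≤ v n := by simp only [hv]; positivity
    have hhw : hw L n ≤ v n := by
      rcases lt_or_ge n M with h | h
      · rw [hw_zero_left (by linarith) (by positivity) (Nat.lt_ceil.1 h).le]; exact hvn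
      · refine (hw_le (by positivity)).trans ?_
        simp only [hv]; rw [max_eq_left h]
    split_ifs with hp
    · exact mul_nonneg (hg0 n) hvn
    · simp only [hg, if_neg hp]
      exact mul_le_mul_of_nonneg_left hhw vonMangoldt_nonneg
  refine h1.trans ?_
  rw [by_parts]
  have h2 : G 0 * v 0 = 0 := by simp [hG]
  have h3 : G (NN L) * v (NN L) ≤ C * exp (-(L/2)) := by
    have hN0 : exp L ≤ NN L := (exp_le_exp.2 (by linarith)).trans (exp_le_NN L)
    have hN1 : (0:ℝ) < NN L := lt_of_lt_of_le (exp_pos _) hN0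
    have a1 : G (NN L) ≤ C * sqrt (NN L) := by
      refine le_trans ?_ (hGle (NN L))
      simp only [hG, sum_range_succ]; linarith [hg0 (NN L)]
    have a2 : v (NN L) ≤ 1 / (NN L) := by
      simp only [hv]
      exact one_div_le_one_div_of_le hN1 (by exact_mod_cast le_max_left _ _)
    calc _ ≤ (C * sqrt (NN L)) * (1 / (NN L)) := by
          apply mul_le_mul a1 a2 (by simp only [hv]; positivity) (by positivity)
      _ = C * (1 / sqrt (NN L)) := by
          rw [mul_assoc]; congr 1
          rw [mul_one_div, sqrt_div_self']
      _ ≤ _ := by gcongr; exact hsq' _ hN0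
  have h4 : ∑ n ∈ range (NN L), G (n+1) * (v n - v (n+1)) ≤ C * exp (-(L/2)) * ∑ n ∈ range (NN L), 1 / (n:ℝ) := by
    rw [mul_sum]
    refine sum_le_sum fun n _ => ?_
    rcases lt_or_ge n M with h | h
    · have : v n = v (n+1) := by
        simp only [hv]; rw [max_eq_right h.le, max_eq_right (by omega)]
      rw [this, sub_self, mul_zero]; positivity
    · have hn : exp L ≤ n := hM1.trans (by exact_mod_cast h)
      have hn0 : (0:ℝ) < n := lt_of_lt_of_le (exp_pos _) hn
      have e : v n - v (n+1) = 1 / n * (1 / (n+1)) := by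
        simp only [hv]; rw [max_eq_left h, max_eq_left (by omega)]
        push_cast
        field_simp
        ring
      rw [e]
      have h0 : sqrt n * (1 / ((n:ℝ)+1)) ≤ exp (-(L/2)) := by
        refine le_trans ?_ (hsq' n hn)
        rw [mul_one_div, ← sqrt_div_self']
        gcongr
        linarith
      calc _ ≤ C * sqrt n * (1 / n * (1 / (n+1))) := by gcongr; exact hGle n
        _ = C * (sqrt n * (1 / (n+1))) * (1 / n) := by ring
        _ ≤ _ := by gcongr
  have h5 := NN_inv_sum L hL
  have h6 : C * exp (-(L/2)) * ∑ n ∈ range (NN L), 1 / (n:ℝ) ≤ C * exp (-(L/2)) * (4 * L) := by gcongr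
  have h7 : C * exp (-(L/2)) * 1 ≤ C * exp (-(L/2)) * L := by gcongr
  linarith

/-- Main term lower bound. -/
lemma main_lower : ∀ᶠ L : ℝ in atTop, L / 8 ≤ ∑ n ∈ range (NN L), vonMangoldt n * hw L n := by
  have hpsi : ∃ n0 : ℕ, ∀ n : ℕ, n0 ≤ n → (n:ℝ) / 2 ≤ Chebyshev.psi n := by
    have h1 : Tendsto (fun n : ℕ => log ((n:ℝ)+1) / ((n:ℝ)+1)) atTop (nhds 0) := by
      have := Real.isLittleO_log_id_atTop.tendsto_div_nhds_zero
      have h2 : Tendsto (fun n : ℕ => ((n:ℝ)+1)) atTop atTop :=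
        tendsto_atTop_add_const_right _ _ tendsto_natCast_atTop_atTop
      exact this.comp h2
    have h2 := h1.eventually (gt_mem_nhds (show (0:ℝ) < 1/20 by norm_num))
    obtain ⟨n0, h3⟩ := eventually_atTop.1 h2
    refine ⟨max n0 1, fun n hn => ?_⟩
    have h4 := h3 n (le_trans (le_max_left _ _) hn)
    have h5 : (1:ℝ) ≤ n := by exact_mod_cast le_trans (le_max_right _ _) hn
    rw [div_lt_iff₀ (by positivity)] at h4
    have h6 := Chebyshev.psi_ge n
    have h7 := Real.log_two_gt_d9
    nlinarith
  obtain ⟨n0, hn0⟩ := hpsi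
  have hev : ∀ᶠ L : ℝ in atTop, (n0:ℝ) ≤ exp (5/4*L) := by
    have : Tendsto (fun L : ℝ => exp (5/4*L)) atTop atTop :=
      tendsto_exp_atTop.comp (tendsto_id.const_mul_atTop (by norm_num))
    exact this.eventually_ge_atTop _
  filter_upwards [hev, eventually_ge_atTop (100:ℝ)] with L h0 hL
  set M : ℕ := ⌈exp (5/4*L)⌉₊ with hM
  set N : ℕ := ⌊exp (7/4*L)⌋₊ with hN
  have hM1 : exp (5/4*L) ≤ M := le_ceil _
  have hM2 : (M:ℝ) < exp (5/4*L) + 1 := Nat.ceil_lt_add_one (exp_pos _).le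
  have hM0 : (0:ℝ) < M := lt_of_lt_of_le (exp_pos _) hM1
  have hN1 : (N:ℝ) ≤ exp (7/4*L) := floor_le (exp_pos _).le
  have hN2 : exp (7/4*L) < N + 1 := Nat.lt_floor_add_one _
  have hn0M : n0 ≤ M := by exact_mod_cast h0.trans hM1
  set v : ℕ → ℝ := fun n => 1 / (max n M : ℕ) with hv
  have hv0 : ∀ n, 0 ≤ v n := fun n => by simp only [hv]; positivity
  set G : ℕ → ℝ := fun N => ∑ n ∈ range N, vonMangoldt n with hG
  have hGpsi : ∀ n, G (n+1) = Chebyshev.psi n := fun n => by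
    rw [Chebyshev.psi, Nat.floor_natCast, hG]
    exact range_succ_Ioc (fun n => vonMangoldt n) (by simp) n
  have hG0 : ∀ n, 0 ≤ G n := fun n => sum_nonneg fun _ _ => vonMangoldt_nonneg
  have hexp : exp (5/4*L) + 3 ≤ exp (7/4*L) := by
    have e : exp (7/4*L) = exp (5/4*L) * exp (L/2) := by rw [← exp_add]; ring_nf
    have a1 := add_one_le_exp (L/2)
    have a2 := add_one_le_exp (5/4*L)
    rw [e]; nlinarith
  have hMN : M + 1 ≤ N := by
    have : (M:ℝ) + 1 < N + 1 := by linarith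
    have : M + 1 < N + 1 := by exact_mod_cast this
    omega
  -- lower bound for the truncated sum
  have step1 : ∑ n ∈ range (N+1), vonMangoldt n * v n ≤
      (∑ n ∈ range (NN L), vonMangoldt n * hw L n) + (log 4 + 4) := by
    have hsplit : ∑ n ∈ range (N+1), vonMangoldt n * v n ≤
      (∑ n ∈ range (N+1), vonMangoldt n * hw L n) + ∑ n ∈ range (M+1), vonMangoldt n * (1/M) := by
      have : ∑ n ∈ range (M+1), vonMangoldt n * (1/M) = ∑ n ∈ range (N+1), if n < M+1 then vonMangoldt n * (1/(M:ℝ)) else 0 := by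
        rw [← sum_filter]
        refine sum_congr ?_ fun _ _ => rfl
        ext x; simp; omega
      rw [this, ← sum_add_distrib]
      refine sum_le_sum fun n hn => ?_
      have hnN : n ≤ N := by have := mem_range.1 hn; omega
      have b0 : 0 ≤ vonMangoldt n * hw L n := mul_nonneg vonMangoldt_nonneg (hw_nonneg (by positivity))
      split_ifs with h
      · have : v n = 1 / M := by simp only [hv]; rw [max_eq_right (by omega)]
        rw [this]; linarith
      · have hMn : M ≤ n := by omega
        have hMn' : exp (5/4*L) ≤ n := hM1.trans (by exact_mod_cast hMn)
        have hnpos : (0:ℝ) < n := lt_of_lt_of_le (exp_pos _) hMn'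
        have hn2 : (n:ℝ) ≤ exp (7/4*L) := le_trans (by exact_mod_cast hnN) hN1
        have : hw L n = 1 / n := by
          rw [hw, F_one]
          · rw [le_div_iff₀ (by linarith)]
            exact (le_log_iff_exp_le hnpos).2 hMn'
          · rw [div_le_iff₀ (by linarith)]
            exact (log_le_iff_le_exp hnpos).2 hn2
        rw [this]; simp only [hv]; rw [max_eq_left hMn]; linarith
    have hA : ∑ n ∈ range (N+1), vonMangoldt n * hw L n ≤ ∑ n ∈ range (NN L), vonMangoldt n * hw L n := by
      refine sum_le_sum_of_subset_of_nonneg ?_ fun n _ _ =>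
        mul_nonneg vonMangoldt_nonneg (hw_nonneg (by positivity))
      refine range_subset_range.2 ?_
      have : (N:ℝ) ≤ ⌈exp (2*L)⌉₊ := hN1.trans ((exp_le_exp.2 (by linarith)).trans (le_ceil _))
      have : N ≤ ⌈exp (2*L)⌉₊ := by exact_mod_cast this
      rw [NN]; omega
    have hB : ∑ n ∈ range (M+1), vonMangoldt n * (1/(M:ℝ)) ≤ log 4 + 4 := by
      rw [← sum_mul]
      have := hGpsi M
      simp only [hG] at this
      rw [this, mul_one_div, div_le_iff₀ hM0]
      exact Chebyshev.psi_le_const_mul_self hM0.le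
    linarith
  have step2 : ∑ n ∈ range (N+1), vonMangoldt n * v n ≥ 1/2 * ∑ n ∈ Ico M N, 1 / ((n:ℝ)+1) := by
    have e : ∑ n ∈ range (N+1), vonMangoldt n * v n = ∑ n ∈ range (N+1), (G (n+1) - G n) * v n := by
      refine sum_congr rfl fun n _ => ?_
      simp only [hG, sum_range_succ]; ring
    rw [e, by_parts]
    have h2 : G 0 * v 0 = 0 := by simp [hG]
    have h3 : 0 ≤ G (N+1) * v (N+1) := mul_nonneg (hG0 _) (hv0 _)
    have h4 : 1/2 * ∑ n ∈ Ico M N, 1 / ((n:ℝ)+1) ≤ ∑ n ∈ range (N+1), G (n+1) * (v n - v (n+1)) := by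
      rw [mul_sum]
      have hvanti : ∀ n, 0 ≤ v n - v (n+1) := fun n => by
        rw [sub_nonneg]; simp only [hv]
        apply one_div_le_one_div_of_le
        · have : M ≤ max n M := le_max_right _ _
          exact lt_of_lt_of_le hM0 (by exact_mod_cast this)
        · have : max n M ≤ max (n+1) M := max_le_max (by omega) le_rfl
          exact_mod_cast this
      refine le_trans ?_ (sum_le_sum_of_subset_of_nonneg (s := Ico M N) ?_ ?_)
      · refine sum_le_sum fun n hn => ?_
        obtain ⟨h, h'⟩ := mem_Ico.1 hn
        have hnp : (0:ℝ) < n := lt_of_lt_of_le hM0 (by exact_mod_cast h)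
        have e : v n - v (n+1) = 1 / n * (1 / (n+1)) := by
          simp only [hv]; rw [max_eq_left h, max_eq_left (by omega)]
          push_cast
          field_simp
          ring
        rw [e, hGpsi]
        have := hn0 n (by omega)
        calc 1/2 * (1 / ((n:ℝ)+1)) = (n:ℝ)/2 * (1 / n * (1 / (n+1))) := by field_simp
          _ ≤ _ := by gcongr
      · intro n hn
        have := mem_Ico.1 hn
        exact mem_range.2 (by omega)
      · intro n _ _
        exact mul_nonneg (hG0 _) (hvanti n)
    linarith
  have step3 : L/2 - 2 ≤ ∑ n ∈ Ico M N, 1 / ((n:ℝ)+1) := by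
    have hlog : ∀ N : ℕ, M ≤ N → log (N+1) - log (M+1) ≤ ∑ n ∈ Ico M N, 1 / ((n:ℝ)+1) := by
      intro N hMN
      induction N, hMN using Nat.le_induction with
      | base => simp
      | succ N hMN ih =>
        rw [sum_Ico_succ_top hMN]
        have : log ((N:ℝ)+1+1) - log (N+1) ≤ 1 / ((N:ℝ)+1) := by
          rw [← log_div (by positivity) (by positivity)]
          have := log_le_sub_one_of_pos (show 0 < ((N:ℝ)+1+1)/(N+1) by positivity)
          refine this.trans (le_of_eq ?_)
          field_simp
          ring
        push_cast
        linarith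
    have a := hlog N (by omega)
    have a1 : 7/4*L ≤ log (N+1) := (le_log_iff_exp_le (by positivity)).2 hN2.le
    have a2 : log (M+1) ≤ 5/4*L + 2 := by
      rw [log_le_iff_le_exp (by positivity), exp_add]
      have b1 := add_one_le_exp (5/4*L)
      have b2 := add_one_le_exp (2:ℝ)
      nlinarith
    linarith
  have hl4 : log 4 ≤ 3 := by
    have := log_le_sub_one_of_pos (show (0:ℝ) < 4 by norm_num)
    linarith
  linarith

open DirichletCharacter

def PP (L : ℝ) : ℝ :=
  ∑ n ∈ (range (NN L)).filter (fun n => ¬ n.Prime), vonMangoldt n * hw L n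

def Main (L : ℝ) : ℝ := ∑ n ∈ range (NN L), vonMangoldt n * hw L n

lemma Lhw_nonneg (L : ℝ) (n : ℕ) : 0 ≤ vonMangoldt n * hw L n :=
  mul_nonneg vonMangoldt_nonneg (hw_nonneg (by positivity))

lemma PP_nonneg (L : ℝ) : 0 ≤ PP L := sum_nonneg fun n _ => Lhw_nonneg L n

lemma hw_le_exp {L : ℝ} (hL : 0 < L) (n : ℕ) : hw L n ≤ exp (-L) := by
  rcases le_or_gt (n:ℝ) (exp L) with h | h
  · rw [hw_zero_left hL (by positivity) h]; positivity
  · refine (hw_le (by positivity)).trans ?_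
    rw [Real.exp_neg, ← one_div]
    exact one_div_le_one_div_of_le (exp_pos _) h.le

lemma noncoprime_sum (L : ℝ) (hL : 1 ≤ L) (q : ℕ) (hq : q ≠ 0) :
    ∑ n ∈ (range (NN L)).filter (fun n => ¬ n.Coprime q), vonMangoldt n * hw L n ≤
      PP L + q * (3 * L * exp (-L)) := by
  have h1 : ∑ n ∈ (range (NN L)).filter (fun n => ¬ n.Coprime q), vonMangoldt n * hw L n ≤
      PP L + ∑ n ∈ (range (NN L)).filter (fun n => n ∣ q), vonMangoldt n * hw L n := by
    rw [PP, sum_filter, sum_filter, sum_filter, ← sum_add_distrib]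
    refine sum_le_sum fun n _ => ?_
    have := Lhw_nonneg L n
    by_cases hp : n.Prime
    · have : ¬ n.Coprime q ↔ n ∣ q := by rw [hp.coprime_iff_not_dvd, not_not]
      simp only [this, hp]
      simp
    · simp only [hp, not_false_eq_true, if_true]
      split_ifs <;> linarith
  refine h1.trans ?_
  gcongr
  calc _ ≤ ∑ n ∈ (range (NN L)).filter (fun n => n ∣ q), 3 * L * exp (-L) := by
        refine sum_le_sum fun n hn => ?_
        have hn' := mem_range.1 (mem_filter.1 hn).1
        exact mul_le_mul (vonMangoldt_le_log.trans (log_lt_NN L hL n hn')) (hw_le_exp (by linarith) n)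
          (hw_nonneg (by positivity)) (by positivity)
    _ ≤ _ := by
        rw [sum_const, nsmul_eq_mul]
        gcongr
        calc _ ≤ q.divisors.card := card_le_card fun n hn =>
              Nat.mem_divisors.2 ⟨(mem_filter.1 hn).2, hq⟩
          _ ≤ q := Nat.card_divisors_le_self q

lemma psi_prim (L : ℝ) (hL : 1 ≤ L) (q : ℕ) (hq : q ≠ 0) (χ : DirichletCharacter ℂ q) :
    ‖psiX L χ - psiX L χ.primitiveCharacter‖ ≤ PP L + q * (3 * L * exp (-L)) := by
  refine le_trans ?_ (noncoprime_sum L hL q hq)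
  rw [psiX, psiX, ← sum_sub_distrib, sum_filter]
  refine (norm_sum_le _ _).trans (sum_le_sum fun n _ => ?_)
  by_cases h : ¬ n.Coprime q
  · rw [if_pos h, chi_zero χ n h, zero_mul, mul_zero, zero_sub, norm_neg, norm_mul, norm_mul]
    rw [norm_real, norm_real, norm_of_nonneg vonMangoldt_nonneg,
      norm_of_nonneg (hw_nonneg (by positivity))]
    have := χ.primitiveCharacter.norm_le_one (n : ZMod χ.conductor)
    have h2 := Lhw_nonneg L n
    have h3 : 0 ≤ hw L n := hw_nonneg (by positivity)
    gcongr
    exact mul_le_of_le_one_left h3 this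
  · rw [if_neg h]
    rw [not_not] at h
    have : χ (n : ZMod q) = χ.primitiveCharacter (n : ZMod χ.conductor) := by
      conv_lhs => rw [← changeLevel_primitiveCharacter χ]
      exact cl_apply _ _ _ h
    rw [this, sub_self, norm_zero]

lemma psiX_one_one (L : ℝ) : psiX L (1 : DirichletCharacter ℂ 1) = (Main L : ℂ) := by
  rw [psiX, Main]
  push_cast
  refine sum_congr rfl fun n _ => ?_
  rw [MulChar.one_apply (by exact isUnit_of_subsingleton _), one_mul]

lemma psiX_one_prim (L : ℝ) (q : ℕ) [NeZero q] : psiX L (1 : DirichletCharacter ℂ q).primitiveCharacter = (Main L : ℂ) := by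
  rw [primitiveCharacter_one]
  have : ∀ r, r = 1 → psiX L (1 : DirichletCharacter ℂ r) = (Main L : ℂ) := by
    rintro r rfl; exact psiX_one_one L
  exact this _ conductor_one

def T1 (L : ℝ) (q : ℕ) : ℝ := ∑ χ : DirichletCharacter ℂ q,
  open Classical in if χ ≠ 1 then ‖psiX L χ.primitiveCharacter‖ else 0

lemma psi_ap (L : ℝ) (hL : 1 ≤ L) (q : ℕ) [NeZero q] (a : ℕ) (ha : a.Coprime q) :
    |∑ n ∈ (range (NN L)).filter (fun n => n ≡ a [MOD q]), vonMangoldt n * hw L n - Main L / q.totient| ≤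
      PP L + q * (3 * L * exp (-L)) + T1 L q / q.totient := by
  classical
  have hq : q ≠ 0 := NeZero.ne q
  have hphi : (0:ℝ) < q.totient := by exact_mod_cast totient_pos.2 (Nat.pos_of_ne_zero hq)
  have hphi' : (q.totient : ℂ) ≠ 0 := by exact_mod_cast hphi.ne'
  have hu : IsUnit (a : ZMod q) := (ZMod.isUnit_iff_coprime a q).2 ha
  have e1 : ((∑ n ∈ (range (NN L)).filter (fun n => n ≡ a [MOD q]), vonMangoldt n * hw L n : ℝ) : ℂ) * q.totient
      = ∑ χ : DirichletCharacter ℂ q, χ (a : ZMod q)⁻¹ * psiX L χ := by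
    simp only [psiX, mul_sum]
    rw [sum_comm, sum_filter]
    push_cast
    rw [sum_mul]
    refine sum_congr rfl fun n _ => ?_
    have := sum_char_inv_mul_char_eq ℂ hu (n : ZMod q)
    calc _ = ((vonMangoldt n : ℝ) : ℂ) * (hw L n : ℂ) * (if (a : ZMod q) = n then (q.totient : ℂ) else 0) := by
          have : (n ≡ a [MOD q]) ↔ (a : ZMod q) = n := by
            rw [eq_comm, ZMod.natCast_eq_natCast_iff]
          simp only [this]
          split_ifs <;> simp
      _ = _ := by rw [← this, mul_sum]; refine sum_congr rfl fun χ _ => by ring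
  have hcard : (Fintype.card (DirichletCharacter ℂ q) : ℝ) = q.totient := by
    rw [← Nat.card_eq_fintype_card, card_eq_totient_of_hasEnoughRootsOfUnity]
  have hnorm : ∀ χ : DirichletCharacter ℂ q, ‖χ (a : ZMod q)⁻¹‖ ≤ 1 := fun χ => χ.norm_le_one _
  have e2 : ‖∑ χ : DirichletCharacter ℂ q, χ (a : ZMod q)⁻¹ * psiX L χ - (Main L : ℂ)‖ ≤
      q.totient * (PP L + q * (3 * L * exp (-L))) + T1 L q := by
    have hM : (Main L : ℂ) = ∑ χ : DirichletCharacter ℂ q, if χ = 1 then (Main L : ℂ) else 0 := by simp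
    rw [hM, ← sum_sub_distrib, T1, ← hcard]
    have : (Fintype.card (DirichletCharacter ℂ q) : ℝ) * (PP L + q * (3 * L * exp (-L))) =
      ∑ χ : DirichletCharacter ℂ q, (PP L + q * (3 * L * exp (-L))) := by
      rw [sum_const, nsmul_eq_mul]; rfl
    rw [this, ← sum_add_distrib]
    refine (norm_sum_le _ _).trans (sum_le_sum fun χ _ => ?_)
    have h0 := psi_prim L hL q hq χ
    by_cases h : χ = 1
    · subst h
      simp only [if_true, ne_eq, not_true_eq_false, if_false, add_zero]
      rw [psiX_one_prim] at h0
      have hu' : IsUnit ((a : ZMod q)⁻¹) := by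
        exact ⟨hu.unit⁻¹, by
          rw [eq_comm]
          calc (a:ZMod q)⁻¹ = (a:ZMod q)⁻¹ * ((hu.unit : ZMod q) * ((hu.unit⁻¹ : (ZMod q)ˣ) : ZMod q)) := by simp
            _ = _ := by rw [← mul_assoc, IsUnit.unit_spec, ZMod.inv_mul_of_unit _ hu, one_mul]⟩
      rwa [MulChar.one_apply hu', one_mul]
    · simp only [h, if_false, sub_zero, ne_eq, not_false_eq_true, if_true]
      rw [norm_mul]
      calc _ ≤ 1 * ‖psiX L χ‖ := by gcongr; exact hnorm χ
        _ = ‖(psiX L χ - psiX L χ.primitiveCharacter) + psiX L χ.primitiveCharacter‖ := by rw [one_mul, sub_add_cancel]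
        _ ≤ _ := (norm_add_le _ _).trans (by gcongr)
  rw [← e1] at e2
  set S := ∑ n ∈ (range (NN L)).filter (fun n => n ≡ a [MOD q]), vonMangoldt n * hw L n
  have e3 : |S * q.totient - Main L| ≤ q.totient * (PP L + q * (3 * L * exp (-L))) + T1 L q := by
    have : (S:ℂ) * q.totient - Main L = ((S * q.totient - Main L : ℝ) : ℂ) := by push_cast; rfl
    rw [this, norm_real] at e2
    exact e2
  have e4 : S - Main L / q.totient = (S * q.totient - Main L) / q.totient := by field_simp
  rw [e4, abs_div, abs_of_pos hphi, div_le_iff₀ hphi, add_mul, div_mul_cancel₀ _ hphi.ne']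
  linarith

lemma theta_ap (L : ℝ) (hL : 1 ≤ L) (q : ℕ) [NeZero q] (a : ℕ) (ha : a.Coprime q) :
    |∑ p ∈ (range (NN L)).filter (fun n => n.Prime ∧ n ≡ a [MOD q]), log p * hw L p - Main L / q.totient| ≤
      2 * PP L + q * (3 * L * exp (-L)) + T1 L q / q.totient := by
  have h := psi_ap L hL q a ha
  set S := ∑ n ∈ (range (NN L)).filter (fun n => n ≡ a [MOD q]), vonMangoldt n * hw L n with hS
  set T := ∑ p ∈ (range (NN L)).filter (fun n => n.Prime ∧ n ≡ a [MOD q]), log p * hw L p with hT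
  have h1 : |S - T| ≤ PP L := by
    have : S - T = ∑ n ∈ (range (NN L)).filter (fun n => ¬ n.Prime), if n ≡ a [MOD q] then vonMangoldt n * hw L n else 0 := by
      rw [hS, hT, sum_filter, sum_filter, sum_filter, ← sum_sub_distrib]
      refine sum_congr rfl fun n _ => ?_
      by_cases hp : n.Prime
      · simp [hp, vonMangoldt_apply_prime hp]
      · simp [hp]
    rw [this, abs_of_nonneg, PP]
    · refine sum_le_sum fun n _ => ?_
      split_ifs
      · exact le_rfl
      · exact Lhw_nonneg L n
    · refine sum_nonneg fun n _ => ?_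
      split_ifs
      · exact Lhw_nonneg L n
      · exact le_rfl
  rw [abs_le] at *
  constructor <;> linarith [h.1, h.2, h1.1, h1.2]

/-- sum over primitive nonprincipal characters modulo r -/
def SP (L : ℝ) (r : ℕ) : ℝ := ∑ χ : DirichletCharacter ℂ r,
  open Classical in if χ.IsPrimitive ∧ χ ≠ 1 then ‖psiX L χ‖ else 0

lemma T1_le (L : ℝ) (q : ℕ) [NeZero q] : T1 L q ≤ ∑ r ∈ q.divisors, SP L r := by
  classical
  have hq : q ≠ 0 := NeZero.ne q
  unfold T1 SP
  rw [sum_sigma', ← sum_filter]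
  let e : DirichletCharacter ℂ q → (r : ℕ) × DirichletCharacter ℂ r := fun χ => ⟨χ.conductor, χ.primitiveCharacter⟩
  have hinj : Function.Injective e := by
    intro χ1 χ2 h
    have key : ∀ (x : (r : ℕ) × DirichletCharacter ℂ r) (χ : DirichletCharacter ℂ q), e χ = x → ∃ h : x.1 ∣ q, χ = changeLevel h x.2 := by
      rintro x χ rfl
      exact ⟨conductor_dvd_level χ, (changeLevel_primitiveCharacter χ).symm⟩
    obtain ⟨h1, h1'⟩ := key (e χ2) χ1 h
    obtain ⟨h2, h2'⟩ := key (e χ2) χ2 rfl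
    exact h1'.trans h2'.symm
  have hfl : (∑ χ : DirichletCharacter ℂ q, if χ ≠ 1 then ‖psiX L χ.primitiveCharacter‖ else 0) =
      ∑ χ ∈ univ.filter (fun χ : DirichletCharacter ℂ q => χ ≠ 1), ‖psiX L (e χ).2‖ := by
    rw [sum_filter]
  refine (le_of_eq ?_).trans (hfl.le.trans ?_)
  · refine sum_congr rfl fun χ _ => ?_
    by_cases h : χ = 1 <;> simp [h]
  rw [← sum_image (f := fun x : (r : ℕ) × DirichletCharacter ℂ r => ‖psiX L x.2‖) (g := e) (hinj.injOn)]
  refine sum_le_sum_of_subset_of_nonneg ?_ fun _ _ _ => norm_nonneg _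
  intro x hx
  obtain ⟨χ, hχ, rfl⟩ := mem_image.1 hx
  have hχ' := (mem_filter.1 hχ).2
  refine mem_filter.2 ⟨mem_sigma.2 ⟨Nat.mem_divisors.2 ⟨conductor_dvd_level χ, hq⟩, mem_univ _⟩,
    primitiveCharacter_isPrimitive χ, fun h => hχ' ?_⟩
  rw [← changeLevel_primitiveCharacter χ]
  have h' : χ.primitiveCharacter = 1 := h
  rw [h', changeLevel_one]

lemma SP_nonneg (L : ℝ) (r : ℕ) : 0 ≤ SP L r := by
  refine sum_nonneg fun χ _ => ?_
  split_ifs <;> positivity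

lemma SP_total : ∃ C : ℝ, 0 ≤ C ∧ ∀ (L : ℝ) (_ : 8 ≤ L) (Q : ℕ) (_ : 1 ≤ Q) (_ : (Q:ℝ)^4 ≤ exp (L/8)),
    ∑ r ∈ range Q, SP L (r+1) ≤ C * L^5 := by
  classical
  obtain ⟨C, hC0, hC⟩ := mean_value
  refine ⟨C, hC0, fun L hL Q hQ hQ4 => ?_⟩
  let ι : Type := (r : Fin Q) × {χ : DirichletCharacter ℂ (r+1) // χ.IsPrimitive ∧ χ ≠ 1}
  let f : ι → ℕ → ℂ := fun i n => i.2.1 (n : ZMod (i.1+1))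
  have hcard : (Fintype.card ι : ℝ) ≤ (Q:ℝ)^2 := by
    have : Fintype.card ι ≤ Q^2 := by
      rw [Fintype.card_sigma]
      calc _ ≤ ∑ r : Fin Q, Q := by
            refine sum_le_sum fun r _ => ?_
            refine (Fintype.card_subtype_le _).trans ?_
            rw [← Nat.card_eq_fintype_card, card_eq_totient_of_hasEnoughRootsOfUnity]
            refine (totient_le _).trans ?_
            have := r.2; omega
        _ = _ := by simp [pow_two]
    exact_mod_cast this
  have hr : ∀ i : ι, ((i.1:ℕ)+1 : ℕ) ≤ Q := fun i => by have := i.1.2; omega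
  have key := hC (ι := ι) L hL Q (by exact_mod_cast hQ) hQ4 f hcard
    (fun i n => i.2.1.norm_le_one _) (fun i m n => by simp [f])
    (fun i N => (char_sum_bound _ _ i.2.2.2 N).trans (by exact_mod_cast hr i)) ?_
  · refine le_trans (le_of_eq ?_) key
    rw [Fintype.sum_sigma, ← Fin.sum_univ_eq_sum_range (fun r => SP L (r+1)) Q]
    refine sum_congr rfl fun r _ => ?_
    have h1 : SP L (r+1) = ∑ χ ∈ univ.filter (fun χ : DirichletCharacter ℂ (r+1) => χ.IsPrimitive ∧ χ ≠ 1), ‖psiX L χ‖ := by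
      rw [sum_filter, SP]
      refine sum_congr rfl fun χ _ => ?_
      by_cases h : χ.IsPrimitive ∧ χ ≠ 1
      · rw [if_pos h, if_pos h]
      · rw [if_neg h, if_neg h]
    rw [h1, ← sum_subtype_eq_sum_filter, subtype_univ]
    rfl
  · intro i j hij N
    have hb := char_sum_bound (((i.1:ℕ)+1) * ((j.1:ℕ)+1)) (changeLevel (Nat.dvd_mul_right ((i.1:ℕ)+1) ((j.1:ℕ)+1)) i.2.1 *
      changeLevel (Nat.dvd_mul_left ((j.1:ℕ)+1) ((i.1:ℕ)+1)) (j.2.1)⁻¹) ?_ N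
    · have e : ∀ n : ℕ, f i n * conj (f j n) = (changeLevel (Nat.dvd_mul_right ((i.1:ℕ)+1) ((j.1:ℕ)+1)) i.2.1 *
        changeLevel (Nat.dvd_mul_left ((j.1:ℕ)+1) ((i.1:ℕ)+1)) (j.2.1)⁻¹) (n : ZMod (((i.1:ℕ)+1) * ((j.1:ℕ)+1))) := by
        intro n
        rw [prod_apply, ← MulChar.star_apply']
        rfl
      simp only [e]
      refine hb.trans ?_
      push_cast
      rw [pow_two]
      have h1 : ((i.1:ℕ):ℝ)+1 ≤ Q := by exact_mod_cast hr i
      have h2 : ((j.1:ℕ):ℝ)+1 ≤ Q := by exact_mod_cast hr j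
      gcongr
    · intro h
      apply hij
      rw [map_inv, mul_inv_eq_one] at h
      have hc := congrArg conductor h
      rw [conductor_changeLevel, conductor_changeLevel, (isPrimitive_def _).1 i.2.2.1, (isPrimitive_def _).1 j.2.2.1] at hc
      obtain ⟨⟨r1, hr1⟩, χ1, h1⟩ := i
      obtain ⟨⟨r2, hr2⟩, χ2, h2⟩ := j
      have : r1 = r2 := by simpa using hc
      subst this
      have h' := changeLevel_injective (R := ℂ) (Nat.dvd_mul_right (r1+1) (r1+1)) h
      have h' : χ1 = χ2 := h'
      subst h'
      rfl

lemma w_le (W k : ℕ) (hW : 1 ≤ W) : ∃ C : ℝ, 0 ≤ C ∧ ∀ D r : ℕ, 1 ≤ r →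
    ∑ d ∈ (Icc 1 D).filter (fun d => r ∣ W * d), (d.divisors.card : ℝ)^k / (W*d).totient ≤
      C / sqrt r * (∑ n ∈ range (D+1), 1 / (n:ℝ))^(2^(k+1)) := by
  obtain ⟨C, hC1, hC⟩ := tau_bound (k+1)
  refine ⟨C * sqrt W, by positivity, fun D r hr => ?_⟩
  obtain ⟨r', hr'⟩ : ∃ r', r' = r / r.gcd W := ⟨_, rfl⟩
  have hg : 0 < r.gcd W := Nat.gcd_pos_of_pos_left _ hr
  have hrr : r' * r.gcd W = r := hr' ▸ Nat.div_mul_cancel (Nat.gcd_dvd_left _ _)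
  have hr'0 : r' ≠ 0 := by rintro h; rw [h] at hrr; omega
  have hdvd : ∀ d, r ∣ W * d → r' ∣ d := fun d hd => by
    have h1 : r' ∣ (W / r.gcd W) * d := by
      rw [← hrr] at hd
      have : W * d = ((W / r.gcd W) * d) * r.gcd W := by
        conv_lhs => rw [← Nat.div_mul_cancel (Nat.gcd_dvd_right r W)]
        ring
      rw [this] at hd
      exact Nat.dvd_of_mul_dvd_mul_right hg (by rwa [hrr] at hd ⊢)
    have hcop : Nat.Coprime r' (W / r.gcd W) := hr' ▸ Nat.coprime_div_gcd_div_gcd hg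
    exact hcop.dvd_of_dvd_mul_left h1
  have hphi : ∀ n : ℕ, 1 ≤ n → 1 / (n.totient : ℝ) ≤ n.divisors.card / n := fun n hn => by
    have h1 : (0:ℝ) < n.totient := by exact_mod_cast totient_pos.2 hn
    have h2 : (0:ℝ) < n := by exact_mod_cast hn
    rw [div_le_div_iff₀ h1 h2, one_mul, mul_comm]
    exact_mod_cast le_totient_mul_tau n
  have hterm : ∀ e : ℕ, 1 ≤ e → ((r'*e).divisors.card : ℝ)^k / (W*(r'*e)).totient ≤
      ((r'.divisors.card : ℝ)^(k+1) / r') * ((e.divisors.card : ℝ)^(k+1) / e) := fun e he => by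
    have hr'1 : 1 ≤ r' := Nat.pos_of_ne_zero hr'0
    have a1 : ((r'*e).divisors.card : ℝ) ≤ r'.divisors.card * e.divisors.card := by
      exact_mod_cast card_divisors_mul_le _ _
    have p1 : (0:ℝ) < r'.totient := by exact_mod_cast totient_pos.2 hr'1
    have p2 : (0:ℝ) < e.totient := by exact_mod_cast totient_pos.2 he
    have a2 : (r'.totient : ℝ) * e.totient ≤ (W*(r'*e)).totient := by
      have h1 := Nat.totient_super_multiplicative r' e
      have h2 : (r'*e).totient ≤ (W*(r'*e)).totient :=
        Nat.le_of_dvd (totient_pos.2 (by positivity)) (Nat.totient_dvd_of_dvd (Nat.dvd_mul_left _ _))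
      exact_mod_cast h1.trans h2
    calc _ ≤ ((r'.divisors.card : ℝ) * e.divisors.card)^k / (r'.totient * e.totient) := by gcongr
      _ = ((r'.divisors.card : ℝ)^k * (1 / r'.totient)) * ((e.divisors.card : ℝ)^k * (1/e.totient)) := by
          rw [mul_pow]; field_simp
      _ ≤ ((r'.divisors.card : ℝ)^k * (r'.divisors.card / r')) * ((e.divisors.card : ℝ)^k * (e.divisors.card / e)) := by
          exact mul_le_mul (mul_le_mul_of_nonneg_left (hphi _ hr'1) (by positivity))
            (mul_le_mul_of_nonneg_left (hphi _ he) (by positivity)) (by positivity) (by positivity)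
      _ = _ := by ring
  have hsum : ∑ d ∈ (Icc 1 D).filter (fun d => r ∣ W * d), (d.divisors.card : ℝ)^k / (W*d).totient ≤
      ∑ e ∈ range (D+1), ((r'.divisors.card : ℝ)^(k+1) / r') * ((e.divisors.card : ℝ)^(k+1) / e) := by
    have hinj : Set.InjOn (fun d => d / r') ((Icc 1 D).filter (fun d => r ∣ W * d) : Set ℕ) := by
      intro d1 h1 d2 h2 h
      have h1' := hdvd d1 (mem_filter.1 h1).2
      have h2' := hdvd d2 (mem_filter.1 h2).2
      have h' : d1 / r' = d2 / r' := h
      rw [← Nat.div_mul_cancel h1', ← Nat.div_mul_cancel h2', h']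
    calc _ ≤ ∑ d ∈ (Icc 1 D).filter (fun d => r ∣ W * d),
          ((r'.divisors.card : ℝ)^(k+1) / r') * (((d/r').divisors.card : ℝ)^(k+1) / (d/r' : ℕ)) := by
          refine sum_le_sum fun d hd => ?_
          obtain ⟨hd1, hd2⟩ := mem_filter.1 hd
          obtain ⟨e, rfl⟩ := hdvd d hd2
          have he : 1 ≤ e := by
            rcases e.eq_zero_or_pos with h | h
            · subst h; simp at hd1
            · exact h
          rw [Nat.mul_div_cancel_left _ (Nat.pos_of_ne_zero hr'0)]
          exact hterm e he
      _ = ∑ e ∈ ((Icc 1 D).filter (fun d => r ∣ W * d)).image (fun d => d / r'),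
          ((r'.divisors.card : ℝ)^(k+1) / r') * ((e.divisors.card : ℝ)^(k+1) / e) := by
          rw [sum_image hinj]
      _ ≤ _ := by
          refine sum_le_sum_of_subset_of_nonneg ?_ fun _ _ _ => by positivity
          intro e he
          obtain ⟨d, hd, rfl⟩ := mem_image.1 he
          have h1 := (mem_Icc.1 (mem_filter.1 hd).1).2
          have h2 := Nat.div_le_self d r'
          exact mem_range.2 (by omega)
  refine hsum.trans ?_
  rw [← mul_sum]
  refine mul_le_mul ?_ (tau_pow_sum (k+1) (D+1)) (sum_nonneg fun _ _ => by positivity) (by positivity)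
  · have h1 := hC r' hr'0
    have p1 : (0:ℝ) < r' := by exact_mod_cast Nat.pos_of_ne_zero hr'0
    have p2 : (0:ℝ) < r := by exact_mod_cast hr
    calc _ ≤ C * sqrt r' / r' := by gcongr
      _ = C * (1 / sqrt r') := by rw [mul_div_assoc, sqrt_div_self']
      _ ≤ C * (sqrt W / sqrt r) := by
          refine mul_le_mul_of_nonneg_left ?_ (by linarith)
          rw [div_le_div_iff₀ (sqrt_pos.2 p1) (sqrt_pos.2 p2), one_mul, ← Real.sqrt_mul (by positivity)]
          apply sqrt_le_sqrt
          have : r ≤ W * r' := by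
            conv_lhs => rw [← hrr]
            rw [mul_comm]
            exact Nat.mul_le_mul_right _ (Nat.le_of_dvd hW (Nat.gcd_dvd_right _ _))
          exact_mod_cast this
      _ = _ := by ring

def DD (L : ℝ) : ℕ := ⌊exp (L/64)⌋₊

def dset (W ps : ℕ) (L : ℝ) : Finset ℕ := (Icc 1 (DD L)).filter (fun d => d.Coprime (W*ps))

lemma bad_prime (W B : ℕ) (hW : 1 ≤ W) : ∀ᶠ u : ℝ in atTop, ∃ ps : ℕ, (ps = 1 ∨ (ps.Prime ∧ ¬ ps ∣ W)) ∧
    ∀ (r : ℕ) [NeZero r] (χ : DirichletCharacter ℂ r), (r:ℝ) ≤ u^B → χ.IsPrimitive → χ ≠ 1 → Bad u χ →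
      ∀ d : ℕ, d.Coprime (W*ps) → ¬ r ∣ W * d := by
  have hfix : ∀ᶠ u : ℝ in atTop, ∀ r ∈ W.divisors, ∀ χ : DirichletCharacter ℂ r, χ ≠ 1 → ¬ Bad u χ := by
    rw [Filter.eventually_all_finset]
    intro r hr
    rw [Filter.eventually_all]
    intro χ
    haveI : NeZero r := ⟨(Nat.pos_of_mem_divisors hr).ne'⟩
    by_cases h : χ = 1
    · exact Eventually.of_forall fun u h' => absurd h h'
    · filter_upwards [fixed_nonbad r χ h] with u hu _
      exact hu
  filter_upwards [hfix, two_bad B] with u hfix htwo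
  by_cases hex : ∃ (r : ℕ) (_ : NeZero r) (χ : DirichletCharacter ℂ r), (r:ℝ) ≤ u^B ∧ χ.IsPrimitive ∧ χ ≠ 1 ∧ Bad u χ
  · obtain ⟨r0, hr0, χ0, h1, h2, h3, h4⟩ := hex
    have huniq : ∀ (r : ℕ) [NeZero r] (χ : DirichletCharacter ℂ r), (r:ℝ) ≤ u^B → χ.IsPrimitive → χ ≠ 1 → Bad u χ → r = r0 := by
      intro r _ χ a1 a2 a3 a4
      by_contra hne
      exact htwo r r0 χ χ0 a2 h2 hne a1 h1 a4 h4
    by_cases hp : ∃ p : ℕ, p.Prime ∧ p ∣ r0 ∧ ¬ p ∣ W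
    · obtain ⟨p, hp, hpr, hpW⟩ := hp
      refine ⟨p, Or.inr ⟨hp, hpW⟩, fun r _ χ a1 a2 a3 a4 d hd hdvd => ?_⟩
      have := huniq r χ a1 a2 a3 a4
      subst this
      have h5 := (hp.dvd_mul.1 (hpr.trans hdvd)).resolve_left hpW
      have h6 : d.Coprime p := Nat.Coprime.coprime_mul_left_right hd
      exact hp.one_lt.ne' (Nat.Coprime.eq_one_of_dvd (h6.symm) h5)
    · push Not at hp
      refine ⟨1, Or.inl rfl, fun r _ χ a1 a2 a3 a4 d hd hdvd => ?_⟩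
      have := huniq r χ a1 a2 a3 a4
      subst this
      rw [mul_one] at hd
      have hcop : r.Coprime d := by
        refine Nat.Coprime.symm (Nat.coprime_of_dvd fun p hp1 hp2 hp3 => ?_)
        have := hp p hp1 hp3
        have h7 := Nat.dvd_gcd hp2 this
        rw [hd] at h7
        exact hp1.one_lt.ne' (Nat.dvd_one.1 h7)
      have : r ∣ W := hcop.dvd_of_dvd_mul_right hdvd
      exact hfix r (Nat.mem_divisors.2 ⟨this, by omega⟩) χ a3 a4
  · refine ⟨1, Or.inl rfl, fun r inst χ a1 a2 a3 a4 => ?_⟩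
    exact absurd ⟨r, inst, χ, a1, a2, a3, a4⟩ hex

lemma DD_le {L : ℝ} : (DD L : ℝ) ≤ exp (L/64) := floor_le (exp_pos _).le

lemma DD_inv_sum {L : ℝ} (hL : 1 ≤ L) : ∑ n ∈ range (DD L + 1), 1 / (n:ℝ) ≤ 4 * L := by
  refine le_trans (sum_le_sum_of_subset_of_nonneg ?_ fun _ _ _ => by positivity) (NN_inv_sum L hL)
  refine range_subset_range.2 ?_
  have : (DD L : ℝ) ≤ ⌈exp (2*L)⌉₊ := DD_le.trans ((exp_le_exp.2 (by linarith)).trans (le_ceil _))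
  have : DD L ≤ ⌈exp (2*L)⌉₊ := by exact_mod_cast this
  rw [NN]; omega

/-- the trivial part of the error -/
lemma triv_part (W k A : ℕ) : ∀ᶠ L : ℝ in atTop, ∀ ps : ℕ,
    ∑ d ∈ dset W ps L, (d.divisors.card : ℝ)^k * (2 * PP L + (W * d : ℕ) * (3 * L * exp (-L))) ≤ 1 / (2 * L^A) := by
  obtain ⟨C, hC1, hC⟩ := tau_bound k
  obtain ⟨C2, hC20, hC2⟩ := PP_bound
  have hlim : Tendsto (fun L : ℝ => 2 * (C * (2 * C2 + 3 * W)) * ((L/4)^(A+1) * exp (-(L/4))) * 4^(A+1)) atTop (nhds 0) := by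
    have h1 := Real.tendsto_pow_mul_exp_neg_atTop_nhds_zero (A+1)
    have h2 : Tendsto (fun L : ℝ => L/4) atTop atTop := tendsto_id.atTop_div_const (by norm_num)
    have h3 := ((h1.comp h2).const_mul (2 * (C * (2 * C2 + 3 * W)))).mul_const ((4:ℝ)^(A+1))
    simpa using h3
  filter_upwards [hlim.eventually (gt_mem_nhds one_pos), eventually_ge_atTop (1:ℝ)] with L h1 hL ps
  set D := exp (L/64) with hD
  have hD1 : 1 ≤ D := one_le_exp (by positivity)
  have hterm : ∀ d ∈ dset W ps L, (d.divisors.card : ℝ)^k * (2 * PP L + (W * d : ℕ) * (3 * L * exp (-L))) ≤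
      C * D * (2 * (C2 * L * exp (-(L/2))) + (W * D) * (3 * L * exp (-L))) := by
    intro d hd
    obtain ⟨hd1, _⟩ := mem_filter.1 hd
    obtain ⟨hd1, hd2⟩ := mem_Icc.1 hd1
    have hdD : (d:ℝ) ≤ D := le_trans (by exact_mod_cast hd2) DD_le
    have hd1' : (1:ℝ) ≤ d := by exact_mod_cast hd1
    have hs : sqrt d ≤ d := by
      rw [Real.sqrt_le_left (by linarith)]; nlinarith
    have hPP : PP L ≤ C2 * L * exp (-(L/2)) := hC2 L hL
    have hPP0 := PP_nonneg L
    push_cast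
    refine mul_le_mul ((hC d (by omega)).trans ?_) ?_ (by positivity) (by positivity)
    · gcongr; linarith
    · gcongr
  have hcard : ((dset W ps L).card : ℝ) ≤ D := by
    have : (dset W ps L).card ≤ DD L := (card_filter_le _ _).trans (by simp)
    exact le_trans (by exact_mod_cast this) DD_le
  refine (sum_le_sum hterm).trans ?_
  rw [sum_const, nsmul_eq_mul]
  have hstep : ((dset W ps L).card : ℝ) * (C * D * (2 * (C2 * L * exp (-(L/2))) + (W * D) * (3 * L * exp (-L)))) ≤
      C * (2 * C2 + 3 * W) * L * exp (-(L/4)) := by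
    have e1 : D * D * exp (-(L/2)) ≤ exp (-(L/4)) := by
      rw [hD, ← exp_add, ← exp_add, exp_le_exp]; linarith
    have e2 : D * D * D * exp (-L) ≤ exp (-(L/4)) := by
      rw [hD, ← exp_add, ← exp_add, ← exp_add, exp_le_exp]; linarith
    calc _ ≤ D * (C * D * (2 * (C2 * L * exp (-(L/2))) + (W * D) * (3 * L * exp (-L)))) := by gcongr
      _ = C * (2 * C2) * L * (D * D * exp (-(L/2))) + C * (3 * W) * L * (D * D * D * exp (-L)) := by ring
      _ ≤ C * (2 * C2) * L * exp (-(L/4)) + C * (3 * W) * L * exp (-(L/4)) := by gcongr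
      _ = _ := by ring
  refine hstep.trans ?_
  rw [le_div_iff₀ (by positivity)]
  refine le_trans (le_of_eq ?_) h1.le
  rw [div_pow]
  field_simp
  ring

lemma dvd_prop_sum (W ps k : ℕ) (hW : 1 ≤ W) (L : ℝ) :
    ∑ d ∈ dset W ps L, (d.divisors.card : ℝ)^k * (T1 L (W*d) / (W*d).totient) ≤
    ∑ r ∈ range (W * DD L), SP L (r+1) *
      ∑ d ∈ (dset W ps L).filter (fun d => (r+1) ∣ W * d), (d.divisors.card : ℝ)^k / (W*d).totient := by
  have h1 : ∀ d ∈ dset W ps L, (d.divisors.card : ℝ)^k * (T1 L (W*d) / (W*d).totient) ≤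
      ∑ r ∈ range (W * DD L), if (r+1) ∣ W * d then SP L (r+1) * ((d.divisors.card : ℝ)^k / (W*d).totient) else 0 := by
    intro d hd
    obtain ⟨hd1, _⟩ := mem_filter.1 hd
    obtain ⟨hd1, hd2⟩ := mem_Icc.1 hd1
    haveI : NeZero (W*d) := ⟨by positivity⟩
    rw [← sum_filter, ← sum_mul]
    have h2 : T1 L (W*d) ≤ ∑ r ∈ (range (W * DD L)).filter (fun r => (r+1) ∣ W * d), SP L (r+1) := by
      refine (T1_le L (W*d)).trans ?_
      have himg : (W*d).divisors ⊆ ((range (W * DD L)).filter (fun r => (r+1) ∣ W * d)).image (fun r => r+1) := by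
        intro r hr
        obtain ⟨hr1, hr2⟩ := Nat.mem_divisors.1 hr
        have hr0 : 1 ≤ r := Nat.pos_of_mem_divisors hr
        have hle := Nat.le_of_dvd (Nat.pos_of_ne_zero hr2) hr1
        have hle2 : W * d ≤ W * DD L := Nat.mul_le_mul_left _ hd2
        refine mem_image.2 ⟨r-1, mem_filter.2 ⟨mem_range.2 (by omega), ?_⟩, by omega⟩
        rwa [Nat.sub_add_cancel hr0]
      refine (sum_le_sum_of_subset_of_nonneg himg fun _ _ _ => SP_nonneg _ _).trans ?_
      rw [sum_image (fun a _ b _ h => by simpa using h)]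
    calc _ = T1 L (W*d) * ((d.divisors.card : ℝ)^k / (W*d).totient) := by ring
      _ ≤ _ := by gcongr
  refine (sum_le_sum h1).trans (le_of_eq ?_)
  rw [sum_comm]
  refine sum_congr rfl fun r _ => ?_
  rw [← sum_filter, mul_sum]

lemma SP_nonbad (L ε : ℝ) (r : ℕ) [NeZero r] (hε : 0 ≤ ε)
    (h : ∀ χ : DirichletCharacter ℂ r, χ.IsPrimitive → χ ≠ 1 → ‖psiX L χ‖ ≤ ε) : SP L r ≤ r * ε := by
  classical
  unfold SP
  refine (sum_le_card_nsmul _ _ ε fun χ _ => ?_).trans ?_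
  · by_cases h2 : χ.IsPrimitive ∧ χ ≠ 1
    · rw [if_pos h2]; exact h χ h2.1 h2.2
    · rw [if_neg h2]; exact hε
  rw [nsmul_eq_mul, card_univ, ← Nat.card_eq_fintype_card,
    DirichletCharacter.card_eq_totient_of_hasEnoughRootsOfUnity ℂ r]
  have : (r.totient : ℝ) ≤ r := by exact_mod_cast totient_le r
  gcongr

lemma BV_u (W k A : ℕ) (hW : 1 ≤ W) : ∀ᶠ u : ℝ in atTop, ∃ ps : ℕ, (ps = 1 ∨ (ps.Prime ∧ ¬ ps ∣ W)) ∧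
    ∑ d ∈ dset W ps (u^100), (d.divisors.card : ℝ)^k * (T1 (u^100) (W*d) / (W*d).totient) ≤ 1 / (2 * (u^100)^A) := by
  obtain ⟨C, hC0, hC⟩ := w_le W k hW
  obtain ⟨C', hC'0, hC'⟩ := SP_total
  obtain ⟨N0, hN0⟩ : ∃ N0, N0 = 2^(k+1) := ⟨_, rfl⟩
  obtain ⟨E, hE⟩ : ∃ E, E = A + N0 + 6 := ⟨_, rfl⟩
  have hu : Tendsto (fun u : ℝ => u^100) atTop atTop := tendsto_pow_atTop (by norm_num)
  have hW4 : ∀ᶠ L : ℝ in atTop, (W:ℝ)^4 ≤ exp (L/16) :=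
    (tendsto_exp_atTop.comp (tendsto_id.atTop_div_const (by norm_num : (0:ℝ) < 16))).eventually_ge_atTop _
  filter_upwards [bad_prime W (200*E) hW, nonbad_small (5*E) (200*E), hu.eventually hW4,
    hu.eventually_ge_atTop 8, hu.eventually_ge_atTop (2 * (C * 4^N0 * (C' + 1)))] with u hbad hnon hW4 h8 hbig
  obtain ⟨ps, hps, hbad⟩ := hbad
  refine ⟨ps, hps, (dvd_prop_sum W ps k hW _).trans ?_⟩
  have huB : u^(200*E) = (u^100)^(2*E) := by rw [← pow_mul]; congr 1; ring
  rw [huB] at hbad hnon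
  set L := u^100 with hL
  have hL1 : 1 ≤ L := by linarith
  have hw : ∀ r : ℕ, ∑ d ∈ (dset W ps L).filter (fun d => (r+1) ∣ W * d), (d.divisors.card : ℝ)^k / (W*d).totient ≤
      C / sqrt ((r+1 : ℕ):ℝ) * (4*L)^N0 := by
    intro r
    refine le_trans (sum_le_sum_of_subset_of_nonneg ?_ fun _ _ _ => by positivity) ((hC (DD L) (r+1) (by omega)).trans ?_)
    · exact filter_subset_filter _ (filter_subset _ _)
    · rw [← hN0]
      have h1 := DD_inv_sum hL1
      have h0 : 0 ≤ ∑ n ∈ range (DD L + 1), 1 / (n:ℝ) := sum_nonneg fun _ _ => by positivity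
      gcongr
  have hterm : ∀ r ∈ range (W * DD L), SP L (r+1) *
      ∑ d ∈ (dset W ps L).filter (fun d => (r+1) ∣ W * d), (d.divisors.card : ℝ)^k / (W*d).totient ≤
      C * (4*L)^N0 * (SP L (r+1) / L^E) + if ((r+1:ℕ):ℝ) ≤ L^(2*E) then C * (4*L)^N0 * (L^(2*E) / L^(5*E)) else 0 := by
    intro r _
    have hSP := SP_nonneg L (r+1)
    have hr1 : (1:ℝ) ≤ ((r+1:ℕ):ℝ) := by push_cast; linarith [Nat.cast_nonneg (α := ℝ) r]
    by_cases hr : ((r+1:ℕ):ℝ) ≤ L^(2*E)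
    · rw [if_pos hr]
      by_cases hb : ∃ χ : DirichletCharacter ℂ (r+1), χ.IsPrimitive ∧ χ ≠ 1 ∧ Bad u χ
      · obtain ⟨χ, a1, a2, a3⟩ := hb
        have : (dset W ps L).filter (fun d => (r+1) ∣ W * d) = ∅ := by
          refine filter_eq_empty_iff.2 fun d hd => ?_
          exact hbad (r+1) χ hr a1 a2 a3 d (mem_filter.1 hd).2
        rw [this, sum_empty, mul_zero]
        positivity
      · push Not at hb
        have h1 : SP L (r+1) ≤ ((r+1:ℕ):ℝ) * (1 / L^(5*E)) := by
          refine SP_nonbad L _ (r+1) (by positivity) fun χ a1 a2 => ?_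
          exact hnon (r+1) χ a2 hr (hb χ a1 a2)
        have h2 : C / sqrt ((r+1 : ℕ):ℝ) * (4*L)^N0 ≤ C * (4*L)^N0 := by
          gcongr
          exact div_le_self hC0 (Real.one_le_sqrt.2 hr1)
        calc _ ≤ (L^(2*E) * (1 / L^(5*E))) * (C * (4*L)^N0) := by
              refine mul_le_mul (h1.trans ?_) ((hw r).trans h2) (sum_nonneg fun _ _ => by positivity) (by positivity)
              gcongr
          _ = 0 + C * (4*L)^N0 * (L^(2*E) / L^(5*E)) := by ring
          _ ≤ _ := by gcongr; positivity
    · rw [if_neg hr, add_zero]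
      push Not at hr
      have h2 : C / sqrt ((r+1 : ℕ):ℝ) * (4*L)^N0 ≤ C / L^E * (4*L)^N0 := by
        gcongr
        refine Real.le_sqrt_of_sq_le ?_
        rw [← pow_mul, mul_comm E 2]; exact hr.le
      calc _ ≤ SP L (r+1) * (C / L^E * (4*L)^N0) := by gcongr; exact (hw r).trans h2
        _ = _ := by ring
  refine (sum_le_sum hterm).trans ?_
  rw [sum_add_distrib, ← mul_sum, ← sum_div]
  have hS : ∑ r ∈ range (W * DD L), SP L (r+1) ≤ C' * L^5 := by
    by_cases h0 : W * DD L = 0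
    · rw [h0, range_zero, sum_empty]; positivity
    · refine hC' L h8 _ (Nat.one_le_iff_ne_zero.2 h0) ?_
      push_cast
      have h3 : (DD L : ℝ)^4 ≤ exp (L/16) := by
        calc (DD L : ℝ)^4 ≤ exp (L/64)^4 := by gcongr; exact DD_le
          _ = _ := by rw [← exp_nat_mul]; congr 1; push_cast; ring
      calc ((W:ℝ) * DD L)^4 = (W:ℝ)^4 * (DD L : ℝ)^4 := by ring
        _ ≤ exp (L/16) * exp (L/16) := by gcongr
        _ = _ := by rw [← exp_add]; congr 1; ring
  have hcnt : (∑ r ∈ range (W * DD L), if ((r+1:ℕ):ℝ) ≤ L^(2*E) then C * (4*L)^N0 * (L^(2*E) / L^(5*E)) else 0) ≤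
      L^(2*E) * (C * (4*L)^N0 * (L^(2*E) / L^(5*E))) := by
    rw [← sum_filter, sum_const, nsmul_eq_mul]
    have : (((range (W * DD L)).filter (fun r => ((r+1:ℕ):ℝ) ≤ L^(2*E))).card : ℝ) ≤ L^(2*E) := by
      have h4 : (range (W * DD L)).filter (fun r => ((r+1:ℕ):ℝ) ≤ L^(2*E)) ⊆ range ⌊L^(2*E)⌋₊ := by
        intro r hr
        exact mem_range.2 (Nat.le_floor (mem_filter.1 hr).2)
      have h5 := card_le_card h4
      rw [card_range] at h5
      exact le_trans (by exact_mod_cast h5) (floor_le (by positivity))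
    gcongr
  calc _ ≤ C * (4*L)^N0 * (C' * L^5 / L^E) + L^(2*E) * (C * (4*L)^N0 * (L^(2*E) / L^(5*E))) := by
        gcongr
    _ = C * (4*L)^N0 * (C' * L^5 / L^E + L^(2*E) * L^(2*E) / L^(5*E)) := by ring
    _ ≤ C * (4*L)^N0 * (C' * L^5 / L^E + L^5 / L^E) := by
        refine mul_le_mul_of_nonneg_left (add_le_add_right ?_ _) (by positivity)
        rw [div_le_div_iff₀ (by positivity) (by positivity)]
        have h6 : L^(2*E) * L^(2*E) * L^E = L^(5*E) := by rw [← pow_add, ← pow_add]; congr 1; ring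
        rw [h6]
        exact le_mul_of_one_le_left (by positivity) (one_le_pow₀ hL1)
    _ = (C * 4^N0 * (C'+1)) * (L^(N0+5) / L^E) := by rw [mul_pow, pow_add]; ring
    _ ≤ (L / 2) * (L^(N0+5) / L^E) := by gcongr; linarith
    _ = _ := by
        rw [hE, div_mul_div_comm, div_eq_div_iff (by positivity) (by positivity)]
        ring

/-- Bombieri-Vinogradov type theorem, with an exceptional prime removed. -/
lemma BV (W k A : ℕ) (hW : 1 ≤ W) : ∀ᶠ L : ℝ in atTop, ∃ ps : ℕ, (ps = 1 ∨ (ps.Prime ∧ ¬ ps ∣ W)) ∧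
    ∃ Bd : ℕ → ℝ, (∀ d ∈ dset W ps L, 0 ≤ Bd d) ∧ ∑ d ∈ dset W ps L, (d.divisors.card : ℝ)^k * Bd d ≤ 1 / L^A ∧
    ∀ d ∈ dset W ps L, ∀ a : ℕ, a.Coprime (W*d) →
      |∑ p ∈ (range (NN L)).filter (fun n => n.Prime ∧ n ≡ a [MOD (W*d)]), log p * hw L p - Main L / (W*d).totient| ≤ Bd d := by
  have hu : Tendsto (fun L : ℝ => L ^ ((1:ℝ)/100)) atTop atTop := tendsto_rpow_atTop (by norm_num)
  filter_upwards [hu.eventually (BV_u W k A hW), triv_part W k A, eventually_ge_atTop 1] with L h1 h2 hL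
  have hpow : (L ^ ((1:ℝ)/100))^100 = L := by
    rw [← Real.rpow_natCast, ← Real.rpow_mul (by linarith)]; norm_num
  rw [hpow] at h1
  obtain ⟨ps, hps, h1⟩ := h1
  refine ⟨ps, hps, fun d => (2 * PP L + (W * d : ℕ) * (3 * L * exp (-L))) + T1 L (W*d) / (W*d).totient, ?_, ?_, ?_⟩
  · intro d _
    have := PP_nonneg L
    have hT : 0 ≤ T1 L (W*d) := by
      classical
      exact sum_nonneg fun χ _ => by positivity
    positivity
  · simp only [mul_add (_ ^ k) (2 * PP L + _)]
    rw [sum_add_distrib]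
    calc _ ≤ 1 / (2 * L^A) + 1 / (2 * L^A) := add_le_add (h2 ps) h1
      _ = _ := by field_simp; norm_num
  · intro d hd a ha
    obtain ⟨hd1, _⟩ := mem_filter.1 hd
    obtain ⟨hd1, hd2⟩ := mem_Icc.1 hd1
    haveI : NeZero (W*d) := ⟨by positivity⟩
    exact theta_ap L hL (W*d) a ha

end

end TDR

namespace TDR

noncomputable section
open Finset

/-- tensor-product quadratic form -/
def QF {ι S T : Type} [Fintype ι] [DecidableEq ι] [Fintype S] [Fintype T] (w : ι → T → ℝ) (e : ι → S → T → ℝ)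
    (y : (ι → S) → ℝ) : ℝ :=
  ∑ t : ι → T, (∏ i, w i (t i)) * (∑ c : ι → S, y c * ∏ i, e i (c i) (t i))^2

lemma QF_option {α S T : Type} [Fintype α] [DecidableEq α] [Fintype S] [Fintype T] (w : Option α → T → ℝ)
    (e : Option α → S → T → ℝ) (y : (Option α → S) → ℝ) :
    QF w e y = ∑ t0 : T, w none t0 * QF (fun i => w (some i)) (fun i => e (some i))
      (fun c1 => ∑ c0 : S, y ((Equiv.piOptionEquivProd (β := fun _ => S)).symm (c0, c1)) * e none c0 t0) := by
  unfold QF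
  rw [← (Equiv.piOptionEquivProd (β := fun _ : Option α => T)).symm.sum_comp, Fintype.sum_prod_type]
  refine sum_congr rfl fun t0 _ => ?_
  rw [mul_sum]
  refine sum_congr rfl fun t1 _ => ?_
  rw [← (Equiv.piOptionEquivProd (β := fun _ : Option α => S)).symm.sum_comp, Fintype.sum_prod_type]
  simp only [Fintype.prod_option, Equiv.piOptionEquivProd]
  rw [sum_comm, ← mul_assoc]
  congr 2
  refine sum_congr rfl fun c1 _ => ?_
  rw [sum_mul]
  refine sum_congr rfl fun c0 _ => ?_
  simp [mul_assoc]

lemma QF_equiv {α β S T : Type} [Fintype α] [DecidableEq α] [Fintype β] [DecidableEq β] [Fintype S] [Fintype T]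
    (f : α ≃ β) (w : β → T → ℝ) (e : β → S → T → ℝ) (y : (β → S) → ℝ) :
    QF w e y = QF (fun i => w (f i)) (fun i => e (f i)) (fun c => y (fun b => c (f.symm b))) := by
  unfold QF
  rw [← (Equiv.arrowCongr f (Equiv.refl T)).sum_comp]
  refine sum_congr rfl fun t _ => ?_
  congr 1
  · rw [← f.prod_comp]
    simp [Equiv.arrowCongr]
  · congr 1
    rw [← (Equiv.arrowCongr f (Equiv.refl S)).sum_comp]
    refine sum_congr rfl fun c _ => ?_
    rw [← f.prod_comp]
    simp [Equiv.arrowCongr, Function.comp_def]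

lemma tensor_aux {S T T' : Type} [Fintype S] [Fintype T] [Fintype T'] : ∀ (ι : Type) [Fintype ι],
    ∀ [DecidableEq ι] (w : ι → T → ℝ) (w' : ι → T' → ℝ) (e : ι → S → T → ℝ) (e' : ι → S → T' → ℝ),
    (∀ i t, 0 ≤ w i t) → (∀ i t, 0 ≤ w' i t) →
    (∀ i (a : S → ℝ), ∑ t, w i t * (∑ s, a s * e i s t)^2 ≤ ∑ t, w' i t * (∑ s, a s * e' i s t)^2) →
    ∀ y : (ι → S) → ℝ, QF w e y ≤ QF w' e' y := by
  refine Fintype.induction_empty_option ?_ ?_ ?_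
  · intro α β _ f ih _ w w' e e' hw hw' hl y
    classical
    letI := Fintype.ofEquiv β f.symm
    rw [QF_equiv f, QF_equiv f]
    have := ih (fun i => w (f i)) (fun i => w' (f i)) (fun i => e (f i)) (fun i => e' (f i)) (fun i => hw _) (fun i => hw' _) (fun i => hl _)
      (fun c => y (fun b => c (f.symm b)))
    exact this
  · intro _ w w' e e' hw hw' hl y
    unfold QF
    simp
  · intro α _ ih inst w w' e e' hw hw' hl y
    classical
    have hinst : inst = Option.instDecidableEq := Subsingleton.elim _ _
    subst hinst
    rw [QF_option, QF_option]
    calc _ ≤ ∑ t0 : T, w none t0 * QF (fun i => w' (some i)) (fun i => e' (some i))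
                  (fun c1 => ∑ c0 : S, y ((Equiv.piOptionEquivProd (β := fun _ => S)).symm (c0, c1)) * e none c0 t0) := by
          refine sum_le_sum fun t0 _ => mul_le_mul_of_nonneg_left ?_ (hw _ _)
          exact ih _ _ _ _ (fun i => hw _) (fun i => hw' _) (fun i => hl _) _
      _ ≤ _ := by
          unfold QF
          simp only [mul_sum]
          rw [sum_comm, sum_comm (s := (univ : Finset T'))]
          refine sum_le_sum fun t1 _ => ?_
          have h := hl none (fun c0 => ∑ c1 : α → S, y ((Equiv.piOptionEquivProd (β := fun _ => S)).symm (c0, c1)) * ∏ i, e' (some i) (c1 i) (t1 i))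
          have hp : 0 ≤ ∏ i, w' (some i) (t1 i) := prod_nonneg fun i _ => hw' _ _
          have key : ∀ (E : S → ℝ), ∑ c1 : α → S, (∑ c0 : S, y ((Equiv.piOptionEquivProd (β := fun _ => S)).symm (c0, c1)) * E c0) * ∏ i, e' (some i) (c1 i) (t1 i) =
              ∑ c0 : S, (∑ c1 : α → S, y ((Equiv.piOptionEquivProd (β := fun _ => S)).symm (c0, c1)) * ∏ i, e' (some i) (c1 i) (t1 i)) * E c0 := by
            intro E
            simp only [sum_mul]
            rw [sum_comm]
            refine sum_congr rfl fun c0 _ => sum_congr rfl fun c1 _ => by ring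
          simp only [key]
          have h2 := mul_le_mul_of_nonneg_left h hp
          rw [mul_sum, mul_sum] at h2
          refine le_trans (le_of_eq ?_) (h2.trans (le_of_eq ?_))
          · exact sum_congr rfl fun _ _ => by ring
          · exact sum_congr rfl fun _ _ => by ring

lemma tensor {ι S T T' : Type} [Fintype S] [Fintype T] [Fintype T'] [Fintype ι]
    [DecidableEq ι] (w : ι → T → ℝ) (w' : ι → T' → ℝ) (e : ι → S → T → ℝ) (e' : ι → S → T' → ℝ)
    (hw : ∀ i t, 0 ≤ w i t) (hw' : ∀ i t, 0 ≤ w' i t)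
    (hl : ∀ i (a : S → ℝ), ∑ t, w i t * (∑ s, a s * e i s t)^2 ≤ ∑ t, w' i t * (∑ s, a s * e' i s t)^2)
    (y : (ι → S) → ℝ) : QF w e y ≤ QF w' e' y := tensor_aux ι w w' e e' hw hw' hl y

section core
variable {ι J : Type} [Fintype ι] [DecidableEq ι] [Fintype J] [DecidableEq J]

def rr (P : ι → ℕ) (s : Finset ι) : ℝ := ∏ i ∈ s, (P i : ℝ)
def cls (c : ι → Option J) (j : J) : Finset ι := univ.filter (fun i => c i = some j)
def spt (c : ι → Option J) : Finset ι := univ.filter (fun i => c i ≠ none)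
def ee (P : ι → ℕ) (i : ι) (c s : Option J) : ℝ :=
  if c = none then 1 else (if s = c then (P i : ℝ) else 0) - 1
def zz (P : ι → ℕ) (g : ℝ → ℝ) (R : ℝ) (c : ι → Option J) : ℝ :=
  if rr P (spt c) ≤ R then ∏ j, g (rr P (cls c j)) else 0
def yy (P : ι → ℕ) (g : ℝ → ℝ) (R : ℝ) (c : ι → Option J) : ℝ :=
  (∏ i, if c i = none then (1:ℝ) else -1 / P i) * zz P g R c
def GG (P : ι → ℕ) (g : ℝ → ℝ) (R : ℝ) (o : ι → Option J) : ℝ :=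
  ∑ c : ι → Option J, yy P g R c * ∏ i, ee P i (c i) (o i)
def w1 (J : Type) [Fintype J] (P : ι → ℕ) (i : ι) (s : Option J) : ℝ :=
  if s = none then 1 - Fintype.card J / P i else 1 / P i

lemma rr_pos {P : ι → ℕ} (hP : ∀ i, 0 < P i) (s : Finset ι) : 0 < rr P s :=
  prod_pos fun i _ => by exact_mod_cast hP i

lemma one_le_rr {P : ι → ℕ} (hP : ∀ i, 0 < P i) (s : Finset ι) : 1 ≤ rr P s := by
  unfold rr
  calc (1:ℝ) = ∏ i ∈ s, (1:ℝ) := by simp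
    _ ≤ _ := Finset.prod_le_prod (fun _ _ => zero_le_one) fun i _ => by exact_mod_cast hP i

lemma rr_spt (P : ι → ℕ) (c : ι → Option J) : rr P (spt c) = ∏ j, rr P (cls c j) := by
  unfold rr cls spt
  simp only [prod_filter]
  rw [Finset.prod_comm]
  refine prod_congr rfl fun i _ => ?_
  rcases h : c i with _ | j
  · simp
  · simp

lemma cls_injective : Function.Injective (cls : (ι → Option J) → J → Finset ι) := by
  intro c c' h
  funext i
  have h1 : ∀ j, c i = some j ↔ c' i = some j := by
    intro j
    have := congrFun h j
    have h2 : i ∈ cls c j ↔ i ∈ cls c' j := by rw [this]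
    simpa [cls] using h2
  exact Option.ext h1

lemma sum_tuples (f : J → Finset ι → ℝ) (hf : ∀ j s, 0 ≤ f j s) :
    ∑ c : ι → Option J, ∏ j, f j (cls c j) ≤ ∏ j, ∑ s : Finset ι, f j s := by
  rw [prod_univ_sum, ← sum_image (s := univ) (g := cls) (f := fun x => ∏ j, f j (x j)) (fun a _ b _ h => cls_injective h)]
  refine sum_le_sum_of_subset_of_nonneg ?_ fun _ _ _ => prod_nonneg fun _ _ => hf _ _
  intro x _
  simp

lemma sum_delta {ι S : Type} [Fintype ι] [DecidableEq ι] [Fintype S] [DecidableEq S] (y : (ι → S) → ℝ) (t : ι → S) :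
    ∑ c : ι → S, y c * ∏ i, (if c i = t i then (1:ℝ) else 0) = y t := by
  rw [sum_eq_single t]
  · simp
  · intro c _ hc
    obtain ⟨i, hi⟩ := Function.ne_iff.1 hc
    rw [prod_eq_zero (mem_univ i) (if_neg hi), mul_zero]
  · simp

lemma sum_ee (P : ι → ℕ) (i : ι) (a : Option J → ℝ) (s : Option J) :
    ∑ c, a c * ee P i c s = a none - ∑ j, a (some j) + (if s = none then 0 else P i * a s) := by
  unfold ee
  rw [sum_option]
  rcases s with _ | l
  · simp [sub_eq_add_neg]
  · simp only [if_true, mul_one, reduceCtorEq, if_false]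
    simp only [mul_sub, mul_one, sum_sub_distrib, mul_ite, mul_zero]
    simp [mul_comm]
    ring

lemma yy_sq (P : ι → ℕ) (hP : ∀ i, 0 < P i) (g : ℝ → ℝ) (R : ℝ) (c : ι → Option J) :
    (∏ i, if c i = none then (1:ℝ) else P i) * (yy P g R c)^2 = (zz P g R c)^2 / rr P (spt c) := by
  unfold yy
  rw [mul_pow, ← mul_assoc, ← prod_pow, ← prod_mul_distrib]
  have : rr P (spt c) = ∏ i, if c i = none then (1:ℝ) else P i := by
    unfold rr spt
    rw [prod_filter]
    refine prod_congr rfl fun i _ => ?_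
    by_cases h : c i = none <;> simp [h]
  rw [this, div_eq_inv_mul, ← prod_inv_distrib]
  congr 1
  refine prod_congr rfl fun i _ => ?_
  have : (P i : ℝ) ≠ 0 := by exact_mod_cast (hP i).ne'
  by_cases h : c i = none
  · simp [h]
  · simp only [h, if_false]; field_simp

lemma zz_sq_le (P : ι → ℕ) (hP : ∀ i, 0 < P i) (g : ℝ → ℝ) (R : ℝ) (c : ι → Option J) :
    (zz P g R c)^2 / rr P (spt c) ≤ ∏ j, (g (rr P (cls c j)))^2 / rr P (cls c j) := by
  rw [prod_div_distrib, ← rr_spt, prod_pow]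
  have := rr_pos hP (spt c)
  refine div_le_div_of_nonneg_right ?_ this.le
  unfold zz
  by_cases h : rr P (spt c) ≤ R
  · rw [if_pos h]
  · rw [if_neg h, zero_pow two_ne_zero]; positivity

lemma w1_nonneg (P : ι → ℕ) (hP : ∀ i, Fintype.card J < P i) (i : ι) (s : Option J) : 0 ≤ w1 J P i s := by
  unfold w1
  have h0 : (0:ℝ) < P i := by exact_mod_cast lt_of_le_of_lt (Nat.zero_le _) (hP i)
  by_cases h : s = none
  · rw [if_pos h, sub_nonneg, div_le_one h0]; exact_mod_cast (hP i).le
  · rw [if_neg h]; positivity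

lemma local_S1 (P : ι → ℕ) (hP : ∀ i, Fintype.card J < P i) (i : ι) (a : Option J → ℝ) :
    ∑ s, w1 J P i s * (∑ c, a c * ee P i c s)^2 ≤
    ∑ t : Option J, (if t = none then (1:ℝ) else P i) * (∑ c, a c * (if c = t then (1:ℝ) else 0))^2 := by
  have h0 : (0:ℝ) < P i := by exact_mod_cast lt_of_le_of_lt (Nat.zero_le _) (hP i)
  simp only [sum_ee, sum_ite_eq', mul_ite, mul_one, mul_zero, mem_univ, if_true, w1]
  rw [sum_option, sum_option]
  simp only [if_true, reduceCtorEq, if_false, add_zero, one_mul]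
  set A := a none - ∑ j, a (some j) with hA
  have h1 : ∑ j : J, 1 / (P i : ℝ) * (A + P i * a (some j))^2 =
      Fintype.card J / P i * A^2 + 2 * A * ∑ j, a (some j) + P i * ∑ j, a (some j)^2 := by
    have : ∀ j : J, 1 / (P i : ℝ) * (A + P i * a (some j))^2 = 1 / P i * A^2 + 2 * A * a (some j) + P i * a (some j)^2 := by
      intro j; field_simp; ring
    simp only [this, sum_add_distrib, ← mul_sum, sum_const, card_univ, nsmul_eq_mul]
    ring
  rw [h1, ← mul_sum]
  have : a none = A + ∑ j, a (some j) := by rw [hA]; ring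
  rw [this]
  nlinarith [sq_nonneg (∑ j, a (some j))]

lemma S1_bound (P : ι → ℕ) (hP : ∀ i, Fintype.card J < P i) (g : ℝ → ℝ) (R : ℝ) :
    ∑ o : ι → Option J, (∏ i, w1 J P i (o i)) * (GG P g R o)^2 ≤
      (∑ s : Finset ι, (g (rr P s))^2 / rr P s)^(Fintype.card J) := by
  have hP0 : ∀ i, 0 < P i := fun i => (hP i).pos
  have h1 := tensor (w1 J P) (fun i (t : Option J) => if t = none then (1:ℝ) else P i) (ee P)
    (fun i c t => if c = t then (1:ℝ) else 0) (w1_nonneg P hP) (fun i t => by positivity) (local_S1 P hP) (yy P g R)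
  refine h1.trans ?_
  unfold QF
  simp only [sum_delta, yy_sq P hP0]
  refine (sum_le_sum fun c _ => zz_sq_le P hP0 g R c).trans ?_
  refine (sum_tuples (fun _ s => g (rr P s)^2 / rr P s) (fun j s => by have := rr_pos hP0 s; positivity)).trans ?_
  simp

lemma sum_tuples2 (j0 : J) (H : Finset ι → ({j // j ≠ j0} → Finset ι) → ℝ) (hH : ∀ s x, 0 ≤ H s x) :
    ∑ c : ι → Option J, H (cls c j0) (fun j => cls c j) ≤ ∑ x : {j // j ≠ j0} → Finset ι, ∑ s : Finset ι, H s x := by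
  rw [sum_comm, ← Fintype.sum_prod_type']
  rw [← sum_image (s := univ) (g := fun c : ι → Option J => (cls c j0, fun j : {j // j ≠ j0} => cls c j))
    (f := fun x => H x.1 x.2)]
  · exact sum_le_sum_of_subset_of_nonneg (subset_univ _) fun _ _ _ => hH _ _
  · intro c _ c' _ h
    simp only [Prod.mk.injEq] at h
    refine cls_injective (funext fun j => ?_)
    by_cases hj : j = j0
    · subst hj; exact h.1
    · exact congrFun h.2 ⟨j, hj⟩

lemma sum_update {ι S : Type} [Fintype ι] [DecidableEq ι] [Fintype S] [DecidableEq S] (y : (ι → S) → ℝ) (t : ι → S) (i0 : ι)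
    (E : S → ℝ) :
    ∑ c : ι → S, y c * ∏ i, (if i = i0 then E (c i) else (if c i = t i then (1:ℝ) else 0)) =
      ∑ s : S, y (update t i0 s) * E s := by
  symm
  refine sum_of_injOn (fun s => update t i0 s) ?_ ?_ ?_ ?_
  · intro a _ b _ h
    have := congrFun h i0
    simpa using this
  · intro s _; simp
  · intro c _ hc
    have : ∃ i, i ≠ i0 ∧ c i ≠ t i := by
      by_contra hcon
      push Not at hcon
      refine hc ⟨c i0, by simp, ?_⟩
      funext i
      by_cases hi : i = i0
      · subst hi; simp
      · simp [hi, hcon i hi]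
    obtain ⟨i, hi, hci⟩ := this
    rw [prod_eq_zero (mem_univ i) (by rw [if_neg hi, if_neg hci]), mul_zero]
  · intro s _
    congr 1
    rw [prod_eq_single i0]
    · simp
    · intro i _ hi; simp [hi]
    · simp

lemma prod_split_update (i0 : ι) (f : ι → Option J → ℝ) (t : ι → Option J) (ht : f i0 (t i0) = 1) (s : Option J) :
    ∏ i, f i (update t i0 s i) = f i0 s * ∏ i, f i (t i) := by
  rw [← mul_prod_erase _ _ (mem_univ i0), ← mul_prod_erase univ (fun i => f i (t i)) (mem_univ i0), ht, one_mul]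
  congr 1
  · simp
  · refine prod_congr rfl fun i hi => ?_
    simp [ne_of_mem_erase hi]

lemma SB_step (P : ι → ℕ) (hP : ∀ i, Fintype.card J < P i) (g : ℝ → ℝ) (R : ℝ) (i0 : ι) (j0 : J) :
    ∑ o : ι → Option J, (∏ i, w1 J P i (o i)) * (if o i0 = some j0 then (GG P g R o)^2 else 0) ≤
      ∑ t : ι → Option J, if t i0 = none then 1 / (P i0 : ℝ) * (1 / rr P (spt t) *
        (zz P g R t - zz P g R (update t i0 (some j0)) + 1 / P i0 * ∑ l, zz P g R (update t i0 (some l)))^2) else 0 := by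
  have hP0 : ∀ i, 0 < P i := fun i => (hP i).pos
  have hPr : ∀ i, (0:ℝ) < P i := fun i => by exact_mod_cast hP0 i
  have h1 := tensor (fun i s => if i = i0 then (if s = some j0 then 1 / (P i : ℝ) else 0) else w1 J P i s)
    (fun i (t : Option J) => if i = i0 then (if t = none then 1 / (P i : ℝ) else 0) else if t = none then (1:ℝ) else P i) (ee P)
    (fun i c t => if i = i0 then ee P i0 c (some j0) else if c = t then (1:ℝ) else 0)
    (fun i s => by
      by_cases hi : i = i0
      · rw [if_pos hi]; positivity
      · rw [if_neg hi]; exact w1_nonneg P hP i s)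
    (fun i t => by positivity)
    (fun i a => by
      by_cases hi : i = i0
      · subst hi
        simp only [if_true, ite_mul, zero_mul, sum_ite_eq', mem_univ, le_refl]
      · simp only [hi, if_false]
        exact local_S1 P hP i a) (yy P g R)
  refine le_trans (le_of_eq ?_) (h1.trans (le_of_eq ?_))
  · unfold QF GG
    refine sum_congr rfl fun o _ => ?_
    by_cases ho : o i0 = some j0
    · rw [if_pos ho]
      congr 1
      refine prod_congr rfl fun i _ => ?_
      by_cases hi : i = i0
      · subst hi; simp [ho, w1]
      · simp [hi]
    · rw [if_neg ho, mul_zero, prod_eq_zero (mem_univ i0) (by simp [ho]), zero_mul]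
  · unfold QF
    refine sum_congr rfl fun t _ => ?_
    by_cases ht : t i0 = none
    · rw [if_pos ht]
      have e1 : ∏ i, (if i = i0 then (if t i = none then 1 / (P i : ℝ) else 0) else if t i = none then (1:ℝ) else P i) =
          1 / P i0 * ∏ i, (if t i = none then (1:ℝ) else P i) := by
        rw [← mul_prod_erase _ _ (mem_univ i0), ← mul_prod_erase univ (fun i => (if t i = none then (1:ℝ) else P i)) (mem_univ i0)]
        simp only [ht, if_true, one_mul]
        congr 1
        refine prod_congr rfl fun i hi => ?_
        simp [ne_of_mem_erase hi]
      rw [e1, sum_update (yy P g R) t i0 (fun c => ee P i0 c (some j0)), sum_ee]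
      set V := ∏ i, (if t i = none then (1:ℝ) else -1 / P i) with hV
      have hy : ∀ s, yy P g R (update t i0 s) = (if s = none then (1:ℝ) else -1 / P i0) * V * zz P g R (update t i0 s) := by
        intro s
        unfold yy
        rw [prod_split_update i0 (fun i s => if s = none then (1:ℝ) else -1 / P i) t (by simp [ht])]
      have hVsq : (∏ i, (if t i = none then (1:ℝ) else P i)) * V^2 = 1 / rr P (spt t) := by
        have := yy_sq P hP0 (fun _ => 1) (rr P (spt t)) t
        unfold yy zz at this
        simpa using this
      have hupd : update t i0 none = t := by rw [← ht]; simp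
      have hyt : yy P g R t = V * zz P g R t := rfl
      simp only [hupd, hyt, hy, if_true, reduceCtorEq, if_false, one_mul, ← hVsq]
      rw [show ∑ x : J, -1 / (P i0:ℝ) * V * zz P g R (update t i0 (some x)) = -1 / (P i0:ℝ) * V * ∑ x : J, zz P g R (update t i0 (some x)) by rw [mul_sum]]
      have := (hPr i0).ne'
      field_simp
      ring
    · rw [if_neg ht, prod_eq_zero (mem_univ i0) (by simp [ht]), zero_mul]

lemma cls_update_ne (t : ι → Option J) (i0 : ι) (ht : t i0 = none) (l j : J) (h : j ≠ l) :
    cls (update t i0 (some l)) j = cls t j := by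
  ext i
  by_cases hi : i = i0
  · subst hi; simp [cls, ht, h.symm]
  · simp [cls, hi]

lemma cls_update_eq (t : ι → Option J) (i0 : ι) (l : J) :
    cls (update t i0 (some l)) l = insert i0 (cls t l) := by
  ext i
  by_cases hi : i = i0
  · subst hi; simp [cls]
  · simp [cls, hi]

lemma rr_update (P : ι → ℕ) (t : ι → Option J) (i0 : ι) (ht : t i0 = none) (l : J) :
    rr P (cls (update t i0 (some l)) l) = P i0 * rr P (cls t l) := by
  rw [cls_update_eq, rr, prod_insert (by simp [cls, ht])]
  rfl

lemma rr_spt_update (P : ι → ℕ) (t : ι → Option J) (i0 : ι) (ht : t i0 = none) (l : J) :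
    rr P (spt (update t i0 (some l))) = P i0 * rr P (spt t) := by
  have : spt (update t i0 (some l)) = insert i0 (spt t) := by
    ext i
    by_cases hi : i = i0
    · subst hi; simp [spt]
    · simp [spt, hi]
  rw [this, rr, prod_insert (by simp [spt, ht])]
  rfl

lemma zz_nonneg {P : ι → ℕ} {g : ℝ → ℝ} {R : ℝ} (hg0 : ∀ x, 0 ≤ g x) (t : ι → Option J) : 0 ≤ zz P g R t := by
  unfold zz
  have : 0 ≤ ∏ j, g (rr P (cls t j)) := prod_nonneg fun _ _ => hg0 _
  positivity

lemma zz_le_one {P : ι → ℕ} {g : ℝ → ℝ} {R : ℝ} (hg0 : ∀ x, 0 ≤ g x) (hg1 : ∀ x, g x ≤ 1) (t : ι → Option J) : zz P g R t ≤ 1 := by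
  unfold zz
  have : ∏ j, g (rr P (cls t j)) ≤ 1 := prod_le_one (fun _ _ => hg0 _) fun _ _ => hg1 _
  split_ifs
  · exact this
  · exact zero_le_one

def aR (P : ι → ℕ) (R : ℝ) (s : Finset ι) : ℝ := if rr P s ≤ R then 1 / rr P s else 0
def lay (P : ι → ℕ) (p y : ℝ) (s : Finset ι) : ℝ := if y / p < rr P s ∧ rr P s ≤ y then 1 / rr P s else 0

lemma aR_nonneg {P : ι → ℕ} (hP : ∀ i, 0 < P i) (R : ℝ) (s : Finset ι) : 0 ≤ aR P R s := by
  have := rr_pos hP s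
  unfold aR; positivity

lemma lay_nonneg {P : ι → ℕ} (hP : ∀ i, 0 < P i) (p y : ℝ) (s : Finset ι) : 0 ≤ lay P p y s := by
  have := rr_pos hP s
  unfold lay; positivity

lemma near_le (P : ι → ℕ) (hP : ∀ i, 0 < P i) (g : ℝ → ℝ) (R : ℝ) (i0 : ι) (j0 : J)
    (hg0 : ∀ x, 0 ≤ g x) (hg1 : ∀ x, g x ≤ 1) (Y : Finset ℝ)
    (hY : ∀ a, 1 ≤ a → g a ≠ g (P i0 * a) → ∃ y ∈ Y, a ≤ y ∧ y < P i0 * a)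
    (t : ι → Option J) (ht : t i0 = none) (hR : rr P (spt t) ≤ R) :
    1 / rr P (cls t j0) * (zz P g R t - zz P g R (update t i0 (some j0)))^2 ≤
      ∑ y ∈ Y, lay P (P i0) y (cls t j0) + lay P (P i0) (R / ∏ j : {j // j ≠ j0}, rr P (cls t j)) (cls t j0) := by
  have hp : (0:ℝ) < P i0 := by exact_mod_cast hP i0
  have hr := rr_pos hP (cls t j0)
  have hQ : 0 < ∏ j : {j // j ≠ j0}, rr P (cls t j) := prod_pos fun _ _ => rr_pos hP _
  have hsum0 : 0 ≤ ∑ y ∈ Y, lay P (P i0) y (cls t j0) := sum_nonneg fun _ _ => lay_nonneg hP _ _ _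
  have hl0 := lay_nonneg hP (P i0) (R / ∏ j : {j // j ≠ j0}, rr P (cls t j)) (cls t j0)
  have hz1 := zz_nonneg (P := P) (R := R) hg0 t
  have hz2 := zz_le_one (P := P) (R := R) hg0 hg1 t
  have hz3 := zz_nonneg (P := P) (R := R) hg0 (update t i0 (some j0))
  have hz4 := zz_le_one (P := P) (R := R) hg0 hg1 (update t i0 (some j0))
  have hsq : (zz P g R t - zz P g R (update t i0 (some j0)))^2 ≤ 1 := by
    rw [sq_le_one_iff_abs_le_one, abs_le]; constructor <;> linarith
  have hle : 1 / rr P (cls t j0) * (zz P g R t - zz P g R (update t i0 (some j0)))^2 ≤ 1 / rr P (cls t j0) :=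
    mul_le_of_le_one_right (by positivity) hsq
  have hspt : rr P (spt t) = rr P (cls t j0) * ∏ j : {j // j ≠ j0}, rr P (cls t j) := by
    rw [rr_spt, prod_eq_mul_prod_subtype_ne _ j0]
  by_cases h1 : P i0 * rr P (spt t) ≤ R
  · by_cases h2 : g (rr P (cls t j0)) = g (P i0 * rr P (cls t j0))
    · have : zz P g R t = zz P g R (update t i0 (some j0)) := by
        unfold zz
        rw [if_pos hR, rr_spt_update P t i0 ht, if_pos h1]
        refine prod_congr rfl fun j _ => ?_
        by_cases hj : j = j0
        · subst hj; rw [rr_update P t i0 ht, h2]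
        · rw [cls_update_ne t i0 ht j0 j hj]
      rw [this]; simp; linarith
    · obtain ⟨y, hy, hy1, hy2⟩ := hY _ (one_le_rr hP _) h2
      have : lay P (P i0) y (cls t j0) = 1 / rr P (cls t j0) := by
        unfold lay
        rw [if_pos ⟨by rw [div_lt_iff₀ hp]; linarith, hy1⟩]
      have h3 := single_le_sum (f := fun y => lay P (P i0) y (cls t j0)) (fun y _ => lay_nonneg hP _ _ _) hy
      simp only [this] at h3
      linarith
  · push Not at h1
    have : lay P (P i0) (R / ∏ j : {j // j ≠ j0}, rr P (cls t j)) (cls t j0) = 1 / rr P (cls t j0) := by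
      unfold lay
      rw [if_pos]
      constructor
      · rw [div_div, div_lt_iff₀ (by positivity)]
        rw [hspt] at h1
        linarith
      · rw [le_div_iff₀ hQ, ← hspt]; exact hR
    linarith

lemma SB_bound (P : ι → ℕ) (hP : ∀ i, Fintype.card J < P i) (g : ℝ → ℝ) (R : ℝ) (i0 : ι) (j0 : J)
    (hg0 : ∀ x, 0 ≤ g x) (hg1 : ∀ x, g x ≤ 1) (Y : Finset ℝ)
    (hY : ∀ a, 1 ≤ a → g a ≠ g (P i0 * a) → ∃ y ∈ Y, a ≤ y ∧ y < P i0 * a)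
    (L M : ℝ) (hL : ∀ y, ∑ s, lay P (P i0) y s ≤ L) (hM : ∑ s, aR P R s ≤ M) :
    ∑ o : ι → Option J, (∏ i, w1 J P i (o i)) * (if o i0 = some j0 then (GG P g R o)^2 else 0) ≤
      1 / P i0 * (M^(Fintype.card J - 1) * (2 * ((Y.card + 1) * L) + 2 * (Fintype.card J / P i0)^2 * M)) := by
  have hP0 : ∀ i, 0 < P i := fun i => (hP i).pos
  have hp : (0:ℝ) < P i0 := by exact_mod_cast hP0 i0
  refine (SB_step P hP g R i0 j0).trans ?_
  set H : Finset ι → ({j // j ≠ j0} → Finset ι) → ℝ := fun s x => (∏ j, aR P R (x j)) *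
    (2 * (∑ y ∈ Y, lay P (P i0) y s + lay P (P i0) (R / ∏ j, rr P (x j)) s) + 2 * (Fintype.card J / P i0)^2 * aR P R s) with hH
  have hH0 : ∀ s x, 0 ≤ H s x := by
    intro s x
    have h1 : 0 ≤ ∏ j, aR P R (x j) := prod_nonneg fun _ _ => aR_nonneg hP0 _ _
    have h2 : 0 ≤ ∑ y ∈ Y, lay P (P i0) y s := sum_nonneg fun _ _ => lay_nonneg hP0 _ _ _
    have h3 := lay_nonneg hP0 (P i0) (R / ∏ j, rr P (x j)) s
    have h4 := aR_nonneg hP0 R s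
    simp only [hH]; positivity
  have hterm : ∀ t : ι → Option J, (if t i0 = none then 1 / (P i0 : ℝ) * (1 / rr P (spt t) *
        (zz P g R t - zz P g R (update t i0 (some j0)) + 1 / P i0 * ∑ l, zz P g R (update t i0 (some l)))^2) else 0) ≤
      1 / P i0 * H (cls t j0) (fun j => cls t j) := by
    intro t
    have hH1 := hH0 (cls t j0) (fun j => cls t j)
    by_cases ht : t i0 = none
    swap
    · rw [if_neg ht]; positivity
    rw [if_pos ht]
    refine mul_le_mul_of_nonneg_left ?_ (by positivity)
    have hspt : rr P (spt t) = rr P (cls t j0) * ∏ j : {j // j ≠ j0}, rr P (cls t j) := by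
      rw [rr_spt, prod_eq_mul_prod_subtype_ne _ j0]
    by_cases hR : rr P (spt t) ≤ R
    swap
    · have hz : zz P g R t = 0 := by unfold zz; rw [if_neg hR]
      have hz' : ∀ l, zz P g R (update t i0 (some l)) = 0 := by
        intro l
        unfold zz; rw [if_neg]
        rw [rr_spt_update P t i0 ht]
        have h1 : (1:ℝ) ≤ P i0 := by exact_mod_cast hP0 i0
        have h2 := rr_pos hP0 (spt t)
        nlinarith
      simp only [hz, hz']; simpa using hH1
    have hclsle : ∀ j, rr P (cls t j) ≤ R := by
      intro j
      refine le_trans ?_ hR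
      rw [rr_spt, prod_eq_mul_prod_subtype_ne _ j]
      refine le_mul_of_one_le_right (rr_pos hP0 _).le ?_
      calc (1:ℝ) = ∏ j' : {j' // j' ≠ j}, (1:ℝ) := by simp
        _ ≤ _ := Finset.prod_le_prod (fun _ _ => zero_le_one) fun i _ => one_le_rr hP0 _
    have ha : ∀ j, aR P R (cls t j) = 1 / rr P (cls t j) := fun j => by unfold aR; rw [if_pos (hclsle j)]
    have hnear := near_le P hP0 g R i0 j0 hg0 hg1 Y hY t ht hR
    set S := ∑ l, zz P g R (update t i0 (some l)) with hS
    have hS0 : 0 ≤ S := sum_nonneg fun l _ => zz_nonneg hg0 _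
    have hS1 : S ≤ Fintype.card J := by
      calc S ≤ ∑ l : J, (1:ℝ) := sum_le_sum fun l _ => zz_le_one hg0 hg1 _
        _ = _ := by simp
    set d := zz P g R t - zz P g R (update t i0 (some j0)) with hd
    have hr := rr_pos hP0 (cls t j0)
    have hQ : 0 < ∏ j : {j // j ≠ j0}, rr P (cls t j) := prod_pos fun _ _ => rr_pos hP0 _
    have hsq : (d + 1 / P i0 * S)^2 ≤ 2 * d^2 + 2 * (Fintype.card J / P i0)^2 := by
      have h1 : (1 / P i0 * S)^2 ≤ (Fintype.card J / P i0 : ℝ)^2 := by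
        refine pow_le_pow_left₀ (by positivity) ?_ 2
        rw [one_div, inv_mul_eq_div]; gcongr
      nlinarith [sq_nonneg (d - 1 / P i0 * S)]
    simp only [hH, ha]
    rw [hspt, prod_div_distrib, prod_const_one]
    calc _ = 1 / (∏ j : {j // j ≠ j0}, rr P (cls t j)) * (1 / rr P (cls t j0) * (d + 1 / P i0 * S)^2) := by
          field_simp
      _ ≤ 1 / (∏ j : {j // j ≠ j0}, rr P (cls t j)) * (1 / rr P (cls t j0) * (2 * d^2 + 2 * (Fintype.card J / P i0)^2)) := by
          gcongr
      _ = 1 / (∏ j : {j // j ≠ j0}, rr P (cls t j)) * (2 * (1 / rr P (cls t j0) * d^2) + 2 * (Fintype.card J / P i0)^2 * (1 / rr P (cls t j0))) := by ring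
      _ ≤ _ := by gcongr
  refine (sum_le_sum fun t _ => hterm t).trans ?_
  rw [← mul_sum]
  refine mul_le_mul_of_nonneg_left ((sum_tuples2 j0 H hH0).trans ?_) (by positivity)
  have hM0 : 0 ≤ ∑ s, aR P R s := sum_nonneg fun s _ => aR_nonneg hP0 R s
  have hinner : ∀ x : {j // j ≠ j0} → Finset ι, ∑ s, H s x ≤ (∏ j, aR P R (x j)) * (2 * ((Y.card + 1) * L) + 2 * (Fintype.card J / P i0)^2 * M) := by
    intro x
    simp only [hH]
    rw [← mul_sum]
    refine mul_le_mul_of_nonneg_left ?_ (prod_nonneg fun _ _ => aR_nonneg hP0 _ _)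
    rw [sum_add_distrib, ← mul_sum, ← mul_sum, sum_add_distrib, sum_comm]
    have h1 : ∑ y ∈ Y, ∑ s, lay P (P i0) y s ≤ Y.card * L := by
      refine (sum_le_card_nsmul Y _ L fun y _ => hL y).trans ?_
      rw [nsmul_eq_mul]
    have h2 := hL (R / ∏ j, rr P (x j))
    gcongr
    linarith
  refine (sum_le_sum fun x _ => hinner x).trans ?_
  rw [← sum_mul]
  have hL0 : 0 ≤ L := le_trans (sum_nonneg fun s _ => lay_nonneg hP0 _ _ _) (hL 0)
  refine mul_le_mul_of_nonneg_right ?_ (by have := hM0.trans hM; positivity)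
  have : ∑ x : {j // j ≠ j0} → Finset ι, ∏ j, aR P R (x j) = (∑ s, aR P R s)^(Fintype.card J - 1) := by
    rw [← piFinset_univ, ← prod_univ_sum, prod_const, card_univ]
    congr 1
    rw [Fintype.card_subtype_compl]; simp
  rw [this]
  gcongr

def w2 (P : ι → ℕ) (j0 : J) (i : ι) (s : Option J) : ℝ :=
  if s = some j0 then 0 else if s = none then ((P i : ℝ) - Fintype.card J) / (P i - 1) else 1 / (P i - 1)

def w2' (P : ι → ℕ) (j0 : J) (i : ι) (t : Option J) : ℝ :=
  if t = none then 1 - 1 / (P i : ℝ)^2 else if t = some j0 then 0 else (P i : ℝ) - 7 * Fintype.card J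

def e2' (j0 : J) (c t : Option J) : ℝ :=
  if t = none then (if c = none then 1 else if c = some j0 then -1 else 0) else if c = t then 1 else 0

lemma S2_real (p m D τ q : ℝ) (hm : 1 ≤ m) (hp : 2 ≤ p) (hτ : τ^2 ≤ m * q) (hq : 0 ≤ q) :
    (1 - 1/p^2) * D^2 + (p - 7 * m) * q ≤ (p - m) / (p-1) * (D - τ)^2 + 1/(p-1) * ((m-1) * (D-τ)^2 + 2 * p * (D-τ) * τ + p^2 * q) := by
  have h1 : 0 < p - 1 := by linarith
  have e1 : (p - m) / (p-1) * (D - τ)^2 + 1/(p-1) * ((m-1) * (D-τ)^2 + 2 * p * (D-τ) * τ + p^2 * q) =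
      ((p-1) * (D-τ)^2 + 2 * p * (D-τ) * τ + p^2 * q) / (p-1) := by
    field_simp; ring
  rw [e1, le_div_iff₀ h1]
  have h2 : 0 ≤ (p-1) * D^2/p^2 + 2 * D * τ + p^2/(p-1) * τ^2 := by
    have : (p-1) * D^2/p^2 + 2 * D * τ + p^2/(p-1) * τ^2 = (p-1) * (D/p + p/(p-1) * τ)^2 := by field_simp; ring
    rw [this]; positivity
  have h3 : p^2/(p-1) ≤ 2 * p := by rw [div_le_iff₀ h1]; nlinarith
  have h4 : p^2/(p-1) * τ^2 ≤ 2 * p * (m * q) := mul_le_mul h3 hτ (sq_nonneg _) (by linarith)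
  have h5 : (p+1) * τ^2 ≤ (p+1) * (m*q) := by gcongr
  have e2 : (1 - 1/p^2) * D^2 * (p-1) = (p-1) * D^2 - (p-1) * D^2/p^2 := by field_simp
  rw [add_mul, e2]
  have h6 : 0 ≤ (4 * p - 8) * (m * q) := mul_nonneg (by linarith) (by positivity)
  have h7 : 0 ≤ p * q := by positivity
  nlinarith

lemma local_S2 (P : ι → ℕ) (hP : ∀ i, 7 * Fintype.card J < P i) (j0 : J) (i : ι) (a : Option J → ℝ) :
    ∑ t : Option J, w2' P j0 i t * (∑ c, a c * e2' j0 c t)^2 ≤ ∑ s, w2 P j0 i s * (∑ c, a c * ee P i c s)^2 := by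
  have hm : 1 ≤ Fintype.card J := Fintype.card_pos_iff.2 ⟨j0⟩
  have hm' : (1:ℝ) ≤ Fintype.card J := by exact_mod_cast hm
  have hp2 : (2:ℝ) ≤ P i := by have := hP i; exact_mod_cast (by omega : 2 ≤ P i)
  set b : J → ℝ := fun j => if j = j0 then 0 else a (some j) with hb
  have hsum : ∑ j, a (some j) = a (some j0) + ∑ j, b j := by
    rw [Fintype.sum_eq_add_sum_subtype_ne _ j0, Fintype.sum_eq_add_sum_subtype_ne b j0]
    simp only [hb, if_true, zero_add]
    congr 1
    refine sum_congr rfl fun j _ => ?_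
    rw [if_neg j.2]
  have hτ : (∑ j, b j)^2 ≤ Fintype.card J * ∑ j, b j^2 := by
    have := sq_sum_le_card_mul_sum_sq (s := (univ : Finset J)) (f := b)
    simpa using this
  have key := S2_real (P i) (Fintype.card J) (a none - a (some j0)) (∑ j, b j) (∑ j, b j^2) hm' hp2 hτ
    (sum_nonneg fun _ _ => sq_nonneg _)
  simp only [sum_ee]
  have hL1 : ∑ c, a c * e2' j0 c none = a none - a (some j0) := by
    rw [sum_option]
    simp only [e2', if_true, reduceCtorEq, if_false, mul_one, Option.some.injEq]
    simp [sub_eq_add_neg]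
  have hL2 : ∀ j, ∑ c, a c * e2' j0 c (some j) = a (some j) := by
    intro j
    simp [e2']
  have hL3 : ∑ j, w2' P j0 i (some j) * (∑ c, a c * e2' j0 c (some j))^2 = (P i - 7 * Fintype.card J) * ∑ j, b j^2 := by
    rw [mul_sum]
    refine sum_congr rfl fun j _ => ?_
    rw [hL2]
    by_cases hj : j = j0 <;> simp [w2', hb, hj]
  have hR : ∑ j, w2 P j0 i (some j) * (a none - ∑ j, a (some j) + (if (some j : Option J) = none then 0 else P i * a (some j)))^2 =
      1 / ((P i:ℝ) - 1) * ((Fintype.card J - 1) * (a none - a (some j0) - ∑ j, b j)^2 + 2 * P i * (a none - a (some j0) - ∑ j, b j) * (∑ j, b j) + P i^2 * ∑ j, b j^2) := by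
    rw [hsum, ← sub_sub]
    set A := a none - a (some j0) - ∑ j, b j
    have h1 : ∀ j, w2 P j0 i (some j) * (A + (if (some j : Option J) = none then 0 else P i * a (some j)))^2 =
        1 / ((P i:ℝ) - 1) * ((1 - if j = j0 then 1 else 0) * A^2 + 2 * P i * A * b j + P i^2 * b j^2) := by
      intro j
      by_cases hj : j = j0
      · simp [w2, hb, hj]
      · simp only [w2, hb, hj, Option.some.injEq, if_false, reduceCtorEq]; ring
    simp only [h1]
    rw [← mul_sum]
    congr 1
    rw [sum_add_distrib, sum_add_distrib, ← mul_sum, ← mul_sum, ← sum_mul, sum_sub_distrib]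
    simp
  rw [sum_option (f := fun t => w2' P j0 i t * (∑ c, a c * e2' j0 c t)^2), hL1, hL3, sum_option, hR, hsum, ← sub_sub]
  simp only [if_true, add_zero]
  have e1 : w2' P j0 i none = 1 - 1 / (P i:ℝ)^2 := by simp [w2']
  have e2 : w2 P j0 i none = ((P i : ℝ) - Fintype.card J) / (P i - 1) := by simp [w2]
  rw [e1, e2]
  exact key

/-- place the set `s` in class `j0` -/
def place (j0 : J) (t : ι → Option J) (s : Finset ι) : ι → Option J := fun i => if i ∈ s then some j0 else t i

lemma inner_S2 (y : (ι → Option J) → ℝ) (j0 : J) (t : ι → Option J) (ht : cls t j0 = ∅) :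
    ∑ c : ι → Option J, y c * ∏ i, e2' j0 (c i) (t i) =
      ∑ s ∈ univ.filter (fun s : Finset ι => Disjoint s (spt t)), y (place j0 t s) * (-1)^s.card := by
  have htj : ∀ i, t i ≠ some j0 := by
    intro i hi
    have : i ∈ cls t j0 := by simp [cls, hi]
    rw [ht] at this; simp at this
  symm
  refine sum_of_injOn (fun s => place j0 t s) ?_ ?_ ?_ ?_
  · intro s hs s' hs' h
    ext i
    have h1 := congrFun h i
    simp only [place] at h1
    by_cases a1 : i ∈ s <;> by_cases a2 : i ∈ s' <;> simp [a1, a2] at h1 ⊢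
    · exact absurd h1.symm (htj i)
    · exact absurd h1 (htj i)
  · intro s _; simp
  · intro c _ hc
    have : ∃ i, e2' j0 (c i) (t i) = 0 := by
      by_contra hcon
      push Not at hcon
      refine hc ⟨univ.filter (fun i => t i = none ∧ c i = some j0), ?_, ?_⟩
      · simp only [coe_filter, mem_univ, true_and, Set.mem_setOf_eq]
        rw [disjoint_left]
        intro i hi
        simp at hi
        simp [spt, hi.1]
      · funext i
        have h2 := hcon i
        simp only [place, mem_filter, mem_univ, true_and]
        unfold e2' at h2
        by_cases h3 : t i = none
        · rw [if_pos h3] at h2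
          by_cases h4 : c i = some j0
          · rw [if_pos ⟨h3, h4⟩, h4]
          · rw [if_neg (fun h => h4 h.2), h3]
            by_contra h5
            rw [if_neg (fun h => h5 h.symm), if_neg h4] at h2
            exact h2 rfl
        · rw [if_neg h3] at h2
          rw [if_neg (fun h => h3 h.1)]
          by_contra h5
          rw [if_neg (fun h => h5 h.symm)] at h2
          exact h2 rfl
    obtain ⟨i, hi⟩ := this
    rw [prod_eq_zero (mem_univ i) hi, mul_zero]
  · intro s hs
    have hd := (mem_filter.1 hs).2
    congr 1
    have h1 : ∀ i, e2' j0 (place j0 t s i) (t i) = if i ∈ s then -1 else 1 := by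
      intro i
      by_cases hi : i ∈ s
      · have h3 : t i = none := by
          have := disjoint_left.1 hd hi
          simpa [spt] using this
        simp [e2', place, hi, h3]
      · by_cases h3 : t i = none <;> simp [e2', place, hi, h3]
    simp only [h1]
    rw [prod_ite]
    simp

end core

lemma one_sub_sum_le_prod' {α : Type} (s : Finset α) (f : α → ℝ) (h0 : ∀ i ∈ s, 0 ≤ f i) (h1 : ∀ i ∈ s, f i ≤ 1) :
    1 - ∑ i ∈ s, f i ≤ ∏ i ∈ s, (1 - f i) := by
  classical
  induction s using Finset.induction_on with
  | empty => simp
  | insert a s ha ih =>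
    rw [sum_insert ha, prod_insert ha]
    have ih' := ih (fun i hi => h0 i (mem_insert_of_mem hi)) (fun i hi => h1 i (mem_insert_of_mem hi))
    have ha0 := h0 a (mem_insert_self _ _)
    have ha1 := h1 a (mem_insert_self _ _)
    have hp : ∏ i ∈ s, (1 - f i) ≤ 1 := prod_le_one
      (fun i hi => by have := h1 i (mem_insert_of_mem hi); linarith)
      (fun i hi => by have := h0 i (mem_insert_of_mem hi); linarith)
    nlinarith

section core
variable {ι J : Type} [Fintype ι] [DecidableEq ι] [Fintype J] [DecidableEq J]

lemma dvd_sum (P : ι → ℕ) (A : Finset ι → ℝ) (hA : ∀ s, 0 ≤ A s) (i : ι)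
    (hd : ∀ s, i ∉ s → A (insert i s) ≤ 1 / P i * A s) :
    ∑ s ∈ univ.filter (fun s : Finset ι => i ∈ s), A s ≤ 1 / P i * ∑ s, A s := by
  calc ∑ s ∈ univ.filter (fun s : Finset ι => i ∈ s), A s ≤
      ∑ s ∈ univ.filter (fun s : Finset ι => i ∈ s), 1 / P i * A (s.erase i) := by
        refine sum_le_sum fun s hs => ?_
        have := hd (s.erase i) (notMem_erase _ _)
        rwa [insert_erase (mem_filter.1 hs).2] at this
    _ = 1 / P i * ∑ s ∈ (univ.filter (fun s : Finset ι => i ∈ s)).image (fun s => s.erase i), A s := by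
        rw [← mul_sum, sum_image]
        intro s hs s' hs' h
        have h1 := (mem_filter.1 hs).2
        have h2 := (mem_filter.1 hs').2
        rw [← insert_erase h1, ← insert_erase h2]
        simp only at h
        rw [h]
    _ ≤ _ := by
        gcongr
        · exact fun s _ _ => hA s
        · exact subset_univ _

def Aα (P : ι → ℕ) (g : ℝ → ℝ) (R1 : ℝ) (s : Finset ι) : ℝ := if rr P s ≤ R1 then g (rr P s) / rr P s else 0
def nu (P : ι → ℕ) (g : ℝ → ℝ) (s : Finset ι) : ℝ := g (rr P s)^2 / rr P s

lemma rr_insert (P : ι → ℕ) (i : ι) (s : Finset ι) (h : i ∉ s) : rr P (insert i s) = P i * rr P s := by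
  unfold rr; rw [prod_insert h]

lemma nu_nonneg {P : ι → ℕ} (hP : ∀ i, 0 < P i) (g : ℝ → ℝ) (s : Finset ι) : 0 ≤ nu P g s := by
  have := rr_pos hP s; unfold nu; positivity

lemma Aα_nonneg {P : ι → ℕ} (hP : ∀ i, 0 < P i) {g : ℝ → ℝ} (hg0 : ∀ x, 0 ≤ g x) (R1 : ℝ) (s : Finset ι) : 0 ≤ Aα P g R1 s := by
  have := rr_pos hP s; have := hg0 (rr P s); unfold Aα; positivity

lemma nu_dvd (P : ι → ℕ) (hP : ∀ i, 0 < P i) (g : ℝ → ℝ) (hg0 : ∀ x, 0 ≤ g x) (hg : Antitone g) (i : ι) :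
    ∑ s ∈ univ.filter (fun s : Finset ι => i ∈ s), nu P g s ≤ 1 / P i * ∑ s, nu P g s := by
  refine dvd_sum P (nu P g) (nu_nonneg hP g) i fun s hs => ?_
  have hp : (1:ℝ) ≤ P i := by exact_mod_cast hP i
  have hr := rr_pos hP s
  unfold nu
  rw [rr_insert P i s hs, div_mul_div_comm, one_mul]
  gcongr
  · exact hg0 _
  · exact hg (by nlinarith)

lemma Aα_dvd (P : ι → ℕ) (hP : ∀ i, 0 < P i) (g : ℝ → ℝ) (hg0 : ∀ x, 0 ≤ g x) (hg : Antitone g) (R1 : ℝ) (i : ι) :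
    ∑ s ∈ univ.filter (fun s : Finset ι => i ∈ s), Aα P g R1 s ≤ 1 / P i * ∑ s, Aα P g R1 s := by
  refine dvd_sum P (Aα P g R1) (Aα_nonneg hP hg0 R1) i fun s hs => ?_
  have hp : (1:ℝ) ≤ P i := by exact_mod_cast hP i
  have hr := rr_pos hP s
  have hA := Aα_nonneg hP hg0 R1 s
  by_cases h : rr P (insert i s) ≤ R1
  · have h' : rr P s ≤ R1 := by rw [rr_insert P i s hs] at h; nlinarith
    unfold Aα
    rw [if_pos h, if_pos h', rr_insert P i s hs, div_mul_div_comm, one_mul]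
    gcongr
    exact hg (by nlinarith)
  · have : Aα P g R1 (insert i s) = 0 := by unfold Aα; rw [if_neg h]
    rw [this]; positivity

lemma alpha_t (P : ι → ℕ) (hP : ∀ i, 0 < P i) (g : ℝ → ℝ) (hg0 : ∀ x, 0 ≤ g x) (hg : Antitone g) (R1 : ℝ) (T : Finset ι) :
    (∑ s, Aα P g R1 s) * (1 - ∑ i ∈ T, 1 / (P i : ℝ)) ≤ ∑ s ∈ univ.filter (fun s : Finset ι => Disjoint s T), Aα P g R1 s := by
  have h1 : ∀ s : Finset ι, Aα P g R1 s - ∑ i ∈ T, (if i ∈ s then Aα P g R1 s else 0) ≤ if Disjoint s T then Aα P g R1 s else 0 := by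
    intro s
    have hA := Aα_nonneg hP hg0 R1 s
    have h0 : 0 ≤ ∑ i ∈ T, (if i ∈ s then Aα P g R1 s else 0) := sum_nonneg fun i _ => by positivity
    by_cases hd : Disjoint s T
    · rw [if_pos hd]; linarith
    · rw [if_neg hd]
      obtain ⟨i, hi, hiT⟩ := not_disjoint_iff.1 hd
      have := single_le_sum (f := fun i => if i ∈ s then Aα P g R1 s else 0) (fun i _ => by positivity) hiT
      simp only [hi, if_true] at this
      linarith
  have h2 := sum_le_sum fun s (_ : s ∈ (univ : Finset (Finset ι))) => h1 s
  rw [sum_sub_distrib, sum_comm, ← sum_filter] at h2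
  refine le_trans ?_ h2
  rw [mul_sub, mul_one, mul_sum]
  refine sub_le_sub_left (sum_le_sum fun i _ => ?_) _
  rw [← sum_filter, mul_comm]
  exact Aα_dvd P hP g hg0 hg R1 i

lemma mem_cls (c : ι → Option J) (j : J) (i : ι) : i ∈ cls c j ↔ c i = some j := by simp [cls]

lemma cls_place_self (j0 : J) (t : ι → Option J) (ht : cls t j0 = ∅) (s : Finset ι) : cls (place j0 t s) j0 = s := by
  ext i
  have : t i ≠ some j0 := by
    intro hi
    have : i ∈ cls t j0 := by simp [cls, hi]
    rw [ht] at this; simp at this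
  by_cases h : i ∈ s <;> simp [cls, place, h, this]

lemma cls_place_ne (j0 : J) (t : ι → Option J) (s : Finset ι) (hs : Disjoint s (spt t)) (j : J) (hj : j ≠ j0) :
    cls (place j0 t s) j = cls t j := by
  ext i
  rw [mem_cls, mem_cls, place]
  by_cases h : i ∈ s
  · have h2 : t i = none := by
      have := disjoint_left.1 hs h
      simpa [spt] using this
    rw [if_pos h, h2]
    constructor
    · intro h3
      exact absurd (Option.some.inj h3).symm hj
    · intro h3
      cases h3
  · rw [if_neg h]

lemma zz_place (P : ι → ℕ) (hP : ∀ i, 0 < P i) (g : ℝ → ℝ) (R R1 R2 : ℝ) (hR1 : 0 ≤ R1) (hR : R1 * R2 ≤ R) (j0 : J) (t : ι → Option J) (ht : cls t j0 = ∅)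
    (hR2 : rr P (spt t) ≤ R2) (s : Finset ι) (hs : Disjoint s (spt t)) (hsR : rr P s ≤ R1) :
    zz P g R (place j0 t s) = g (rr P s) * ∏ j : {j // j ≠ j0}, g (rr P (cls t j)) := by
  have h1 : rr P (spt (place j0 t s)) = rr P s * rr P (spt t) := by
    rw [rr_spt, rr_spt, prod_eq_mul_prod_subtype_ne _ j0, prod_eq_mul_prod_subtype_ne (fun j => rr P (cls t j)) j0,
      cls_place_self j0 t ht, ht]
    simp only [rr, prod_empty, one_mul]
    congr 1
    refine prod_congr rfl fun j _ => ?_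
    rw [cls_place_ne j0 t s hs j j.2]
  unfold zz
  rw [if_pos, prod_eq_mul_prod_subtype_ne _ j0, cls_place_self j0 t ht]
  · congr 1
    refine prod_congr rfl fun j _ => ?_
    rw [cls_place_ne j0 t s hs j j.2]
  · rw [h1]
    exact (mul_le_mul hsR hR2 (rr_pos hP _).le hR1).trans hR

lemma pref_place (P : ι → ℕ) (j0 : J) (t : ι → Option J) (s : Finset ι) (hs : Disjoint s (spt t)) :
    (∏ i, if place j0 t s i = none then (1:ℝ) else -1 / P i) * (-1)^s.card =
      (∏ i, if t i = none then (1:ℝ) else -1 / P i) * (1 / rr P s) := by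
  have h1 : (1 / rr P s) = (∏ i, if i ∈ s then (-1 / (P i:ℝ)) else 1) * (-1)^s.card := by
    have : ∏ i, (if i ∈ s then (-1 / (P i:ℝ)) else 1) = ∏ i ∈ s, (-1 / (P i:ℝ)) := by
      rw [prod_ite_mem]; simp
    rw [this, prod_div_distrib, prod_const, rr, div_mul_eq_mul_div, ← mul_pow]
    simp
  rw [h1, ← mul_assoc, ← prod_mul_distrib]
  congr 1
  refine prod_congr rfl fun i _ => ?_
  by_cases h : i ∈ s
  · have h2 : t i = none := by
      have := disjoint_left.1 hs h
      simpa [spt] using this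
    simp [place, h, h2]
  · simp [place, h]

set_option maxHeartbeats 1000000 in
lemma S2_term (P : ι → ℕ) (hP : ∀ i, 7 * Fintype.card J < P i) (g : ℝ → ℝ) (hg0 : ∀ x, 0 ≤ g x) (hg : Antitone g)
    (R R1 R2 : ℝ) (hR1 : 0 ≤ R1) (hR : R1 * R2 ≤ R) (j0 : J) (t : ι → Option J) (ht : cls t j0 = ∅) (hR2 : rr P (spt t) ≤ R2)
    (hσ : ∑ i, 1 / (P i : ℝ)^2 ≤ 1) :
    (1 - ∑ i, 1 / (P i : ℝ)^2) * (∑ s, Aα P g R1 s)^2 * ((∏ j : {j // j ≠ j0}, nu P g (cls t j)) *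
      (1 - (7 * Fintype.card J + 2) * ∑ i ∈ spt t, 1 / (P i : ℝ))) ≤
    (∏ i, w2' P j0 i (t i)) * (∑ c : ι → Option J, yy P g R c * ∏ i, e2' j0 (c i) (t i))^2 := by
  have hP0 : ∀ i, 0 < P i := fun i => (hP i).pos
  have hPr : ∀ i, (0:ℝ) < P i := fun i => by exact_mod_cast hP0 i
  have hP7 : ∀ i, 7 * (Fintype.card J : ℝ) ≤ P i := fun i => by exact_mod_cast (hP i).le
  have htj : ∀ i, t i ≠ some j0 := by
    intro i hi
    have : i ∈ cls t j0 := by simp [cls, hi]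
    rw [ht] at this; simp at this
  rw [inner_S2 _ j0 t ht]
  set V := ∏ i, (if t i = none then (1:ℝ) else -1 / P i) with hV
  set Γ := ∏ j : {j // j ≠ j0}, g (rr P (cls t j)) with hΓ
  have hΓ0 : 0 ≤ Γ := prod_nonneg fun _ _ => hg0 _
  set α := ∑ s, Aα P g R1 s with hα
  have hα0 : 0 ≤ α := sum_nonneg fun s _ => Aα_nonneg hP0 hg0 R1 s
  set X := ∑ i ∈ spt t, 1 / (P i : ℝ) with hX
  have hX0 : 0 ≤ X := sum_nonneg fun i _ => by positivity
  set σ := ∑ i, 1 / (P i : ℝ)^2 with hσd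
  set αt := ∑ s ∈ univ.filter (fun s : Finset ι => Disjoint s (spt t)), Aα P g R1 s with hαt
  have hαt1 : α * (1 - X) ≤ αt := alpha_t P hP0 g hg0 hg R1 (spt t)
  have hαt0 : 0 ≤ αt := sum_nonneg fun s _ => Aα_nonneg hP0 hg0 R1 s
  have e1 : ∑ s ∈ univ.filter (fun s : Finset ι => Disjoint s (spt t)), yy P g R (place j0 t s) * (-1)^s.card =
      V * ∑ s ∈ univ.filter (fun s : Finset ι => Disjoint s (spt t)), zz P g R (place j0 t s) / rr P s := by
    rw [mul_sum]
    refine sum_congr rfl fun s hs => ?_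
    have := pref_place P j0 t s (mem_filter.1 hs).2
    unfold yy
    rw [mul_right_comm, this]; ring
  have h2 : Γ * αt ≤ ∑ s ∈ univ.filter (fun s : Finset ι => Disjoint s (spt t)), zz P g R (place j0 t s) / rr P s := by
    rw [hαt, mul_sum]
    refine sum_le_sum fun s hs => ?_
    unfold Aα
    by_cases h : rr P s ≤ R1
    · rw [if_pos h, zz_place P hP0 g R R1 R2 hR1 hR j0 t ht hR2 s (mem_filter.1 hs).2 h, ← hΓ]
      exact le_of_eq (by ring)
    · rw [if_neg h, mul_zero]
      exact div_nonneg (zz_nonneg hg0 _) (rr_pos hP0 _).le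
  have e3 : (∏ i, w2' P j0 i (t i)) * V^2 = (∏ i, (1 - if t i = none then 1 / (P i:ℝ)^2 else 0)) * (∏ i ∈ spt t, (1 - 7 * Fintype.card J / (P i:ℝ))) * (1 / rr P (spt t)) := by
    rw [hV, ← prod_pow, ← prod_mul_distrib, rr, one_div, ← prod_inv_distrib, mul_assoc, ← prod_mul_distrib]
    have : ∏ i ∈ spt t, ((1 - 7 * Fintype.card J / (P i:ℝ)) * (P i:ℝ)⁻¹) = ∏ i, if t i = none then 1 else ((1 - 7 * Fintype.card J / (P i:ℝ)) * (P i:ℝ)⁻¹) := by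
      unfold spt
      rw [prod_filter]
      refine prod_congr rfl fun i _ => ?_
      by_cases h : t i = none <;> simp [h]
    rw [this, ← prod_mul_distrib]
    refine prod_congr rfl fun i _ => ?_
    have := (hPr i).ne'
    by_cases h : t i = none
    · simp [h, w2']
    · simp only [w2', h, if_false, htj i]
      field_simp
      ring
  have e4 : 1 / rr P (spt t) * Γ^2 = ∏ j : {j // j ≠ j0}, nu P g (cls t j) := by
    unfold nu
    rw [rr_spt, prod_eq_mul_prod_subtype_ne _ j0, ht, prod_div_distrib, prod_pow, ← hΓ]
    simp [rr]; ring
  have h5 : 1 - σ ≤ ∏ i, (1 - if t i = none then 1 / (P i:ℝ)^2 else 0) := by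
    have h1le : ∀ i, 1 / (P i:ℝ)^2 ≤ 1 := fun i => by
      rw [div_le_one (by have := hPr i; positivity)]
      exact one_le_pow₀ (by exact_mod_cast hP0 i)
    refine le_trans ?_ (one_sub_sum_le_prod' univ _ (fun i _ => by positivity) (fun i _ => by split_ifs; exact h1le i; exact zero_le_one))
    refine sub_le_sub_left (sum_le_sum fun i _ => ?_) _
    split_ifs
    · exact le_refl _
    · positivity
  have h6 : 1 - 7 * Fintype.card J * X ≤ ∏ i ∈ spt t, (1 - 7 * Fintype.card J / (P i:ℝ)) := by
    refine le_trans (le_of_eq ?_) (one_sub_sum_le_prod' _ _ (fun i _ => by positivity) (fun i _ => by rw [div_le_one (hPr i)]; exact hP7 i))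
    rw [hX, mul_sum]; congr 1
    exact sum_congr rfl fun i _ => by ring
  have h60 : 0 ≤ ∏ i ∈ spt t, (1 - 7 * Fintype.card J / (P i:ℝ)) :=
    prod_nonneg fun i _ => by rw [sub_nonneg, div_le_one (hPr i)]; exact hP7 i
  have h7 : α^2 * (1 - 2 * X) ≤ αt^2 := by
    by_cases hx : X ≤ 1
    · have : (α * (1 - X))^2 ≤ αt^2 := pow_le_pow_left₀ (mul_nonneg hα0 (by linarith)) hαt1 2
      nlinarith [sq_nonneg (α * X)]
    · push Not at hx
      nlinarith [sq_nonneg αt, sq_nonneg α]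
  set Pi7 := ∏ i ∈ spt t, (1 - 7 * Fintype.card J / (P i:ℝ)) with hPi7
  set N := ∏ j : {j // j ≠ j0}, nu P g (cls t j) with hN
  have hN0 : 0 ≤ N := prod_nonneg fun j _ => nu_nonneg hP0 g _
  have h8 : α^2 * (1 - (7 * Fintype.card J + 2) * X) ≤ Pi7 * αt^2 := by
    have hm0 : (0:ℝ) ≤ 7 * Fintype.card J * X := by positivity
    have hA2 : 0 ≤ α^2 := sq_nonneg α
    by_cases hx : 7 * Fintype.card J * X ≤ 1 ∧ 2 * X ≤ 1
    · calc α^2 * (1 - (7 * Fintype.card J + 2) * X) ≤ α^2 * ((1 - 7 * Fintype.card J * X) * (1 - 2 * X)) := by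
            refine mul_le_mul_of_nonneg_left ?_ hA2
            nlinarith [mul_nonneg hm0 hX0]
        _ = (1 - 7 * Fintype.card J * X) * (α^2 * (1 - 2 * X)) := by ring
        _ ≤ Pi7 * αt^2 := mul_le_mul h6 h7 (mul_nonneg hA2 (by linarith)) h60
    · have : 1 - (7 * Fintype.card J + 2) * X ≤ 0 := by
        by_contra hcon
        push Not at hcon
        exact hx ⟨by linarith, by linarith⟩
      have h9 : 0 ≤ Pi7 * αt^2 := mul_nonneg h60 (sq_nonneg _)
      nlinarith
  rw [e1, mul_pow, ← mul_assoc (∏ i, w2' P j0 i (t i)), e3]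
  have h10 : (Γ * αt)^2 ≤ (∑ s ∈ univ.filter (fun s : Finset ι => Disjoint s (spt t)), zz P g R (place j0 t s) / rr P s)^2 :=
    pow_le_pow_left₀ (by positivity) h2 2
  have hr := rr_pos hP0 (spt t)
  have hσ0 : 0 ≤ 1 - σ := by linarith
  calc (1 - σ) * α^2 * (N * (1 - (7 * Fintype.card J + 2) * X)) = (1 - σ) * (N * (α^2 * (1 - (7 * Fintype.card J + 2) * X))) := by ring
    _ ≤ (1 - σ) * (N * (Pi7 * αt^2)) := by gcongr
    _ ≤ (∏ i, (1 - if t i = none then 1 / (P i:ℝ)^2 else 0)) * (N * (Pi7 * αt^2)) := by gcongr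
    _ = (∏ i, (1 - if t i = none then 1 / (P i:ℝ)^2 else 0)) * Pi7 * (1 / rr P (spt t)) * (Γ * αt)^2 := by rw [← e4]; ring
    _ ≤ _ := by
      refine mul_le_mul_of_nonneg_left h10 ?_
      have := hσ0.trans h5
      positivity

lemma fac_one {K S : Type} [Fintype K] [DecidableEq K] [Fintype S] (ν f : S → ℝ) (hν : ∀ s, 0 ≤ ν s) (hf : ∀ s, 0 ≤ f s)
    (τ : ℝ) (h : ∑ s, ν s * f s ≤ τ * ∑ s, ν s) (a : K) :
    ∑ x : K → S, (∏ j, ν (x j)) * f (x a) ≤ τ * (∑ s, ν s)^(Fintype.card K) := by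
  have e1 : ∀ x : K → S, (∏ j, ν (x j)) * f (x a) = ∏ j, (ν (x j) * if j = a then f (x j) else 1) := by
    intro x
    rw [prod_mul_distrib, prod_ite_eq']; simp
  simp only [e1]
  have e2 := prod_univ_sum (fun _ : K => (univ : Finset S)) (fun j s => ν s * if j = a then f s else 1)
  rw [piFinset_univ] at e2
  rw [← e2]
  calc ∏ j : K, ∑ s, ν s * (if j = a then f s else 1) ≤ ∏ j : K, ((if j = a then τ else 1) * ∑ s, ν s) := by
        refine Finset.prod_le_prod (fun j _ => sum_nonneg fun s _ => mul_nonneg (hν s) ?_) fun j _ => ?_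
        · by_cases hj : j = a
          · rw [if_pos hj]; exact hf s
          · rw [if_neg hj]; exact zero_le_one
        · by_cases hj : j = a
          · simp only [if_pos hj]; exact h
          · simp only [if_neg hj, mul_one, one_mul]; exact le_refl _
    _ = _ := by rw [prod_mul_distrib, prod_ite_eq']; simp

lemma fac_two {K S : Type} [Fintype K] [DecidableEq K] [Fintype S] (ν f g : S → ℝ) (hν : ∀ s, 0 ≤ ν s) (hf : ∀ s, 0 ≤ f s) (hg : ∀ s, 0 ≤ g s)
    (τ τ' : ℝ) (h : ∑ s, ν s * f s ≤ τ * ∑ s, ν s) (h' : ∑ s, ν s * g s ≤ τ' * ∑ s, ν s) (a b : K) (hab : a ≠ b) :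
    ∑ x : K → S, (∏ j, ν (x j)) * (f (x a) * g (x b)) ≤ τ * τ' * (∑ s, ν s)^(Fintype.card K) := by
  have e1 : ∀ x : K → S, (∏ j, ν (x j)) * (f (x a) * g (x b)) = ∏ j, (ν (x j) * ((if j = a then f (x j) else 1) * if j = b then g (x j) else 1)) := by
    intro x
    rw [prod_mul_distrib, prod_mul_distrib, prod_ite_eq', prod_ite_eq']; simp
  simp only [e1]
  have e2 := prod_univ_sum (fun _ : K => (univ : Finset S)) (fun j s => ν s * ((if j = a then f s else 1) * if j = b then g s else 1))
  rw [piFinset_univ] at e2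
  rw [← e2]
  calc ∏ j : K, ∑ s, ν s * ((if j = a then f s else 1) * if j = b then g s else 1) ≤ ∏ j : K, (((if j = a then τ else 1) * (if j = b then τ' else 1)) * ∑ s, ν s) := by
        refine Finset.prod_le_prod (fun j _ => sum_nonneg fun s _ => mul_nonneg (hν s) (mul_nonneg ?_ ?_)) fun j _ => ?_
        · by_cases hj : j = a
          · rw [if_pos hj]; exact hf s
          · rw [if_neg hj]; exact zero_le_one
        · by_cases hj : j = b
          · rw [if_pos hj]; exact hg s
          · rw [if_neg hj]; exact zero_le_one
        · by_cases hj : j = a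
          · have hb : j ≠ b := by rw [hj]; exact hab
            simp only [if_pos hj, if_neg hb, mul_one]; exact h
          · by_cases hj' : j = b
            · simp only [if_neg hj, if_pos hj', one_mul]; exact h'
            · simp only [if_neg hj, if_neg hj', mul_one, one_mul]; exact le_refl _
    _ = _ := by rw [prod_mul_distrib, prod_mul_distrib, prod_ite_eq', prod_ite_eq']; simp

lemma mem_spt (c : ι → Option J) (i : ι) : i ∈ spt c ↔ c i ≠ none := by simp [spt]

open Classical in
def mk (j0 : J) (x : {j // j ≠ j0} → Finset ι) : ι → Option J := fun i =>
  if h : ∃ j, i ∈ x j then some (Classical.choose h).1 else none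

lemma mk_cls_self (j0 : J) (x : {j // j ≠ j0} → Finset ι) : cls (mk j0 x) j0 = ∅ := by
  ext i
  rw [mem_cls, mk]
  by_cases h : ∃ j, i ∈ x j
  · rw [dif_pos h]
    have := (Classical.choose h).2
    simp [this]
  · rw [dif_neg h]; simp

lemma mk_cls (j0 : J) (x : {j // j ≠ j0} → Finset ι) (hx : ∀ j l, j ≠ l → Disjoint (x j) (x l)) (j : {j // j ≠ j0}) :
    cls (mk j0 x) j = x j := by
  ext i
  rw [mem_cls, mk]
  by_cases h : ∃ j, i ∈ x j
  · rw [dif_pos h]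
    have h1 := Classical.choose_spec h
    constructor
    · intro h2
      have : Classical.choose h = j := Subtype.ext (Option.some.inj h2)
      rwa [this] at h1
    · intro h2
      have : Classical.choose h = j := by
        by_contra hne
        exact disjoint_left.1 (hx _ _ hne) h1 h2
      rw [this]
  · rw [dif_neg h]
    push Not at h
    simp [h j]

def psi {K : Type} [Fintype K] [DecidableEq K] (P : ι → ℕ) (L c : ℝ) (x : K → Finset ι) : ℝ :=
  1 - ∑ j, log (rr P (x j)) / L - c * ∑ j, ∑ i ∈ x j, 1 / (P i : ℝ) -
    ∑ j, ∑ l ∈ univ.erase j, ∑ i, (if i ∈ x j then (1:ℝ) else 0) * (if i ∈ x l then 1 else 0)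

lemma psi_sum {K : Type} [Fintype K] [DecidableEq K] (P : ι → ℕ) (hP : ∀ i, 0 < P i) (g : ℝ → ℝ) (hg0 : ∀ x, 0 ≤ g x) (hg : Antitone g)
    (L c τ : ℝ) (hL : 0 < L) (hc : 0 ≤ c) (hη : ∑ s, nu P g s * log (rr P s) ≤ τ * L * ∑ s, nu P g s) :
    (∑ s, nu P g s)^(Fintype.card K) * (1 - Fintype.card K * τ - c * (Fintype.card K * ∑ i, 1 / (P i : ℝ)^2) -
      Fintype.card K * (Fintype.card K * ∑ i, 1 / (P i : ℝ)^2)) ≤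
    ∑ x : K → Finset ι, (∏ j, nu P g (x j)) * psi P L c x := by
  set β := ∑ s, nu P g s with hβ
  set n := Fintype.card K with hn
  set σ := ∑ i, 1 / (P i : ℝ)^2 with hσ
  have hν := nu_nonneg hP g
  have hβ0 : 0 ≤ β := sum_nonneg fun s _ => hν s
  have hσ0 : 0 ≤ σ := sum_nonneg fun s _ => by positivity
  have hind : ∀ i, ∑ s, nu P g s * (if i ∈ s then (1:ℝ) else 0) ≤ 1 / P i * β := by
    intro i
    have := nu_dvd P hP g hg0 hg i
    rw [sum_filter] at this
    simpa using this
  have b1 : ∀ a : K, ∑ x : K → Finset ι, (∏ j, nu P g (x j)) * (log (rr P (x a)) / L) ≤ τ * β^n := by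
    intro a
    refine fac_one (nu P g) (fun s => log (rr P s) / L) hν (fun s => div_nonneg (log_nonneg (one_le_rr hP s)) hL.le) τ ?_ a
    simp only [← mul_div_assoc]
    rw [← sum_div, div_le_iff₀ hL]
    linarith
  have b2 : ∀ a : K, ∑ x : K → Finset ι, (∏ j, nu P g (x j)) * (∑ i ∈ x a, 1 / (P i : ℝ)) ≤ σ * β^n := by
    intro a
    refine fac_one (nu P g) (fun s => ∑ i ∈ s, 1 / (P i : ℝ)) hν (fun s => sum_nonneg fun i _ => by positivity) σ ?_ a
    have : ∀ s : Finset ι, nu P g s * ∑ i ∈ s, 1 / (P i:ℝ) = ∑ i, (1 / (P i : ℝ)) * (nu P g s * (if i ∈ s then (1:ℝ) else 0)) := by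
      intro s
      rw [mul_sum]
      simp only [mul_ite, mul_one, mul_zero]
      rw [← sum_filter, filter_mem_eq_inter, univ_inter]
      exact sum_congr rfl fun i _ => mul_comm _ _
    simp only [this]
    rw [sum_comm, hσ, sum_mul]
    refine sum_le_sum fun i _ => ?_
    rw [← mul_sum]
    calc (1 / (P i : ℝ)) * _ ≤ (1 / (P i : ℝ)) * (1 / P i * β) := by gcongr; exact hind i
      _ = _ := by ring
  have b3 : ∀ a b : K, a ≠ b → ∀ i, ∑ x : K → Finset ι, (∏ j, nu P g (x j)) * ((if i ∈ x a then (1:ℝ) else 0) * (if i ∈ x b then 1 else 0)) ≤ 1 / (P i:ℝ)^2 * β^n := by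
    intro a b hab i
    have := fac_two (nu P g) (fun s => if i ∈ s then (1:ℝ) else 0) (fun s => if i ∈ s then (1:ℝ) else 0) hν (fun s => by positivity) (fun s => by positivity)
      (1 / P i) (1 / P i) (hind i) (hind i) a b hab
    calc _ ≤ _ := this
      _ = _ := by rw [← hn]; ring
  have e0 : ∑ x : K → Finset ι, (∏ j, nu P g (x j)) = β^n := by
    have e2 := prod_univ_sum (fun _ : K => (univ : Finset (Finset ι))) (fun _ s => nu P g s)
    rw [piFinset_univ] at e2
    rw [← e2]; simp [hβ, hn]
  have eS : ∑ x : K → Finset ι, (∏ j, nu P g (x j)) * psi P L c x = β^n -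
      ∑ a : K, ∑ x : K → Finset ι, (∏ j, nu P g (x j)) * (log (rr P (x a)) / L) -
      c * ∑ a : K, ∑ x : K → Finset ι, (∏ j, nu P g (x j)) * (∑ i ∈ x a, 1 / (P i : ℝ)) -
      ∑ a : K, ∑ b ∈ univ.erase a, ∑ i, ∑ x : K → Finset ι, (∏ j, nu P g (x j)) * ((if i ∈ x a then (1:ℝ) else 0) * (if i ∈ x b then 1 else 0)) := by
    unfold psi
    simp only [mul_sub, sum_sub_distrib, mul_one]
    rw [e0]
    congr 1
    · congr 1
      · congr 1
        simp only [mul_sum]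
        rw [sum_comm]
      · rw [sum_comm, mul_sum]
        refine sum_congr rfl fun x _ => ?_
        rw [← mul_sum]; ring
    · simp only [mul_sum]
      rw [sum_comm]
      refine sum_congr rfl fun a _ => ?_
      rw [sum_comm]
      refine sum_congr rfl fun b _ => ?_
      rw [sum_comm]
  rw [eS]
  have c1 : ∑ a : K, ∑ x : K → Finset ι, (∏ j, nu P g (x j)) * (log (rr P (x a)) / L) ≤ n * (τ * β^n) := by
    calc _ ≤ ∑ a : K, τ * β^n := sum_le_sum fun a _ => b1 a
      _ = _ := by simp [hn]
  have c2 : ∑ a : K, ∑ x : K → Finset ι, (∏ j, nu P g (x j)) * (∑ i ∈ x a, 1 / (P i : ℝ)) ≤ n * (σ * β^n) := by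
    calc _ ≤ ∑ a : K, σ * β^n := sum_le_sum fun a _ => b2 a
      _ = _ := by simp [hn]
  have c3 : ∑ a : K, ∑ b ∈ univ.erase a, ∑ i, ∑ x : K → Finset ι, (∏ j, nu P g (x j)) * ((if i ∈ x a then (1:ℝ) else 0) * (if i ∈ x b then 1 else 0)) ≤ n * (n * (σ * β^n)) := by
    calc _ ≤ ∑ a : K, ∑ b : K, σ * β^n := by
          refine sum_le_sum fun a _ => ?_
          calc _ ≤ ∑ b ∈ univ.erase a, σ * β^n := by
                refine sum_le_sum fun b hb => ?_
                rw [hσ, sum_mul]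
                exact sum_le_sum fun i _ => b3 a b (ne_of_mem_erase hb).symm i
            _ ≤ _ := sum_le_sum_of_subset_of_nonneg (subset_univ _) fun _ _ _ => by positivity
      _ = _ := by simp [hn]
  have c4 := mul_le_mul_of_nonneg_left c2 hc
  linarith

lemma psi_nonpos_of_not_disj {K : Type} [Fintype K] [DecidableEq K] (P : ι → ℕ) (hP : ∀ i, 0 < P i) (L c : ℝ) (hL : 0 < L) (hc : 0 ≤ c) (x : K → Finset ι)
    (j l : K) (hjl : j ≠ l) (h : ¬ Disjoint (x j) (x l)) : psi P L c x ≤ 0 := by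
  unfold psi
  have h1 : 0 ≤ ∑ j, log (rr P (x j)) / L := sum_nonneg fun j _ => div_nonneg (log_nonneg (one_le_rr hP _)) hL.le
  have h2 : 0 ≤ c * ∑ j, ∑ i ∈ x j, 1 / (P i : ℝ) := mul_nonneg hc (sum_nonneg fun j _ => sum_nonneg fun i _ => by positivity)
  obtain ⟨i, hi, hil⟩ := not_disjoint_iff.1 h
  have h3 : 1 ≤ ∑ j, ∑ l ∈ univ.erase j, ∑ i, (if i ∈ x j then (1:ℝ) else 0) * (if i ∈ x l then 1 else 0) := by
    calc (1:ℝ) = (if i ∈ x j then (1:ℝ) else 0) * (if i ∈ x l then 1 else 0) := by rw [if_pos hi, if_pos hil, one_mul]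
      _ ≤ ∑ i, (if i ∈ x j then (1:ℝ) else 0) * (if i ∈ x l then 1 else 0) :=
        single_le_sum (f := fun i => (if i ∈ x j then (1:ℝ) else 0) * (if i ∈ x l then 1 else 0)) (fun i _ => by positivity) (mem_univ i)
      _ ≤ ∑ l ∈ univ.erase j, ∑ i, (if i ∈ x j then (1:ℝ) else 0) * (if i ∈ x l then 1 else 0) :=
        single_le_sum (f := fun l => ∑ i, (if i ∈ x j then (1:ℝ) else 0) * (if i ∈ x l then 1 else 0))
          (fun l _ => sum_nonneg fun i _ => by positivity) (mem_erase.2 ⟨hjl.symm, mem_univ _⟩)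
      _ ≤ _ := single_le_sum (f := fun j => ∑ l ∈ univ.erase j, ∑ i, (if i ∈ x j then (1:ℝ) else 0) * (if i ∈ x l then 1 else 0))
          (fun l _ => sum_nonneg fun i _ => sum_nonneg fun i _ => by positivity) (mem_univ j)
  linarith

lemma psi_le {K : Type} [Fintype K] [DecidableEq K] (P : ι → ℕ) (L c : ℝ) (x : K → Finset ι) :
    psi P L c x ≤ 1 - ∑ j, log (rr P (x j)) / L - c * ∑ j, ∑ i ∈ x j, 1 / (P i : ℝ) := by
  unfold psi
  have : 0 ≤ ∑ j, ∑ l ∈ univ.erase j, ∑ i, (if i ∈ x j then (1:ℝ) else 0) * (if i ∈ x l then 1 else 0) :=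
    sum_nonneg fun l _ => sum_nonneg fun i _ => sum_nonneg fun i _ => by positivity
  linarith

lemma S2_bound (P : ι → ℕ) (hP : ∀ i, 7 * Fintype.card J < P i) (g : ℝ → ℝ) (hg0 : ∀ x, 0 ≤ g x) (hg : Antitone g)
    (R R1 R2 : ℝ) (hR1 : 0 ≤ R1) (hR2 : 1 < R2) (hR : R1 * R2 ≤ R) (j0 : J)
    (hσ : 10 * (Fintype.card J : ℝ)^2 * ∑ i, 1 / (P i : ℝ)^2 ≤ 1 / 4)
    (hη : 4 * Fintype.card J * ∑ s, nu P g s * log (rr P s) ≤ log R2 * ∑ s, nu P g s) :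
    (∑ s, Aα P g R1 s)^2 * (∑ s, nu P g s)^(Fintype.card J - 1) / 4 ≤
      ∑ o : ι → Option J, (∏ i, w2 P j0 i (o i)) * (GG P g R o)^2 := by
  have hP0 : ∀ i, 0 < P i := fun i => (hP i).pos
  have hm1 : (1:ℝ) ≤ Fintype.card J := by
    exact_mod_cast Fintype.card_pos_iff.2 ⟨j0⟩
  have hPm : ∀ i, 7 * (Fintype.card J : ℝ) < P i := fun i => by exact_mod_cast hP i
  set m := (Fintype.card J : ℝ) with hm
  have hm0 : 0 < m := by linarith
  set σ := ∑ i, 1 / (P i : ℝ)^2 with hσd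
  have hσ0 : 0 ≤ σ := sum_nonneg fun s _ => by positivity
  have hσ4 : σ ≤ 1 / 4 := by nlinarith
  set β := ∑ s, nu P g s with hβ
  have hβ0 : 0 ≤ β := sum_nonneg fun s _ => nu_nonneg hP0 g s
  set α := ∑ s, Aα P g R1 s with hα
  set L := log R2 with hL
  have hL0 : 0 < L := Real.log_pos hR2
  have hw2' : ∀ i t, 0 ≤ w2' P j0 i t := by
    intro i t
    have := hPm i
    have hpi : (1:ℝ) ≤ P i := by exact_mod_cast hP0 i
    unfold w2'
    split_ifs
    · rw [sub_nonneg, div_le_one (by positivity)]; exact one_le_pow₀ hpi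
    · exact le_refl _
    · linarith
  have hw2 : ∀ i t, 0 ≤ w2 P j0 i t := by
    intro i t
    have := hPm i
    have hpi : (1:ℝ) ≤ P i := by exact_mod_cast hP0 i
    unfold w2
    split_ifs
    · exact le_refl _
    · exact div_nonneg (by linarith) (by linarith)
    · exact div_nonneg (by linarith) (by linarith)
  have hT := tensor (fun i => w2' P j0 i) (fun i => w2 P j0 i) (fun i c t => e2' j0 c t) (fun i => ee P i) hw2' hw2
    (fun i a => local_S2 P hP j0 i a) (yy P g R)
  unfold QF at hT
  refine le_trans ?_ hT
  set F : (ι → Option J) → ℝ := fun t => (∏ i, w2' P j0 i (t i)) * (∑ c : ι → Option J, yy P g R c * ∏ i, e2' j0 (c i) (t i))^2 with hF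
  have hF0 : ∀ t, 0 ≤ F t := fun t => mul_nonneg (prod_nonneg fun i _ => hw2' i _) (sq_nonneg _)
  set A := (1 - σ) * α^2 with hA
  have hA0 : 0 ≤ A := mul_nonneg (by linarith) (sq_nonneg _)
  set c := 7 * m + 2 with hc
  have hc0 : 0 ≤ c := by linarith
  classical
  set good := univ.filter (fun x : {j // j ≠ j0} → Finset ι => (∀ j l, j ≠ l → Disjoint (x j) (x l)) ∧ ∏ j, rr P (x j) ≤ R2) with hgood
  have k1 : ∑ x ∈ good, F (mk j0 x) ≤ ∑ t, F t := by
    rw [← sum_image (s := good) (g := mk j0) (f := F)]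
    · exact sum_le_sum_of_subset_of_nonneg (subset_univ _) fun _ _ _ => hF0 _
    · intro x hx y hy hxy
      funext j
      rw [← mk_cls j0 x (mem_filter.1 hx).2.1 j, ← mk_cls j0 y (mem_filter.1 hy).2.1 j, hxy]
  have k2 : ∑ x : {j // j ≠ j0} → Finset ι, A * ((∏ j, nu P g (x j)) * psi P L c x) ≤ ∑ x ∈ good, F (mk j0 x) := by
    rw [hgood, sum_filter]
    refine sum_le_sum fun x _ => ?_
    have hN0 : 0 ≤ ∏ j, nu P g (x j) := prod_nonneg fun j _ => nu_nonneg hP0 g _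
    by_cases hd : ∀ j l, j ≠ l → Disjoint (x j) (x l)
    · have hlog : ∑ j, log (rr P (x j)) / L = log (∏ j, rr P (x j)) / L := by
        rw [← sum_div, Real.log_prod (fun j _ => (rr_pos hP0 _).ne')]
      have hspt : spt (mk j0 x) = univ.biUnion x := by
        ext i
        rw [mem_spt, mem_biUnion, mk]
        simp only [mem_univ, true_and]
        by_cases h : ∃ j, i ∈ x j
        · rw [dif_pos h]
          exact ⟨fun _ => let ⟨j, hj⟩ := h; ⟨j, hj⟩, fun _ => Option.some_ne_none _⟩
        · rw [dif_neg h]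
          exact ⟨fun h2 => absurd rfl h2, fun h2 => absurd (let ⟨j, hj⟩ := h2; ⟨j, hj⟩) h⟩
      have hrs : rr P (spt (mk j0 x)) = ∏ j, rr P (x j) := by
        rw [rr_spt, prod_eq_mul_prod_subtype_ne _ j0, mk_cls_self]
        simp only [rr, prod_empty, one_mul]
        exact prod_congr rfl fun j _ => by rw [mk_cls j0 x hd j]
      have hple := psi_le P L c x
      rw [hlog] at hple
      by_cases hr : ∏ j, rr P (x j) ≤ R2
      · rw [if_pos ⟨hd, hr⟩]
        have := S2_term P hP g hg0 hg R R1 R2 hR1 hR j0 (mk j0 x) (mk_cls_self j0 x) (by rw [hrs]; exact hr) (by linarith)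
        refine le_trans ?_ this
        rw [← hσd, ← hα, ← hA, ← hm, ← hc]
        refine mul_le_mul_of_nonneg_left ?_ hA0
        have en : ∏ j : {j // j ≠ j0}, nu P g (cls (mk j0 x) j) = ∏ j, nu P g (x j) :=
          prod_congr rfl fun j _ => by rw [mk_cls j0 x hd j]
        rw [en]
        refine mul_le_mul_of_nonneg_left ?_ hN0
        have es : ∑ i ∈ spt (mk j0 x), 1 / (P i:ℝ) = ∑ j, ∑ i ∈ x j, 1 / (P i : ℝ) := by
          rw [hspt, sum_biUnion]
          intro a _ b _ hab
          exact hd a b hab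
        rw [es]
        have h1 : 1 ≤ ∏ j, rr P (x j) := by rw [← hrs]; exact one_le_rr hP0 _
        have : 0 ≤ log (∏ j, rr P (x j)) / L := div_nonneg (log_nonneg h1) hL0.le
        linarith
      · rw [if_neg (fun h => hr h.2)]
        push Not at hr
        have h1 : 1 ≤ log (∏ j, rr P (x j)) / L := by
          rw [le_div_iff₀ hL0, one_mul]
          exact log_le_log (by linarith) hr.le
        have h2 : 0 ≤ c * ∑ j, ∑ i ∈ x j, 1 / (P i : ℝ) := mul_nonneg hc0 (sum_nonneg fun j _ => sum_nonneg fun i _ => by positivity)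
        exact mul_nonpos_of_nonneg_of_nonpos hA0 (mul_nonpos_of_nonneg_of_nonpos hN0 (by linarith))
    · rw [if_neg (fun h => hd h.1)]
      push Not at hd
      obtain ⟨j, l, hjl, h⟩ := hd
      exact mul_nonpos_of_nonneg_of_nonpos hA0 (mul_nonpos_of_nonneg_of_nonpos hN0 (psi_nonpos_of_not_disj P hP0 L c hL0 hc0 x j l hjl h))
  refine le_trans (le_trans ?_ k2) k1
  rw [← mul_sum]
  have k3 := psi_sum (K := {j // j ≠ j0}) P hP0 g hg0 hg L c (1 / (4 * m)) hL0 hc0 (by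
    rw [← hβ, div_mul_eq_mul_div, one_mul, div_mul_eq_mul_div, le_div_iff₀ (by positivity)]
    linarith)
  have hcard : Fintype.card {j // j ≠ j0} = Fintype.card J - 1 := by
    rw [Fintype.card_subtype_compl]; simp
  have hcardr : (Fintype.card {j // j ≠ j0} : ℝ) = m - 1 := by
    rw [hcard, Nat.cast_sub (Fintype.card_pos_iff.2 ⟨j0⟩), Nat.cast_one]
  rw [hcardr, hcard, ← hβ, ← hσd] at k3
  have k4 : (1:ℝ) / 2 ≤ 1 - (m - 1) * (1 / (4 * m)) - c * ((m - 1) * σ) - (m - 1) * ((m - 1) * σ) := by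
    have q1 : (m - 1) * (1 / (4 * m)) ≤ 1 / 4 := by
      rw [mul_one_div, div_le_iff₀ (by positivity)]; linarith
    have q2 : c * ((m - 1) * σ) + (m - 1) * ((m - 1) * σ) ≤ 10 * m^2 * σ := by
      rw [hc]; nlinarith [mul_nonneg hσ0 hm0.le, mul_nonneg (mul_nonneg hσ0 hm0.le) hm0.le]
    linarith
  have hβn : 0 ≤ β^(Fintype.card J - 1) := pow_nonneg hβ0 _
  calc α^2 * β^(Fintype.card J - 1) / 4 ≤ A * (β^(Fintype.card J - 1) * (1 / 2)) := by
        rw [hA]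
        nlinarith [mul_nonneg (sq_nonneg α) hβn]
    _ ≤ A * (β^(Fintype.card J - 1) * (1 - (m - 1) * (1 / (4 * m)) - c * ((m - 1) * σ) - (m - 1) * ((m - 1) * σ))) := by gcongr
    _ ≤ _ := by gcongr

def ctn (o d : ι → Option J) : Prop := ∀ i, d i = none ∨ o i = d i
instance (o d : ι → Option J) : Decidable (ctn o d) := by unfold ctn; infer_instance

def ind (o d : ι → Option J) : ℝ := if ctn o d then 1 else 0

lemma ind_prod (o d : ι → Option J) : ind o d = ∏ i, (if d i = none ∨ o i = d i then (1:ℝ) else 0) := by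
  rw [prod_ite_zero]
  simp [ind, ctn]

def uu (P : ι → ℕ) (i : ι) (c s : Option J) : ℝ :=
  if c = none then (if s = none then 1 else 0) else (if s = none then -1 else if s = c then (P i : ℝ) else 0)

lemma ee_uu (P : ι → ℕ) (i : ι) (c o : Option J) : ee P i c o = ∑ s, uu P i c s * (if s = none ∨ o = s then (1:ℝ) else 0) := by
  unfold ee uu
  rw [sum_option]
  by_cases hc : c = none
  · simp [hc]
  · obtain ⟨j, rfl⟩ := Option.ne_none_iff_exists'.1 hc
    simp only [reduceCtorEq, if_false, if_true, true_or, false_or, mul_one, Option.some.injEq]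
    rw [sum_eq_single j]
    · by_cases h : o = some j <;> simp [h]; ring
    · intro l _ hl; simp [hl]
    · simp

def lam (P : ι → ℕ) (g : ℝ → ℝ) (R : ℝ) (d : ι → Option J) : ℝ :=
  ∑ c : ι → Option J, yy P g R c * ∏ i, uu P i (c i) (d i)

lemma GG_lam (P : ι → ℕ) (g : ℝ → ℝ) (R : ℝ) (o : ι → Option J) : GG P g R o = ∑ d, lam P g R d * ind o d := by
  unfold GG lam
  simp only [sum_mul]
  rw [sum_comm]
  refine sum_congr rfl fun c _ => ?_
  simp only [mul_assoc]
  rw [← mul_sum]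
  congr 1
  simp only [ind_prod, ← prod_mul_distrib, ee_uu]
  have e2 := prod_univ_sum (fun _ : ι => (univ : Finset (Option J))) (fun i s => uu P i (c i) s * (if s = none ∨ o i = s then (1:ℝ) else 0))
  rw [piFinset_univ] at e2
  exact e2

def rem (c d : ι → Option J) : ι → Option J := fun i => if d i = none then c i else none

lemma rr_mono {P : ι → ℕ} (hP : ∀ i, 0 < P i) {s t : Finset ι} (h : s ⊆ t) : rr P s ≤ rr P t := by
  unfold rr
  rw [← prod_sdiff h]
  have h1 := one_le_rr hP (t \ s)
  have h2 := rr_pos hP s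
  unfold rr at h1 h2
  nlinarith

lemma lam_term (P : ι → ℕ) (hP : ∀ i, 0 < P i) (g : ℝ → ℝ) (hg0 : ∀ x, 0 ≤ g x) (hg1 : ∀ x, g x ≤ 1) (R : ℝ) (c d : ι → Option J) :
    |yy P g R c * ∏ i, uu P i (c i) (d i)| ≤ if ctn c d then ∏ j, aR P R (cls (rem c d) j) else 0 := by
  have hPr : ∀ i, (0:ℝ) < P i := fun i => by exact_mod_cast hP i
  by_cases h : ctn c d
  · rw [if_pos h]
    unfold yy
    by_cases hR : rr P (spt c) ≤ R
    · have hz0 := zz_nonneg (P := P) (R := R) hg0 c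
      have hz1 := zz_le_one (P := P) (R := R) hg0 hg1 c
      rw [mul_right_comm, abs_mul, abs_of_nonneg hz0, ← prod_mul_distrib]
      have hsub : spt (rem c d) ⊆ spt c := by
        intro i hi
        rw [mem_spt] at hi ⊢
        unfold rem at hi
        by_cases hd : d i = none
        · rwa [if_pos hd] at hi
        · rw [if_neg hd] at hi; exact absurd rfl hi
      have hsubj : ∀ j, cls (rem c d) j ⊆ spt c := by
        intro j i hi
        refine hsub ?_
        rw [mem_cls] at hi; rw [mem_spt, hi]; simp
      have e1 : ∏ j, aR P R (cls (rem c d) j) = 1 / rr P (spt (rem c d)) := by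
        rw [rr_spt, one_div, ← prod_inv_distrib]
        refine prod_congr rfl fun j _ => ?_
        unfold aR
        rw [if_pos ((rr_mono hP (hsubj j)).trans hR), one_div]
      have e2 : |∏ i, ((if c i = none then (1:ℝ) else -1 / P i) * uu P i (c i) (d i))| = 1 / rr P (spt (rem c d)) := by
        rw [abs_prod]
        unfold rr spt
        rw [prod_filter, one_div, ← prod_inv_distrib]
        refine prod_congr rfl fun i _ => ?_
        have hpi := hPr i
        unfold uu rem
        by_cases hc : c i = none
        · have hd : d i = none := by
            rcases h i with h1 | h1
            · exact h1
            · rw [← h1, hc]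
          simp [hc, hd]
        · by_cases hd : d i = none
          · simp [hc, hd, neg_div, abs_neg, abs_of_pos hpi]
          · have : d i = c i := by
              rcases h i with h1 | h1
              · exact absurd h1 hd
              · exact h1.symm
            simp only [this, hc, if_false, if_true, not_true_eq_false, ne_eq]
            rw [div_mul_cancel₀ _ hpi.ne']
            simp
      rw [e2, e1]
      have := rr_pos hP (spt (rem c d))
      calc 1 / rr P (spt (rem c d)) * zz P g R c ≤ 1 / rr P (spt (rem c d)) * 1 := by gcongr
        _ = _ := mul_one _
    · have : zz P g R c = 0 := by unfold zz; rw [if_neg hR]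
      rw [this]
      simp only [mul_zero, zero_mul, abs_zero]
      exact prod_nonneg fun j _ => aR_nonneg hP R _
  · rw [if_neg h]
    unfold ctn at h
    push Not at h
    obtain ⟨i, h1, h2⟩ := h
    rw [prod_eq_zero (mem_univ i), mul_zero, abs_zero]
    unfold uu
    by_cases hc : c i = none
    · simp [hc, h1]
    · simp [hc, h1, h2.symm]

lemma lam_bound (P : ι → ℕ) (hP : ∀ i, 0 < P i) (g : ℝ → ℝ) (hg0 : ∀ x, 0 ≤ g x) (hg1 : ∀ x, g x ≤ 1) (R : ℝ) (d : ι → Option J) :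
    |lam P g R d| ≤ (∑ s, aR P R s)^(Fintype.card J) := by
  unfold lam
  calc _ ≤ ∑ c : ι → Option J, |yy P g R c * ∏ i, uu P i (c i) (d i)| := abs_sum_le_sum_abs _ _
    _ ≤ ∑ c : ι → Option J, if ctn c d then ∏ j, aR P R (cls (rem c d) j) else 0 := sum_le_sum fun c _ => lam_term P hP g hg0 hg1 R c d
    _ = ∑ c ∈ univ.filter (fun c => ctn c d), ∏ j, aR P R (cls (rem c d) j) := by rw [sum_filter]
    _ = ∑ c ∈ (univ.filter (fun c => ctn c d)).image (fun c => rem c d), ∏ j, aR P R (cls c j) := by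
        rw [sum_image]
        intro c hc c' hc' h
        have h1 := (mem_filter.1 hc).2
        have h2 := (mem_filter.1 hc').2
        funext i
        have h3 := congrFun h i
        simp only [rem] at h3
        by_cases hd : d i = none
        · simpa [hd] using h3
        · rw [(h1 i).resolve_left hd, (h2 i).resolve_left hd]
    _ ≤ ∑ c : ι → Option J, ∏ j, aR P R (cls c j) :=
        sum_le_sum_of_subset_of_nonneg (subset_univ _) fun _ _ _ => prod_nonneg fun _ _ => aR_nonneg hP R _
    _ ≤ ∏ j : J, ∑ s : Finset ι, aR P R s := sum_tuples (fun _ => aR P R) fun _ s => aR_nonneg hP R s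
    _ = _ := by simp

lemma lam_zero (P : ι → ℕ) (hP : ∀ i, 0 < P i) (g : ℝ → ℝ) (R : ℝ) (d : ι → Option J)
    (hd : R < rr P (spt d)) : lam P g R d = 0 := by
  unfold lam
  refine sum_eq_zero fun c _ => ?_
  by_cases h : ctn c d
  · have hsub : spt d ⊆ spt c := by
      intro i hi
      rw [mem_spt] at hi ⊢
      rwa [(h i).resolve_left hi]
    have : ¬ rr P (spt c) ≤ R := not_le.2 (lt_of_lt_of_le hd (rr_mono hP hsub))
    unfold yy zz
    rw [if_neg this]; simp
  · unfold ctn at h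
    push Not at h
    obtain ⟨i, h1, h2⟩ := h
    rw [prod_eq_zero (mem_univ i), mul_zero]
    unfold uu
    by_cases hc : c i = none
    · simp [hc, h1]
    · simp [hc, h1, h2.symm]

def wt (w : ι → Option J → ℝ) (e : ι → Option J) : ℝ := ∏ i, if e i = none then 1 else w i (e i)

lemma model_ind (w : ι → Option J → ℝ) (hw : ∀ i, ∑ s, w i s = 1) (e : ι → Option J) :
    ∑ o : ι → Option J, (∏ i, w i (o i)) * ind o e = wt w e := by
  simp only [ind_prod, ← prod_mul_distrib]
  have e2 := prod_univ_sum (fun _ : ι => (univ : Finset (Option J))) (fun i s => w i s * (if e i = none ∨ s = e i then (1:ℝ) else 0))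
  rw [piFinset_univ] at e2
  rw [← e2, wt]
  refine prod_congr rfl fun i _ => ?_
  by_cases h : e i = none
  · simp [h, hw i]
  · simp [h]

def joi (a d : ι → Option J) : ι → Option J := fun i => if a i = none then d i else a i

lemma spt_joi (a d : ι → Option J) : spt (joi a d) = spt a ∪ spt d := by
  ext i
  rw [mem_union, mem_spt, mem_spt, mem_spt, joi]
  by_cases h : a i = none <;> simp [h]

def cmp (a d : ι → Option J) : Prop := ∀ i, a i = none ∨ d i = none ∨ a i = d i

lemma ind_mul_of_cmp (a d o : ι → Option J) (h : cmp a d) : ind o a * ind o d = ind o (joi a d) := by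
  have : ctn o (joi a d) ↔ ctn o a ∧ ctn o d := by
    unfold ctn joi
    rw [← forall_and]
    refine forall_congr' fun i => ?_
    by_cases ha : a i = none
    · simp [ha]
    · rcases h i with h1 | h1 | h1
      · exact absurd h1 ha
      · simp [ha, h1]
      · simp [← h1]
  unfold ind
  by_cases h1 : ctn o a <;> by_cases h2 : ctn o d <;> simp [this, h1, h2]

lemma ind_mul_of_not_cmp (a d o : ι → Option J) (h : ¬ cmp a d) : ind o a * ind o d = 0 := by
  unfold cmp at h
  push Not at h
  obtain ⟨i, h1, h2, h3⟩ := h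
  unfold ind
  by_cases ha : ctn o a
  · have : ¬ ctn o d := by
      intro hd
      exact h3 (((ha i).resolve_left h1).symm.trans ((hd i).resolve_left h2))
    simp [this]
  · simp [ha]

lemma pair_err {N : Type} (S : Finset N) (a : N → ℝ) (om : N → ι → Option J) (w : ι → Option J → ℝ) (hw : ∀ i, ∑ s, w i s = 1) (X : ℝ)
    (Er : Finset ι → ℝ) (U : Finset ι) (hE : ∀ e : ι → Option J, spt e = U → |∑ n ∈ S, a n * ind (om n) e - X * wt w e| ≤ Er U) (hEr : 0 ≤ Er U)
    (x y z : ι → Option J) (hU : spt x ∪ spt y ∪ spt z = U) :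
    |∑ n ∈ S, a n * (ind (om n) x * ind (om n) y * ind (om n) z) - X * ∑ o : ι → Option J, (∏ i, w i (o i)) * (ind o x * ind o y * ind o z)| ≤ Er U := by
  by_cases h1 : cmp x y
  · simp only [ind_mul_of_cmp x y _ h1]
    by_cases h2 : cmp (joi x y) z
    · simp only [ind_mul_of_cmp _ z _ h2]
      rw [model_ind w hw]
      exact hE _ (by rw [spt_joi, spt_joi, hU])
    · simp only [ind_mul_of_not_cmp _ z _ h2]
      simpa using hEr
  · simp only [ind_mul_of_not_cmp x y _ h1]
    simpa using hEr

lemma card_spt_le (s : Finset ι) : (univ.filter (fun d : ι → Option J => spt d ⊆ s)).card ≤ (Fintype.card J + 1)^s.card := by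
  calc _ ≤ (Fintype.piFinset (fun i => if i ∈ s then (univ : Finset (Option J)) else {none})).card := by
        refine card_le_card fun d hd => ?_
        rw [Fintype.mem_piFinset]
        intro i
        by_cases h : i ∈ s
        · simp [h]
        · rw [if_neg h, mem_singleton]
          by_contra hc
          exact h ((mem_filter.1 hd).2 ((mem_spt d i).2 hc))
    _ = _ := by
        rw [Fintype.card_piFinset]
        have : ∀ i, (if i ∈ s then (univ : Finset (Option J)) else {none}).card = if i ∈ s then Fintype.card J + 1 else 1 := by
          intro i
          by_cases h : i ∈ s <;> simp [h]
        simp only [this]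
        rw [prod_ite_mem]; simp

lemma transfer {N : Type} (S : Finset N) (a : N → ℝ) (om : N → ι → Option J) (w : ι → Option J → ℝ) (hw : ∀ i, ∑ s, w i s = 1) (X : ℝ)
    (P : ι → ℕ) (hP : ∀ i, 0 < P i) (g : ℝ → ℝ) (hg0 : ∀ x, 0 ≤ g x) (hg1 : ∀ x, g x ≤ 1) (R : ℝ) (hR : 0 ≤ R)
    (e0 : ι → Option J) (Er : Finset ι → ℝ) (hEr : ∀ s, 0 ≤ Er s)
    (hE : ∀ e : ι → Option J, rr P (spt e) ≤ R^2 * rr P (spt e0) → |∑ n ∈ S, a n * ind (om n) e - X * wt w e| ≤ Er (spt e)) :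
    |∑ n ∈ S, a n * (ind (om n) e0 * (GG P g R (om n))^2) - X * ∑ o : ι → Option J, (∏ i, w i (o i)) * (ind o e0 * (GG P g R o)^2)| ≤
      ((∑ s, aR P R s)^(Fintype.card J))^2 * ∑ s ∈ univ.filter (fun s => rr P s ≤ R^2 * rr P (spt e0)), ((Fintype.card J : ℝ) + 1)^(2 * s.card) * Er s := by
  have key : ∀ o : ι → Option J, ind o e0 * (GG P g R o)^2 = ∑ d, ∑ d', lam P g R d * lam P g R d' * (ind o e0 * ind o d * ind o d') := by
    intro o
    rw [GG_lam, sq, sum_mul_sum, mul_sum]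
    refine sum_congr rfl fun d _ => ?_
    rw [mul_sum]
    exact sum_congr rfl fun d' _ => by ring
  set Λ := (∑ s, aR P R s)^(Fintype.card J) with hΛ
  have hΛ0 : 0 ≤ Λ := pow_nonneg (sum_nonneg fun s _ => aR_nonneg hP R s) _
  have e1 : ∑ n ∈ S, a n * (ind (om n) e0 * (GG P g R (om n))^2) - X * ∑ o : ι → Option J, (∏ i, w i (o i)) * (ind o e0 * (GG P g R o)^2) =
      ∑ d, ∑ d', lam P g R d * lam P g R d' * (∑ n ∈ S, a n * (ind (om n) e0 * ind (om n) d * ind (om n) d') -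
        X * ∑ o : ι → Option J, (∏ i, w i (o i)) * (ind o e0 * ind o d * ind o d')) := by
    simp only [key, mul_sum, mul_sub, sum_sub_distrib]
    congr 1
    · rw [sum_comm]
      refine sum_congr rfl fun d _ => ?_
      rw [sum_comm]
      refine sum_congr rfl fun d' _ => ?_
      exact sum_congr rfl fun n _ => by ring
    · rw [sum_comm]
      refine sum_congr rfl fun d _ => ?_
      rw [sum_comm]
      refine sum_congr rfl fun d' _ => ?_
      exact sum_congr rfl fun n _ => by ring
  rw [e1]
  set U := fun q : (ι → Option J) × (ι → Option J) => spt e0 ∪ spt q.1 ∪ spt q.2 with hU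
  set good := univ.filter (fun q : (ι → Option J) × (ι → Option J) => rr P (U q) ≤ R^2 * rr P (spt e0)) with hgood
  have hunion : ∀ s t : Finset ι, rr P (s ∪ t) ≤ rr P s * rr P t := by
    intro s t
    have h1 : rr P (s ∪ t) * rr P (s ∩ t) = rr P s * rr P t := prod_union_inter
    have h2 := one_le_rr hP (s ∩ t)
    have h3 := rr_pos hP (s ∪ t)
    nlinarith
  calc _ ≤ ∑ d, ∑ d', |lam P g R d * lam P g R d' * (∑ n ∈ S, a n * (ind (om n) e0 * ind (om n) d * ind (om n) d') -
        X * ∑ o : ι → Option J, (∏ i, w i (o i)) * (ind o e0 * ind o d * ind o d'))| :=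
        (abs_sum_le_sum_abs _ _).trans (sum_le_sum fun d _ => abs_sum_le_sum_abs _ _)
    _ ≤ ∑ d, ∑ d', (if rr P (U (d, d')) ≤ R^2 * rr P (spt e0) then Λ^2 * Er (U (d, d')) else 0) := by
        refine sum_le_sum fun d _ => sum_le_sum fun d' _ => ?_
        by_cases hd : rr P (spt d) ≤ R
        · by_cases hd' : rr P (spt d') ≤ R
          · have hg : rr P (U (d, d')) ≤ R^2 * rr P (spt e0) := by
              have h1 := hunion (spt e0 ∪ spt d) (spt d')
              have h2 := hunion (spt e0) (spt d)
              have p0 := rr_pos hP (spt e0)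
              have p1 := rr_pos hP (spt d)
              have p2 := rr_pos hP (spt d')
              calc rr P (U (d, d')) ≤ rr P (spt e0 ∪ spt d) * rr P (spt d') := h1
                _ ≤ (rr P (spt e0) * rr P (spt d)) * rr P (spt d') := by gcongr
                _ ≤ (rr P (spt e0) * R) * R := by gcongr
                _ = _ := by ring
            rw [if_pos hg, abs_mul, abs_mul]
            have hp := pair_err S a om w hw X Er (U (d, d')) (fun e he => by rw [← he]; exact hE e (by rw [he]; exact hg)) (hEr _) e0 d d' rfl
            calc _ ≤ Λ * Λ * Er (U (d, d')) := by
                  gcongr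
                  · exact lam_bound P hP g hg0 hg1 R d
                  · exact lam_bound P hP g hg0 hg1 R d'
              _ = _ := by ring
          · rw [lam_zero P hP g R d' (not_le.1 hd')]
            simp only [mul_zero, zero_mul, abs_zero]
            have := hEr (U (d, d'))
            positivity
        · rw [lam_zero P hP g R d (not_le.1 hd)]
          simp only [zero_mul, abs_zero]
          have := hEr (U (d, d'))
          positivity
    _ = ∑ q ∈ good, Λ^2 * Er (U q) := by
        rw [hgood, sum_filter, Fintype.sum_prod_type]
    _ = ∑ s ∈ univ.filter (fun s => rr P s ≤ R^2 * rr P (spt e0)), ∑ q ∈ good.filter (fun q => U q = s), Λ^2 * Er (U q) := by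
        rw [sum_fiberwise_of_maps_to]
        intro q hq
        exact mem_filter.2 ⟨mem_univ _, (mem_filter.1 hq).2⟩
    _ ≤ ∑ s ∈ univ.filter (fun s => rr P s ≤ R^2 * rr P (spt e0)), ((Fintype.card J : ℝ) + 1)^(2 * s.card) * (Λ^2 * Er s) := by
        refine sum_le_sum fun s _ => ?_
        have h1 : ∑ q ∈ good.filter (fun q => U q = s), Λ^2 * Er (U q) = (good.filter (fun q => U q = s)).card * (Λ^2 * Er s) := by
          rw [← nsmul_eq_mul, ← sum_const]
          exact sum_congr rfl fun q hq => by rw [(mem_filter.1 hq).2]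
        rw [h1]
        have h2 : ((good.filter (fun q => U q = s)).card : ℝ) ≤ ((Fintype.card J : ℝ) + 1)^(2 * s.card) := by
          have h3 : (good.filter (fun q => U q = s)).card ≤ ((univ.filter (fun d : ι → Option J => spt d ⊆ s)) ×ˢ (univ.filter (fun d : ι → Option J => spt d ⊆ s))).card := by
            refine card_le_card fun q hq => ?_
            have := (mem_filter.1 hq).2
            rw [mem_product, mem_filter, mem_filter]
            refine ⟨⟨mem_univ _, ?_⟩, ⟨mem_univ _, ?_⟩⟩
            · rw [← this]; exact subset_union_right.trans subset_union_left
            · rw [← this]; exact subset_union_right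
          rw [card_product] at h3
          have h4 := h3.trans (Nat.mul_le_mul (card_spt_le (J := J) s) (card_spt_le (J := J) s))
          rw [← pow_add, ← two_mul] at h4
          exact_mod_cast h4
        have := hEr s
        gcongr
    _ = _ := by
        rw [mul_sum]
        exact sum_congr rfl fun s _ => by ring

end core

lemma per_bound (e : ℕ → ℝ) (W : ℕ) (hW : 1 ≤ W) (he : ∀ n, |e n| ≤ 1) (h0 : ∀ N, ∑ n ∈ Ico N (N + W), e n = 0) :
    ∀ N, |∑ n ∈ range N, e n| ≤ W := by
  intro N
  induction N using Nat.strong_induction_on with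
  | _ N ih =>
    by_cases h : N ≤ W
    · calc _ ≤ ∑ n ∈ range N, |e n| := abs_sum_le_sum_abs _ _
        _ ≤ ∑ n ∈ range N, (1:ℝ) := sum_le_sum fun n _ => he n
        _ = N := by simp
        _ ≤ W := by exact_mod_cast h
    · push Not at h
      have h1 := h0 (N - W)
      rw [Nat.sub_add_cancel h.le, sum_Ico_eq_sub _ (Nat.sub_le _ _)] at h1
      have h2 : ∑ n ∈ range N, e n = ∑ n ∈ range (N - W), e n := by linarith
      rw [h2]
      exact ih _ (by omega)

lemma abel_real (e : ℕ → ℝ) (B : ℝ) (N0 M : ℕ) (h0 : 1 ≤ N0) (hM : N0 ≤ M) (ha : ∀ N, |∑ n ∈ range N, e n| ≤ B) :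
    |∑ n ∈ Ico N0 M, e n / n| ≤ 2 * B / N0 := by
  have h := abel_bound (fun n => (e n : ℂ)) (fun n => ((1 / (n:ℝ) : ℝ) : ℂ)) (fun n => 1 / (n:ℝ)) B N0 M hM
    (fun N => by rw [← Complex.ofReal_sum, norm_real]; exact ha N)
    (fun n hn => by
      have hn0 : (0:ℝ) < n := by exact_mod_cast (by omega : 0 < n)
      rw [← Complex.ofReal_sub, norm_real, norm_eq_abs, abs_of_nonneg]
      rw [sub_nonneg]
      apply one_div_le_one_div_of_le hn0
      push_cast; linarith)
    (fun n hn => by rw [norm_real, norm_eq_abs, abs_of_nonneg (by positivity)])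
  have e1 : ∑ n ∈ Ico N0 M, (e n : ℂ) * ((1 / (n:ℝ) : ℝ) : ℂ) = ((∑ n ∈ Ico N0 M, e n / n : ℝ) : ℂ) := by
    rw [Complex.ofReal_sum]
    exact sum_congr rfl fun n _ => by rw [← Complex.ofReal_mul]; congr 1; ring
  rw [e1, norm_real, norm_eq_abs] at h
  calc _ ≤ _ := h
    _ = _ := by ring

lemma per_sum (p : ℕ → Prop) [DecidablePred p] (W c : ℕ) (hW : 1 ≤ W) (hc : c ≤ W) (hp : ∀ N, ((Ico N (N + W)).filter p).card = c) (N0 M : ℕ) (h0 : 1 ≤ N0) (hM : N0 ≤ M) :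
    |∑ n ∈ (Ico N0 M).filter p, 1 / (n:ℝ) - (c:ℝ) / W * ∑ n ∈ Ico N0 M, 1 / (n:ℝ)| ≤ 2 * W / N0 := by
  have hW0 : (0:ℝ) < W := by exact_mod_cast hW
  have hcW : (c:ℝ) / W ≤ 1 := by rw [div_le_one hW0]; exact_mod_cast hc
  have hc0 : 0 ≤ (c:ℝ) / W := by positivity
  have h := abel_real (fun n => (if p n then 1 else 0) - (c:ℝ) / W) W N0 M h0 hM (per_bound _ W hW
    (fun n => by
      by_cases h : p n
      · rw [if_pos h, abs_le]; constructor <;> linarith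
      · rw [if_neg h, abs_le]; constructor <;> linarith)
    (fun N => by
      rw [sum_sub_distrib, sum_boole, hp N]
      simp
      field_simp
      ring))
  have e1 : ∑ n ∈ Ico N0 M, ((if p n then 1 else 0) - (c:ℝ) / W) / n = ∑ n ∈ (Ico N0 M).filter p, 1 / (n:ℝ) - (c:ℝ) / W * ∑ n ∈ Ico N0 M, 1 / (n:ℝ) := by
    rw [sum_filter, mul_sum, ← sum_sub_distrib]
    refine sum_congr rfl fun n _ => ?_
    by_cases h : p n
    · rw [if_pos h, if_pos h]; ring
    · rw [if_neg h, if_neg h]; ring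
  rw [← e1]; exact h

def cop (W : ℕ) (y : ℝ) : ℝ := ∑ n ∈ (Icc 1 ⌊y⌋₊).filter (fun n => n.Coprime W), 1 / (n:ℝ)

lemma cop_bound (W : ℕ) (hW : 1 ≤ W) (y : ℝ) (hy : 1 ≤ y) : |cop W y - W.totient / W * log y| ≤ 2 * W + 1 := by
  have hW0 : (0:ℝ) < W := by exact_mod_cast hW
  have h1 := per_sum (fun n => n.Coprime W) W W.totient hW (totient_le W) (fun N => by
    rw [← Nat.filter_coprime_Ico_eq_totient W N]
    congr 1
    exact filter_congr fun n _ => Nat.coprime_comm) 1 (⌊y⌋₊ + 1) (le_refl _) (by omega)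
  have e : Ico 1 (⌊y⌋₊ + 1) = Icc 1 ⌊y⌋₊ := by ext; simp
  rw [e] at h1
  have h2 : ∑ n ∈ Icc 1 ⌊y⌋₊, 1 / (n:ℝ) = (harmonic ⌊y⌋₊ : ℚ) := by
    rw [harmonic_eq_sum_Icc]; push_cast; simp
  have h3 := log_le_harmonic_floor y (by linarith)
  have h4 := harmonic_floor_le_one_add_log y hy
  rw [h2] at h1
  have hφ : (W.totient : ℝ) / W ≤ 1 := by rw [div_le_one hW0]; exact_mod_cast totient_le W
  have hφ0 : 0 ≤ (W.totient : ℝ) / W := by positivity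
  have h5 : |(W.totient : ℝ) / W * ((harmonic ⌊y⌋₊ : ℚ) : ℝ) - W.totient / W * log y| ≤ 1 := by
    rw [← mul_sub, abs_of_nonneg (mul_nonneg hφ0 (by linarith))]
    nlinarith
  unfold cop
  rw [Nat.cast_one, div_one] at h1
  have := abs_sub_le (∑ n ∈ (Icc 1 ⌊y⌋₊).filter (fun n => n.Coprime W), 1 / (n:ℝ)) ((W.totient : ℝ) / W * ((harmonic ⌊y⌋₊ : ℚ) : ℝ)) (W.totient / W * log y)
  linarith

lemma ap_window (q a : ℕ) (hq : 1 ≤ q) (N : ℕ) : ((Ico N (N + q)).filter (fun n => n ≡ a [MOD q])).card = 1 := by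
  have hper : Function.Periodic (fun n => n ≡ a [MOD q]) q := by
    intro n
    simp [Nat.ModEq]
  rw [Nat.filter_Ico_card_eq_of_periodic N q _ hper, Nat.count_modEq_card _ hq]
  simp [Nat.mod_lt _ hq, Nat.div_self hq]

lemma ap_sum (q a : ℕ) (hq : 1 ≤ q) (N0 M : ℕ) (h0 : 1 ≤ N0) (hM : N0 ≤ M) :
    |∑ n ∈ (Ico N0 M).filter (fun n => n ≡ a [MOD q]), 1 / (n:ℝ) - 1 / q * ∑ n ∈ Ico N0 M, 1 / (n:ℝ)| ≤ 2 * q / N0 := by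
  have := per_sum (fun n => n ≡ a [MOD q]) q 1 hq hq (ap_window q a hq) N0 M h0 hM
  simpa using this

lemma sum_inj {α β : Type} [DecidableEq β] (S : Finset α) (T : Finset β) (f : α → β) (hf : Set.InjOn f S) (hST : ∀ a ∈ S, f a ∈ T)
    (v : α → ℝ) (w : β → ℝ) (hw : ∀ b ∈ T, 0 ≤ w b) (hvw : ∀ a ∈ S, v a ≤ w (f a)) : ∑ a ∈ S, v a ≤ ∑ b ∈ T, w b := by
  calc ∑ a ∈ S, v a ≤ ∑ a ∈ S, w (f a) := sum_le_sum hvw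
    _ = ∑ b ∈ S.image f, w b := (sum_image hf).symm
    _ ≤ _ := sum_le_sum_of_subset_of_nonneg (image_subset_iff.2 hST) (fun b hb _ => hw b hb)

section core
variable {ι : Type} [Fintype ι] [DecidableEq ι]

def nn (P : ι → ℕ) (s : Finset ι) : ℕ := ∏ i ∈ s, P i

lemma rr_nn (P : ι → ℕ) (s : Finset ι) : rr P s = nn P s := by
  unfold rr nn; push_cast; rfl

/-- The indexing family `P` runs over all primes up to `R`, not dividing `W`, different from `ps`. -/
structure Fam (P : ι → ℕ) (W ps : ℕ) (R : ℝ) : Prop where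
  pr : ∀ i, (P i).Prime
  ndvd : ∀ i, ¬ P i ∣ W
  ne : ∀ i, P i ≠ ps
  le : ∀ i, (P i : ℝ) ≤ R
  inj : Function.Injective P
  surj : ∀ p : ℕ, p.Prime → ¬ p ∣ W → p ≠ ps → (p : ℝ) ≤ R → ∃ i, P i = p

variable {P : ι → ℕ} {W ps : ℕ} {R : ℝ}

lemma Fam.pos (h : Fam P W ps R) (i : ι) : 0 < P i := (h.pr i).pos

lemma dvd_nn (h : Fam P W ps R) (s : Finset ι) (p : ℕ) (hp : p.Prime) : p ∣ nn P s ↔ ∃ i ∈ s, P i = p := by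
  unfold nn
  rw [hp.prime.dvd_finsetProd_iff]
  constructor
  · rintro ⟨i, hi, hd⟩
    exact ⟨i, hi, ((prime_dvd_prime_iff_eq hp (h.pr i)).1 hd).symm⟩
  · rintro ⟨i, hi, rfl⟩
    exact ⟨i, hi, dvd_rfl⟩

lemma nn_inj (h : Fam P W ps R) : Function.Injective (nn P) := by
  intro s t hst
  ext i
  have key : ∀ s : Finset ι, i ∈ s ↔ P i ∣ nn P s := fun s => by
    rw [dvd_nn h s _ (h.pr i)]
    exact ⟨fun hi => ⟨i, hi, rfl⟩, fun ⟨j, hj, e⟩ => h.inj e ▸ hj⟩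
  rw [key, key, hst]

lemma nn_pos (h : Fam P W ps R) (s : Finset ι) : 0 < nn P s := prod_pos fun i _ => h.pos i

lemma nn_coprime (h : Fam P W ps R) (s : Finset ι) (q : ℕ) (hq : ∀ i, ¬ P i ∣ q) : (nn P s).Coprime q :=
  Nat.Coprime.prod_left fun i _ => (Nat.Prime.coprime_iff_not_dvd (h.pr i)).2 (hq i)

lemma nn_tau (h : Fam P W ps R) (s : Finset ι) : (nn P s).divisors.card = 2 ^ s.card := by
  induction s using Finset.induction_on with
  | empty => simp [nn]
  | insert i s hi ih =>
    have e : nn P (insert i s) = P i * nn P s := prod_insert hi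
    have hc : (P i).Coprime (nn P s) := (Nat.Prime.coprime_iff_not_dvd (h.pr i)).2 (fun hd => by
      obtain ⟨j, hj, hij⟩ := (dvd_nn h s _ (h.pr i)).1 hd
      exact hi (h.inj hij ▸ hj))
    rw [e, hc.card_divisors_mul, ih, card_insert_of_notMem hi, (h.pr i).divisors, card_pair (h.pr i).one_lt.ne, pow_succ]
    ring

lemma win_le (h : Fam P W ps R) (z y : ℝ) : ∑ s : Finset ι, (if z < rr P s ∧ rr P s ≤ y then 1 / rr P s else 0)
    ≤ ∑ n ∈ ((Icc 1 ⌊y⌋₊).filter (fun n => n.Coprime W)).filter (fun n : ℕ => z < n), 1 / (n:ℝ) := by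
  rw [← sum_filter]
  apply sum_inj _ _ (nn P) ((nn_inj h).injOn) _ _ _ (fun b _ => by positivity) (fun s _ => by rw [rr_nn])
  intro s hs
  obtain ⟨h1, h2⟩ := (mem_filter.1 hs).2
  rw [rr_nn] at h1 h2
  rw [mem_filter, mem_filter, mem_Icc]
  exact ⟨⟨⟨nn_pos h s, Nat.le_floor h2⟩, nn_coprime h s W h.ndvd⟩, h1⟩

lemma mass_upper (h : Fam P W ps R) (hW : 1 ≤ W) (y : ℝ) (hy : 1 ≤ y) :
    ∑ s, aR P y s ≤ W.totient / W * log y + (2 * W + 1) := by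
  have h1 := win_le h 0 y
  have h2 : ∑ n ∈ ((Icc 1 ⌊y⌋₊).filter (fun n => n.Coprime W)).filter (fun n : ℕ => (0:ℝ) < n), 1 / (n:ℝ) ≤ cop W y :=
    sum_le_sum_of_subset_of_nonneg (filter_subset _ _) (fun _ _ _ => by positivity)
  have h3 := (abs_le.1 (cop_bound W hW y hy)).2
  have h4 : ∑ s, aR P y s = ∑ s : Finset ι, (if 0 < rr P s ∧ rr P s ≤ y then 1 / rr P s else 0) :=
    sum_congr rfl fun s _ => by
      have := rr_pos (fun i => h.pos i) s
      unfold aR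
      by_cases hh : rr P s ≤ y
      · rw [if_pos hh, if_pos ⟨this, hh⟩]
      · rw [if_neg hh, if_neg (fun h => hh h.2)]
  linarith

lemma lay_upper (h : Fam P W ps R) (hW : 1 ≤ W) (p y : ℝ) (hp : 1 ≤ p) :
    ∑ s, lay P p y s ≤ W.totient / W * log p + 2 * (2 * W + 1) := by
  have hl : 0 ≤ log p := log_nonneg hp
  have hφ : (0:ℝ) ≤ W.totient / W := by positivity
  by_cases hy : y < 1
  · have : ∑ s, lay P p y s = 0 := sum_eq_zero fun s _ => by
      unfold lay
      rw [if_neg]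
      intro hh
      linarith [one_le_rr (fun i => h.pos i) s, hh.2]
    rw [this]; positivity
  push Not at hy
  by_cases hyp : y < p
  · have h1 : ∑ s, lay P p y s ≤ ∑ s, aR P y s := sum_le_sum fun s _ => by
      have := rr_pos (fun i => h.pos i) s
      unfold lay aR
      by_cases hh : rr P s ≤ y
      · rw [if_pos hh]
        by_cases h2 : y / p < rr P s
        · rw [if_pos ⟨h2, hh⟩]
        · rw [if_neg (fun h => h2 h.1)]; positivity
      · rw [if_neg hh, if_neg (fun h => hh h.2)]
    have h2 := mass_upper h hW y hy
    have h3 := mul_le_mul_of_nonneg_left (log_le_log (by linarith) hyp.le) hφ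
    have : (0:ℝ) ≤ 2 * W + 1 := by positivity
    linarith
  push Not at hyp
  have hyp1 : 1 ≤ y / p := by rw [le_div_iff₀ (by linarith)]; linarith
  have h1 := win_le h (y / p) y
  have h2 := sum_filter_add_sum_filter_not ((Icc 1 ⌊y⌋₊).filter (fun n => n.Coprime W)) (fun n : ℕ => y / p < n) (fun n : ℕ => 1 / (n:ℝ))
  have h3 : cop W (y / p) ≤ ∑ n ∈ ((Icc 1 ⌊y⌋₊).filter (fun n => n.Coprime W)).filter (fun n : ℕ => ¬ y / p < n), 1 / (n:ℝ) := by
    apply sum_le_sum_of_subset_of_nonneg _ (fun _ _ _ => by positivity)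
    intro n hn
    rw [mem_filter, mem_Icc] at hn
    rw [mem_filter, mem_filter, mem_Icc]
    have hle : (n:ℝ) ≤ y / p := (Nat.le_floor_iff (by linarith)).1 hn.1.2
    exact ⟨⟨⟨hn.1.1, Nat.le_floor (hle.trans (div_le_self (by linarith) hp))⟩, hn.2⟩, not_lt.2 hle⟩
  have h4 := (abs_le.1 (cop_bound W hW y hy)).2
  have h5 := (abs_le.1 (cop_bound W hW (y / p) hyp1)).1
  rw [log_div (by linarith) (by linarith)] at h5
  unfold lay
  have h6 : cop W y = ∑ n ∈ (Icc 1 ⌊y⌋₊).filter (fun n => n.Coprime W), 1 / (n:ℝ) := rfl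
  linarith

lemma inv_sq_sum (N : ℕ) : ∑ d ∈ Icc 1 N, 1 / (d:ℝ)^2 ≤ 2 := by
  have h := sum_Ioo_inv_sq_le (α := ℝ) 0 (N + 1)
  have e : Ioo 0 (N + 1) = Icc 1 N := by ext; simp; omega
  rw [e] at h
  simp only [one_div]
  norm_num at h ⊢
  exact h

lemma mass_lower (h : Fam P W ps R) (hps : ps = 1 ∨ ps.Prime) (hW : 1 ≤ W) (y : ℝ) (hy : 1 ≤ y) (hyR : y ≤ R) :
    (W.totient / W * log y - (2 * W + 1)) / 4 ≤ ∑ s, aR P y s := by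
  have hps0 : 1 ≤ ps := by rcases hps with h | h; exact h.ge; exact h.one_lt.le
  have hR0 : ∀ s, 0 < rr P s := rr_pos (fun i => h.pos i)
  have hcov : ∀ n ∈ (Icc 1 ⌊y⌋₊).filter (fun n => n.Coprime W), ∃ t : (ℕ × Bool) × Finset ι, t.1.1 ∈ Icc 1 ⌊y⌋₊ ∧
      t.1.1 ^ 2 * (if t.1.2 then ps else 1) * nn P t.2 = n := by
    intro n hn
    rw [mem_filter, mem_Icc] at hn
    obtain ⟨⟨hn1, hn2⟩, hc⟩ := hn
    obtain ⟨a, d, had, hsq⟩ := Nat.sq_mul_squarefree n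
    have hy2 : (n:ℝ) ≤ y := (Nat.le_floor_iff (by linarith)).1 hn2
    have ha0 : a ≠ 0 := hsq.ne_zero
    have hd1 : 1 ≤ d := Nat.pos_of_ne_zero (by rintro rfl; simp at had; omega)
    have hdn : d ∣ n := ⟨d * a, by rw [← had]; ring⟩
    have han : a ∣ n := ⟨d ^ 2, by rw [← had]; ring⟩
    set s : Finset ι := univ.filter (fun i => P i ∣ a) with hs
    have hsp : ∀ p, p.Prime → p ∣ a → p ≠ ps → ∃ i ∈ s, P i = p := by
      intro p hp hpa hne
      have hpn := hpa.trans han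
      obtain ⟨i, hi⟩ := h.surj p hp (fun hpW => by
        have := Nat.dvd_gcd hpn hpW
        rw [hc] at this
        exact hp.one_lt.ne' (Nat.dvd_one.1 this)) hne (le_trans (by exact_mod_cast Nat.le_of_dvd (by omega) hpn) (hy2.trans hyR))
      exact ⟨i, by rw [hs, mem_filter]; exact ⟨mem_univ _, hi ▸ hpa⟩, hi⟩
    have hprod : a = ∏ p ∈ a.primeFactors, p := (Nat.prod_primeFactors_of_squarefree hsq).symm
    have hnn : nn P s = ∏ p ∈ a.primeFactors.erase ps, p := by
      unfold nn
      rw [← prod_image (f := fun p => p) (fun i _ j _ e => h.inj e)]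
      congr 1
      ext p
      rw [mem_image, mem_erase, Nat.mem_primeFactors]
      constructor
      · rintro ⟨i, hi, rfl⟩
        exact ⟨h.ne i, h.pr i, (mem_filter.1 hi).2, ha0⟩
      · rintro ⟨hne, hp, hpa, _⟩
        exact hsp p hp hpa hne
    refine ⟨((d, decide (ps ∈ a.primeFactors)), s), mem_Icc.2 ⟨hd1, (Nat.le_of_dvd (by omega) hdn).trans hn2⟩, ?_⟩
    simp only [decide_eq_true_eq]
    rw [hnn, ← had, mul_assoc]
    by_cases hm : ps ∈ a.primeFactors
    · rw [if_pos hm, mul_prod_erase _ (fun p => p) hm, ← hprod]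
    · rw [if_neg hm, erase_eq_of_notMem hm, ← hprod]; ring
  choose! f hf1 hf2 using hcov
  have key : cop W y ≤ ∑ t ∈ (Icc 1 ⌊y⌋₊ ×ˢ (univ : Finset Bool)) ×ˢ (univ : Finset (Finset ι)), 1 / (t.1.1:ℝ)^2 * aR P y t.2 := by
    apply sum_inj _ _ f
    · intro n hn n' hn' e
      rw [← hf2 n hn, ← hf2 n' hn', e]
    · intro n hn
      simp [mem_product, hf1 n hn, -mem_Icc]
    · intro t _
      have := aR_nonneg (fun i => h.pos i) y t.2
      positivity
    · intro n hn
      have e := hf2 n hn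
      rw [mem_filter, mem_Icc] at hn
      have hy2 : (n:ℝ) ≤ y := (Nat.le_floor_iff (by linarith)).1 hn.1.2
      have hd : 0 < (f n).1.1 := by
        rcases Nat.eq_zero_or_pos (f n).1.1 with h0 | h0
        · rw [h0] at e; simp at e; omega
        · exact h0
      have hg : 1 ≤ (if (f n).1.2 then ps else 1) := by split_ifs; exact hps0; exact le_refl _
      have e3 : (f n).1.1 ^ 2 * nn P (f n).2 ≤ n := by
        conv_rhs => rw [← e]
        calc _ = (f n).1.1 ^ 2 * 1 * nn P (f n).2 := by ring
          _ ≤ _ := by gcongr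
      have e4 : nn P (f n).2 ≤ n := le_trans (Nat.le_mul_of_pos_left _ (by positivity)) e3
      have e5 : rr P (f n).2 ≤ y := by rw [rr_nn]; exact le_trans (by exact_mod_cast e4) hy2
      unfold aR
      rw [if_pos e5, one_div_mul_one_div]
      apply one_div_le_one_div_of_le
      · have := hR0 (f n).2
        positivity
      · rw [rr_nn]; exact_mod_cast e3
  rw [sum_product] at key
  simp only [← mul_sum] at key
  rw [← sum_mul, sum_product] at key
  simp only [sum_const, card_univ, Fintype.card_bool, nsmul_eq_mul] at key
  rw [← mul_sum] at key
  have hM : 0 ≤ ∑ s, aR P y s := sum_nonneg fun s _ => aR_nonneg (fun i => h.pos i) y s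
  have h2 := inv_sq_sum ⌊y⌋₊
  have h3 := (abs_le.1 (cop_bound W hW y hy)).1
  push_cast at key
  have : 2 * (∑ d ∈ Icc 1 ⌊y⌋₊, 1 / (d:ℝ)^2) * ∑ s, aR P y s ≤ 2 * 2 * ∑ s, aR P y s := by gcongr
  linarith

end core

def yj (b : ℕ) (L : ℝ) (j : ℕ) : ℝ := exp (2^j * (L / 2^b))
def gs (b : ℕ) (L : ℝ) (r : ℝ) : ℝ := ∑ j ∈ range b, if r ≤ yj b L j then (1/2:ℝ)^(j+1) else 0

lemma yj_mono (b : ℕ) {L : ℝ} (hL : 0 ≤ L) {i j : ℕ} (hij : i ≤ j) : yj b L i ≤ yj b L j := by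
  unfold yj
  apply exp_le_exp.2
  apply mul_le_mul_of_nonneg_right _ (by positivity)
  exact pow_le_pow_right₀ (by norm_num) hij

lemma gs_nonneg (b : ℕ) (L r : ℝ) : 0 ≤ gs b L r := sum_nonneg fun j _ => by split_ifs <;> positivity

lemma gs_anti (b : ℕ) (L : ℝ) : Antitone (gs b L) := by
  intro r r' hr
  apply sum_le_sum
  intro j _
  by_cases h : r' ≤ yj b L j
  · rw [if_pos h, if_pos (hr.trans h)]
  · rw [if_neg h]; split_ifs <;> positivity

lemma geo_tail (b j0 : ℕ) : ∑ j ∈ Ico j0 b, (1/2:ℝ)^(j+1) ≤ (1/2:ℝ)^j0 := by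
  by_cases h : j0 ≤ b
  · have : ∑ j ∈ Ico j0 b, (1/2:ℝ)^(j+1) = (1/2:ℝ)^j0 - (1/2:ℝ)^b := by
      rw [← neg_sub ((1/2:ℝ)^b), ← sum_Ico_sub (fun j => (1/2:ℝ)^j) h, ← sum_neg_distrib]
      exact sum_congr rfl fun j _ => by rw [pow_succ]; ring
    rw [this]
    have : (0:ℝ) < (1/2:ℝ)^b := by positivity
    linarith
  · rw [Ico_eq_empty (by omega)]; simp

lemma gs_le_one (b : ℕ) (L r : ℝ) : gs b L r ≤ 1 := by
  calc gs b L r ≤ ∑ j ∈ Ico 0 b, (1/2:ℝ)^(j+1) := by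
        rw [← range_eq_Ico]
        exact sum_le_sum fun j _ => by split_ifs; exact le_refl _; positivity
    _ ≤ _ := by simpa using geo_tail b 0

lemma gs_sq (b : ℕ) (L : ℝ) (r : ℝ) : gs b L r ^ 2 ≤ ∑ j ∈ range b, if r ≤ yj b L j then (1/4:ℝ)^j else 0 := by
  by_cases hr : ∃ j, j < b ∧ r ≤ yj b L j
  · classical
    set j0 := Nat.find hr
    obtain ⟨h1, h2⟩ := Nat.find_spec hr
    have h3 : ∀ j < j0, ¬ r ≤ yj b L j := fun j hj h => Nat.find_min hr hj ⟨by omega, h⟩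
    have h4 : gs b L r ≤ (1/2:ℝ)^j0 := by
      refine le_trans ?_ (geo_tail b j0)
      unfold gs
      rw [← sum_filter]
      apply sum_le_sum_of_subset_of_nonneg _ (fun _ _ _ => by positivity)
      intro j hj
      rw [mem_filter, mem_range] at hj
      rw [mem_Ico]
      exact ⟨by by_contra hc; exact h3 j (by omega) hj.2, hj.1⟩
    calc gs b L r ^ 2 ≤ ((1/2:ℝ)^j0)^2 := pow_le_pow_left₀ (gs_nonneg b L r) h4 2
      _ = if r ≤ yj b L j0 then (1/4:ℝ)^j0 else 0 := by rw [if_pos h2, ← pow_mul, mul_comm, pow_mul]; norm_num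
      _ ≤ _ := single_le_sum (f := fun j => if r ≤ yj b L j then (1/4:ℝ)^j else 0) (fun j _ => by split_ifs <;> positivity) (mem_range.2 h1)
  · have : gs b L r = 0 := sum_eq_zero fun j hj => if_neg fun h => hr ⟨j, mem_range.1 hj, h⟩
    rw [this]
    simp only [ne_eq, OfNat.ofNat_ne_zero, not_false_eq_true, zero_pow]
    exact sum_nonneg fun j _ => by split_ifs <;> positivity

lemma gs_jump (b : ℕ) (L : ℝ) (p a : ℝ) (hp : 1 ≤ p) (ha : 1 ≤ a) (h : gs b L a ≠ gs b L (p * a)) :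
    ∃ y ∈ (range b).image (yj b L), a ≤ y ∧ y < p * a := by
  by_contra hc
  push Not at hc
  apply h
  apply sum_congr rfl
  intro j hj
  have := hc (yj b L j) (mem_image_of_mem _ hj)
  by_cases h1 : a ≤ yj b L j
  · rw [if_pos h1, if_pos (this h1)]
  · rw [if_neg h1, if_neg]
    intro h2
    apply h1
    nlinarith

section core
variable {ι : Type} [Fintype ι] [DecidableEq ι] {P : ι → ℕ} {W ps : ℕ} {L : ℝ}

def uW (W b : ℕ) (L : ℝ) : ℝ := W.totient / W * (L / 2^b)

lemma My (h : Fam P W ps (exp L)) (hps : ps = 1 ∨ ps.Prime) (hW : 1 ≤ W) (b : ℕ) (hL : 0 ≤ L) (hu : 2 * (2 * W + 1) ≤ uW W b L) (j : ℕ) (hj : j ≤ b) :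
    2^j * uW W b L / 8 ≤ ∑ s, aR P (yj b L j) s ∧ ∑ s, aR P (yj b L j) s ≤ 2^(j+1) * uW W b L := by
  have hl : log (yj b L j) = 2^j * (L / 2^b) := log_exp _
  have h1 : 1 ≤ yj b L j := one_le_exp (by positivity)
  have h2 : yj b L j ≤ exp L := by
    refine (yj_mono b hL hj).trans (exp_le_exp.2 (le_of_eq ?_))
    field_simp
  have hU := mass_upper h hW _ h1
  have hD := mass_lower h hps hW _ h1 h2
  rw [hl] at hU hD
  have h2j : (1:ℝ) ≤ 2^j := one_le_pow₀ (by norm_num)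
  have hw : (0:ℝ) ≤ W := by positivity
  have e : (W.totient : ℝ) / W * (2^j * (L / 2^b)) = 2^j * uW W b L := by unfold uW; ring
  rw [e] at hU hD
  have h3 : uW W b L ≤ 2^j * uW W b L := le_mul_of_one_le_left (by linarith) h2j
  rw [pow_succ]
  constructor <;> linarith

lemma alpha_lower (h : Fam P W ps (exp L)) (hps : ps = 1 ∨ ps.Prime) (hW : 1 ≤ W) (b : ℕ) (hb : 2 ≤ b) (hL : 0 ≤ L) (hu : 2 * (2 * W + 1) ≤ uW W b L) :
    ((b:ℝ) - 1) * uW W b L / 16 ≤ ∑ s, Aα P (gs b L) (exp (L / 4)) s := by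
  have hR0 : ∀ s, 0 < rr P s := rr_pos (fun i => h.pos i)
  have h1 : ∀ s, ∑ j ∈ range (b - 1), (1/2:ℝ)^(j+1) * aR P (yj b L j) s ≤ Aα P (gs b L) (exp (L / 4)) s := by
    intro s
    have hy : yj b L (b - 2) = exp (L / 4) := by
      unfold yj
      congr 1
      obtain ⟨c, rfl⟩ := Nat.exists_eq_add_of_le hb
      rw [Nat.add_sub_cancel_left, pow_add]
      field_simp
      norm_num
    unfold Aα
    by_cases hs : rr P s ≤ exp (L / 4)
    · rw [if_pos hs]
      unfold gs
      rw [sum_div]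
      calc _ ≤ ∑ j ∈ range (b - 1), (if rr P s ≤ yj b L j then (1/2:ℝ)^(j+1) else 0) / rr P s := by
            apply sum_le_sum
            intro j _
            unfold aR
            by_cases h : rr P s ≤ yj b L j
            · rw [if_pos h, if_pos h, mul_one_div]
            · rw [if_neg h, if_neg h]; simp
        _ ≤ _ := by
            apply sum_le_sum_of_subset_of_nonneg (range_mono (by omega))
            intro j _ _
            have := hR0 s
            split_ifs <;> positivity
    · rw [if_neg hs]
      apply le_of_eq
      apply sum_eq_zero
      intro j hj
      unfold aR
      rw [if_neg, mul_zero]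
      intro h2
      apply hs
      rw [← hy]
      exact h2.trans (yj_mono b hL (by have := mem_range.1 hj; omega))
  refine le_trans ?_ (sum_le_sum fun s _ => h1 s)
  rw [sum_comm]
  simp only [← mul_sum]
  calc ((b:ℝ) - 1) * uW W b L / 16 = ∑ j ∈ range (b - 1), uW W b L / 16 := by
        rw [sum_const, card_range, nsmul_eq_mul, Nat.cast_sub (by omega)]; push_cast; ring
    _ ≤ _ := by
        apply sum_le_sum
        intro j hj
        have h2 := (My h hps hW b hL hu j (by have := mem_range.1 hj; omega)).1
        have h3 := mul_le_mul_of_nonneg_left h2 (by positivity : (0:ℝ) ≤ (1/2)^(j+1))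
        refine le_trans (le_of_eq ?_) h3
        rw [pow_succ, one_div, inv_pow]
        field_simp
        ring

lemma nu_le (h : Fam P W ps (exp L)) (b : ℕ) (s : Finset ι) : nu P (gs b L) s ≤ ∑ j ∈ range b, (1/4:ℝ)^j * aR P (yj b L j) s := by
  have hR0 := rr_pos (fun i => h.pos i) s
  unfold nu
  calc _ ≤ (∑ j ∈ range b, if rr P s ≤ yj b L j then (1/4:ℝ)^j else 0) / rr P s := by gcongr; exact gs_sq b L _
    _ = _ := by
      rw [sum_div]
      apply sum_congr rfl
      intro j _
      unfold aR
      by_cases h : rr P s ≤ yj b L j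
      · rw [if_pos h, if_pos h, mul_one_div]
      · rw [if_neg h, if_neg h]; simp

lemma beta_upper (h : Fam P W ps (exp L)) (hps : ps = 1 ∨ ps.Prime) (hW : 1 ≤ W) (b : ℕ) (hL : 0 ≤ L) (hu : 2 * (2 * W + 1) ≤ uW W b L) :
    ∑ s, nu P (gs b L) s ≤ 4 * uW W b L := by
  have hu0 : 0 ≤ uW W b L := le_trans (by positivity) hu
  refine (sum_le_sum fun s _ => nu_le h b s).trans ?_
  rw [sum_comm]
  simp only [← mul_sum]
  calc _ ≤ ∑ j ∈ range b, 4 * uW W b L * (1/2:ℝ)^(j+1) := by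
        apply sum_le_sum
        intro j hj
        have h2 := (My h hps hW b hL hu j (by have := mem_range.1 hj; omega)).2
        have h3 := mul_le_mul_of_nonneg_left h2 (by positivity : (0:ℝ) ≤ (1/4)^j)
        refine h3.trans (le_of_eq ?_)
        have : (1/4:ℝ)^j * 2^j = (1/2)^j := by rw [← mul_pow]; norm_num
        rw [pow_succ, pow_succ, ← this]; ring
    _ ≤ 4 * uW W b L * 1 := by
        rw [← mul_sum]
        have := geo_tail b 0
        rw [← range_eq_Ico, pow_zero] at this
        gcongr
    _ = _ := by ring

lemma beta_lower (h : Fam P W ps (exp L)) (hps : ps = 1 ∨ ps.Prime) (hW : 1 ≤ W) (b : ℕ) (hb : 1 ≤ b) (hL : 0 ≤ L) (hu : 2 * (2 * W + 1) ≤ uW W b L) :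
    uW W b L / 32 ≤ ∑ s, nu P (gs b L) s := by
  have h0 := (My h hps hW b hL hu 0 (by omega)).1
  have h1 : ∀ s, aR P (yj b L 0) s / 4 ≤ nu P (gs b L) s := by
    intro s
    have hR0 := rr_pos (fun i => h.pos i) s
    unfold aR nu
    by_cases hs : rr P s ≤ yj b L 0
    · rw [if_pos hs]
      have : (1/2:ℝ) ≤ gs b L (rr P s) := by
        have e : (1/2:ℝ) = if rr P s ≤ yj b L 0 then (1/2:ℝ)^(0+1) else 0 := by rw [if_pos hs]; norm_num
        rw [e]
        exact single_le_sum (f := fun j => if rr P s ≤ yj b L j then (1/2:ℝ)^(j+1) else 0) (fun j _ => by split_ifs <;> positivity) (mem_range.2 hb : 0 ∈ range b)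
      rw [div_div, mul_comm, ← div_div]
      gcongr
      nlinarith
    · rw [if_neg hs, zero_div]; positivity
  have h2 := sum_le_sum fun s (_ : s ∈ univ) => h1 s
  rw [← sum_div] at h2
  linarith

lemma eta_upper (h : Fam P W ps (exp L)) (hps : ps = 1 ∨ ps.Prime) (hW : 1 ≤ W) (b : ℕ) (hL : 0 ≤ L) (hu : 2 * (2 * W + 1) ≤ uW W b L) :
    ∑ s, nu P (gs b L) s * log (rr P s) ≤ 2 * b * (L / 2^b) * uW W b L := by
  have h1 : ∀ s, nu P (gs b L) s * log (rr P s) ≤ ∑ j ∈ range b, (1/4:ℝ)^j * (2^j * (L / 2^b) * aR P (yj b L j) s) := by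
    intro s
    have hR1 := one_le_rr (fun i => h.pos i) s
    refine (mul_le_mul_of_nonneg_right (nu_le h b s) (log_nonneg hR1)).trans ?_
    rw [sum_mul]
    apply sum_le_sum
    intro j _
    rw [mul_assoc]
    apply mul_le_mul_of_nonneg_left _ (by positivity)
    rw [mul_comm]
    unfold aR
    by_cases hs : rr P s ≤ yj b L j
    · rw [if_pos hs]
      apply mul_le_mul_of_nonneg_right _ (by positivity)
      rw [log_le_iff_le_exp (by linarith)]
      exact hs
    · rw [if_neg hs]; simp
  refine (sum_le_sum fun s _ => h1 s).trans ?_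
  rw [sum_comm]
  simp only [← mul_sum]
  calc _ ≤ ∑ j ∈ range b, 2 * (L / 2^b) * uW W b L := by
        apply sum_le_sum
        intro j hj
        have h2 := (My h hps hW b hL hu j (by have := mem_range.1 hj; omega)).2
        calc _ ≤ (1/4:ℝ)^j * (2^j * (L / 2^b) * (2^(j+1) * uW W b L)) := by gcongr
          _ = ((1/4:ℝ)^j * 2^j * 2^j) * (2 * (L / 2^b) * uW W b L) := by rw [pow_succ]; ring
          _ = _ := by rw [← mul_pow, ← mul_pow]; norm_num
    _ = _ := by rw [sum_const, card_range, nsmul_eq_mul]; ring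

end core

section core
variable {ι J : Type} [Fintype ι] [DecidableEq ι] [Fintype J] [DecidableEq J]
variable {P : ι → ℕ} {W ps : ℕ} {R : ℝ}

open Classical in
def om (P : ι → ℕ) (bb : J → ℕ) (n : ℕ) : ι → Option J := fun i =>
  if hx : ∃ j, P i ∣ n + bb j then some hx.choose else none

def Sep (P : ι → ℕ) (bb : J → ℕ) : Prop := ∀ i n j l, P i ∣ n + bb j → P i ∣ n + bb l → j = l

lemma om_iff {bb : J → ℕ} (hS : Sep P bb) (n : ℕ) (i : ι) (j : J) : om P bb n i = some j ↔ P i ∣ n + bb j := by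
  unfold om
  by_cases hx : ∃ j, P i ∣ n + bb j
  · rw [dif_pos hx, Option.some_inj]
    constructor
    · rintro rfl; exact hx.choose_spec
    · intro h; exact hS i n _ _ hx.choose_spec h
  · rw [dif_neg hx]
    simp only [reduceCtorEq, false_iff]
    exact fun h => hx ⟨j, h⟩

lemma ctn_iff {bb : J → ℕ} (hS : Sep P bb) (n : ℕ) (e : ι → Option J) :
    ctn (om P bb n) e ↔ ∀ i ∈ spt e, P i ∣ n + (e i).elim 0 bb := by
  unfold ctn
  apply forall_congr'
  intro i
  rw [mem_spt]
  rcases he : e i with _ | j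
  · simp
  · simp [om_iff hS]

lemma dvd_add_iff_modEq (p n c : ℕ) (hp : 0 < p) : p ∣ n + c ↔ n ≡ (p - 1) * c [MOD p] := by
  obtain ⟨q, rfl⟩ := Nat.exists_eq_add_of_le' hp
  rw [Nat.add_sub_cancel]
  have : (q + 1) ∣ n + c ↔ n + c ≡ q * c + c [MOD (q + 1)] := by
    rw [← Nat.modEq_zero_iff_dvd]
    have h0 : q * c + c ≡ 0 [MOD (q + 1)] := (Nat.modEq_zero_iff_dvd).2 ⟨c, by ring⟩
    exact ⟨fun h => h.trans h0.symm, fun h => h.trans h0⟩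
  rw [this]
  exact ⟨fun h => Nat.ModEq.add_right_cancel' c h, fun h => h.add_right c⟩

lemma crt2 (m n : ℕ) (h : m.Coprime n) (a b : ℕ) : ∃ c, ∀ x, (x ≡ a [MOD m] ∧ x ≡ b [MOD n]) ↔ x ≡ c [MOD m * n] := by
  obtain ⟨c, h1, h2⟩ := Nat.chineseRemainder h a b
  refine ⟨c, fun x => ?_⟩
  rw [← Nat.modEq_and_modEq_iff_modEq_mul h]
  exact ⟨fun ⟨x1, x2⟩ => ⟨x1.trans h1.symm, x2.trans h2.symm⟩, fun ⟨x1, x2⟩ => ⟨x1.trans h1, x2.trans h2⟩⟩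

lemma crt_fam (hF : Fam P W ps R) (Q v : ℕ) (hQ : ∀ i, ¬ P i ∣ Q) (c : ι → ℕ) (s : Finset ι) :
    ∃ a, ∀ n, (n ≡ v [MOD Q] ∧ ∀ i ∈ s, P i ∣ n + c i) ↔ n ≡ a [MOD Q * nn P s] := by
  induction s using Finset.induction_on with
  | empty => exact ⟨v, fun n => by simp [nn]⟩
  | insert i s hi ih =>
    obtain ⟨a, ha⟩ := ih
    have e : nn P (insert i s) = P i * nn P s := prod_insert hi
    have hc : (Q * nn P s).Coprime (P i) := by
      apply Nat.Coprime.symm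
      rw [Nat.Prime.coprime_iff_not_dvd (hF.pr i), (hF.pr i).dvd_mul, dvd_nn hF s _ (hF.pr i)]
      rintro (h | ⟨j, hj, hij⟩)
      · exact hQ i h
      · exact hi (hF.inj hij ▸ hj)
    obtain ⟨c', hc'⟩ := crt2 _ _ hc a ((P i - 1) * c i)
    refine ⟨c', fun n => ?_⟩
    rw [e, mul_comm (P i), ← mul_assoc, ← hc' n, ← ha n, forall_mem_insert, ← dvd_add_iff_modEq _ _ _ (hF.pos i)]
    tauto

lemma w1_sum (i : ι) : ∑ s, w1 J P i s = 1 := by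
  rw [sum_option]
  simp [w1]
  rw [div_eq_mul_inv]; ring

lemma w2_sum (hP : 1 < P i) (j0 : J) : ∑ s, w2 P j0 i s = 1 := by
  have h1 : (1:ℝ) < P i := by exact_mod_cast hP
  have h2 : (P i : ℝ) - 1 ≠ 0 := by linarith
  rw [sum_option]
  simp only [w2, reduceCtorEq, if_false, if_true, Option.some_inj]
  have : ∑ x : J, (if x = j0 then (0:ℝ) else 1 / (P i - 1)) = ((Fintype.card J : ℝ) - 1) * (1 / (P i - 1)) := by
    rw [← add_sum_erase _ _ (mem_univ j0), if_pos rfl, zero_add, sum_congr rfl (fun x hx => if_neg (ne_of_mem_erase hx)),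
      sum_const, card_erase_of_mem (mem_univ _), nsmul_eq_mul,
      card_univ, Nat.cast_sub (Fintype.card_pos_iff.2 ⟨j0⟩)]
    push_cast; rfl
  rw [this]
  field_simp
  ring

lemma wt_w1 (e : ι → Option J) : wt (w1 J P) e = 1 / nn P (spt e) := by
  unfold wt nn spt
  push_cast
  rw [one_div, ← prod_inv_distrib, prod_filter]
  refine prod_congr rfl fun i _ => ?_
  by_cases h : e i = none
  · simp [h]
  · simp [h, w1]

lemma wt_w2 (hF : Fam P W ps R) (j0 : J) (e : ι → Option J) (he : ∀ i, e i ≠ some j0) : wt (w2 P j0) e = 1 / (nn P (spt e)).totient := by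
  have : ∀ s : Finset ι, ((nn P s).totient : ℝ) = ∏ i ∈ s, ((P i : ℝ) - 1) := by
    intro s
    induction s using Finset.induction_on with
    | empty => simp [nn]
    | insert i s hi ih =>
      have e : nn P (insert i s) = P i * nn P s := prod_insert hi
      have hc : (P i).Coprime (nn P s) := (Nat.Prime.coprime_iff_not_dvd (hF.pr i)).2 (fun hd => by
        obtain ⟨j, hj, hij⟩ := (dvd_nn hF s _ (hF.pr i)).1 hd
        exact hi (hF.inj hij ▸ hj))
      rw [e, Nat.totient_mul hc, prod_insert hi, Nat.totient_prime (hF.pr i), Nat.cast_mul, ih, Nat.cast_sub (hF.pos i)]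
      push_cast; rfl
  rw [this]
  unfold wt spt
  rw [one_div, ← prod_inv_distrib, prod_filter]
  refine prod_congr rfl fun i _ => ?_
  by_cases h : e i = none
  · simp [h]
  · simp [h, w2, he i]

lemma S1_transfer (hF : Fam P W ps R) {bb : J → ℕ} (hS : Sep P bb) (Q v : ℕ) (hQ1 : 1 ≤ Q) (hQ : ∀ i, ¬ P i ∣ Q) (X0 X1 : ℕ) (h0 : 1 ≤ X0) (h01 : X0 ≤ X1)
    (g : ℝ → ℝ) (hg0 : ∀ x, 0 ≤ g x) (hg1 : ∀ x, g x ≤ 1) (hR : 0 ≤ R) (e0 : ι → Option J) :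
    |∑ n ∈ (Ico X0 X1).filter (fun n => n ≡ v [MOD Q]), 1 / (n:ℝ) * (ind (om P bb n) e0 * (GG P g R (om P bb n))^2)
      - 1 / Q * (∑ n ∈ Ico X0 X1, 1 / (n:ℝ)) * ∑ o : ι → Option J, (∏ i, w1 J P i (o i)) * (ind o e0 * (GG P g R o)^2)| ≤
      ((∑ s, aR P R s)^(Fintype.card J))^2 * ∑ s ∈ univ.filter (fun s => rr P s ≤ R^2 * rr P (spt e0)), ((Fintype.card J : ℝ) + 1)^(2 * s.card) * (2 * (Q * nn P s : ℕ) / X0) := by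
  apply transfer _ _ _ _ w1_sum _ P hF.pos g hg0 hg1 R hR e0 (fun s => 2 * (Q * nn P s : ℕ) / X0) (fun s => by positivity)
  intro e _
  obtain ⟨a, ha⟩ := crt_fam hF Q v hQ (fun i => (e i).elim 0 bb) (spt e)
  have h1 := ap_sum (Q * nn P (spt e)) a (Nat.mul_pos hQ1 (nn_pos hF _)) X0 X1 h0 h01
  have e1 : ∑ n ∈ (Ico X0 X1).filter (fun n => n ≡ v [MOD Q]), 1 / (n:ℝ) * ind (om P bb n) e =
      ∑ n ∈ (Ico X0 X1).filter (fun n => n ≡ a [MOD Q * nn P (spt e)]), 1 / (n:ℝ) := by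
    rw [sum_filter, sum_filter]
    refine sum_congr rfl fun n _ => ?_
    have h2 := ha n
    rw [← ctn_iff hS n e] at h2
    unfold ind
    by_cases h3 : n ≡ v [MOD Q]
    · by_cases h4 : ctn (om P bb n) e
      · rw [if_pos h3, if_pos h4, if_pos (h2.1 ⟨h3, h4⟩), mul_one]
      · rw [if_pos h3, if_neg h4, if_neg (fun h => h4 (h2.2 h).2), mul_zero]
    · rw [if_neg h3, if_neg (fun h => h3 (h2.2 h).1)]
  rw [e1, wt_w1]
  refine le_trans (le_of_eq ?_) h1
  congr 2
  push_cast
  rw [← one_div_mul_one_div]; ring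

lemma S2_transfer (hF : Fam P W ps R) {bb : J → ℕ} (hS : Sep P bb) (v : ℕ) (hW : 1 ≤ W) (j0 : J) (hb : 1 ≤ bb j0) (hv : (v + bb j0).Coprime W)
    (L : ℝ) (hL : 1 ≤ L) (X0 : ℕ) (hX0 : (X0 : ℝ) + bb j0 ≤ exp L)
    (hRL : R ≤ exp L) (hR2 : R^2 ≤ exp (L/64))
    (g : ℝ → ℝ) (hg0 : ∀ x, 0 ≤ g x) (hg1 : ∀ x, g x ≤ 1) (hR : 0 ≤ R) (hps : ps = 1 ∨ (ps.Prime ∧ ¬ ps ∣ W)) (Bd : ℕ → ℝ)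
    (hBd0 : ∀ d ∈ dset W ps L, 0 ≤ Bd d) (k : ℕ) (hk : ((Fintype.card J : ℝ) + 1)^2 ≤ 2^k) (A : ℕ) (hBd1 : ∑ d ∈ dset W ps L, (d.divisors.card : ℝ)^k * Bd d ≤ 1 / L^A)
    (hBd : ∀ d ∈ dset W ps L, ∀ a : ℕ, a.Coprime (W*d) →
      |∑ p ∈ (range (NN L)).filter (fun n => n.Prime ∧ n ≡ a [MOD (W*d)]), log p * hw L p - Main L / (W*d).totient| ≤ Bd d) :
    |∑ n ∈ (Ico X0 (NN L)).filter (fun n => n ≡ v [MOD W]), (if (n + bb j0).Prime then log (n + bb j0 : ℕ) * hw L (n + bb j0 : ℕ) else 0) * (GG P g R (om P bb n))^2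
      - Main L / W.totient * ∑ o : ι → Option J, (∏ i, w2 P j0 i (o i)) * (GG P g R o)^2| ≤
      ((∑ s, aR P R s)^(Fintype.card J))^2 * (1 / L^A) := by
  have hmem : ∀ s, rr P s ≤ R^2 → nn P s ∈ dset W ps L := by
    intro s hs
    unfold dset DD
    rw [mem_filter, mem_Icc]
    rw [rr_nn] at hs
    refine ⟨⟨nn_pos hF s, Nat.le_floor (hs.trans hR2)⟩, nn_coprime hF s _ fun i hd => ?_⟩
    rcases ((hF.pr i).dvd_mul).1 hd with h | h
    · exact hF.ndvd i h
    · rcases hps with h1 | ⟨h1, _⟩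
      · rw [h1] at h; exact (hF.pr i).one_lt.ne' (Nat.dvd_one.1 h)
      · exact hF.ne i ((prime_dvd_prime_iff_eq (hF.pr i) h1).1 h)
  have hi0 : ∀ o : ι → Option J, ind o (fun _ => none) = 1 := fun o => if_pos (fun i => Or.inl rfl)
  have hs0 : rr P (spt (fun _ : ι => (none : Option J))) = 1 := by simp [spt, rr]
  have key := transfer ((Ico X0 (NN L)).filter (fun n => n ≡ v [MOD W])) (fun n => if (n + bb j0).Prime then log (n + bb j0 : ℕ) * hw L (n + bb j0 : ℕ) else 0)
    (om P bb) (w2 P j0) (fun i => w2_sum (hF.pr i).one_lt j0) (Main L / W.totient) P hF.pos g hg0 hg1 R hR (fun _ => none)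
    (fun s => if rr P s ≤ R^2 then Bd (nn P s) else 0) (fun s => by
      by_cases h : rr P s ≤ R^2
      · rw [if_pos h]; exact hBd0 _ (hmem s h)
      · rw [if_neg h])
  rw [hs0, mul_one] at key
  simp only [hi0, one_mul] at key
  refine (key ?_).trans ?_
  · intro e he
    rw [if_pos he]
    by_cases hj : ∃ i, e i = some j0
    · obtain ⟨i, hi⟩ := hj
      have hw0 : wt (w2 P j0) e = 0 := by
        apply prod_eq_zero (mem_univ i)
        simp [hi, w2]
      rw [hw0, mul_zero, sub_zero, sum_eq_zero]
      · rw [abs_zero]; exact hBd0 _ (hmem _ he)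
      · intro n _
        by_cases hp : (n + bb j0).Prime
        · by_cases hc : ctn (om P bb n) e
          · have h1 := (ctn_iff hS n e).1 hc i (by rw [mem_spt, hi]; simp)
            rw [hi] at h1
            have h2 := (prime_dvd_prime_iff_eq (hF.pr i) hp).1 h1
            have h3 : hw L (n + bb j0 : ℕ) = 0 := by
              rw [← h2]
              exact hw_zero_left (by linarith) (by positivity) ((hF.le i).trans hRL)
            rw [h3]; simp
          · rw [ind, if_neg hc, mul_zero]
        · rw [if_neg hp, zero_mul]
    · push Not at hj
      obtain ⟨a, ha⟩ := crt_fam hF W v hF.ndvd (fun i => (e i).elim 0 bb) (spt e)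
      have haa := (ha a).2 rfl
      have hco : (a + bb j0).Coprime (W * nn P (spt e)) := by
        apply Nat.Coprime.mul_right
        · have := (haa.1.add_right (bb j0)).gcd_eq
          unfold Nat.Coprime at hv ⊢
          rw [this, hv]
        · apply Nat.Coprime.prod_right
          intro i hi
          apply Nat.Coprime.symm
          rw [Nat.Prime.coprime_iff_not_dvd (hF.pr i)]
          intro hd
          have h1 := haa.2 i hi
          rw [mem_spt] at hi
          rcases he2 : e i with _ | l
          · exact hi he2
          · rw [he2] at h1
            exact hj i (by rw [he2, hS i a l j0 h1 hd])
      have h2 := hBd _ (hmem _ he) _ hco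
      rw [wt_w2 hF j0 e hj]
      have h3 : Main L / W.totient * (1 / (nn P (spt e)).totient) = Main L / (W * nn P (spt e)).totient := by
        rw [Nat.totient_mul (nn_coprime hF _ W hF.ndvd).symm]
        push_cast
        rw [div_mul_div_comm, mul_one]
      rw [h3]
      refine le_trans (le_of_eq ?_) h2
      congr 2
      have hin : ∀ n, (n + bb j0 ≡ a + bb j0 [MOD W * nn P (spt e)]) ↔ (n ≡ v [MOD W] ∧ ctn (om P bb n) e) := by
        intro n
        rw [ctn_iff hS n e, ha n]
        exact ⟨fun h => Nat.ModEq.add_right_cancel' _ h, fun h => h.add_right _⟩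
      rw [sum_filter, sum_filter]
      have hz : ∀ p ∈ range (NN L), p ∉ Ico (X0 + bb j0) (NN L) → (if p.Prime ∧ p ≡ a + bb j0 [MOD W * nn P (spt e)] then log p * hw L p else 0) = 0 := by
        intro p hp hp2
        have h4 : p < X0 + bb j0 := by
          by_contra hc
          exact hp2 (mem_Ico.2 ⟨by omega, mem_range.1 hp⟩)
        have h5 : (p:ℝ) ≤ X0 + bb j0 := by exact_mod_cast h4.le
        rw [hw_zero_left (by linarith) (by positivity) (h5.trans hX0)]
        simp
      rw [← sum_subset (fun p hp => mem_range.2 (mem_Ico.1 hp).2) hz]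
      have hz2 : ∀ p ∈ Ico (X0 + bb j0) (NN L + bb j0), p ∉ Ico (X0 + bb j0) (NN L) → (if p.Prime ∧ p ≡ a + bb j0 [MOD W * nn P (spt e)] then log p * hw L p else 0) = 0 := by
        intro p hp hp2
        rw [mem_Ico] at hp hp2
        rw [hw_NN_zero L hL p (by omega)]
        simp
      rw [sum_subset (Ico_subset_Ico_right (by omega)) hz2, ← sum_Ico_add' (fun p => if p.Prime ∧ p ≡ a + bb j0 [MOD W * nn P (spt e)] then log p * hw L p else 0)]
      refine sum_congr rfl fun n _ => ?_
      simp only [hin n]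
      unfold ind
      by_cases h3 : n ≡ v [MOD W] <;> by_cases h4 : ctn (om P bb n) e <;> by_cases h5 : (n + bb j0).Prime <;> simp [h3, h4, h5]
  · apply mul_le_mul_of_nonneg_left _ (by positivity)
    refine le_trans ?_ hBd1
    apply sum_inj _ _ (nn P) ((nn_inj hF).injOn)
    · intro s hs
      exact hmem s (mem_filter.1 hs).2
    · intro d hd
      exact mul_nonneg (by positivity) (hBd0 d hd)
    · intro s hs
      have hs2 := (mem_filter.1 hs).2
      rw [if_pos hs2, nn_tau hF]
      apply mul_le_mul_of_nonneg_right _ (hBd0 _ (hmem s hs2))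
      push_cast
      rw [pow_mul, pow_right_comm (2:ℝ)]
      gcongr

end core

open ArithmeticFunction hiding log in
lemma logp_sum (N : ℕ) : ∑ p ∈ (Ioc 0 N).filter Nat.Prime, log p / p ≤ 2 * log N := by
  rcases N.eq_zero_or_pos with rfl | hN
  · simp
  have hN0 : (0:ℝ) < N := by exact_mod_cast hN
  have h1 := sum_Ioc_mul_zeta_eq_sum vonMangoldt N
  rw [vonMangoldt_mul_zeta] at h1
  have h2 : ∑ n ∈ Ioc 0 N, ArithmeticFunction.log n ≤ N * log N := by
    calc _ ≤ ∑ n ∈ Ioc 0 N, log N := sum_le_sum fun n hn => by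
          rw [mem_Ioc] at hn
          rw [log_apply]
          exact log_le_log (by exact_mod_cast hn.1) (by exact_mod_cast hn.2)
      _ = _ := by simp
  have h3 : N * ∑ p ∈ (Ioc 0 N).filter Nat.Prime, log p / p ≤ 2 * ∑ n ∈ Ioc 0 N, vonMangoldt n * (N / n : ℕ) := by
    rw [mul_sum, mul_sum, sum_filter]
    apply sum_le_sum
    intro p hp
    rw [mem_Ioc] at hp
    have hp0 : (0:ℝ) < p := by exact_mod_cast hp.1
    by_cases hpr : p.Prime
    · rw [if_pos hpr, vonMangoldt_apply_prime hpr]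
      have hq : 1 ≤ N / p := (Nat.one_le_div_iff hp.1).2 hp.2
      have h4 : N < p * (N / p) + p := by
        have := Nat.div_add_mod N p
        have := Nat.mod_lt N hp.1
        omega
      have h5 : N ≤ 2 * (p * (N / p)) := by nlinarith
      have h6 : (N:ℝ) ≤ 2 * (p * (N / p : ℕ)) := by exact_mod_cast h5
      have hl : 0 ≤ log p := log_nonneg (by exact_mod_cast hp.1)
      rw [mul_div_assoc', div_le_iff₀ hp0]
      nlinarith
    · rw [if_neg hpr]
      have := vonMangoldt_nonneg (n := p)
      positivity
  rw [← h1] at h3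
  have h4 : N * ∑ p ∈ (Ioc 0 N).filter Nat.Prime, log p / p ≤ N * (2 * log N) := by linarith
  exact le_of_mul_le_mul_left h4 hN0

section core
variable {ι J : Type} [Fintype ι] [DecidableEq ι] [Fintype J] [DecidableEq J]
variable {P : ι → ℕ} {W ps : ℕ} {R : ℝ}

lemma fam_logp (hF : Fam P W ps R) (z : ℝ) (hz : 1 ≤ z) : ∑ i ∈ univ.filter (fun i => (P i : ℝ) ≤ z), log (P i) / P i ≤ 2 * log z := by
  have h1 : ∑ i ∈ univ.filter (fun i => (P i : ℝ) ≤ z), log (P i) / P i ≤ ∑ p ∈ (Ioc 0 ⌊z⌋₊).filter Nat.Prime, log p / p := by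
    apply sum_inj _ _ P hF.inj.injOn
    · intro i hi
      rw [mem_filter, mem_Ioc]
      exact ⟨⟨hF.pos i, Nat.le_floor (mem_filter.1 hi).2⟩, hF.pr i⟩
    · intro p hp
      have : 0 ≤ log p := log_natCast_nonneg p
      positivity
    · intro i _; exact le_refl _
  refine h1.trans ((logp_sum _).trans ?_)
  gcongr
  · exact_mod_cast Nat.floor_pos.2 hz
  · exact floor_le (by linarith)

lemma fam_sq (hF : Fam P W ps R) (D0 : ℕ) (hD : 1 ≤ D0) (hP : ∀ i, D0 < P i) : ∑ i, 1 / (P i : ℝ)^2 ≤ (2:ℝ) / D0 := by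
  have h1 : ∑ i, 1 / (P i : ℝ)^2 ≤ ∑ p ∈ Ioo D0 (∑ i, P i + 1), ((p:ℝ)^2)⁻¹ := by
    apply sum_inj _ _ P hF.inj.injOn
    · intro i hi
      rw [mem_Ioo]
      exact ⟨hP i, Nat.lt_succ_of_le (single_le_sum (f := P) (fun _ _ => Nat.zero_le _) hi)⟩
    · intro p _; positivity
    · intro i _; rw [one_div]
  refine h1.trans ((sum_Ioo_inv_sq_le D0 _).trans ?_)
  have : (0:ℝ) < D0 := by exact_mod_cast hD
  gcongr
  linarith

lemma fam_inv (hF : Fam P W ps R) (z C δ : ℝ) (hz : 1 ≤ z) (hC : 0 ≤ C) (hδ : 0 < δ) :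
    ∑ i ∈ univ.filter (fun i => (P i : ℝ) ≤ z), C / P i ≤ 2 * δ * log z + C * exp (C / δ) := by
  have h1 : ∀ i, C / P i ≤ δ * (log (P i) / P i) + if (P i : ℝ) ≤ exp (C / δ) then C else 0 := by
    intro i
    have hp : (1:ℝ) ≤ P i := by exact_mod_cast hF.pos i
    have hl := log_nonneg hp
    by_cases h : (P i : ℝ) ≤ exp (C / δ)
    · rw [if_pos h]
      have : C / P i ≤ C := div_le_self hC hp
      have : 0 ≤ δ * (log (P i) / P i) := by positivity
      linarith
    · rw [if_neg h, add_zero, mul_div_assoc']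
      gcongr
      rw [← div_le_iff₀' hδ, le_log_iff_exp_le (by linarith)]
      exact (not_le.1 h).le
  refine (sum_le_sum fun i _ => h1 i).trans ?_
  rw [sum_add_distrib, ← mul_sum]
  have h2 := fam_logp hF z hz
  have h3 : ∑ i ∈ univ.filter (fun i => (P i : ℝ) ≤ z), (if (P i : ℝ) ≤ exp (C / δ) then C else 0) ≤ C * exp (C / δ) := by
    have h4 : ∑ i ∈ univ.filter (fun i => (P i : ℝ) ≤ z), (if (P i : ℝ) ≤ exp (C / δ) then C else 0) ≤ ∑ p ∈ Icc 1 ⌊exp (C / δ)⌋₊, C := by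
      rw [← sum_filter]
      apply sum_inj _ _ P hF.inj.injOn
      · intro i hi
        rw [mem_Icc]
        exact ⟨hF.pos i, Nat.le_floor (mem_filter.1 hi).2⟩
      · intro _ _; exact hC
      · intro _ _; exact le_refl _
    refine h4.trans ?_
    rw [sum_const, Nat.card_Icc, nsmul_eq_mul, mul_comm, Nat.add_sub_cancel]
    gcongr
    exact floor_le (exp_pos _).le
  nlinarith

lemma err_sum (hF : Fam P W ps R) (k : ℕ) (hk : ((Fintype.card J : ℝ) + 1)^2 ≤ 2^k) (C : ℝ) (hC : 1 ≤ C)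
    (hCk : ∀ n : ℕ, n ≠ 0 → (n.divisors.card : ℝ)^k ≤ C * sqrt n) (Y Y' : ℝ) (hY : 1 ≤ Y) (hY' : Y' ≤ Y) (Q X0 : ℕ) :
    ∑ s ∈ univ.filter (fun s => rr P s ≤ Y'), ((Fintype.card J : ℝ) + 1)^(2 * s.card) * (2 * (Q * nn P s : ℕ) / X0) ≤ 2 * C * Q * Y^3 / X0 := by
  have h1 : ∑ s ∈ univ.filter (fun s => rr P s ≤ Y'), ((Fintype.card J : ℝ) + 1)^(2 * s.card) * (2 * (Q * nn P s : ℕ) / X0) ≤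
      ∑ d ∈ Icc 1 ⌊Y⌋₊, (C * Y) * (2 * (Q * Y) / X0) := by
    apply sum_inj _ _ (nn P) ((nn_inj hF).injOn)
    · intro s hs
      have := (mem_filter.1 hs).2
      rw [rr_nn] at this
      rw [mem_Icc]
      exact ⟨nn_pos hF s, Nat.le_floor (this.trans hY')⟩
    · intro _ _; positivity
    · intro s hs
      have h2 := (mem_filter.1 hs).2.trans hY'
      rw [rr_nn] at h2
      have h3 := hCk (nn P s) (nn_pos hF s).ne'
      rw [nn_tau hF] at h3
      have h4 : ((Fintype.card J : ℝ) + 1)^(2 * s.card) ≤ C * Y := by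
        calc ((Fintype.card J : ℝ) + 1)^(2 * s.card) ≤ ((2 ^ s.card : ℕ):ℝ)^k := by
              push_cast
              rw [pow_mul, pow_right_comm (2:ℝ)]
              gcongr
          _ ≤ C * sqrt (nn P s) := h3
          _ ≤ C * Y := by
              gcongr
              rw [Real.sqrt_le_left (by linarith)]
              nlinarith
      push_cast
      gcongr
  refine h1.trans ?_
  rw [sum_const, Nat.card_Icc, nsmul_eq_mul, Nat.add_sub_cancel]
  have := floor_le (by linarith : 0 ≤ Y)
  calc _ ≤ Y * (C * Y * (2 * (Q * Y) / X0)) := by gcongr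
    _ = _ := by ring

end core

section core
variable {ι J : Type} [Fintype ι] [DecidableEq ι] [Fintype J] [DecidableEq J]
variable {P : ι → ℕ} {W ps : ℕ} {L : ℝ}

def EE (M : ℝ) (m : ℕ) (C R : ℝ) (Q X0 : ℕ) : ℝ := (M^m)^2 * (2 * C * Q * (R^3)^3 / X0)

lemma yj_top (b : ℕ) (L : ℝ) : yj b L b = exp L := by
  unfold yj; congr 1; field_simp

lemma s1_up (hF : Fam P W ps (exp L)) (hL : 0 ≤ L) {bb : J → ℕ} (hS : Sep P bb) (hm : ∀ i, Fintype.card J < P i)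
    (k : ℕ) (hk : ((Fintype.card J : ℝ) + 1)^2 ≤ 2^k) (C : ℝ) (hC : 1 ≤ C) (hCk : ∀ n : ℕ, n ≠ 0 → (n.divisors.card : ℝ)^k ≤ C * sqrt n)
    (b Q v : ℕ) (hQ1 : 1 ≤ Q) (hQ : ∀ i, ¬ P i ∣ Q) (X0 X1 : ℕ) (h0 : 1 ≤ X0) (h01 : X0 ≤ X1) :
    ∑ n ∈ (Ico X0 X1).filter (fun n => n ≡ v [MOD Q]), 1 / (n:ℝ) * (GG P (gs b L) (exp L) (om P bb n))^2 ≤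
      1 / Q * (∑ n ∈ Ico X0 X1, 1 / (n:ℝ)) * (∑ s, nu P (gs b L) s)^(Fintype.card J) + EE (∑ s, aR P (exp L) s) (Fintype.card J) C (exp L) Q X0 := by
  have hR1 : 1 ≤ exp L := one_le_exp hL
  have h1 := S1_transfer hF hS Q v hQ1 hQ X0 X1 h0 h01 (gs b L) (gs_nonneg b L) (gs_le_one b L) (exp_pos L).le (fun _ => none)
  have hi0 : ∀ o : ι → Option J, ind o (fun _ => none) = 1 := fun o => if_pos (fun i => Or.inl rfl)
  have hs0 : rr P (spt (fun _ : ι => (none : Option J))) = 1 := by simp [spt, rr]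
  simp only [hi0, one_mul, hs0, mul_one] at h1
  have h2 := err_sum (J := J) hF k hk C hC hCk (exp L ^ 3) (exp L ^ 2) (one_le_pow₀ hR1) (pow_le_pow_right₀ hR1 (by norm_num)) Q X0
  have h3 := S1_bound P hm (gs b L) (exp L)
  have h4 : ∑ s, (gs b L (rr P s))^2 / rr P s = ∑ s, nu P (gs b L) s := rfl
  rw [h4] at h3
  have h5 := (abs_le.1 h1).2
  have hH : 0 ≤ 1 / (Q:ℝ) * (∑ n ∈ Ico X0 X1, 1 / (n:ℝ)) := by positivity
  have h6 := mul_le_mul_of_nonneg_left h3 hH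
  have h7 := mul_le_mul_of_nonneg_left h2 (by positivity : 0 ≤ ((∑ s, aR P (exp L) s)^(Fintype.card J))^2)
  unfold EE
  linarith

lemma bad_up (hF : Fam P W ps (exp L)) (hL : 0 ≤ L) (hW : 1 ≤ W) {bb : J → ℕ} (hS : Sep P bb) (hm : ∀ i, Fintype.card J < P i)
    (k : ℕ) (hk : ((Fintype.card J : ℝ) + 1)^2 ≤ 2^k) (C : ℝ) (hC : 1 ≤ C) (hCk : ∀ n : ℕ, n ≠ 0 → (n.divisors.card : ℝ)^k ≤ C * sqrt n)
    (b v : ℕ) (X0 X1 : ℕ) (h0 : 1 ≤ X0) (h01 : X0 ≤ X1) (i0 : ι) (j0 : J) (M : ℝ) (hM : ∑ s, aR P (exp L) s ≤ M) :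
    ∑ n ∈ (Ico X0 X1).filter (fun n => n ≡ v [MOD W]), 1 / (n:ℝ) * (if P i0 ∣ n + bb j0 then (GG P (gs b L) (exp L) (om P bb n))^2 else 0) ≤
      1 / W * (∑ n ∈ Ico X0 X1, 1 / (n:ℝ)) * (1 / P i0 * (M^(Fintype.card J - 1) * (2 * ((b + 1) * (W.totient / W * log (P i0) + 2 * (2 * W + 1))) + 2 * (Fintype.card J / P i0)^2 * M)))
       + EE (∑ s, aR P (exp L) s) (Fintype.card J) C (exp L) W X0 := by
  have hR1 : 1 ≤ exp L := one_le_exp hL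
  have hp1 : (1:ℝ) ≤ P i0 := by exact_mod_cast hF.pos i0
  set e0 : ι → Option J := update (fun _ => none) i0 (some j0) with he0
  have h1 := S1_transfer hF hS W v hW hF.ndvd X0 X1 h0 h01 (gs b L) (gs_nonneg b L) (gs_le_one b L) (exp_pos L).le e0
  have hsp : spt e0 = {i0} := by
    ext i
    rw [mem_spt, he0, mem_singleton]
    by_cases h : i = i0
    · subst h; simp
    · simp [h]
  have hi0 : ∀ o : ι → Option J, ind o e0 = if o i0 = some j0 then 1 else 0 := by
    intro o
    unfold ind ctn
    congr 1
    rw [eq_iff_iff]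
    constructor
    · intro h
      have := h i0
      simpa [he0] using this
    · intro h i
      by_cases hi : i = i0
      · subst hi; right; simp [he0, h]
      · left; simp [he0, hi]
  have hs0 : rr P (spt e0) = P i0 := by rw [hsp]; simp [rr]
  have e1 : ∀ n, ind (om P bb n) e0 * (GG P (gs b L) (exp L) (om P bb n))^2 = if P i0 ∣ n + bb j0 then (GG P (gs b L) (exp L) (om P bb n))^2 else 0 := by
    intro n
    rw [hi0, ite_mul, one_mul, zero_mul]
    simp only [om_iff hS]
  have e2 : ∀ o : ι → Option J, ind o e0 * (GG P (gs b L) (exp L) o)^2 = if o i0 = some j0 then (GG P (gs b L) (exp L) o)^2 else 0 := by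
    intro o
    rw [hi0, ite_mul, one_mul, zero_mul]
  simp only [e1, e2, hs0] at h1
  have h2 := err_sum (J := J) hF k hk C hC hCk (exp L ^ 3) (exp L ^ 2 * P i0) (one_le_pow₀ hR1) (by
    rw [pow_succ (exp L) 2]
    exact mul_le_mul_of_nonneg_left (hF.le i0) (by positivity)) W X0
  have hM0 : 0 ≤ M := le_trans (sum_nonneg fun s _ => aR_nonneg hF.pos _ s) hM
  have h3 := SB_bound P hm (gs b L) (exp L) i0 j0 (gs_nonneg b L) (gs_le_one b L) ((range b).image (yj b L))
    (fun a ha hne => gs_jump b L (P i0) a hp1 ha hne) _ M (fun y => lay_upper hF hW (P i0) y hp1) hM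
  have hcard : (((range b).image (yj b L)).card : ℝ) ≤ b := by exact_mod_cast (card_image_le).trans (by simp)
  have hl := log_nonneg hp1
  have h3b := h3.trans (show _ ≤ 1 / (P i0 : ℝ) * (M^(Fintype.card J - 1) * (2 * ((b + 1) * (W.totient / W * log (P i0) + 2 * (2 * W + 1))) + 2 * (Fintype.card J / P i0)^2 * M)) by gcongr)
  have h5 := (abs_le.1 h1).2
  have hH : 0 ≤ 1 / (W:ℝ) * (∑ n ∈ Ico X0 X1, 1 / (n:ℝ)) := by positivity
  have h6 := mul_le_mul_of_nonneg_left h3b hH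
  have h7 := mul_le_mul_of_nonneg_left h2 (by positivity : 0 ≤ ((∑ s, aR P (exp L) s)^(Fintype.card J))^2)
  unfold EE
  linarith

/-- Sum of the main terms of the bad contributions over all primes up to `z`. -/
lemma bad_sum (hF : Fam P W ps (exp L)) (hW : 1 ≤ W) (z : ℝ) (hz : 1 ≤ z) (D0 b m' : ℕ) (hD : 1 ≤ D0) (hP : ∀ i, D0 < P i) (M m : ℝ) (hM : 0 ≤ M) :
    ∑ i ∈ univ.filter (fun i => (P i : ℝ) ≤ z), (1 / (P i : ℝ) * (M^m' * (2 * ((b + 1) * (W.totient / W * log (P i) + 2 * (2 * W + 1))) + 2 * (m / P i)^2 * M))) ≤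
      M^m' * (2 * (b + 1) * (4 * (W.totient / W) * log z + 2 * (2 * W + 1) * exp (2 * (2 * W + 1) / (W.totient / W))) + 2 * m^2 * M * (2 / D0)) := by
  have hW0 : (0:ℝ) < W := by exact_mod_cast hW
  have hφ : (0:ℝ) < W.totient / W := div_pos (by exact_mod_cast totient_pos.2 hW) hW0
  have h1 := fam_logp hF z hz
  have h2 := fam_inv hF z (2 * (2 * W + 1)) (W.totient / W) hz (by positivity) hφ
  have h3 := fam_sq hF D0 hD hP
  have h4 : ∑ i ∈ univ.filter (fun i => (P i : ℝ) ≤ z), 1 / (P i : ℝ)^2 ≤ (2:ℝ) / D0 :=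
    le_trans (sum_le_sum_of_subset_of_nonneg (filter_subset _ _) (fun _ _ _ => by positivity)) h3
  have e : ∀ i, 1 / (P i : ℝ) * (M^m' * (2 * ((b + 1) * (W.totient / W * log (P i) + 2 * (2 * W + 1))) + 2 * (m / P i)^2 * M)) ≤
      M^m' * (2 * (b + 1) * (W.totient / W * (log (P i) / P i) + 2 * (2 * W + 1) / P i) + 2 * m^2 * M * (1 / (P i : ℝ)^2)) := by
    intro i
    have hp1 : (1:ℝ) ≤ P i := by exact_mod_cast hF.pos i
    have hp0 : (0:ℝ) < P i := by linarith
    have : 1 / (P i : ℝ) * (M^m' * (2 * ((b + 1) * (W.totient / W * log (P i) + 2 * (2 * W + 1))) + 2 * (m / P i)^2 * M)) =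
      M^m' * (2 * (b + 1) * (W.totient / W * (log (P i) / P i) + 2 * (2 * W + 1) / P i) + 2 * m^2 * M * (1 / (P i : ℝ)^2 / P i)) := by
      field_simp
    rw [this]
    have : 1 / (P i : ℝ)^2 / P i ≤ 1 / (P i : ℝ)^2 := div_le_self (by positivity) hp1
    have hMm : 0 ≤ M^m' := by positivity
    have : 2 * m^2 * M * (1 / (P i : ℝ)^2 / P i) ≤ 2 * m^2 * M * (1 / (P i : ℝ)^2) := mul_le_mul_of_nonneg_left this (by positivity)
    exact mul_le_mul_of_nonneg_left (by linarith) hMm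
  refine (sum_le_sum fun i _ => e i).trans ?_
  rw [← mul_sum, sum_add_distrib, ← mul_sum, ← mul_sum, sum_add_distrib, ← mul_sum]
  have h5 := mul_le_mul_of_nonneg_left h1 hφ.le
  have h6 := mul_le_mul_of_nonneg_left h4 (by positivity : 0 ≤ 2 * m^2 * M)
  refine mul_le_mul_of_nonneg_left (add_le_add (mul_le_mul_of_nonneg_left ?_ (by positivity)) h6) (by positivity)
  linarith

lemma s2_low (hF : Fam P W ps (exp L)) (hL : 0 < L) (hW : 1 ≤ W) (hps : ps = 1 ∨ ps.Prime) (D0 : ℕ) (hD1 : 80 * (Fintype.card J)^2 ≤ D0) (hD2 : 7 * Fintype.card J ≤ D0) (hD : 1 ≤ D0)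
    (hP : ∀ i, D0 < P i) (b : ℕ) (hb : 2 ≤ b) (hu : 2 * (2 * W + 1) ≤ uW W b L) (hB : 512 * Fintype.card J * b ≤ 2^b) (j0 : J) :
    ((b:ℝ) - 1)^2 * uW W b L * (∑ s, nu P (gs b L) s)^(Fintype.card J) / 2^12 ≤
      ∑ o : ι → Option J, (∏ i, w2 P j0 i (o i)) * (GG P (gs b L) (exp L) o)^2 := by
  have hm : 1 ≤ Fintype.card J := Fintype.card_pos_iff.2 ⟨j0⟩
  have hu0 : 0 < uW W b L := lt_of_lt_of_le (by positivity) hu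
  have hDr : (0:ℝ) < D0 := by exact_mod_cast hD
  have hσ : 10 * (Fintype.card J : ℝ)^2 * ∑ i, 1 / (P i : ℝ)^2 ≤ 1 / 4 := by
    calc _ ≤ 10 * (Fintype.card J : ℝ)^2 * (2 / D0) := by gcongr; exact fam_sq hF D0 hD hP
      _ ≤ _ := by
        have : (80:ℝ) * (Fintype.card J : ℝ)^2 ≤ D0 := by exact_mod_cast hD1
        rw [mul_div_assoc', div_le_iff₀ hDr]
        linarith
  have hbl := beta_lower hF hps hW b (by omega) hL.le hu
  have hbu := beta_upper hF hps hW b hL.le hu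
  have hη : 4 * Fintype.card J * ∑ s, nu P (gs b L) s * log (rr P s) ≤ log (exp (3 * L / 4)) * ∑ s, nu P (gs b L) s := by
    rw [log_exp]
    have h1 := eta_upper hF hps hW b hL.le hu
    have h2 : (512:ℝ) * Fintype.card J * b ≤ 2^b := by exact_mod_cast hB
    have h2b : (0:ℝ) < 2^b := by positivity
    have h3 : 4 * (Fintype.card J : ℝ) * (2 * b * (L / 2^b) * uW W b L) ≤ 3 * L / 4 * (uW W b L / 32) := by
      have e : 4 * (Fintype.card J : ℝ) * (2 * b * (L / 2^b) * uW W b L) = (512 * Fintype.card J * b) / 2^b * (L * uW W b L / 64) := by ring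
      have h4 : (512 * Fintype.card J * b) / 2^b ≤ (1:ℝ) := by rw [div_le_one h2b]; exact h2
      rw [e]
      have : 0 < L * uW W b L := by positivity
      nlinarith
    calc _ ≤ 4 * (Fintype.card J : ℝ) * (2 * b * (L / 2^b) * uW W b L) := by gcongr
      _ ≤ _ := h3
      _ ≤ _ := by gcongr
  have h := S2_bound P (fun i => lt_of_le_of_lt hD2 (hP i)) (gs b L) (gs_nonneg b L) (gs_anti b L) (exp L) (exp (L / 4)) (exp (3 * L / 4)) (exp_pos _).le
    (by rw [Real.one_lt_exp_iff]; positivity) (by rw [← exp_add]; apply exp_le_exp.2; linarith) j0 hσ hη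
  refine le_trans ?_ h
  have hα := alpha_lower hF hps hW b hb hL.le hu
  have hb1 : (0:ℝ) ≤ (b:ℝ) - 1 := by have : (2:ℝ) ≤ b := by exact_mod_cast hb
                                     linarith
  set β := ∑ s, nu P (gs b L) s with hβ
  have hβ0 : 0 < β := lt_of_lt_of_le (by positivity) hbl
  have e : β^(Fintype.card J) = β^(Fintype.card J - 1) * β := by rw [← pow_succ]; congr 1; omega
  rw [e]
  calc ((b:ℝ) - 1)^2 * uW W b L * (β^(Fintype.card J - 1) * β) / 2^12 ≤ ((b:ℝ) - 1)^2 * uW W b L * (β^(Fintype.card J - 1) * (4 * uW W b L)) / 2^12 := by gcongr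
    _ = (((b:ℝ) - 1) * uW W b L / 16)^2 * β^(Fintype.card J - 1) / 4 := by ring
    _ ≤ _ := by gcongr

end core

section core
variable {ι : Type} [Fintype ι] [DecidableEq ι]
variable {P : ι → ℕ} {W ps : ℕ} {L : ℝ}

/-- `n` is good: many of the `n + h i + 1` are prime, and every prime factor outside `W` of `n + h i` is large. -/
def Good {k : ℕ} (h : Fin k → ℕ) (K T W n : ℕ) : Prop :=
  K ≤ (univ.filter (fun i => (n + h i + 1).Prime)).card ∧ ∀ i, ∀ p : ℕ, p.Prime → ¬ p ∣ W → p ∣ n + h i → n + h i + 1 ≤ p^T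

def bbf {k : ℕ} (h : Fin k → ℕ) : Fin k × Bool → ℕ := fun j => if j.2 then h j.1 else h j.1 + 1

open Classical in
lemma pt_bound {k K T : ℕ} (hK : 1 ≤ K) (h : Fin k → ℕ) (hF : Fam P W ps (exp L)) (ℓ : ℝ) (hℓ : 1 ≤ ℓ) (z : ℝ) (hz : 0 ≤ z) (hzR : z ≤ exp L) (n : ℕ) (hn : 1 ≤ n)
    (hT : ∀ i, ((n + h i + 1 : ℕ) : ℝ) ≤ z^T) (hng : ¬ Good h K T W n) :
    ∑ i, (if (n + bbf h (i, false)).Prime then log (n + bbf h (i, false) : ℕ) * hw ℓ (n + bbf h (i, false) : ℕ) else 0) ≤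
      3 * ℓ * (1 / n * ((K:ℝ) - 1 + k * (∑ i, ∑ s ∈ univ.filter (fun s => (P s : ℝ) ≤ z), (if P s ∣ n + h i then (1:ℝ) else 0)
        + ∑ i, if (ps.Prime ∧ (ps:ℝ) ≤ z ∧ ps ∣ n + h i) then (1:ℝ) else 0))) := by
  have hn0 : (0:ℝ) < n := by exact_mod_cast hn
  set X := ∑ i, ∑ s ∈ univ.filter (fun s => (P s : ℝ) ≤ z), (if P s ∣ n + h i then (1:ℝ) else 0) with hX
  set Y := ∑ i, (if (ps.Prime ∧ (ps:ℝ) ≤ z ∧ ps ∣ n + h i) then (1:ℝ) else 0) with hY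
  have hX0 : 0 ≤ X := sum_nonneg fun i _ => sum_nonneg fun s _ => by split_ifs <;> norm_num
  have hY0 : 0 ≤ Y := sum_nonneg fun i _ => by split_ifs <;> norm_num
  set c := (univ.filter (fun i => (n + h i + 1).Prime)).card with hc
  have hck : (c:ℝ) ≤ k := by
    have : c ≤ (univ : Finset (Fin k)).card := card_le_card (filter_subset _ _)
    rw [card_fin] at this
    exact_mod_cast this
  have h1 : ∑ i, (if (n + bbf h (i, false)).Prime then log (n + bbf h (i, false) : ℕ) * hw ℓ (n + bbf h (i, false) : ℕ) else 0) ≤ 3 * ℓ * (1 / n * c) := by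
    have : ∀ i, (if (n + bbf h (i, false)).Prime then log (n + bbf h (i, false) : ℕ) * hw ℓ (n + bbf h (i, false) : ℕ) else 0) ≤
        (if (n + h i + 1).Prime then 3 * ℓ * (1 / n) else 0) := by
      intro i
      have e : n + bbf h (i, false) = n + h i + 1 := by simp [bbf, add_assoc]
      rw [e]
      by_cases hp : (n + h i + 1).Prime
      · rw [if_pos hp, if_pos hp]
        by_cases hN : n + h i + 1 < NN ℓ
        · have a1 := log_lt_NN ℓ hℓ _ hN
          have a2 : hw ℓ (n + h i + 1 : ℕ) ≤ 1 / (n + h i + 1 : ℕ) := hw_le (Nat.cast_nonneg _)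
          have a3 : (1:ℝ) / (n + h i + 1 : ℕ) ≤ 1 / n := by
            apply one_div_le_one_div_of_le hn0
            exact_mod_cast (by omega : n ≤ n + h i + 1)
          exact mul_le_mul a1 (a2.trans a3) (hw_nonneg (Nat.cast_nonneg _)) (by positivity)
        · rw [hw_NN_zero ℓ hℓ _ (not_lt.1 hN), mul_zero]; positivity
      · rw [if_neg hp, if_neg hp]
    refine (sum_le_sum fun i _ => this i).trans (le_of_eq ?_)
    rw [← sum_filter, sum_const, nsmul_eq_mul, ← hc]; ring
  refine h1.trans ?_
  have h2 : (c:ℝ) ≤ (K:ℝ) - 1 + k * (X + Y) := by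
    by_cases hcK : K ≤ c
    · have h1 : 1 ≤ X + Y := by
        have hex : ∃ i, ∃ p : ℕ, p.Prime ∧ ¬ p ∣ W ∧ p ∣ n + h i ∧ p^T < n + h i + 1 := by
          by_contra hcon
          push Not at hcon
          exact hng ⟨hcK, hcon⟩
        obtain ⟨i, p, hp, hpW, hpn, hpT⟩ := hex
        have hpz : (p:ℝ) ≤ z := by
          by_contra hcon
          push Not at hcon
          have a := hT i
          have a2 : z^T ≤ (p:ℝ)^T := pow_le_pow_left₀ hz hcon.le T
          have a3 : ((p^T : ℕ) : ℝ) < ((n + h i + 1 : ℕ) : ℝ) := by exact_mod_cast hpT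
          push_cast at a a3
          linarith
        by_cases hps : p = ps
        · subst hps
          have : (1:ℝ) ≤ Y := by
            have a := single_le_sum (f := fun i => if (p.Prime ∧ (p:ℝ) ≤ z ∧ p ∣ n + h i) then (1:ℝ) else 0) (fun i _ => by split_ifs <;> norm_num) (mem_univ i)
            simp only [if_pos (And.intro hp (And.intro hpz hpn))] at a
            exact a
          linarith
        · obtain ⟨s, rfl⟩ := hF.surj p hp hpW hps (hpz.trans hzR)
          have : (1:ℝ) ≤ X := by
            have a := single_le_sum (f := fun i => ∑ s ∈ univ.filter (fun s => (P s : ℝ) ≤ z), (if P s ∣ n + h i then (1:ℝ) else 0))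
              (fun i _ => sum_nonneg fun s _ => by split_ifs <;> norm_num) (mem_univ i)
            have a2 := single_le_sum (f := fun s => (if P s ∣ n + h i then (1:ℝ) else 0)) (fun i _ => by split_ifs <;> norm_num)
              (mem_filter.2 ⟨mem_univ s, hpz⟩ : s ∈ univ.filter (fun s => (P s : ℝ) ≤ z))
            simp only [if_pos hpn] at a2
            exact a2.trans a
          linarith
      have : (1:ℝ) ≤ K := by exact_mod_cast hK
      have hk0 : (0:ℝ) ≤ k := Nat.cast_nonneg k
      nlinarith
    · have : (c:ℝ) + 1 ≤ K := by exact_mod_cast (not_le.1 hcK)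
      have hk0 : (0:ℝ) ≤ k := Nat.cast_nonneg k
      have : 0 ≤ (k:ℝ) * (X + Y) := by positivity
      linarith
  gcongr

open Classical in
lemma comb {k K T : ℕ} (hK : 1 ≤ K) (h : Fin k → ℕ) (hF : Fam P W ps (exp L)) (Y : ℝ) (hY : 1 ≤ Y) (z : ℝ) (hz : 0 ≤ z) (hzR : z ≤ exp L) (S : Finset ℕ)
    (hS : ∀ n ∈ S, 1 ≤ n) (hT : ∀ n ∈ S, ∀ i, ((n + h i + 1 : ℕ) : ℝ) ≤ z^T) (hng : ∀ n ∈ S, ¬ Good h K T W n) (G : ℕ → ℝ) (hG : ∀ n, 0 ≤ G n) :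
    ∑ i, ∑ n ∈ S, (if (n + bbf h (i, false)).Prime then log (n + bbf h (i, false) : ℕ) * hw Y (n + bbf h (i, false) : ℕ) else 0) * G n ≤
      3 * Y * (((K:ℝ) - 1) * (∑ n ∈ S, 1 / (n:ℝ) * G n) + k * (∑ i, ∑ s ∈ univ.filter (fun s => (P s : ℝ) ≤ z), ∑ n ∈ S, 1 / (n:ℝ) * (if P s ∣ n + bbf h (i, true) then G n else 0)
        + ∑ i, ∑ n ∈ S, 1 / (n:ℝ) * (if (ps.Prime ∧ (ps:ℝ) ≤ z ∧ ps ∣ n + h i) then G n else 0))) := by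
  rw [sum_comm]
  have e1 : ∀ n ∈ S, ∑ i, (if (n + bbf h (i, false)).Prime then log (n + bbf h (i, false) : ℕ) * hw Y (n + bbf h (i, false) : ℕ) else 0) * G n ≤
      3 * Y * (((K:ℝ) - 1) * (1 / (n:ℝ) * G n) + k * (∑ i, ∑ s ∈ univ.filter (fun s => (P s : ℝ) ≤ z), 1 / (n:ℝ) * (if P s ∣ n + bbf h (i, true) then G n else 0)
        + ∑ i, 1 / (n:ℝ) * (if (ps.Prime ∧ (ps:ℝ) ≤ z ∧ ps ∣ n + h i) then G n else 0))) := by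
    intro n hn
    rw [← sum_mul]
    refine (mul_le_mul_of_nonneg_right (pt_bound hK h hF Y hY z hz hzR n (hS n hn) (hT n hn) (hng n hn)) (hG n)).trans (le_of_eq ?_)
    have a1 : ∀ i, ∑ s ∈ univ.filter (fun s => (P s : ℝ) ≤ z), 1 / (n:ℝ) * (if P s ∣ n + bbf h (i, true) then G n else 0) =
        (∑ s ∈ univ.filter (fun s => (P s : ℝ) ≤ z), (if P s ∣ n + h i then (1:ℝ) else 0)) * (1 / n * G n) := by
      intro i
      rw [sum_mul]
      refine sum_congr rfl fun s _ => ?_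
      simp [bbf]
    have a2 : ∀ i, 1 / (n:ℝ) * (if (ps.Prime ∧ (ps:ℝ) ≤ z ∧ ps ∣ n + h i) then G n else 0) = (if (ps.Prime ∧ (ps:ℝ) ≤ z ∧ ps ∣ n + h i) then (1:ℝ) else 0) * (1 / n * G n) := by
      intro i
      rw [ite_mul, one_mul, zero_mul, mul_ite, mul_zero]
    simp only [a1, a2, ← sum_mul]
    ring
  refine (sum_le_sum e1).trans (le_of_eq ?_)
  rw [← mul_sum, sum_add_distrib, ← mul_sum, ← mul_sum, sum_add_distrib]
  have b1 : ∀ F : ℕ → Fin k → ι → ℝ, ∑ n ∈ S, ∑ i, ∑ s ∈ univ.filter (fun s => (P s : ℝ) ≤ z), F n i s = ∑ i, ∑ s ∈ univ.filter (fun s => (P s : ℝ) ≤ z), ∑ n ∈ S, F n i s := by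
    intro F
    rw [sum_comm]
    exact sum_congr rfl fun i _ => sum_comm
  rw [b1, sum_comm (s := S)]

variable {J : Type} [Fintype J] [DecidableEq J]

open Classical in
lemma star_up (hF : Fam P W ps (exp L)) (hL : 0 ≤ L) (hW : 1 ≤ W) {bb : J → ℕ} (hS : Sep P bb) (hm : ∀ i, Fintype.card J < P i)
    (k : ℕ) (hk : ((Fintype.card J : ℝ) + 1)^2 ≤ 2^k) (C : ℝ) (hC : 1 ≤ C) (hCk : ∀ n : ℕ, n ≠ 0 → (n.divisors.card : ℝ)^k ≤ C * sqrt n)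
    (b v : ℕ) (X0 X1 : ℕ) (h0 : 1 ≤ X0) (h01 : X0 ≤ X1) (c D0 : ℕ) (hD0 : 1 ≤ D0) (hD : ps.Prime → D0 < ps ∧ ¬ ps ∣ W) (z : ℝ) (hzR : z ≤ exp L) :
    ∑ n ∈ (Ico X0 X1).filter (fun n => n ≡ v [MOD W]), 1 / (n:ℝ) * (if (ps.Prime ∧ (ps:ℝ) ≤ z ∧ ps ∣ n + c) then (GG P (gs b L) (exp L) (om P bb n))^2 else 0) ≤
      1 / W * (∑ n ∈ Ico X0 X1, 1 / (n:ℝ)) * (∑ s, nu P (gs b L) s)^(Fintype.card J) / D0 + ((∑ s, aR P (exp L) s)^(Fintype.card J))^2 * (2 * C * (W * exp L) * (exp L ^ 3)^3 / X0) := by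
  have hβ : 0 ≤ ∑ s, nu P (gs b L) s := sum_nonneg fun s _ => div_nonneg (sq_nonneg _) (rr_pos hF.pos s).le
  by_cases hp : ps.Prime ∧ (ps:ℝ) ≤ z
  · obtain ⟨hp, hpz⟩ := hp
    obtain ⟨hD1, hpW⟩ := hD hp
    obtain ⟨c', hc'⟩ := crt2 W ps ((Nat.Prime.coprime_iff_not_dvd hp).2 hpW).symm v ((ps - 1) * c)
    have h1 := s1_up hF hL hS hm k hk C hC hCk b (W * ps) c' (Nat.mul_pos hW hp.pos) (fun i hi => by
      rcases (Nat.Prime.dvd_mul (hF.pr i)).1 hi with h | h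
      · exact hF.ndvd i h
      · exact hF.ne i ((prime_dvd_prime_iff_eq (hF.pr i) hp).1 h)) X0 X1 h0 h01
    have e : ∑ n ∈ (Ico X0 X1).filter (fun n => n ≡ v [MOD W]), 1 / (n:ℝ) * (if (ps.Prime ∧ (ps:ℝ) ≤ z ∧ ps ∣ n + c) then (GG P (gs b L) (exp L) (om P bb n))^2 else 0) =
        ∑ n ∈ (Ico X0 X1).filter (fun n => n ≡ c' [MOD W * ps]), 1 / (n:ℝ) * (GG P (gs b L) (exp L) (om P bb n))^2 := by
      rw [sum_filter, sum_filter]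
      refine sum_congr rfl fun n _ => ?_
      have h3 := hc' n
      rw [← dvd_add_iff_modEq ps n c hp.pos] at h3
      by_cases h4 : n ≡ v [MOD W]
      · by_cases h5 : ps ∣ n + c
        · rw [if_pos h4, if_pos ⟨hp, hpz, h5⟩, if_pos (h3.1 ⟨h4, h5⟩)]
        · rw [if_pos h4, if_neg (fun h => h5 h.2.2), if_neg (fun h => h5 (h3.2 h).2), mul_zero]
      · rw [if_neg h4, if_neg (fun h => h4 (h3.2 h).1)]
    rw [e]
    refine h1.trans (add_le_add ?_ ?_)
    · have hDr : (0:ℝ) < D0 := by exact_mod_cast hD0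
      have hDp : (D0:ℝ) ≤ ps := by exact_mod_cast hD1.le
      have hWr : (0:ℝ) < W := by exact_mod_cast hW
      have : 1 / ((W * ps : ℕ) : ℝ) ≤ 1 / W / D0 := by
        rw [div_div]; push_cast
        apply one_div_le_one_div_of_le (by positivity)
        gcongr
      calc _ ≤ 1 / W / D0 * (∑ n ∈ Ico X0 X1, 1 / (n:ℝ)) * (∑ s, nu P (gs b L) s)^(Fintype.card J) := by gcongr
        _ = _ := by ring
    · unfold EE
      have : ((W * ps : ℕ) : ℝ) ≤ W * exp L := by
        push_cast
        gcongr
        linarith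
      gcongr
  · rw [sum_eq_zero]
    · positivity
    · intro n _
      rw [if_neg (fun h => hp ⟨h.1, h.2.1⟩), mul_zero]

end core

lemma bad_num (b m k D0 : ℕ) (hk : 1 ≤ k) (hm : 1 ≤ m) (hD0 : 1 ≤ D0) (u β φ L CW : ℝ) (hu : 0 < u) (hL : φ * L = 2^b * u) (hβ : u ≤ 32 * β)
    (hCW : 2 * (b + 1) * CW ≤ 2^(b+1) * u / D0) (hD : k^2 * ((64 * 2^b)^m * (4 * b + 5 + 4 * m^2)) ≤ D0) :
    (2^(b+1) * u)^(m - 1) * (2 * (b + 1) * (4 * φ * (L / D0) + CW) + 2 * (m:ℝ)^2 * (2^(b+1) * u) * (2 / D0)) ≤ β^m / k^2 := by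
  have hDr : (0:ℝ) < D0 := by exact_mod_cast hD0
  have hkr : (0:ℝ) < k := by exact_mod_cast hk
  have hβ0 : 0 < β := by linarith
  have hM : 2^(b+1) * u ≤ 64 * 2^b * β := by
    have : (0:ℝ) < 2^b := by positivity
    rw [pow_succ]; nlinarith
  have hM0 : 0 ≤ 2^(b+1) * u := by positivity
  have h1 : 2 * (b + 1) * (4 * φ * (L / D0) + CW) + 2 * (m:ℝ)^2 * (2^(b+1) * u) * (2 / D0) ≤ (2^(b+1) * u) * ((4 * b + 5 + 4 * m^2) / D0) := by
    have e : 2 * ((b:ℝ) + 1) * (4 * φ * (L / D0)) = 2^(b+1) * u * ((4 * b + 4) / D0) := by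
      have : 4 * φ * (L / D0) = 4 * (φ * L) / D0 := by ring
      rw [this, hL]; ring
    have e2 : (2^(b+1) * u) * ((4 * (b:ℝ) + 5 + 4 * m^2) / D0) = 2^(b+1) * u * ((4 * b + 4) / D0) + 2^(b+1) * u / D0 + 2 * (m:ℝ)^2 * (2^(b+1) * u) * (2 / D0) := by ring
    rw [e2, mul_add, e]
    linarith
  have h2 : ((k:ℝ)^2 * ((64 * 2^b)^m * (4 * b + 5 + 4 * m^2))) ≤ D0 := by exact_mod_cast hD
  calc _ ≤ (2^(b+1) * u)^(m - 1) * ((2^(b+1) * u) * ((4 * b + 5 + 4 * m^2) / D0)) := mul_le_mul_of_nonneg_left h1 (by positivity)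
    _ = (2^(b+1) * u)^m * ((4 * b + 5 + 4 * m^2) / D0) := by
      rw [← mul_assoc, ← pow_succ, Nat.sub_add_cancel hm]
    _ ≤ (64 * 2^b * β)^m * ((4 * b + 5 + 4 * m^2) / D0) := by gcongr
    _ = β^m * (((64 * 2^b)^m * (4 * b + 5 + 4 * m^2)) / D0) := by rw [mul_pow]; ring
    _ ≤ β^m * (1 / k^2) := by
      refine mul_le_mul_of_nonneg_left ?_ (by positivity)
      rw [div_le_div_iff₀ hDr (by positivity)]
      linarith
    _ = _ := by ring

section core
variable {ι : Type} [Fintype ι] [DecidableEq ι]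
variable {P : ι → ℕ} {W ps : ℕ}

lemma fam_card {R : ℝ} (hF : Fam P W ps R) (hR : 0 ≤ R) (S : Finset ι) : (S.card : ℝ) ≤ R := by
  have : S.card ≤ (Ioc 0 ⌊R⌋₊).card := by
    apply card_le_card_of_injOn P _ hF.inj.injOn
    intro i _
    rw [coe_Ioc, Set.mem_Ioc]
    exact ⟨hF.pos i, Nat.le_floor (hF.le i)⟩
  rw [Nat.card_Ioc] at this
  calc (S.card : ℝ) ≤ (⌊R⌋₊ : ℝ) := by exact_mod_cast this
    _ ≤ R := floor_le hR

set_option maxHeartbeats 2000000 in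
lemma sieve_fixed {k K b D0 W v k' : ℕ} {h : Fin k → ℕ} {C Y : ℝ} (hK : 1 ≤ K) (hk : 1 ≤ k) (hb : 2 ≤ b) (hB : 512 * (2 * k) * b ≤ 2^b)
    (hkey : (2:ℝ)^22 * 2^b * (12 * (K + 1) + 1) < k * ((b:ℝ) - 1)^2)
    (hD1 : 80 * (2 * k)^2 ≤ D0) (hD2 : k^2 * ((64 * 2^b)^(2 * k) * (4 * b + 5 + 4 * (2 * k)^2)) ≤ D0)
    (hW : 1 ≤ W) (hWD : ∀ p : ℕ, p.Prime → p ≤ D0 → p ∣ W)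
    (hcop : ∀ i, (v + h i + 1).Coprime W)
    (hk' : ((2 * k : ℝ) + 1)^2 ≤ 2^k') (hC : 1 ≤ C) (hCk : ∀ n : ℕ, n ≠ 0 → (n.divisors.card : ℝ)^k' ≤ C * sqrt n)
    (hY : 1 ≤ Y) (hF : Fam P W ps (exp (Y / 128))) (hS : Sep P (bbf h)) (hps : ps = 1 ∨ (ps.Prime ∧ ¬ ps ∣ W)) (Bd : ℕ → ℝ)
    (hBd0 : ∀ d ∈ dset W ps Y, 0 ≤ Bd d) (hBd1 : ∑ d ∈ dset W ps Y, (d.divisors.card : ℝ)^k' * Bd d ≤ 1 / Y^(4 * k + 1))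
    (hBd : ∀ d ∈ dset W ps Y, ∀ a : ℕ, a.Coprime (W*d) →
      |∑ p ∈ (range (NN Y)).filter (fun n => n.Prime ∧ n ≡ a [MOD (W*d)]), log p * hw Y p - Main Y / (W*d).totient| ≤ Bd d)
    (hMain : Y / 8 ≤ Main Y) (hu : 2 * (2 * W + 1) ≤ uW W b (Y / 128)) (hu32 : 32 ≤ uW W b (Y / 128))
    (hCW : 2 * ((b:ℝ) + 1) * (2 * (2 * W + 1) * exp (2 * (2 * W + 1) / (W.totient / W))) ≤ 2^(b+1) * uW W b (Y / 128) / D0)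
    (hX : ∀ i, (⌈exp (Y / 2)⌉₊ : ℝ) + h i + 1 ≤ exp Y) (hX1 : ∀ i, (NN Y : ℝ) + h i + 1 ≤ exp (4 * Y)) (hWY : (W:ℝ) ≤ Y^2)
    (herr : 3 * Y * (((K:ℝ) + k^2 * exp (Y / 128) + k^2) * ((Y^(2*k))^2 * (2 * C * (W * exp (Y / 128)) * (exp (Y / 128) ^ 3)^3 / ⌈exp (Y / 2)⌉₊))) + k * (1 / Y) ≤ 1) :
    ∃ n, ⌈exp (Y / 2)⌉₊ ≤ n ∧ n ≡ v [MOD W] ∧ Good h K (512 * D0) W n := by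
  classical
  by_contra hcon
  push Not at hcon
  set L := Y / 128 with hLdef
  set R := exp L with hR
  set X0 := ⌈exp (Y / 2)⌉₊ with hX0d
  set u := uW W b L with hud
  have hL0 : 0 < L := by positivity
  have hR1 : 1 ≤ R := one_le_exp hL0.le
  have hkr : (1:ℝ) ≤ k := by exact_mod_cast hk
  have hk2 : 1 ≤ k^2 := Nat.one_le_pow _ _ hk
  have hD0 : 1 ≤ D0 := by nlinarith
  have hDr : (0:ℝ) < D0 := by exact_mod_cast hD0
  have hWr : (0:ℝ) < W := by exact_mod_cast hW
  have hm : Fintype.card (Fin k × Bool) = 2 * k := by simp [mul_comm]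
  have hPD : ∀ i, D0 < P i := fun i => by
    by_contra hc
    exact hF.ndvd i (hWD _ (hF.pr i) (not_lt.1 hc))
  have hps' : ps = 1 ∨ ps.Prime := hps.imp_right And.left
  have hX0 : 1 ≤ X0 := Nat.one_le_ceil_iff.2 (exp_pos _)
  have h01 : X0 ≤ NN Y := by
    unfold NN
    refine le_trans (Nat.ceil_le_ceil (exp_le_exp.2 (by linarith))) (Nat.le_succ _)
  have hcard : ∀ i, Fintype.card (Fin k × Bool) < P i := fun i => by rw [hm]; exact lt_of_le_of_lt (by nlinarith) (hPD i)
  have hkJ : ((Fintype.card (Fin k × Bool) : ℝ) + 1)^2 ≤ 2^k' := by rw [hm]; push_cast; exact hk'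
  set β := ∑ s, nu P (gs b L) s with hβd
  have hβl : u / 32 ≤ β := beta_lower hF hps' hW b (by omega) hL0.le hu
  have hβ1 : 1 ≤ β := by linarith
  have hM := (My hF hps' hW b hL0.le hu b le_rfl).2
  rw [yj_top] at hM
  set M0 := ∑ s, aR P R s with hM0d
  have hM00 : 0 ≤ M0 := sum_nonneg fun s _ => aR_nonneg hF.pos _ s
  have hφ1 : (W.totient : ℝ) / W ≤ 1 := by
    rw [div_le_one hWr]; exact_mod_cast totient_le W
  have hφ0 : (0:ℝ) < W.totient := by exact_mod_cast totient_pos.2 hW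
  have huL : (W.totient : ℝ) / W * L = 2^b * u := by
    rw [hud]; unfold uW; field_simp
  have hMY : M0 ≤ Y := by
    have : 2^(b+1) * u = 2 * (W.totient / W * L) := by rw [huL]; ring
    have h3 : (W.totient : ℝ) / W * L ≤ 1 * L := by gcongr
    have : L ≤ Y / 2 := by rw [hLdef]; linarith
    linarith
  set E0 := (Y^(2*k))^2 * (2 * C * (W * R) * (R^3)^3 / X0) with hE0
  have hE00 : 0 ≤ E0 := by positivity
  have hEE : EE M0 (2 * k) C R W X0 ≤ E0 := by
    unfold EE
    have : (W:ℝ) ≤ W * R := le_mul_of_one_le_right hWr.le hR1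
    rw [hE0]
    gcongr
  set H := ∑ n ∈ Ico X0 (NN Y), 1 / (n:ℝ) with hHd
  have hH0 : 0 ≤ H := by positivity
  have hH : H ≤ 4 * Y := by
    refine le_trans ?_ (NN_inv_sum Y hY)
    apply sum_le_sum_of_subset_of_nonneg
    · intro n hn; rw [mem_range]; exact (mem_Ico.1 hn).2
    · intro _ _ _; positivity
  set z := exp (L / D0) with hz
  have hz1 : 1 ≤ z := one_le_exp (by positivity)
  have hzR : z ≤ R := exp_le_exp.2 (div_le_self hL0.le (by exact_mod_cast hD0))
  set S := (Ico X0 (NN Y)).filter (fun n => n ≡ v [MOD W]) with hSd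
  set G : ℕ → ℝ := fun n => (GG P (gs b L) R (om P (bbf h) n))^2 with hG
  -- upper bounds
  have g1 : ∑ n ∈ S, 1 / (n:ℝ) * G n ≤ 1 / W * H * β^(2*k) + E0 := by
    have := s1_up hF hL0.le hS hcard k' hkJ C hC hCk b W v hW hF.ndvd X0 (NN Y) hX0 h01
    rw [hm] at this
    exact this.trans (by linarith)
  have g2 : ∀ i : Fin k, ∑ s ∈ univ.filter (fun s => (P s : ℝ) ≤ z), ∑ n ∈ S, 1 / (n:ℝ) * (if P s ∣ n + bbf h (i, true) then G n else 0) ≤ 1 / W * H * (β^(2*k) / k^2) + R * E0 := by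
    intro i
    have a1 := fun s => bad_up hF hL0.le hW hS hcard k' hkJ C hC hCk b v X0 (NN Y) hX0 h01 s (i, true) _ hM
    rw [hm] at a1
    refine (sum_le_sum fun s _ => a1 s).trans ?_
    rw [sum_add_distrib, sum_const, nsmul_eq_mul, ← mul_sum]
    have a2 := bad_sum hF hW z hz1 D0 b (2 * k - 1) hD0 hPD (2^(b+1) * u) (2 * k : ℕ) (by positivity)
    have a3 := bad_num b (2 * k) k D0 hk (by omega) hD0 u β (W.totient / W) L _ (by linarith) huL (by linarith) hCW hD2
    rw [hz, log_exp, ← hz] at a2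
    have a4 := a2.trans a3
    have a5 := fam_card hF (by positivity) (univ.filter (fun s => (P s : ℝ) ≤ z))
    have a6 : ((univ.filter (fun s => (P s : ℝ) ≤ z)).card : ℝ) * EE M0 (2 * k) C R W X0 ≤ R * E0 := by
      have : 0 ≤ EE M0 (2 * k) C R W X0 := by unfold EE; positivity
      gcongr
    exact add_le_add (mul_le_mul_of_nonneg_left a4 (by positivity)) a6
  have g3 : ∀ i : Fin k, ∑ n ∈ S, 1 / (n:ℝ) * (if (ps.Prime ∧ (ps:ℝ) ≤ z ∧ ps ∣ n + h i) then G n else 0) ≤ 1 / W * H * (β^(2*k) / k^2) + E0 := by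
    intro i
    have a1 := star_up hF hL0.le hW hS hcard k' hkJ C hC hCk b v X0 (NN Y) hX0 h01 (h i) D0 hD0 (fun hp => by
      rcases hps with h | h
      · exact absurd hp (by rw [h]; exact Nat.not_prime_one)
      · refine ⟨?_, h.2⟩
        by_contra hc
        exact h.2 (hWD _ hp (not_lt.1 hc))) z hzR
    rw [hm] at a1
    refine a1.trans (add_le_add ?_ ?_)
    · rw [mul_div_assoc]
      have : (k:ℝ)^2 ≤ D0 := by exact_mod_cast (show k^2 ≤ D0 by nlinarith)
      gcongr
    · rw [hE0]; gcongr
  -- lower bounds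
  have g4 : ∀ i : Fin k, Main Y / W.totient * (((b:ℝ) - 1)^2 * u * β^(2*k) / 2^12) - 1 / Y ≤
      ∑ n ∈ S, (if (n + bbf h (i, false)).Prime then log (n + bbf h (i, false) : ℕ) * hw Y (n + bbf h (i, false) : ℕ) else 0) * G n := by
    intro i
    have ebb : bbf h (i, false) = h i + 1 := by simp [bbf]
    have a1 := S2_transfer hF hS v hW (i, false) (by rw [ebb]; omega) (by rw [ebb, ← add_assoc]; exact hcop i) Y hY X0
      (by rw [ebb]; push_cast; have := hX i; linarith) (exp_le_exp.2 (by rw [hLdef]; linarith))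
      (by rw [← exp_nat_mul]; apply exp_le_exp.2; rw [hLdef]; push_cast; linarith) (gs b L) (gs_nonneg b L) (gs_le_one b L) (by positivity) hps Bd hBd0 k' hkJ (4 * k + 1) hBd1 hBd
    have a2 := s2_low hF hL0 hW hps' D0 (J := Fin k × Bool) (by rw [hm]; exact hD1) (by rw [hm]; nlinarith) hD0 hPD b hb hu (by rw [hm]; exact hB) (i, false)
    rw [hm] at a1 a2
    have a3 := mul_le_mul_of_nonneg_left a2 (by have : 0 ≤ Main Y := by linarith
                                                positivity : 0 ≤ Main Y / W.totient)
    have a4 : (M0^(2*k))^2 * (1 / Y^(4*k+1)) ≤ 1 / Y := by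
      have hY0 : 0 < Y := by linarith
      calc (M0^(2*k))^2 * (1 / Y^(4*k+1)) ≤ (Y^(2*k))^2 * (1 / Y^(4*k+1)) := by gcongr
        _ = 1 / Y := by
          rw [← pow_mul, pow_succ, show 2 * k * 2 = 4 * k by ring]
          field_simp
    have a5 := (abs_le.1 a1).1
    linarith
  have g5 := comb hK h hF Y hY z (by positivity) hzR S (T := 512 * D0) (fun n hn => by
      rw [hSd, mem_filter, mem_Ico] at hn; omega) (fun n hn i => by
      rw [hSd, mem_filter, mem_Ico] at hn
      have e : z^(512 * D0) = exp (4 * Y) := by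
        rw [hz, ← exp_nat_mul]; congr 1; rw [hLdef]; push_cast; field_simp; norm_num
      rw [e]
      refine le_trans ?_ (hX1 i)
      push_cast
      have : (n:ℝ) ≤ NN Y := by exact_mod_cast hn.1.2.le
      linarith) (fun n hn => by
      rw [hSd, mem_filter, mem_Ico] at hn
      exact hcon n hn.1.1 hn.2) G (fun n => sq_nonneg _)
  have g6 := sum_le_sum fun (i : Fin k) (_ : i ∈ univ) => g4 i
  have g7 := sum_le_sum fun (i : Fin k) (_ : i ∈ univ) => g2 i
  have g8 := sum_le_sum fun (i : Fin k) (_ : i ∈ univ) => g3 i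
  rw [sum_const, card_fin, nsmul_eq_mul] at g6 g7 g8
  set Bm := β^(2*k) with hBm
  have hBm1 : 1 ≤ Bm := one_le_pow₀ hβ1
  have hKr : (1:ℝ) ≤ K := by exact_mod_cast hK
  have q1 : 3 * Y * (((K:ℝ) - 1) * (1 / W * H * Bm + E0) + k * (k * (1 / W * H * (Bm / k^2) + R * E0) + k * (1 / W * H * (Bm / k^2) + E0))) ≤
      3 * Y * (((K:ℝ) + 1) * (1 / W * H * Bm)) + 3 * Y * (((K:ℝ) + k^2 * R + k^2) * E0) := by
    have e : ((K:ℝ) - 1) * (1 / W * H * Bm + E0) + k * (k * (1 / W * H * (Bm / k^2) + R * E0) + k * (1 / W * H * (Bm / k^2) + E0)) = ((K:ℝ) + 1) * (1 / W * H * Bm) + (((K:ℝ) - 1) + k^2 * R + k^2) * E0 := by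
      field_simp
      ring
    rw [e, ← mul_add]
    gcongr
    linarith
  have q2 : k * (Main Y / W.totient * (((b:ℝ) - 1)^2 * u * Bm / 2^12) - 1 / Y) ≤ 3 * Y * (((K:ℝ) + 1) * (1 / W * H * Bm)) + 3 * Y * (((K:ℝ) + k^2 * R + k^2) * E0) := by
    refine le_trans (g6.trans (g5.trans ?_)) q1
    have hK1 : (0:ℝ) ≤ (K:ℝ) - 1 := by linarith
    gcongr
  have q3 : 3 * Y * (((K:ℝ) + 1) * (1 / W * H * Bm)) ≤ 12 * (K + 1) * (Y^2 * Bm / W) := by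
    calc _ ≤ 3 * Y * (((K:ℝ) + 1) * (1 / W * (4 * Y) * Bm)) := by gcongr
      _ = _ := by ring
  have q4 : k * ((b:ℝ) - 1)^2 / (2^22 * 2^b) * (Y^2 * Bm / W) ≤ k * (Main Y / W.totient * (((b:ℝ) - 1)^2 * u * Bm / 2^12)) := by
    calc k * ((b:ℝ) - 1)^2 / (2^22 * 2^b) * (Y^2 * Bm / W) = k * ((Y / 8) / W.totient * (((b:ℝ) - 1)^2 * u * Bm / 2^12)) := by
          rw [hud]; unfold uW; rw [hLdef]; field_simp; ring
      _ ≤ _ := by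
        have : 0 ≤ u := by linarith
        gcongr
  have q5 : 1 ≤ Y^2 * Bm / W := by
    rw [le_div_iff₀ hWr]; nlinarith
  have q6 : 12 * ((K:ℝ) + 1) + 1 < k * ((b:ℝ) - 1)^2 / (2^22 * 2^b) := by
    rw [lt_div_iff₀ (by positivity)]; linarith
  have q7 := mul_lt_mul_of_pos_right q6 (by linarith : 0 < Y^2 * Bm / W)
  rw [mul_sub] at q2
  linarith

end core

open Filter

lemma fam_exists (W ps : ℕ) (R : ℝ) (hR : 0 ≤ R) : Fam (fun p : {p // p ∈ (range (⌊R⌋₊ + 1)).filter (fun p => p.Prime ∧ ¬ p ∣ W ∧ p ≠ ps)} => p.1) W ps R where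
  pr := fun i => (mem_filter.1 i.2).2.1
  ndvd := fun i => (mem_filter.1 i.2).2.2.1
  ne := fun i => (mem_filter.1 i.2).2.2.2
  le := fun i => by
    have := mem_range.1 (mem_filter.1 i.2).1
    exact (Nat.le_floor_iff hR).1 (by omega)
  inj := Subtype.val_injective
  surj := fun p h1 h2 h3 h4 => ⟨⟨p, mem_filter.2 ⟨mem_range.2 (Nat.lt_succ_of_le (Nat.le_floor h4)), h1, h2, h3⟩⟩, rfl⟩

lemma param (K : ℕ) : ∃ b k : ℕ, 1 ≤ k ∧ 2 ≤ b ∧ 512 * (2 * k) * b ≤ 2^b ∧ (2:ℝ)^22 * 2^b * (12 * (K + 1) + 1) < k * ((b:ℝ) - 1)^2 := by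
  obtain ⟨b, hb⟩ : ∃ b : ℕ, 2^35 * (12 * K + 13) < b := ⟨_, Nat.lt_succ_self _⟩
  have hb100 : 100 ≤ b := by omega
  have h1 : 1024 * b ≤ 2^b := by
    obtain ⟨c, rfl⟩ : ∃ c, b = 10 + c := ⟨b - 10, by omega⟩
    have : ∀ c : ℕ, 4 ≤ c → 10 + c ≤ 2^c := by
      intro c hc
      induction c, hc using Nat.le_induction with
      | base => norm_num
      | succ n hn ih => rw [pow_succ]; omega
    have := this c (by omega)
    rw [pow_add]; omega
  have hbpos : 0 < 1024 * b := by omega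
  have hk1 : 1 ≤ 2^b / (1024 * b) := (Nat.one_le_div_iff hbpos).2 h1
  have hk2 := Nat.div_mul_le_self (2^b) (1024 * b)
  have hk3 : 2^b < 1024 * b * (2^b / (1024 * b) + 1) := Nat.lt_mul_div_succ _ hbpos
  generalize hkd : 2^b / (1024 * b) = k at *
  refine ⟨b, k, hk1, by omega, by linarith, ?_⟩
  have a1 : (2:ℝ)^b < 1024 * b * (k + 1) := by exact_mod_cast hk3
  have a2 : (2:ℝ)^35 * (12 * K + 13) < b := by exact_mod_cast hb
  have a3 : (100:ℝ) ≤ b := by exact_mod_cast hb100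
  have a4 : (1:ℝ) ≤ k := by exact_mod_cast hk1
  have a5 : (2:ℝ)^b < 2048 * b * k := by
    have : (1024:ℝ) * b * (k + 1) ≤ 2048 * b * k := by nlinarith
    linarith
  have a6 : (b:ℝ)^2 ≤ 4 * ((b:ℝ) - 1)^2 := by nlinarith
  have hK0 : (0:ℝ) ≤ K := Nat.cast_nonneg K
  calc (2:ℝ)^22 * 2^b * (12 * (K + 1) + 1) ≤ (2:ℝ)^22 * (2048 * b * k) * (12 * (K + 1) + 1) := by gcongr
    _ = (k:ℝ) * b * (2^35 * (12 * K + 13)) / 4 := by ring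
    _ < (k:ℝ) * b * b / 4 := by gcongr
    _ = k * (b:ℝ)^2 / 4 := by ring
    _ ≤ k * (4 * ((b:ℝ) - 1)^2) / 4 := by gcongr
    _ = _ := by ring

lemma ev_err (k K W : ℕ) (C : ℝ) (hC : 1 ≤ C) : ∀ᶠ L : ℝ in atTop,
    3 * L * (((K:ℝ) + k^2 * exp (L / 128) + k^2) * ((L^(2*k))^2 * (2 * C * (W * exp (L / 128)) * (exp (L / 128) ^ 3)^3 / ⌈exp (L / 2)⌉₊))) + k * (1 / L) ≤ 1 := by
  set c : ℝ := (6 * C * W * (K + 2 * k^2) + 1) with hc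
  have hc0 : 0 < c := by positivity
  have h1 := (isLittleO_pow_exp_pos_mul_atTop (k := 4 * k + 1) (b := (53:ℝ) / 128) (by norm_num)).bound (show 0 < 1 / (2 * c) by positivity)
  filter_upwards [h1, eventually_ge_atTop (1:ℝ), eventually_ge_atTop (2 * k : ℝ)] with L h1 h2 h3
  have hL0 : 0 < L := by linarith
  rw [norm_of_nonneg (by positivity), norm_of_nonneg (by positivity)] at h1
  have a1 : (k:ℝ) * (1 / L) ≤ 1 / 2 := by
    rw [mul_one_div, div_le_iff₀ hL0]; linarith
  have hX : exp (L / 2) ≤ ⌈exp (L / 2)⌉₊ := le_ceil _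
  set R := exp (L / 128) with hR
  have hR1 : 1 ≤ R := one_le_exp (by positivity)
  have e2 : exp (L / 2) = R^11 * exp (53 / 128 * L) := by
    rw [hR, ← exp_nat_mul, ← exp_add]; congr 1; push_cast; ring
  set Y := exp (53 / 128 * L) with hY
  have hY0 : 0 < Y := exp_pos _
  have a2 : 3 * L * (((K:ℝ) + k^2 * R + k^2) * ((L^(2*k))^2 * (2 * C * (W * R) * (R ^ 3)^3 / ⌈exp (L / 2)⌉₊))) ≤
      3 * L * ((((K:ℝ) + 2 * k^2) * R) * ((L^(2*k))^2 * (2 * C * (W * R) * (R ^ 3)^3 / (R^11 * Y)))) := by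
    rw [e2] at hX
    have : (K:ℝ) + k^2 * R + k^2 ≤ ((K:ℝ) + 2 * k^2) * R := by
      have q1 : (K:ℝ) ≤ K * R := le_mul_of_one_le_right (Nat.cast_nonneg K) hR1
      have q2 : (k:ℝ)^2 ≤ k^2 * R := le_mul_of_one_le_right (by positivity) hR1
      linarith
    rw [e2]
    gcongr
  have a3 : 3 * L * ((((K:ℝ) + 2 * k^2) * R) * ((L^(2*k))^2 * (2 * C * (W * R) * (R ^ 3)^3 / (R^11 * Y)))) = (c - 1) * L^(4 * k + 1) / Y := by
    rw [hc]
    have : L^(4 * k + 1) = L * (L^(2*k))^2 := by rw [← pow_mul, pow_succ]; ring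
    rw [this]
    field_simp
    ring
  have a4 : (c - 1) * L^(4 * k + 1) / Y ≤ 1 / 2 := by
    rw [div_le_iff₀ hY0]
    calc (c - 1) * L^(4 * k + 1) ≤ c * L^(4 * k + 1) := by gcongr; linarith
      _ ≤ c * (1 / (2 * c) * Y) := by gcongr
      _ = _ := by field_simp
  linarith

lemma ev_u (W b : ℕ) (hW : 1 ≤ W) (c : ℝ) : ∀ᶠ L : ℝ in atTop, c ≤ uW W b (L / 128) := by
  have hφ0 : (0:ℝ) < W.totient := by exact_mod_cast totient_pos.2 hW
  have hWr : (0:ℝ) < W := by exact_mod_cast hW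
  have h : Tendsto (fun L : ℝ => (W.totient / W / 128 / 2^b : ℝ) * L) atTop atTop := tendsto_id.const_mul_atTop (by positivity)
  filter_upwards [h.eventually_ge_atTop c] with L hL
  refine hL.trans (le_of_eq ?_)
  unfold uW; ring

set_option maxHeartbeats 2000000 in
theorem sieve (K : ℕ) (hK : 1 ≤ K) : ∃ k D0 T : ℕ, 2 * k ≤ D0 ∧ 2 ≤ D0 ∧ ∀ (h : Fin k → ℕ) (W v : ℕ), 1 ≤ W → (∀ p : ℕ, p.Prime → p ≤ D0 → p ∣ W) →
    (∀ j l, j ≠ l → ∀ p : ℕ, p.Prime → (p:ℤ) ∣ (bbf h j : ℤ) - bbf h l → p ∣ W) → (∀ i, (v + h i + 1).Coprime W) →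
    ∀ x, ∃ n, x ≤ n ∧ n ≡ v [MOD W] ∧ Good h K T W n := by
  obtain ⟨b, k, hk, hb, hB, hkey⟩ := param K
  obtain ⟨D0, hD⟩ : ∃ D0 : ℕ, 80 * (2 * k)^2 + k^2 * ((64 * 2^b)^(2 * k) * (4 * b + 5 + 4 * (2 * k)^2)) ≤ D0 := ⟨_, le_rfl⟩
  have hD1 : 80 * (2 * k)^2 ≤ D0 := le_trans (Nat.le_add_right _ _) hD
  have hD2 : k^2 * ((64 * 2^b)^(2 * k) * (4 * b + 5 + 4 * (2 * k)^2)) ≤ D0 := le_trans (Nat.le_add_left _ _) hD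
  refine ⟨k, D0, 512 * D0, by nlinarith, by nlinarith, ?_⟩
  intro h W v hW hWD hsep hcop x
  obtain ⟨k', hk'⟩ : ∃ k' : ℕ, ((2 * k : ℝ) + 1)^2 ≤ 2^k' := by
    obtain ⟨k', h⟩ := pow_unbounded_of_one_lt (((2 * k : ℝ) + 1)^2) (by norm_num : (1:ℝ) < 2)
    exact ⟨k', h.le⟩
  obtain ⟨C, hC, hCk⟩ := tau_bound k'
  have hyall : ∀ᶠ L : ℝ in atTop, ∀ i, (h i : ℝ) + 4 ≤ exp (L / 2) := by
    rw [Filter.eventually_all]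
    intro i
    have : Tendsto (fun L : ℝ => exp (L / 2)) atTop atTop := tendsto_exp_atTop.comp (tendsto_id.atTop_div_const (by norm_num))
    exact this.eventually_ge_atTop _
  have hev := (((BV W k' (4 * k + 1) hW).and main_lower).and (ev_err k K W C hC)).and (((ev_u W b hW (2 * (2 * W + 1))).and (ev_u W b hW 32)).and
    ((ev_u W b hW (D0 * (2 * ((b:ℝ) + 1) * (2 * (2 * W + 1) * exp (2 * (2 * W + 1) / (W.totient / W)))))).and
    ((hyall.and (eventually_ge_atTop (1:ℝ))).and ((eventually_ge_atTop (W:ℝ)).and (eventually_ge_atTop (2 * x : ℝ))))))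
  obtain ⟨L, ⟨⟨hBV, hMain⟩, herr⟩, ⟨hu, hu32⟩, hCW, ⟨hy, hL⟩, hWL, hx⟩ := hev.exists
  obtain ⟨ps, hps, Bd, hBd0, hBd1, hBd⟩ := hBV
  have hF := fam_exists W ps (exp (L / 128)) (exp_pos _).le
  have hS : Sep (fun p : {p // p ∈ (range (⌊exp (L / 128)⌋₊ + 1)).filter (fun p => p.Prime ∧ ¬ p ∣ W ∧ p ≠ ps)} => p.1) (bbf h) := by
    intro s n j l h1 h2
    by_contra hne
    apply hF.ndvd s
    refine hsep j l hne _ (hF.pr s) ?_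
    have h1' := Int.natCast_dvd_natCast.2 h1
    have h2' := Int.natCast_dvd_natCast.2 h2
    have := dvd_sub h1' h2'
    push_cast at this
    simpa using this
  have hceil : (⌈exp (L / 2)⌉₊ : ℝ) < exp (L / 2) + 1 := Nat.ceil_lt_add_one (exp_pos _).le
  have hceil2 : (⌈exp (2 * L)⌉₊ : ℝ) < exp (2 * L) + 1 := Nat.ceil_lt_add_one (exp_pos _).le
  have e1 : exp L = exp (L / 2) * exp (L / 2) := by rw [← exp_add]; congr 1; ring
  have e2 : exp (4 * L) = exp (2 * L) * exp (2 * L) := by rw [← exp_add]; congr 1; ring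
  have hCW' : 2 * ((b:ℝ) + 1) * (2 * (2 * W + 1) * exp (2 * (2 * W + 1) / (W.totient / W))) ≤ 2^(b+1) * uW W b (L / 128) / D0 := by
    have hD0 : (0:ℝ) < D0 := by exact_mod_cast (show 0 < D0 by nlinarith)
    rw [le_div_iff₀ hD0, mul_comm]
    refine hCW.trans (le_mul_of_one_le_left (by linarith) (one_le_pow₀ (by norm_num)))
  obtain ⟨n, hn1, hn2, hn3⟩ := sieve_fixed hK hk hb hB hkey hD1 hD2 hW hWD hcop hk' hC hCk hL hF hS hps Bd hBd0 hBd1 hBd hMain hu hu32 hCW'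
    (fun i => by
      have := hy i
      have h0 : (0:ℝ) ≤ h i := Nat.cast_nonneg _
      rw [e1]; nlinarith)
    (fun i => by
      have := (hy i).trans (exp_le_exp.2 (by linarith : L / 2 ≤ 2 * L))
      have h0 : (0:ℝ) ≤ h i := Nat.cast_nonneg _
      unfold NN; push_cast
      rw [e2]; nlinarith)
    (by nlinarith) herr
  refine ⟨n, le_trans ?_ hn1, hn2, hn3⟩
  have : (x:ℝ) ≤ ⌈exp (L / 2)⌉₊ := by
    have a := add_one_le_exp (L / 2)
    have := le_ceil (exp (L / 2))
    linarith
  exact_mod_cast this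

lemma tau_rough (L T : ℕ) (hL : L ≠ 0) (h : ∀ p : ℕ, p.Prime → p ∣ L → L + 1 ≤ p^T) : L.divisors.card ≤ 2^T := by
  have hΩ : ∑ p ∈ L.primeFactors, L.factorization p ≤ T := by
    have h1 : (L + 1)^(∑ p ∈ L.primeFactors, L.factorization p) ≤ L^T := by
      calc (L + 1)^(∑ p ∈ L.primeFactors, L.factorization p) = ∏ p ∈ L.primeFactors, (L + 1)^(L.factorization p) := (prod_pow_eq_pow_sum _ _ _).symm
        _ ≤ ∏ p ∈ L.primeFactors, (p^T)^(L.factorization p) := by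
          apply prod_le_prod' 
          intro p hp
          exact Nat.pow_le_pow_left (h p (Nat.prime_of_mem_primeFactors hp) (Nat.dvd_of_mem_primeFactors hp)) _
        _ = (∏ p ∈ L.primeFactors, p^(L.factorization p))^T := by
          rw [← prod_pow]
          refine prod_congr rfl fun p _ => ?_
          rw [← pow_mul, ← pow_mul, mul_comm]
        _ = L^T := by
          congr 1
          exact Nat.prod_factorization_pow_eq_self hL
    have h2 : (L + 1)^(∑ p ∈ L.primeFactors, L.factorization p) ≤ (L + 1)^T := h1.trans (Nat.pow_le_pow_left (Nat.le_succ L) T)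
    exact (Nat.pow_le_pow_iff_right (by omega)).1 h2
  rw [Nat.card_divisors hL]
  calc ∏ p ∈ L.primeFactors, (L.factorization p + 1) ≤ ∏ p ∈ L.primeFactors, 2^(L.factorization p) := by
        apply prod_le_prod'
        intro p _
        exact Nat.lt_two_pow_self
    _ = 2^(∑ p ∈ L.primeFactors, L.factorization p) := prod_pow_eq_pow_sum _ _ _
    _ ≤ 2^T := Nat.pow_le_pow_right (by norm_num) hΩ

lemma tau_part (N W T q e : ℕ) (hq : q.Prime) (hq2 : q ≠ 2) (h2 : 2 ∣ N) (h4 : ¬ 4 ∣ N) (hqe : q^e ∣ N) (hqe' : ¬ q^(e+1) ∣ N)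
    (hW : ∀ p : ℕ, p.Prime → p ∣ W → p ≠ 2 → p ≠ q → ¬ p ∣ N) (hT : ∀ p : ℕ, p.Prime → ¬ p ∣ W → p ∣ N → N + 1 ≤ p^T) (hW2 : 2 ∣ W) (hWq : q ∣ W) :
    2 * (e + 1) ≤ N.divisors.card ∧ N.divisors.card ≤ 2 * (e + 1) * 2^T := by
  have hc2 : Nat.Coprime 2 (q^e) := Nat.Coprime.pow_right e ((Nat.coprime_primes prime_two hq).2 (Ne.symm hq2))
  obtain ⟨L, hL⟩ := Nat.Coprime.mul_dvd_of_dvd_of_dvd hc2 h2 hqe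
  have hN0 : N ≠ 0 := fun h => h4 (h ▸ dvd_zero 4)
  have hL0 : L ≠ 0 := fun h => hN0 (by rw [hL, h, mul_zero])
  have hL2 : ¬ 2 ∣ L := by
    rintro ⟨c, rfl⟩
    exact h4 ⟨q^e * c, by rw [hL]; ring⟩
  have hLq : ¬ q ∣ L := by
    rintro ⟨c, rfl⟩
    exact hqe' ⟨2 * c, by rw [hL]; ring⟩
  have hcop : Nat.Coprime (2 * q^e) L := by
    apply Nat.Coprime.mul_left
    · exact (Nat.Prime.coprime_iff_not_dvd prime_two).2 hL2
    · exact Nat.Coprime.pow_left _ ((Nat.Prime.coprime_iff_not_dvd hq).2 hLq)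
  have hLN : L ∣ N := ⟨2 * q^e, by rw [hL]; ring⟩
  have ht : L.divisors.card ≤ 2^T := by
    apply tau_rough L T hL0
    intro p hp hpL
    have hpN := hpL.trans hLN
    refine le_trans (Nat.succ_le_succ (Nat.le_of_dvd (Nat.pos_of_ne_zero hN0) hLN)) (hT p hp ?_ hpN)
    intro hpW
    refine hW p hp hpW ?_ ?_ hpN
    · rintro rfl; exact hL2 hpL
    · rintro rfl; exact hLq hpL
  have hcard : N.divisors.card = 2 * (e + 1) * L.divisors.card := by
    rw [hL, Nat.Coprime.card_divisors_mul hcop, Nat.Coprime.card_divisors_mul hc2, Nat.divisors_prime_pow hq, Nat.Prime.divisors prime_two]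
    simp
  have h1 : 1 ≤ L.divisors.card := card_pos.2 (Nat.nonempty_divisors.2 hL0)
  rw [hcard]
  exact ⟨Nat.le_mul_of_pos_right _ h1, Nat.mul_le_mul_left _ ht⟩

/-- extraction of a run of consecutive primes -/
lemma extract_run (K n Y : ℕ) (f : ℕ → ℕ)
    (hcount : K ≤ ((Ico (n + 1) Y).filter Nat.Prime).card)
    (hdec : ∀ p q : ℕ, p.Prime → q.Prime → n + 1 ≤ p → p < q → q < Y → f q < f p) :
    ∀ i, i + 1 < K → f (Nat.nth Nat.Prime (Nat.count Nat.Prime (n + 1) + i + 1)) < f (Nat.nth Nat.Prime (Nat.count Nat.Prime (n + 1) + i)) := by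
  intro i hi
  have h1 : Nat.count Nat.Prime (n + 1) + K ≤ Nat.count Nat.Prime Y := by
    rcases K.eq_zero_or_pos with h | h
    · omega
    have hY : n + 1 ≤ Y := by
      by_contra hc
      rw [Ico_eq_empty (by omega)] at hcount
      simp at hcount; omega
    rw [Nat.count_eq_card_filter_range, Nat.count_eq_card_filter_range]
    have : (range Y).filter Nat.Prime = (range (n + 1)).filter Nat.Prime ∪ (Ico (n + 1) Y).filter Nat.Prime := by
      rw [← filter_union]
      congr 1
      ext a; simp only [mem_union, mem_range, mem_Ico]; omega
    rw [this, card_union_of_disjoint]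
    · exact Nat.add_le_add_left hcount _
    · rw [disjoint_left]
      intro a ha hb
      have := mem_range.1 (mem_filter.1 ha).1
      have := (mem_Ico.1 (mem_filter.1 hb).1).1
      omega
  refine hdec _ _ (Nat.prime_nth_prime _) (Nat.prime_nth_prime _) ?_ ?_ ?_
  · exact not_lt.1 fun hc => (not_lt.2 (Nat.le_add_right _ i)) ((Nat.lt_nth_iff_count_lt infinite_setOf_prime).2 hc)
  · exact Nat.nth_strictMono infinite_setOf_prime (Nat.lt_succ_self _)
  · exact Nat.nth_lt_of_lt_count (by omega)

/-- The local conditions at the prime `p`. -/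
structure LC {k : ℕ} (H : ℕ) (q : ℕ → ℕ) (e : Fin k → ℕ) (p r : ℕ) : Prop where
  c1 : ∀ i : Fin k, ¬ p ∣ r + i * H + 1
  c2 : p = 2 → r % 4 = 2
  c3 : ∀ i : Fin k, p ≠ 2 → p ≠ q (i * H) → ¬ p ∣ r + i * H
  c4 : ∀ i : Fin k, p = q (i * H) → p^(e i) ∣ r + i * H ∧ ¬ p^(e i + 1) ∣ r + i * H
  c5 : ∀ t, Even t → ¬ H ∣ t → p = q t → t ≤ k * H → p ∣ r + 1 + t

lemma small_dvd (p B : ℕ) (x : ℤ) (h : (p:ℤ) ∣ x) (h1 : x ≤ B) (h2 : -B ≤ x) (hB : B < p) : x = 0 := by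
  apply Int.eq_zero_of_abs_lt_dvd h
  rw [abs_lt]; omega

lemma generic_res (k p : ℕ) (hp : 2 * k < p) (h : Fin k → ℕ) : ∃ r, ∀ i, ¬ p ∣ r + h i ∧ ¬ p ∣ r + h i + 1 := by
  classical
  set S := (univ : Finset (Fin k × Bool)).image (fun j => ((p - 1) * bbf h j) % p) with hS
  have hc : S.card < (range p).card := by
    refine lt_of_le_of_lt card_image_le ?_
    simp only [card_univ, Fintype.card_prod, Fintype.card_fin, Fintype.card_bool, card_range]; omega
  obtain ⟨r, hr, hrS⟩ := exists_mem_notMem_of_card_lt_card hc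
  have hrp := mem_range.1 hr
  have key : ∀ j, ¬ p ∣ r + bbf h j := by
    intro j hj
    rw [dvd_add_iff_modEq p r _ (by omega)] at hj
    apply hrS
    rw [hS, mem_image]
    exact ⟨j, mem_univ _, by rw [← hj, Nat.mod_eq_of_lt hrp]⟩
  exact ⟨r, fun i => ⟨by simpa [bbf] using key (i, true), by simpa [bbf, add_assoc] using key (i, false)⟩⟩

lemma lc_exists {k D0 H : ℕ} {q : ℕ → ℕ} {e : Fin k → ℕ} (hD : 2 * k ≤ D0) (hH4 : 4 ∣ H) (hH0 : 0 < H) (hHD : ∀ p, p.Prime → p ≤ D0 → p ∣ H)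
    (hq : ∀ t, (q t).Prime) (hqi : Function.Injective q) (hqB : ∀ t, k * H + 2 < q t) (hqD : ∀ t, D0 < q t) (he : ∀ i, 1 ≤ e i) (p : ℕ) (hp : p.Prime) : ∃ r, LC H q e p r := by
  have hiH : ∀ i : Fin k, (i:ℕ) * H ≤ k * H := fun i => Nat.mul_le_mul_right _ i.2.le
  have hi4 : ∀ i : Fin k, 4 ∣ (i:ℕ) * H := fun i => hH4.mul_left _
  have sm : ∀ a b : ℕ, (p:ℤ) ∣ (a:ℤ) - b → k * H + 2 < p → a ≤ k * H + 2 → b ≤ k * H + 2 → a = b := fun a b h h1 h2 h3 => by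
    have := small_dvd p (k * H + 2) _ h (by omega) (by omega) h1
    omega
  by_cases hp2 : p = 2
  · subst hp2
    have hne : ∀ t, 2 ≠ q t := fun t => by have := hqB t; omega
    exact ⟨2, fun i => by have := hi4 i; omega, fun _ => rfl, fun i h => absurd rfl h, fun i h => absurd h (hne _), fun t _ _ h => absurd h (hne _)⟩
  by_cases hpD : p ≤ D0
  · have hne : ∀ t, p ≠ q t := fun t => by have := hqD t; omega
    have hd : ∀ i : Fin k, p ∣ (i:ℕ) * H := fun i => (hHD p hp hpD).mul_left _
    refine ⟨1, fun i h => ?_, fun h => absurd h hp2, fun i _ _ h => ?_, fun i h => absurd h (hne _), fun t _ _ h => absurd h (hne _)⟩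
    · have : p ∣ 2 := by
        have := (Nat.dvd_sub h (hd i))
        rwa [show 1 + (i:ℕ) * H + 1 - i * H = 2 by omega] at this
      exact hp2 ((prime_dvd_prime_iff_eq hp prime_two).1 this)
    · exact hp.one_lt.ne' (Nat.dvd_one.1 ((Nat.dvd_add_left (hd i)).1 h))
  push Not at hpD
  by_cases hA : ∃ i : Fin k, p = q (i * H)
  · obtain ⟨i, hi⟩ := hA
    have hpB : k * H + 2 < p := hi ▸ hqB _
    have hp1 : 1 ≤ p^(e i + 1) := Nat.one_le_pow _ _ hp.pos
    have hr : ∀ c : ℕ, (p:ℤ) ∣ ((p^(e i) + (p^(e i + 1) - 1) * (i * H) + c : ℕ) : ℤ) → (p:ℤ) ∣ (c:ℤ) - (i * H : ℕ) := by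
      intro c hc
      push_cast [Nat.cast_sub hp1] at hc
      have h1 : (p:ℤ) ∣ (p:ℤ)^(e i) := dvd_pow_self _ (by have := he i; omega)
      have h2 : (p:ℤ) ∣ (p:ℤ)^(e i + 1) * (i * H) := (dvd_pow_self _ (by omega)).mul_right _
      have := dvd_sub hc (dvd_add h1 h2)
      obtain ⟨w, hw⟩ := this
      exact ⟨w, by rw [← hw]; push_cast; ring⟩
    have hreq : p^(e i) + (p^(e i + 1) - 1) * (i * H) + i * H = p^(e i) + p^(e i + 1) * (i * H) := by
      rw [Nat.sub_mul, one_mul]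
      have : i * H ≤ p^(e i + 1) * (i * H) := Nat.le_mul_of_pos_left _ hp1
      omega
    refine ⟨p^(e i) + (p^(e i + 1) - 1) * (i * H), fun i' h => ?_, fun h => absurd h hp2, fun i' _ h1 h => ?_, fun i' h => ?_, fun t _ h1 h2 => ?_⟩
    · have h3 := hr (i' * H + 1) (by rw [← add_assoc]; exact Int.natCast_dvd_natCast.2 h)
      have h4 := sm _ _ h3 hpB (by have := hiH i'; omega) (by have := hiH i; omega)
      have a1 := hi4 i; have a2 := hi4 i'
      omega
    · have h3 := hr (i' * H) (Int.natCast_dvd_natCast.2 h)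
      have h4 := sm _ _ h3 hpB (by have := hiH i'; omega) (by have := hiH i; omega)
      exact h1 (by rw [h4]; exact hi)
    · have h5 := hqi (hi.symm.trans h)
      have h6 : i = i' := Fin.ext (Nat.eq_of_mul_eq_mul_right hH0 h5)
      subst h6
      rw [hreq]
      refine ⟨dvd_add dvd_rfl ((pow_dvd_pow _ (Nat.le_succ _)).mul_right _), fun h7 => ?_⟩
      have h8 := (Nat.dvd_add_left (dvd_mul_right _ _)).1 h7
      exact absurd ((Nat.pow_dvd_pow_iff_le_right hp.one_lt).1 h8) (by omega)
    · exact absurd ⟨(i:ℕ), by rw [mul_comm]; exact hqi (h2.symm.trans hi)⟩ h1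
  by_cases hBc : ∃ t, Even t ∧ ¬ H ∣ t ∧ p = q t ∧ t ≤ k * H
  · obtain ⟨t, ht2, htH, htp, htk⟩ := hBc
    have hpB : k * H + 2 < p := htp ▸ hqB _
    have hr : ∀ c : ℕ, (p:ℤ) ∣ (((p - 1) * (1 + t) + c : ℕ) : ℤ) → (p:ℤ) ∣ (c:ℤ) - (1 + t : ℕ) := by
      intro c hc
      push_cast [Nat.cast_sub hp.one_le] at hc
      have := dvd_sub hc (dvd_mul_right (p:ℤ) (1 + t))
      obtain ⟨w, hw⟩ := this
      exact ⟨w, by rw [← hw]; push_cast; ring⟩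
    refine ⟨(p - 1) * (1 + t), fun i' h => ?_, fun h => absurd h hp2, fun i' _ h1 h => ?_, fun i' h => absurd ⟨i', h⟩ hA, fun t' _ h1 h2 _ => ?_⟩
    · have h3 := hr (i' * H + 1) (by rw [← add_assoc]; exact Int.natCast_dvd_natCast.2 h)
      have h4 := sm _ _ h3 hpB (by have := hiH i'; omega) (by omega)
      exact htH ⟨i', by rw [mul_comm]; omega⟩
    · have h3 := hr (i' * H) (Int.natCast_dvd_natCast.2 h)
      have h4 := sm _ _ h3 hpB (by have := hiH i'; omega) (by omega)
      have a2 := hi4 i'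
      obtain ⟨c, hc⟩ := ht2
      omega
    · have h5 : t' = t := hqi (h2.symm.trans htp)
      subst h5
      rw [add_assoc]
      exact ⟨1 + t', by rw [Nat.sub_mul, one_mul]; exact Nat.sub_add_cancel (Nat.le_mul_of_pos_left _ hp.pos)⟩
  · obtain ⟨r, hr⟩ := generic_res k p (by omega) (fun i => (i:ℕ) * H)
    exact ⟨r, fun i => (hr i).2, fun h => absurd h hp2, fun i _ _ => (hr i).1, fun i h => absurd ⟨i, h⟩ hA, fun t h1 h2 h3 h4 => absurd ⟨t, h1, h2, h3, h4⟩ hBc⟩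

lemma lc_congr {k H : ℕ} {q : ℕ → ℕ} {e : Fin k → ℕ} {p r n E : ℕ} (hE : 2 ≤ E) (heE : ∀ i, e i + 1 ≤ E) (h : n ≡ r [MOD p^E]) (hr : LC H q e p r) : LC H q e p n := by
  have key : ∀ j c : ℕ, j ≤ E → (p^j ∣ n + c ↔ p^j ∣ r + c) := by
    intro j c hj
    have : n + c ≡ r + c [MOD p^j] := (h.of_dvd (pow_dvd_pow _ hj)).add_right c
    exact this.dvd_iff dvd_rfl
  have key1 : ∀ c : ℕ, (p ∣ n + c ↔ p ∣ r + c) := by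
    intro c
    have := key 1 c (by omega)
    rwa [pow_one] at this
  refine ⟨fun i => ?_, fun hp => ?_, fun i h1 h2 => ?_, fun i h1 => ?_, fun t h1 h2 h3 h4 => ?_⟩
  · rw [add_assoc, key1, ← add_assoc]; exact hr.c1 i
  · subst hp
    have : n ≡ r [MOD 4] := h.of_dvd (pow_dvd_pow 2 hE)
    rw [this]; exact hr.c2 rfl
  · rw [key1]; exact hr.c3 i h1 h2
  · rw [key _ _ (heE i), key _ _ (le_trans (Nat.le_succ _) (heE i))]; exact hr.c4 i h1
  · rw [add_assoc, key1, ← add_assoc]; exact hr.c5 t h1 h2 h3 h4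

lemma decr_of_lc {k K T H W n Big : ℕ} {q : ℕ → ℕ} {e : Fin k → ℕ} (hH4 : 4 ∣ H) (hH0 : 0 < H)
    (hq : ∀ t, (q t).Prime) (hqB : ∀ t, k * H + 2 < q t) (hqBig : ∀ t, t ≤ k * H → q t ≤ Big)
    (hWBig : ∀ p, p.Prime → (p ∣ W ↔ p ≤ Big)) (hBig2 : 2 ≤ Big)
    (he : ∀ i j : Fin k, i < j → (e j + 1) * 2^T < e i + 1)
    (hLC : ∀ p, p.Prime → p ≤ Big → LC H q e p n) (hn : Big < n)
    (hG : Good (fun i : Fin k => (i:ℕ) * H) K T W n) :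
    ∀ i, i + 1 < K → (Nat.nth Nat.Prime (Nat.count Nat.Prime (n + 1) + i + 1) - 1).divisors.card < (Nat.nth Nat.Prime (Nat.count Nat.Prime (n + 1) + i) - 1).divisors.card := by
  have hi4 : ∀ i : Fin k, 4 ∣ (i:ℕ) * H := fun i => hH4.mul_left _
  have hiH : ∀ i : Fin k, (i:ℕ) * H + H ≤ k * H := fun i => by
    have := Nat.mul_le_mul_right H (show (i:ℕ) + 1 ≤ k from i.2)
    rwa [add_mul, one_mul] at this
  have hn4 : n % 4 = 2 := (hLC 2 prime_two hBig2).c2 rfl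
  have htau : ∀ i : Fin k, 2 * (e i + 1) ≤ (n + i * H).divisors.card ∧ (n + i * H).divisors.card ≤ 2 * (e i + 1) * 2^T := by
    intro i
    have hqp := hq (i * H)
    have hqb := hqBig (i * H) (by have := hiH i; omega)
    have h4 := (hLC _ hqp hqb).c4 i rfl
    have hq2 : q (i * H) ≠ 2 := by have := hqB (i * H); omega
    have hd := hi4 i
    exact tau_part (n + i * H) W T (q (i * H)) (e i) hqp hq2 (by omega) (by omega) h4.1 h4.2
      (fun p hp hpW h2 h3 => (hLC p hp ((hWBig p hp).1 hpW)).c3 i h2 h3)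
      (fun p hp hpW hpN => hG.2 i p hp hpW hpN) ((hWBig 2 prime_two).2 hBig2) ((hWBig _ hqp).2 hqb)
  have hprime : ∀ m, m.Prime → n + 1 ≤ m → m < n + 1 + k * H → ∃ i : Fin k, m = n + 1 + i * H := by
    intro m hm h1 h2
    obtain ⟨t, rfl⟩ := Nat.exists_eq_add_of_le h1
    have htk : t < k * H := by omega
    rcases Nat.even_or_odd t with ht | ht
    · by_cases hHt : H ∣ t
      · obtain ⟨i, rfl⟩ := hHt
        have : i < k := by
          rw [mul_comm] at htk
          exact Nat.lt_of_mul_lt_mul_right htk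
        exact ⟨⟨i, this⟩, by simp [mul_comm]⟩
      · have hqb := hqBig t htk.le
        have h5 := (hLC _ (hq t) hqb).c5 t ht hHt rfl htk.le
        have := (prime_dvd_prime_iff_eq (hq t) hm).1 h5
        omega
    · obtain ⟨c, hc⟩ := ht
      have : 2 ∣ n + 1 + t := by omega
      have := (prime_dvd_prime_iff_eq prime_two hm).1 this
      omega
  refine extract_run K n (n + 1 + k * H) (fun p => (p - 1).divisors.card) ?_ ?_
  · refine le_trans hG.1 ?_
    refine card_le_card_of_injOn (fun i : Fin k => n + i * H + 1) ?_ ?_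
    · intro i hi
      have h1 := (mem_filter.1 hi).2
      have := hiH i
      simp only [coe_filter, Set.mem_setOf_eq, mem_Ico]
      exact ⟨by omega, h1⟩
    · intro i _ j _ hij
      have : (i:ℕ) * H = j * H := by simp only at hij; omega
      exact Fin.ext (Nat.eq_of_mul_eq_mul_right hH0 this)
  · intro p q' hp hq' h1 h2 h3
    obtain ⟨i, rfl⟩ := hprime p hp h1 (by omega)
    obtain ⟨j, rfl⟩ := hprime q' hq' (by omega) h3
    have hij : i < j := by
      have : (i:ℕ) * H < j * H := by omega
      exact Nat.lt_of_mul_lt_mul_right this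
    have a := (htau i).1
    have b := (htau j).2
    have c := he i j hij
    simp only [show ∀ x, n + 1 + x - 1 = n + x from fun x => by omega]
    calc _ ≤ _ := b
      _ = 2 * ((e j + 1) * 2^T) := by ring
      _ < 2 * (e i + 1) := by omega
      _ ≤ _ := a

end

end TDR

open TDR Finset

theorem tau_decreasing_runs (K : ℕ) (hK : 1 ≤ K) :
    {n : ℕ | ∀ i : ℕ, i + 1 < K →
      (Nat.nth Nat.Prime (n + i + 1) - 1).divisors.card <
        (Nat.nth Nat.Prime (n + i) - 1).divisors.card}.Infinite := by
  classical
  obtain ⟨k, D0, T, hkD, hD2, hs⟩ := TDR.sieve K hK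
  set H : ℕ := 2 * D0.factorial with hHdef
  have hHD : ∀ p, p.Prime → p ≤ D0 → p ∣ H := fun p hp h => (hp.dvd_factorial.2 h).mul_left 2
  have hH4 : 4 ∣ H := Nat.mul_dvd_mul_left 2 (prime_two.dvd_factorial.2 hD2)
  have hH0 : 0 < H := Nat.mul_pos (by norm_num) D0.factorial_pos
  have hH4' : 4 ≤ H := Nat.le_of_dvd hH0 hH4
  obtain ⟨q, hqdef⟩ : ∃ q : ℕ → ℕ, ∀ t, q t = Nat.nth Nat.Prime (k * H + 2 + D0 + t) := ⟨_, fun _ => rfl⟩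
  have hq : ∀ t, (q t).Prime := fun t => by rw [hqdef]; exact Nat.prime_nth_prime _
  have hqi : Function.Injective q := by
    intro s t h
    rw [hqdef, hqdef] at h
    have := Nat.nth_injective infinite_setOf_prime h
    omega
  have hqg : ∀ t, k * H + 2 + D0 + t + 2 ≤ q t := fun t => by rw [hqdef]; exact Nat.add_two_le_nth_prime _
  obtain ⟨e, hedef⟩ : ∃ e : Fin k → ℕ, ∀ i, e i + 1 = (2^T + 1)^(k - i) :=
    ⟨fun i => (2^T + 1)^(k - i) - 1, fun i => Nat.sub_add_cancel (Nat.one_le_pow _ _ (Nat.succ_pos _))⟩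
  have hT1 : 1 ≤ 2^T := Nat.one_le_two_pow
  have he1 : ∀ i, 1 ≤ e i := by
    intro i
    have h1 := hedef i
    have h2 : (2^T + 1)^1 ≤ (2^T + 1)^(k - i) := Nat.pow_le_pow_right (by omega) (by have := i.2; omega)
    rw [pow_one] at h2; omega
  have hedec : ∀ i j : Fin k, i < j → (e j + 1) * 2^T < e i + 1 := by
    intro i j hij
    rw [hedef, hedef]
    have hij' : (i:ℕ) < j := hij
    have hj := j.2
    calc (2^T + 1)^(k - j) * 2^T < (2^T + 1)^(k - j) * (2^T + 1) := Nat.mul_lt_mul_of_pos_left (Nat.lt_succ_self _) (Nat.pow_pos (by omega))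
      _ = (2^T + 1)^(k - j + 1) := (pow_succ _ _).symm
      _ ≤ _ := Nat.pow_le_pow_right (by omega) (by omega)
  obtain ⟨E, hE⟩ : ∃ E : ℕ, E = (2^T + 1)^k + 2 := ⟨_, rfl⟩
  have heE : ∀ i, e i + 1 ≤ E := by
    intro i
    rw [hedef, hE]
    have : (2^T + 1)^(k - i) ≤ (2^T + 1)^k := Nat.pow_le_pow_right (by omega) (by omega)
    omega
  obtain ⟨Big, hBig⟩ : ∃ Big : ℕ, Big = D0 + k * H + 2 + ∑ t ∈ range (k * H + 1), q t := ⟨_, rfl⟩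
  have hqBig : ∀ t, t ≤ k * H → q t ≤ Big := by
    intro t ht
    have := single_le_sum (f := q) (s := range (k * H + 1)) (fun _ _ => Nat.zero_le _) (mem_range.2 (by omega : t < k * H + 1))
    omega
  have hlc : ∀ p : ℕ, ∃ r, p.Prime → LC H q e p r := by
    intro p
    by_cases hp : p.Prime
    · obtain ⟨r, hr⟩ := lc_exists hkD hH4 hH0 hHD hq hqi (fun t => by have := hqg t; omega) (fun t => by have := hqg t; omega) he1 p hp
      exact ⟨r, fun _ => hr⟩
    · exact ⟨0, fun h => absurd h hp⟩
  choose a ha using hlc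
  obtain ⟨P, hP⟩ : ∃ P : Finset ℕ, P = (range (Big + 1)).filter Nat.Prime := ⟨_, rfl⟩
  have hPm : ∀ p, p ∈ P ↔ p ≤ Big ∧ p.Prime := fun p => by rw [hP, mem_filter, mem_range, Nat.lt_succ_iff]
  obtain ⟨W, hW⟩ : ∃ W : ℕ, W = ∏ p ∈ P, p^E := ⟨_, rfl⟩
  have hW1 : 1 ≤ W := by
    rw [hW]
    exact prod_pos fun p hp => Nat.pow_pos ((hPm p).1 hp).2.pos
  have hPW : ∀ p ∈ P, p^E ∣ W := fun p hp => by rw [hW]; exact dvd_prod_of_mem _ hp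
  have hWBig : ∀ p, p.Prime → (p ∣ W ↔ p ≤ Big) := by
    intro p hp
    constructor
    · intro h
      rw [hW, hp.prime.dvd_finset_prod_iff] at h
      obtain ⟨r, hr, h⟩ := h
      have := (prime_dvd_prime_iff_eq hp ((hPm r).1 hr).2).1 (hp.dvd_of_dvd_pow h)
      rw [this]; exact ((hPm r).1 hr).1
    · intro h
      exact (dvd_pow_self p (by omega)).trans (hPW p ((hPm p).2 ⟨h, hp⟩))
  obtain ⟨v, hv⟩ := Nat.chineseRemainderOfFinset a (fun p => p^E) P
    (fun p hp => (Nat.pow_pos ((hPm p).1 hp).2.pos).ne')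
    (fun p hp r hr hne => Nat.Coprime.pow _ _ ((Nat.coprime_primes ((hPm p).1 hp).2 ((hPm r).1 hr).2).2 hne))
  have hLC : ∀ n, n ≡ v [MOD W] → ∀ p, p.Prime → p ≤ Big → LC H q e p n := by
    intro n hn p hp hpB
    have hpP := (hPm p).2 ⟨hpB, hp⟩
    exact lc_congr (by omega) heE ((hn.of_dvd (hPW p hpP)).trans (hv p hpP)) (ha p hp)
  have hbb : ∀ j l : Fin k × Bool, j ≠ l → ∀ p : ℕ, p.Prime → (p:ℤ) ∣ (bbf (fun i : Fin k => (i:ℕ) * H) j : ℤ) - bbf (fun i : Fin k => (i:ℕ) * H) l → p ∣ W := by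
    intro j l hjl p hp hd
    rw [hWBig p hp]
    by_contra hc
    have hb : ∀ j : Fin k × Bool, bbf (fun i : Fin k => (i:ℕ) * H) j ≤ k * H + 1 := by
      intro j
      have : (j.1:ℕ) * H ≤ k * H := Nat.mul_le_mul_right _ j.1.2.le
      unfold bbf; split_ifs <;> dsimp only <;> omega
    have h0 := small_dvd p (k * H + 1) _ hd (by have := hb j; omega) (by have := hb l; omega) (by omega)
    have h1 : bbf (fun i : Fin k => (i:ℕ) * H) j = bbf (fun i : Fin k => (i:ℕ) * H) l := by omega
    apply hjl
    obtain ⟨j1, j2⟩ := j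
    obtain ⟨l1, l2⟩ := l
    have d1 : 4 ∣ (j1:ℕ) * H := hH4.mul_left _
    have d2 : 4 ∣ (l1:ℕ) * H := hH4.mul_left _
    have hE : (j1:ℕ) * H = l1 * H → j1 = l1 := fun h => Fin.ext (Nat.eq_of_mul_eq_mul_right hH0 h)
    cases j2 <;> cases l2 <;> simp [bbf] at h1
    · rw [hE (by rcases h1 with h | h; · rw [h]
                 · omega)]
    · omega
    · omega
    · rw [hE (by rcases h1 with h | h; · rw [h]
                 · omega)]
  refine Set.infinite_of_forall_exists_gt fun A => ?_
  obtain ⟨n, hnx, hnv, hG⟩ := hs (fun i => i * H) W v hW1 (fun p hp h => (hWBig p hp).2 (by omega)) hbb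
    (fun i => Nat.Coprime.symm (Nat.coprime_of_dvd fun p hp hpW hpd => (hLC v rfl p hp ((hWBig p hp).1 hpW)).c1 i hpd)) (Big + 1 + Nat.nth Nat.Prime (A + 1))
  refine ⟨Nat.count Nat.Prime (n + 1), decr_of_lc hH4 hH0 hq (fun t => by have := hqg t; omega) hqBig hWBig (by omega) hedec (hLC n hnv) (by omega) hG, ?_⟩
  have : A + 1 < Nat.count Nat.Prime (n + 1) := (Nat.lt_nth_iff_count_lt infinite_setOf_prime).2 (show Nat.nth Nat.Prime (A + 1) < n + 1 by omega)
  omega
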